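/- For all x, y, z ∈ W, the structure constant μ_{x,y}^z of multiplication in the Kazhdan–Lusztig basis is a Laurent polynomial in v all of whose coefficients are nonnegative integers. -/

import Mathlib

open LaurentPolynomial

/-- The Bruhat order on a Coxeter group: `y ≤ x` iff some reduced expression for `x`
admits a subword that is a reduced expression for `y`. -/
def bruhatLE {B W : Type} [Group W] {M : CoxeterMatrix B} (cs : CoxeterSystem M W)
    (y x : W) : Prop :=
  ∃ ω : List B, cs.IsReduced ω ∧ cs.wordProd ω = x ∧
    ∃ ω' : List B, ω'.Sublist ω ∧ cs.IsReduced ω' ∧ cs.wordProd ω' = y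

/-- The strict Bruhat order. -/
def bruhatLT {B W : Type} [Group W] {M : CoxeterMatrix B} (cs : CoxeterSystem M W)
    (y x : W) : Prop :=
  bruhatLE cs y x ∧ y ≠ x

/-- `H`, a `ℤ[v,v⁻¹]`-algebra with basis `h = (h_x)_{x ∈ W}`, is the Hecke algebra of the
Coxeter system `cs`: the unit is `h_e` and multiplication satisfies the usual rules
`h_s h_x = h_{sx}` if `ℓ(sx) > ℓ(x)` and `h_s h_x = (v⁻¹ - v) h_x + h_{sx}` if
`ℓ(sx) < ℓ(x)`.  Here `v := T 1` is the Laurent variable. -/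
def IsHeckeAlgebra {B W : Type} [Group W] {M : CoxeterMatrix B} (cs : CoxeterSystem M W)
    {H : Type} [Ring H] [Algebra (LaurentPolynomial ℤ) H]
    (h : Module.Basis W (LaurentPolynomial ℤ) H) : Prop :=
  h 1 = 1 ∧
  ∀ (i : B) (x : W),
    (cs.length (cs.simple i * x) > cs.length x →
      h (cs.simple i) * h x = h (cs.simple i * x)) ∧
    (cs.length (cs.simple i * x) < cs.length x →
      h (cs.simple i) * h x = (T (-1) - T 1 : LaurentPolynomial ℤ) • h x + h (cs.simple i * x))

/-- `d : H → H` is the bar involution: a ring homomorphism with `d(vⁿ a) = v⁻ⁿ d(a)` and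
`d(h_x) = (h_{x⁻¹})⁻¹`. -/
def IsBarInvolution {W H : Type} [Group W] [Ring H] [Algebra (LaurentPolynomial ℤ) H]
    (h : W → H) (d : H →+* H) : Prop :=
  (∀ (n : ℤ) (a : H), d ((T n : LaurentPolynomial ℤ) • a) = (T (-n) : LaurentPolynomial ℤ) • d a) ∧
  ∀ x : W, d (h x) = Ring.inverse (h x⁻¹)

/-- `b = (b_x)_{x ∈ W}` is the Kazhdan–Lusztig family: each `b_x` is self-dual for the bar
involution `d` and `b_x ∈ h_x + Σ_{y < x} v ℤ[v] h_y`, expressed through the coordinates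
`h.repr (b x) y ∈ ℤ[v,v⁻¹]` of `b_x` in the standard basis. -/
def IsKLFamily {B W : Type} [Group W] {M : CoxeterMatrix B} (cs : CoxeterSystem M W)
    {H : Type} [Ring H] [Algebra (LaurentPolynomial ℤ) H]
    (h : Module.Basis W (LaurentPolynomial ℤ) H) (d : H →+* H) (b : W → H) : Prop :=
  ∀ x : W,
    d (b x) = b x ∧
    h.repr (b x) x = 1 ∧
    ∀ y : W, y ≠ x →
      (¬ bruhatLT cs y x → h.repr (b x) y = 0) ∧
      ∀ k : ℤ, k ≤ 0 → (h.repr (b x) y).coeff k = 0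

set_option linter.unusedSectionVars false

namespace KLPos

open Module

variable {B W : Type} [Group W] {M : CoxeterMatrix B}

/-- The reflection space: simple roots together with one extra vector `ρ`. -/
abbrev RootSpace (B : Type) : Type := Option B →₀ ℝ

/-- Basis vectors of the reflection space. -/
noncomputable def ev (o : Option B) : RootSpace B := Finsupp.single o 1

/-- Gram matrix of the invariant form on the basis. -/
noncomputable def gram (M : CoxeterMatrix B) : Option B → Option B → ℝ
  | none, none => 0
  | none, some _ => 1
  | some _, none => 1
  | some i, some j => -2 * Real.cos (Real.pi / M i j)

/-- The invariant symmetric bilinear form. -/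
noncomputable def bform (M : CoxeterMatrix B) :
    RootSpace B →ₗ[ℝ] RootSpace B →ₗ[ℝ] ℝ :=
  Finsupp.linearCombination ℝ fun o => Finsupp.linearCombination ℝ (gram M o)

lemma bform_ev (o p : Option B) : bform M (ev o) (ev p) = gram M o p := by
  simp [bform, ev]

lemma gram_symm (o p : Option B) : gram M o p = gram M p o := by
  cases o <;> cases p <;> simp [gram, M.symmetric _ _]

lemma bform_symm (u v : RootSpace B) : bform M u v = bform M v u := by
  have : bform M = (bform M).flip := by
    ext o p
    have := bform_ev (M := M) o p
    have h2 := bform_ev (M := M) p o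
    simp only [ev] at this h2
    simp [this, h2, gram_symm o p]
  conv_lhs => rw [this]
  rfl

lemma bform_simple_self (i : B) : bform M (ev (some i)) (ev (some i)) = 2 := by
  rw [bform_ev]; simp [gram]

/-- Simple reflections. -/
noncomputable def srefl (M : CoxeterMatrix B) (i : B) : End ℝ (RootSpace B) :=
  LinearMap.id - (bform M (ev (some i))).smulRight (ev (some i))

lemma srefl_apply (i : B) (v : RootSpace B) :
    srefl M i v = v - bform M (ev (some i)) v • ev (some i) := rfl

lemma srefl_self (i : B) : srefl M i (ev (some i)) = - ev (some i) := by
  rw [srefl_apply, bform_simple_self]; module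

lemma srefl_srefl (i : B) (v : RootSpace B) : srefl M i (srefl M i v) = v := by
  simp only [srefl_apply, map_sub, map_smul, bform_simple_self]
  module

lemma bform_srefl (i : B) (u v : RootSpace B) :
    bform M (srefl M i u) (srefl M i v) = bform M u v := by
  simp only [srefl_apply, map_sub, map_smul, LinearMap.sub_apply, LinearMap.smul_apply,
    bform_simple_self, smul_eq_mul, bform_symm u (ev (some i))]
  ring

/-- Second-kind Chebyshev sequence. -/
noncomputable def chebS (c : ℝ) : ℕ → ℝ
  | 0 => 0
  | 1 => 1
  | k + 2 => c * chebS c (k + 1) - chebS c k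

lemma chebS_sin (θ : ℝ) (k : ℕ) :
    Real.sin θ * chebS (2 * Real.cos θ) k = Real.sin (k * θ) := by
  induction k using Nat.twoStepInduction with
  | zero => simp [chebS]
  | one => simp [chebS]
  | more k h1 h2 =>
    have e : Real.sin ((k + 2 : ℕ) * θ) =
        2 * Real.cos θ * Real.sin ((k + 1 : ℕ) * θ) - Real.sin (k * θ) := by
      have a1 : ((k + 2 : ℕ) : ℝ) * θ = ((k + 1 : ℕ) : ℝ) * θ + θ := by push_cast; ring
      have a2 : (k : ℝ) * θ = ((k + 1 : ℕ) : ℝ) * θ - θ := by push_cast; ring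
      rw [a1, a2, Real.sin_add, Real.sin_sub]; ring
    rw [e, ← h1, ← h2, chebS]; ring

lemma chebS_two (k : ℕ) : chebS 2 k = k := by
  induction k using Nat.twoStepInduction with
  | zero => simp [chebS]
  | one => simp [chebS]
  | more k h1 h2 => rw [chebS, h1, h2]; push_cast; ring

lemma chebS_nonneg (m k : ℕ) (hm : m ≠ 1) (hk : m = 0 ∨ k ≤ m) :
    0 ≤ chebS (2 * Real.cos (Real.pi / m)) k := by
  rcases Nat.eq_zero_or_pos m with rfl | h0
  · simp [chebS_two]
  · have hm2 : (2 : ℝ) ≤ m := by exact_mod_cast (by omega : 2 ≤ m)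
    have hs : 0 < Real.sin (Real.pi / m) := by
      apply Real.sin_pos_of_pos_of_lt_pi (by positivity)
      rw [div_lt_iff₀ (by linarith)]; nlinarith [Real.pi_pos]
    have h := chebS_sin (Real.pi / m) k
    have hk' : (k : ℝ) ≤ m := by exact_mod_cast (by omega : k ≤ m)
    have : 0 ≤ Real.sin (k * (Real.pi / m)) := by
      apply Real.sin_nonneg_of_nonneg_of_le_pi (by positivity)
      rw [mul_div_assoc', div_le_iff₀ (by linarith)]; nlinarith [Real.pi_pos]
    rw [← h] at this
    exact nonneg_of_mul_nonneg_right this hs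

lemma bform_simple (i j : B) :
    bform M (ev (some i)) (ev (some j)) = - (2 * Real.cos (Real.pi / M i j)) := by
  rw [bform_ev]; simp [gram]

/-- The alternating product of `k` simple reflections ending (on the right) with `j`. -/
noncomputable def altRefl (M : CoxeterMatrix B) : B → B → ℕ → End ℝ (RootSpace B)
  | _, _, 0 => 1
  | i, j, k + 1 => altRefl M j i k * srefl M j

lemma altRefl_apply (i j : B) (k : ℕ) :
    let c := 2 * Real.cos (Real.pi / M i j)
    altRefl M i j k (ev (some i)) =
      chebS c (k + 1) • ev (some (if Even k then i else j)) +
      chebS c k • ev (some (if Even k then j else i)) ∧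
    altRefl M i j (k + 1) (ev (some j)) = - altRefl M j i k (ev (some j)) := by
  intro c
  refine ⟨?_, ?_⟩
  · induction k using Nat.twoStepInduction generalizing i j with
    | zero => simp [altRefl, chebS]
    | one =>
      have : bform M (ev (some j)) (ev (some i)) = - c := by
        rw [bform_symm, bform_simple]
      simp [altRefl, chebS, srefl_apply, this, add_comm]
    | more k h1 h2 =>
      have e1 : altRefl M i j (k + 2) (ev (some i)) =
          altRefl M j i (k + 1) (ev (some i)) + c • altRefl M j i (k + 1) (ev (some j)) := by
        have : bform M (ev (some j)) (ev (some i)) = - c := by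
          rw [bform_symm, bform_simple]
        change altRefl M j i (k + 1) (srefl M j _) = _
        rw [srefl_apply, this]; simp
      have e2 : altRefl M j i (k + 1) (ev (some i)) = - altRefl M i j k (ev (some i)) := by
        change altRefl M i j k (srefl M i _) = _
        rw [srefl_self, map_neg]
      have hc : 2 * Real.cos (Real.pi / M j i) = c := by rw [M.symmetric]
      have h1' := h1 i j
      have h2' := h2 j i
      rw [hc] at h2'
      rw [e1, e2, h1', h2', chebS.eq_3 c (k + 1), chebS.eq_3 c k]
      by_cases hk : Even k
      · have h3 : ¬ Even (k + 1) := by simpa [Nat.even_add_one] using hk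
        have h4 : Even (k + 2) := by simpa [Nat.even_add] using hk
        simp only [hk, h3, h4, if_true, if_false]; module
      · have h3 : Even (k + 1) := by simpa [Nat.even_add_one] using hk
        have h4 : ¬ Even (k + 2) := by simpa [Nat.even_add] using hk
        simp only [hk, h3, h4, if_true, if_false]; module
  · change altRefl M j i k (srefl M j _) = _
    rw [srefl_self, map_neg]

lemma altRefl_even (i j : B) (k : ℕ) : altRefl M i j (2 * k) = (srefl M i * srefl M j) ^ k := by
  induction k with
  | zero => rfl
  | succ k ih =>
    rw [show 2 * (k + 1) = (2 * k + 1) + 1 by ring, pow_succ, ← ih, ← mul_assoc]; rfl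

lemma chebS_two_mul (m : ℕ) (hm : 2 ≤ m) :
    chebS (2 * Real.cos (Real.pi / m)) (2 * m) = 0 ∧
    chebS (2 * Real.cos (Real.pi / m)) (2 * m + 1) = 1 := by
  have hm2 : (2 : ℝ) ≤ m := by exact_mod_cast hm
  have hs : 0 < Real.sin (Real.pi / m) := by
    apply Real.sin_pos_of_pos_of_lt_pi (by positivity)
    rw [div_lt_iff₀ (by linarith)]; nlinarith [Real.pi_pos]
  have hm0 : (m : ℝ) ≠ 0 := by positivity
  constructor <;> apply mul_left_cancel₀ hs.ne' <;> rw [chebS_sin]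
  · rw [show ((2 * m : ℕ) : ℝ) * (Real.pi / m) = 2 * Real.pi by push_cast; field_simp]; simp
  · rw [show ((2 * m + 1 : ℕ) : ℝ) * (Real.pi / m) = Real.pi / m + 2 * Real.pi by
      push_cast; field_simp; ring]
    rw [Real.sin_add_two_pi]; ring

lemma srefl_liftable : M.IsLiftable (srefl M) := by
  intro i j
  by_cases hij : i = j
  · subst hij
    rw [M.diagonal, pow_one]
    ext1 v; ext1
    simp [LinearMap.comp_apply, srefl_srefl]
  rcases Nat.eq_zero_or_pos (M i j) with h0 | h0
  · rw [h0, pow_zero]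
  have hm : 2 ≤ M i j := by
    have := M.off_diagonal i j hij
    omega
  obtain ⟨hz, ho⟩ := chebS_two_mul (M i j) hm
  rw [← altRefl_even]
  set A := altRefl M i j (2 * M i j) with hA
  have hi : A (ev (some i)) = ev (some i) := by
    have := (altRefl_apply (M := M) i j (2 * M i j)).1
    rw [← hA, hz, ho] at this
    simpa using this
  have hj : A (ev (some j)) = ev (some j) := by
    obtain ⟨k, hk⟩ : ∃ k, M i j = k + 1 := ⟨M i j - 1, by omega⟩
    have h1 := (altRefl_apply (M := M) i j (2 * k + 1)).2
    have h2 := (altRefl_apply (M := M) j i (2 * k + 1)).1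
    rw [show 2 * k + 1 + 1 = 2 * M i j by omega] at h1 h2
    rw [M.symmetric j i] at h2
    rw [hA, h1, h2]
    have hz' : chebS (2 * Real.cos (Real.pi / M i j)) (2 * k + 1) = -1 := by
      have : chebS (2 * Real.cos (Real.pi / M i j)) (2 * k + 3) = 1 := by
        rw [← ho]; congr 1; omega
      rw [chebS, show 2 * k + 1 + 1 = 2 * M i j by omega, hz] at this
      linarith
    have ho' : ¬ Even (2 * k + 1) := by simp
    simp [hz, hz', ho']
  have hfix : ∀ v, bform M (ev (some i)) v = 0 → bform M (ev (some j)) v = 0 → A v = v := by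
    intro v h1 h2
    have e1 : srefl M i v = v := by rw [srefl_apply, h1]; simp
    have e2 : srefl M j v = v := by rw [srefl_apply, h2]; simp
    rw [hA, altRefl_even]
    generalize M i j = n
    induction n with
    | zero => simp
    | succ n ih => rw [pow_succ]; simp [e1, e2, ih]
  ext1 o
  ext1
  simp only [LinearMap.comp_apply, Finsupp.lsingle_apply]
  generalize Finsupp.single o (1 : ℝ) = v
  set c := Real.cos (Real.pi / M i j) with hc
  have hs : 1 - c ^ 2 ≠ 0 := by
    have hm2 : (2 : ℝ) ≤ M i j := by exact_mod_cast hm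
    have hs : 0 < Real.sin (Real.pi / M i j) := by
      apply Real.sin_pos_of_pos_of_lt_pi (by positivity)
      rw [div_lt_iff₀ (by linarith)]; nlinarith [Real.pi_pos]
    have := Real.sin_sq_add_cos_sq (Real.pi / M i j)
    rw [← hc] at this
    nlinarith
  set a := bform M (ev (some i)) v with ha
  set b := bform M (ev (some j)) v with hb
  set x := (a + c * b) / (2 * (1 - c ^ 2)) with hx
  set y := (b + c * a) / (2 * (1 - c ^ 2)) with hy
  have key : A (v - x • ev (some i) - y • ev (some j)) = v - x • ev (some i) - y • ev (some j) := by
    apply hfix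
    · simp only [map_sub, map_smul, bform_simple_self, bform_simple, smul_eq_mul, ← ha, ← hc, hx, hy]
      field_simp; ring
    · simp only [map_sub, map_smul, bform_simple_self, bform_simple, smul_eq_mul, ← hb,
        M.symmetric j i, ← hc, hx, hy]
      field_simp; ring
  simp only [map_sub, map_smul, hi, hj] at key
  simpa using key

variable (cs : CoxeterSystem M W)

/-- The reflection representation. -/
noncomputable def rep : W →* End ℝ (RootSpace B) := cs.lift ⟨srefl M, srefl_liftable⟩

@[simp] lemma rep_simple (i : B) : rep cs (cs.simple i) = srefl M i :=
  cs.lift_apply_simple srefl_liftable i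

lemma rep_mul_apply (x y : W) (v : RootSpace B) : rep cs (x * y) v = rep cs x (rep cs y v) := by
  rw [map_mul]; rfl

@[simp] lemma rep_inv_rep (x : W) (v : RootSpace B) : rep cs x⁻¹ (rep cs x v) = v := by
  rw [← rep_mul_apply]; simp

@[simp] lemma rep_rep_inv (x : W) (v : RootSpace B) : rep cs x (rep cs x⁻¹ v) = v := by
  rw [← rep_mul_apply]; simp

lemma bform_rep (w : W) (u v : RootSpace B) :
    bform M (rep cs w u) (rep cs w v) = bform M u v := by
  induction w using cs.simple_induction_left generalizing u v with
  | one => simp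
  | mul_simple_left w i ih => simp only [rep_mul_apply, rep_simple, bform_srefl, ih]

lemma rep_none (w : W) (v : RootSpace B) : rep cs w v none = v none := by
  induction w using cs.simple_induction_left generalizing v with
  | one => simp
  | mul_simple_left w i ih =>
    simp [srefl_apply, ih, ev]

end KLPos

namespace KLPos

open Module

variable {B W : Type} [Group W] {M : CoxeterMatrix B} (cs : CoxeterSystem M W)

lemma rep_alternatingWord (i j : B) (k : ℕ) :
    rep cs (cs.wordProd (CoxeterSystem.alternatingWord i j k)) = altRefl M i j k := by
  induction k generalizing i j with
  | zero => simp [CoxeterSystem.alternatingWord, altRefl]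
  | succ k ih =>
    rw [CoxeterSystem.alternatingWord_succ, cs.wordProd_concat, map_mul, ih, rep_simple]; rfl

lemma ev_nonneg (o : Option B) : 0 ≤ (ev o : RootSpace B) := by
  classical
  intro a; simp only [ev, Finsupp.coe_zero, Pi.zero_apply]
  rw [Finsupp.single_apply]; split_ifs <;> norm_num

theorem root_nonneg (w : W) (i : B) (h : cs.length w < cs.length (w * cs.simple i)) :
    0 ≤ rep cs w (ev (some i)) := by
  induction hn : cs.length w using Nat.strong_induction_on generalizing w i with
  | _ n IH =>
  by_cases hw : w = 1
  · subst hw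
    rw [map_one]; exact ev_nonneg _
  obtain ⟨j, hj⟩ := cs.exists_rightDescent_of_ne_one hw
  have hij : i ≠ j := by
    rintro rfl; exact absurd hj (by simp only [CoxeterSystem.IsRightDescent]; omega)
  let P : ℕ → Prop := fun k => ∃ v, w = v * cs.wordProd (CoxeterSystem.alternatingWord i j k) ∧
    cs.length w = cs.length v + k
  classical
  have hP1 : P 1 := by
    refine ⟨w * cs.simple j, ?_, ?_⟩
    · simp [CoxeterSystem.alternatingWord]
    · have := cs.isRightDescent_iff.1 hj; omega
  have hn1 : 1 ≤ cs.length w := by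
    obtain ⟨v, -, h⟩ := hP1; omega
  set k := Nat.findGreatest P (cs.length w) with hk
  have hPk : P k := Nat.findGreatest_spec hn1 hP1
  have hk1 : 1 ≤ k := Nat.le_findGreatest hn1 hP1
  obtain ⟨v, hv, hl⟩ := hPk
  have hmax : ¬ P (k + 1) := by
    intro hP
    have : k + 1 ≤ cs.length w := by obtain ⟨v, -, h⟩ := hP; omega
    have := Nat.le_findGreatest this hP
    omega
  have next : cs.length v < cs.length (v * cs.simple (if Even k then j else i)) := by
    by_contra hcon
    apply hmax
    refine ⟨v * cs.simple (if Even k then j else i), ?_, ?_⟩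
    · rw [CoxeterSystem.alternatingWord_succ', cs.wordProd_cons, ← mul_assoc,
        cs.simple_mul_simple_cancel_right]; exact hv
    · have := cs.length_mul_simple v (if Even k then j else i); omega
  have prev : cs.length v < cs.length (v * cs.simple (if Even k then i else j)) := by
    obtain ⟨k', hk'⟩ : ∃ k', k = k' + 1 := ⟨k - 1, by omega⟩
    have : w = v * cs.simple (if Even k then i else j) *
        cs.wordProd (CoxeterSystem.alternatingWord i j k') := by
      rw [hv, hk', CoxeterSystem.alternatingWord_succ', cs.wordProd_cons, ← mul_assoc]
      by_cases h : Even k' <;> simp [h, Nat.even_add_one]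
    have h2 := cs.length_mul_le (v * cs.simple (if Even k then i else j))
      (cs.wordProd (CoxeterSystem.alternatingWord i j k'))
    rw [← this] at h2
    have h3 := cs.length_wordProd_le (CoxeterSystem.alternatingWord i j k')
    rw [CoxeterSystem.length_alternatingWord] at h3
    omega
  have hkM : M i j = 0 ∨ k + 1 ≤ M i j := by
    by_contra! hcon
    have hnr := cs.not_isReduced_alternatingWord j i (m := k + 1)
      (by rw [M.symmetric]; exact hcon.1) (by rw [M.symmetric]; exact hcon.2)
    have h1 : w * cs.simple i = v * cs.wordProd (CoxeterSystem.alternatingWord j i (k + 1)) := by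
      rw [CoxeterSystem.alternatingWord_succ, cs.wordProd_concat, ← mul_assoc, ← hv]
    have h2 := cs.length_wordProd_le (CoxeterSystem.alternatingWord j i (k + 1))
    rw [CoxeterSystem.IsReduced] at hnr
    rw [CoxeterSystem.length_alternatingWord] at h2 hnr
    have h3 := cs.length_mul_le v (cs.wordProd (CoxeterSystem.alternatingWord j i (k + 1)))
    rw [← h1] at h3
    omega
  have hM1 : M i j ≠ 1 := M.off_diagonal i j hij
  have c1 := chebS_nonneg (M i j) (k + 1) hM1 hkM
  have c0 := chebS_nonneg (M i j) k hM1 (by omega)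
  have e1 := IH (cs.length v) (by omega) v _ next rfl
  have e2 := IH (cs.length v) (by omega) v _ prev rfl
  rw [hv, rep_mul_apply, rep_alternatingWord, (altRefl_apply i j k).1, map_add, map_smul, map_smul]
  exact add_nonneg (smul_nonneg c1 e2) (smul_nonneg c0 e1)

theorem root_nonpos (w : W) (i : B) (h : cs.length (w * cs.simple i) < cs.length w) :
    rep cs w (ev (some i)) ≤ 0 := by
  have := root_nonneg cs (w * cs.simple i) i (by simpa using h)
  rw [rep_mul_apply, rep_simple, srefl_self, map_neg] at this
  exact neg_nonneg.1 this

lemma ev_ne_zero (o : Option B) : ev o ≠ 0 := by simp [ev]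

lemma rep_ne_zero (w : W) {v : RootSpace B} (hv : v ≠ 0) : rep cs w v ≠ 0 := by
  intro h; apply hv; rw [← rep_inv_rep cs w v, h, map_zero]

/-- `β` is a root and `t` the associated reflection. -/
def IsRootOf (t : W) (β : RootSpace B) : Prop :=
  ∃ w i, t = w * cs.simple i * w⁻¹ ∧ β = rep cs w (ev (some i))

variable {cs}

namespace IsRootOf

variable {t : W} {β : RootSpace B} (h : IsRootOf cs t β)

include h

lemma nonneg_or_nonpos : 0 ≤ β ∨ β ≤ 0 := by
  obtain ⟨w, i, rfl, rfl⟩ := h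
  rcases cs.length_mul_simple w i with h | h
  · exact Or.inl (root_nonneg cs w i (by omega))
  · exact Or.inr (root_nonpos cs w i (by omega))

lemma ne_zero : β ≠ 0 := by
  obtain ⟨w, i, rfl, rfl⟩ := h
  exact rep_ne_zero cs w (ev_ne_zero _)

lemma none_eq_zero : β none = 0 := by
  obtain ⟨w, i, rfl, rfl⟩ := h
  rw [rep_none]; simp [ev]

lemma bform_self : bform M β β = 2 := by
  obtain ⟨w, i, rfl, rfl⟩ := h
  rw [bform_rep, bform_simple_self]

lemma rep_apply (v : RootSpace B) : rep cs t v = v - bform M β v • β := by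
  obtain ⟨w, i, rfl, rfl⟩ := h
  rw [rep_mul_apply, rep_mul_apply, rep_simple, srefl_apply, map_sub, map_smul, rep_rep_inv]
  congr 2
  conv_lhs => rw [← bform_rep cs w, rep_rep_inv]

lemma rep_self : rep cs t β = -β := by
  rw [h.rep_apply, h.bform_self]; module

lemma mul_self : t * t = 1 := by
  obtain ⟨w, i, rfl, rfl⟩ := h
  simp [mul_assoc]

lemma conj (y : W) : IsRootOf cs (y * t * y⁻¹) (rep cs y β) := by
  obtain ⟨w, i, rfl, rfl⟩ := h
  exact ⟨y * w, i, by group, by rw [rep_mul_apply]⟩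

end IsRootOf

lemma isRootOf_simple (i : B) : IsRootOf cs (cs.simple i) (ev (some i)) := ⟨1, i, by simp, by simp⟩

lemma not_nonneg_of_nonpos {v : RootSpace B} (hv : v ≠ 0) (h : v ≤ 0) : ¬ 0 ≤ v :=
  fun h' => hv (le_antisymm h h')

theorem rep_injective : Function.Injective (rep cs) := by
  have key : ∀ w, rep cs w = 1 → w = 1 := by
    intro w hw
    by_contra hne
    obtain ⟨i, hi⟩ := cs.exists_rightDescent_of_ne_one hne
    have := root_nonpos cs w i hi
    rw [hw] at this
    exact not_nonneg_of_nonpos (ev_ne_zero _) this (ev_nonneg _)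
  intro x y hxy
  have := key (x * y⁻¹) (by rw [map_mul, hxy, ← map_mul]; simp)
  exact mul_inv_eq_one.1 this

lemma IsRootOf.unique {t t' : W} {β : RootSpace B} (h : IsRootOf cs t β) (h' : IsRootOf cs t' β) :
    t = t' := by
  apply rep_injective (cs := cs)
  ext1 v
  ext1
  simp [h.rep_apply, h'.rep_apply]

/-- The only positive root made negative by `s i` is the simple root. -/
lemma IsRootOf.eq_simple {t : W} {β : RootSpace B} (h : IsRootOf cs t β) (hβ : 0 ≤ β) (i : B)
    (hneg : srefl M i β ≤ 0) : β = ev (some i) := by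
  have hc : ∀ o, o ≠ some i → β o = 0 := by
    intro o ho
    have h1 := hneg o
    have h2 := hβ o
    have h3 : (ev (some i) : RootSpace B) o = 0 := Finsupp.single_eq_of_ne ho
    simp only [srefl_apply, Finsupp.coe_sub, Finsupp.coe_smul, Pi.sub_apply, Pi.smul_apply,
      Finsupp.coe_zero, Pi.zero_apply, h3, smul_zero] at h1 h2
    linarith
  have hβ' : β = β (some i) • ev (some i) := by
    ext o
    by_cases ho : o = some i
    · subst ho; simp [ev]
    · rw [hc o ho]; simp [ev, Ne.symm ho]
  have hn := h.bform_self
  rw [hβ'] at hn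
  simp only [map_smul, LinearMap.smul_apply, bform_simple_self, smul_eq_mul] at hn
  have hp := hβ (some i)
  simp only [Finsupp.coe_zero, Pi.zero_apply] at hp
  have : β (some i) = 1 := by nlinarith
  rw [hβ', this, one_smul]

/-- Positive root with its reflection. -/
def IsPosRoot (cs : CoxeterSystem M W) (t : W) (β : RootSpace B) : Prop :=
  IsRootOf cs t β ∧ 0 ≤ β

lemma IsPosRoot.simple_conj {t : W} {β : RootSpace B} (h : IsPosRoot cs t β) {i : B}
    (ht : t ≠ cs.simple i) :
    IsPosRoot cs (cs.simple i * t * cs.simple i) (srefl M i β) := by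
  have h1 := h.1.conj (cs.simple i)
  rw [rep_simple, cs.inv_simple] at h1
  refine ⟨h1, ?_⟩
  rcases h1.nonneg_or_nonpos with h2 | h2
  · exact h2
  · have := h.1.eq_simple h.2 i h2
    subst this
    exact absurd (h.1.unique (isRootOf_simple i)) ht

lemma IsPosRoot.length_mul_lt {t : W} {β : RootSpace B} (h : IsPosRoot cs t β) (y : W)
    (hy : rep cs y β ≤ 0) : cs.length (y * t) < cs.length y := by
  induction hn : cs.length y using Nat.strong_induction_on generalizing y t β with
  | _ n IH =>
  by_cases hy1 : y = 1
  · subst hy1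
    rw [map_one] at hy
    exact absurd h.2 (not_nonneg_of_nonpos h.1.ne_zero hy)
  obtain ⟨i, hi⟩ := cs.exists_rightDescent_of_ne_one hy1
  have hi' := cs.isRightDescent_iff.1 hi
  by_cases ht : t = cs.simple i
  · rw [ht]; omega
  have h' := h.simple_conj ht
  have := IH (cs.length (y * cs.simple i)) (by omega) h' (y * cs.simple i)
    (by rwa [rep_mul_apply, rep_simple, srefl_srefl]) rfl
  have e : y * t = (y * cs.simple i * (cs.simple i * t * cs.simple i)) * cs.simple i := by
    simp [mul_assoc]
  rcases cs.length_mul_simple (y * cs.simple i * (cs.simple i * t * cs.simple i)) i with h3 | h3 <;>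
    rw [e] <;> omega

lemma IsPosRoot.lt_length_mul {t : W} {β : RootSpace B} (h : IsPosRoot cs t β) (y : W)
    (hy : 0 ≤ rep cs y β) : cs.length y < cs.length (y * t) := by
  have := h.length_mul_lt (y * t) (by
    rw [rep_mul_apply, h.1.rep_self, map_neg]; exact neg_nonpos.2 hy)
  rwa [mul_assoc, h.1.mul_self, mul_one] at this

lemma IsPosRoot.lt_iff {t : W} {β : RootSpace B} (h : IsPosRoot cs t β) (y : W) :
    cs.length y < cs.length (y * t) ↔ 0 ≤ rep cs y β := by
  refine ⟨fun hl => ?_, h.lt_length_mul y⟩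
  rcases (h.1.conj y).nonneg_or_nonpos with h2 | h2
  · exact h2
  · have := h.length_mul_lt y h2; omega

lemma IsPosRoot.lt_simple {t : W} {β : RootSpace B} (h : IsPosRoot cs t β) {i : B}
    (ht : t ≠ cs.simple i) {y : W} (hy : cs.length y < cs.length (y * t)) :
    cs.length (y * cs.simple i) < cs.length (y * t * cs.simple i) := by
  have := ((h.simple_conj ht).lt_iff (y * cs.simple i)).2 (by
    rw [rep_mul_apply, rep_simple, srefl_srefl]; exact (h.lt_iff y).1 hy)
  convert this using 2
  simp [mul_assoc]

theorem exists_inversion_bound (y : W) : ∃ I : Finset W, I.card ≤ cs.length y ∧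
    ∀ t β, IsPosRoot cs t β → cs.length (y * t) < cs.length y → t ∈ I := by
  induction hn : cs.length y using Nat.strong_induction_on generalizing y with
  | _ n IH =>
  classical
  by_cases hy1 : y = 1
  · refine ⟨∅, by simp, fun t β _ h => ?_⟩
    subst hy1; simp at hn; omega
  obtain ⟨i, hi⟩ := cs.exists_rightDescent_of_ne_one hy1
  have hi' := cs.isRightDescent_iff.1 hi
  obtain ⟨I, hI, hI'⟩ := IH (cs.length (y * cs.simple i)) (by omega) _ rfl
  refine ⟨insert (cs.simple i) (I.image fun t => cs.simple i * t * cs.simple i), ?_, ?_⟩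
  · have h1 := Finset.card_insert_le (cs.simple i)
      (I.image fun t => cs.simple i * t * cs.simple i)
    have h2 := Finset.card_image_le (s := I) (f := fun t => cs.simple i * t * cs.simple i)
    omega
  · intro t β h hlt
    by_cases ht : t = cs.simple i
    · simp [ht]
    · refine Finset.mem_insert_of_mem (Finset.mem_image.2 ⟨cs.simple i * t * cs.simple i, ?_, ?_⟩)
      · apply hI' _ _ (h.simple_conj ht)
        by_contra hcon
        have hne : cs.length (y * cs.simple i * (cs.simple i * t * cs.simple i)) ≠
            cs.length (y * cs.simple i) := by
          apply CoxeterSystem.IsReflection.length_mul_left_ne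
          obtain ⟨w, j, h3, -⟩ := (h.simple_conj ht).1
          exact ⟨w, j, h3⟩
        have h4 := (h.simple_conj ht).lt_iff (y * cs.simple i) |>.1 (by omega)
        rw [rep_mul_apply, rep_simple, srefl_srefl] at h4
        have := (h.lt_iff y).2 h4
        omega
      · simp [mul_assoc]

/-- An element of `W` acting as a transvection along `p` is a reflection whose root is
proportional to `p`. -/
theorem exists_root_of_rank_one {w : W} (hw : w ≠ 1) {p : RootSpace B}
    (hp : ∀ v, ∃ c : ℝ, rep cs w v = v + c • p) :
    ∃ β, IsPosRoot cs w β ∧ ∃ c : ℝ, c ≠ 0 ∧ p = c • β := by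
  induction hn : cs.length w using Nat.strong_induction_on generalizing w p with
  | _ n IH =>
  obtain ⟨i, hi⟩ := cs.exists_rightDescent_of_ne_one hw
  have hi' := cs.isRightDescent_iff.1 hi
  have hneg := root_nonpos cs w i hi
  obtain ⟨c, hc⟩ := hp (ev (some i))
  have hc0 : c ≠ 0 := by
    rintro rfl
    rw [hc, zero_smul, add_zero] at hneg
    exact not_nonneg_of_nonpos (ev_ne_zero _) hneg (ev_nonneg _)
  have hcp : c • p ≤ 0 := by
    rw [hc] at hneg
    exact le_trans (le_add_of_nonneg_left (ev_nonneg _)) hneg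
  have hcpi : (c • p) (some i) < 0 := by
    have := hneg (some i)
    rw [hc] at this
    simp only [ev, Finsupp.coe_add, Pi.add_apply, Finsupp.single_eq_same, Finsupp.coe_zero,
      Pi.zero_apply] at this
    linarith
  have hcpn : (c • p) none = 0 := by
    have := rep_none cs w (ev (some i))
    rw [hc] at this
    simpa using this
  set q := c • p with hq
  have hq' : ∀ v, ∃ a : ℝ, rep cs w v = v + a • q := fun v => by
    obtain ⟨a, ha⟩ := hp v
    exact ⟨a * c⁻¹, by rw [ha, hq, smul_smul, mul_assoc, inv_mul_cancel₀ hc0, mul_one]⟩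
  -- pairing of `q` with the extra vector is nonzero
  have hρ : bform M (ev none) q ≠ 0 := by
    have e : bform M (ev none) q = q.sum fun o a => a * gram M none o := by
      simp [bform, ev, Finsupp.linearCombination_apply]
    rw [e, Finsupp.sum]
    apply ne_of_lt
    apply Finset.sum_neg'
    · intro o _
      cases o with
      | none => simp [hcpn]
      | some b => simpa [gram] using hcp (some b)
    · exact ⟨some i, by simpa using hcpi.ne, by simpa [gram] using hcpi⟩
  choose g hg using hq'
  have hgi : g (ev (some i)) • q = q := by
    have := hg (ev (some i)); rw [hc] at this
    exact (add_left_cancel this).symm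
  have hq0 : q ≠ 0 := by
    intro h; rw [h] at hcpi; simp at hcpi
  have hgi1 : g (ev (some i)) = 1 := by
    have : (g (ev (some i)) - 1) • q = 0 := by rw [sub_smul, hgi, one_smul, sub_self]
    rcases smul_eq_zero.1 this with h | h
    · linarith
    · exact absurd h hq0
  have hB : ∀ u v, g u * bform M q v + g v * bform M q u + g u * g v * bform M q q = 0 := by
    intro u v
    have := bform_rep cs w u v
    rw [hg u, hg v] at this
    simp only [map_add, map_smul, LinearMap.add_apply, LinearMap.smul_apply, smul_eq_mul,
      bform_symm u q] at this
    linarith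
  have hBi := hB (ev (some i)) (ev (some i))
  rw [hgi1] at hBi
  have hBv : ∀ v, bform M q v = - (1/2) * g v * bform M q q := by
    intro v
    have := hB (ev (some i)) v
    rw [hgi1] at this
    have h2 : bform M q (ev (some i)) = -(1/2) * bform M q q := by linarith
    rw [h2] at this
    linarith
  have hqq : bform M q q ≠ 0 := by
    intro h0
    apply hρ
    rw [bform_symm, hBv, h0, mul_zero]
  have hrefl : ∀ v, rep cs w v = v - (2 * bform M q v / bform M q q) • q := by
    intro v
    rw [hg v, hBv v, sub_eq_add_neg, ← neg_smul]
    congr 2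
    field_simp
  by_cases hpi : rep cs w (ev (some i)) = - ev (some i)
  · have hqe : q = (-2 : ℝ) • ev (some i) := by
      rw [hc] at hpi
      have : q = - ev (some i) - ev (some i) := by rw [← hpi]; abel
      rw [this]; module
    have hws : w = cs.simple i := by
      apply rep_injective (cs := cs)
      ext1 o; ext1
      simp only [LinearMap.comp_apply, rep_simple]
      rw [hrefl, srefl_apply, hqe]
      simp only [map_smul, LinearMap.smul_apply, bform_simple_self, smul_eq_mul, smul_smul]
      congr 2
      ring
    refine ⟨ev (some i), ⟨?_, ev_nonneg _⟩, -2 * c⁻¹, by positivity, ?_⟩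
    · rw [hws]; exact isRootOf_simple i
    · rw [mul_comm, mul_smul, ← hqe, hq, smul_smul, inv_mul_cancel₀ hc0, one_smul]
  · have hww : w * w = 1 := by
      apply rep_injective (cs := cs)
      ext1 o; ext1
      simp only [LinearMap.comp_apply, map_one, End.one_apply]
      rw [rep_mul_apply, hrefl, hrefl]
      simp only [map_sub, map_smul, smul_eq_mul]
      match_scalars
      · ring
      · field_simp; ring
    have hwi : w⁻¹ = w := by rw [inv_eq_iff_mul_eq_one]; exact hww
    have hroot : IsRootOf cs (w * cs.simple i * w⁻¹) (- rep cs w (ev (some i))) :=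
      ⟨w * cs.simple i, i, by simp [mul_assoc], by
        rw [rep_mul_apply, rep_simple, srefl_self, map_neg]⟩
    have hlen : cs.length (cs.simple i * w * cs.simple i) < cs.length w := by
      by_contra hcon
      have h1 : cs.length (cs.simple i * w) < cs.length w := by
        rw [← cs.length_inv, mul_inv_rev, cs.inv_simple, hwi]; exact hi
      have h2 : cs.length (cs.simple i * w) < cs.length (cs.simple i * w * cs.simple i) := by omega
      have h3 := root_nonneg cs _ _ h2
      rw [rep_mul_apply, rep_simple] at h3
      have h4 := hroot.eq_simple (neg_nonneg.2 hneg) i (by rw [map_neg]; exact neg_nonpos.2 h3)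
      exact hpi (by rw [← neg_eq_iff_eq_neg]; exact h4)
    have hne : cs.simple i * w * cs.simple i ≠ 1 := by
      intro h
      apply hpi
      have : w = 1 := by
        calc w = cs.simple i * (cs.simple i * w * cs.simple i) * cs.simple i := by simp [mul_assoc]
          _ = 1 := by rw [h]; simp
      exact absurd this hw
    obtain ⟨β, hβ, a, ha, hpa⟩ := IH _ (hn ▸ hlen) (w := cs.simple i * w * cs.simple i)
      (p := srefl M i p) hne (fun v => by
        obtain ⟨a, ha⟩ := hp (srefl M i v)
        exact ⟨a, by simp only [rep_mul_apply, rep_simple, ha, map_add, srefl_srefl, map_smul]⟩) rfl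
    have hr := hβ.1.conj (cs.simple i)
    have hws : cs.simple i * (cs.simple i * w * cs.simple i) * (cs.simple i)⁻¹ = w := by
      simp [mul_assoc]
    rw [hws, rep_simple] at hr
    have hp2 : p = a • srefl M i β := by rw [← map_smul, ← hpa, srefl_srefl]
    rcases hr.nonneg_or_nonpos with h5 | h5
    · exact ⟨_, ⟨hr, h5⟩, a, ha, hp2⟩
    · refine ⟨- srefl M i β, ⟨?_, neg_nonneg.2 h5⟩, -a, neg_ne_zero.2 ha, by rw [hp2]; simp⟩
      have := hr.conj w
      rw [hr.rep_self] at this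
      simpa using this

lemma bform_none_pos {β : RootSpace B} {t : W} (h : IsPosRoot cs t β) : 0 < bform M (ev none) β := by
  have e : bform M (ev none) β = β.sum fun o a => a * gram M none o := by
    simp [bform, ev, Finsupp.linearCombination_apply]
  rw [e, Finsupp.sum]
  have hn := h.1.none_eq_zero
  obtain ⟨o, ho⟩ := Finsupp.ne_iff.1 h.1.ne_zero
  have key : ∀ o, 0 ≤ β o * gram M none o := by
    intro o
    cases o with
    | none => simp [gram]
    | some b => simpa [gram] using h.2 (some b)
  apply Finset.sum_pos' (fun o _ => key o)
  refine ⟨o, by simpa using ho, ?_⟩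
  cases o with
  | none => exact absurd hn ho
  | some b => simpa [gram] using lt_of_le_of_ne (h.2 (some b)) (Ne.symm ho)

end KLPos

namespace KLPos

variable {B W : Type} [Group W] {M : CoxeterMatrix B}

/-- An algebraic realization of a Coxeter system: an `ℝ`-algebra `R` (thought of as polynomial
functions) with an action of `W`, Demazure operators, an Euler operator, an augmentation, and a family of positive
roots. -/
structure Realization (cs : CoxeterSystem M W) (R : Type) [CommRing R] [Algebra ℝ R] where
  /-- the action of the group -/
  act : W →* (R ≃ₐ[ℝ] R)
  /-- simple roots -/
  α : B → R
  /-- Demazure operators -/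
  dm : B → R →ₗ[ℝ] R
  /-- twice the Euler operator -/
  eu : R →ₗ[ℝ] R
  /-- the augmentation -/
  ε : R →ₐ[ℝ] ℝ
  /-- linear forms -/
  lin : Submodule ℝ R
  /-- a dominant element -/
  ρ : R
  /-- positive roots with their reflections -/
  IsPR : W → R → Prop
  act_α : ∀ i, act (cs.simple i) (α i) = - α i
  sub_act : ∀ i r, r - act (cs.simple i) r = α i * dm i r
  eu_mul : ∀ r r', eu (r * r') = eu r * r' + r * eu r'
  eu_act : ∀ w r, eu (act w r) = act w (eu r)
  ε_act : ∀ w r, ε (act w r) = ε r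
  ε_eu : ∀ r, ε (eu r) = 0
  α_mem : ∀ i, α i ∈ lin
  α_ne : ∀ i, α i ≠ 0
  ρ_mem : ρ ∈ lin
  act_lin : ∀ w, ∀ r ∈ lin, act w r ∈ lin
  eu_lin : ∀ r ∈ lin, eu r = (2 : ℝ) • r
  dm_lin : ∀ i, ∀ r ∈ lin, dm i r = algebraMap ℝ R (ε (dm i r))
  prime_lin : ∀ r ∈ lin, r ≠ 0 → Prime r
  dvd_lin : ∀ r ∈ lin, ∀ r' ∈ lin, r ∣ r' → ∃ c : ℝ, r' = c • r
  eu_span : ∀ r, r ∈ Submodule.span ℝ {r | ∃ k : ℕ, eu r = (2 * k : ℝ) • r}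
  eu_const : ∀ r, eu r = 0 → r = algebraMap ℝ R (ε r)
  eu_eigen : ∀ r (c : ℝ), eu r = c • r → r = 0 ∨ ∃ k : ℕ, c = 2 * k
  rho_pos : ∀ x i, cs.length x < cs.length (x * cs.simple i) → 0 < ε (dm i (act x⁻¹ ρ))
  pr_simple : ∀ i, IsPR (cs.simple i) (α i)
  pr_lin : ∀ t β, IsPR t β → β ∈ lin ∧ β ≠ 0
  pr_conj : ∀ t β i, IsPR t β → t ≠ cs.simple i →
    IsPR (cs.simple i * t * cs.simple i) (act (cs.simple i) β)
  pr_mul_self : ∀ t β, IsPR t β → t * t = 1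
  pr_lt : ∀ t β i y, IsPR t β → t ≠ cs.simple i → cs.length y < cs.length (y * t) →
    cs.length (y * cs.simple i) < cs.length (y * t * cs.simple i)
  pr_not_dvd : ∀ t β i, IsPR t β → t ≠ cs.simple i → ¬ β ∣ α i
  pr_act : ∀ t β r, IsPR t β → β ∣ r - act t r
  pr_length_ne : ∀ t β y, IsPR t β → cs.length (y * t) ≠ cs.length y
  pr_bound : ∀ y, ∃ I : Finset W, I.card ≤ cs.length y ∧
    ∀ t β, IsPR t β → cs.length (y * t) < cs.length y → t ∈ I
  pr_unique : ∀ t β β', IsPR t β → IsPR t β' → β = β'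
  separate : ∀ y y', y ≠ y' → ∀ p ∈ lin, p ≠ 0 → ∃ r ∈ lin, act y⁻¹ r - act y'⁻¹ r ≠ 0 ∧
    (¬ p ∣ act y⁻¹ r - act y'⁻¹ r ∨
      ∃ t β, IsPR t β ∧ y' = y * t ∧ ∃ c : ℝ, c ≠ 0 ∧ p = c • β)

end KLPos

namespace KLPos

open MvPolynomial

variable {B W : Type} [Group W] {M : CoxeterMatrix B} (cs : CoxeterSystem M W)

/-- The polynomial ring on the reflection space. -/
abbrev PolyRing (B : Type) : Type := MvPolynomial (Option B) ℝ

/-- Vectors as linear forms. -/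
noncomputable def linForm : RootSpace B →ₗ[ℝ] PolyRing B := Finsupp.linearCombination ℝ X

@[simp] lemma linForm_ev (o : Option B) : linForm (ev o) = X o := by simp [linForm, ev]

lemma coeff_linForm (v : RootSpace B) (o : Option B) :
    coeff (Finsupp.single o 1) (linForm v) = v o := by
  classical
  rw [linForm, Finsupp.linearCombination_apply, Finsupp.sum, coeff_sum]
  simp only [coeff_smul, coeff_X, Finsupp.single_left_inj (one_ne_zero), smul_eq_mul, mul_ite,
    mul_one, mul_zero, Finset.sum_ite_eq', Finsupp.mem_support_iff, ite_eq_left_iff, not_not]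
  exact fun h => h.symm

lemma linForm_injective : Function.Injective (linForm : RootSpace B → PolyRing B) := by
  intro u v h
  ext o
  rw [← coeff_linForm u, h, coeff_linForm]

lemma isHomogeneous_linForm (v : RootSpace B) : (linForm v).IsHomogeneous 1 := by
  rw [linForm, Finsupp.linearCombination_apply, Finsupp.sum]
  apply IsHomogeneous.sum
  intro o _
  rw [MvPolynomial.smul_eq_C_mul]
  simpa using (isHomogeneous_C _ (v o)).mul (isHomogeneous_X ℝ o)

lemma totalDegree_linForm {v : RootSpace B} (hv : v ≠ 0) : (linForm v).totalDegree = 1 :=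
  (isHomogeneous_linForm v).totalDegree
    (fun h => hv (linForm_injective (h.trans (map_zero _).symm)))

lemma prime_linForm {v : RootSpace B} (hv : v ≠ 0) : Prime (linForm v) := by
  apply Irreducible.prime
  apply irreducible_of_totalDegree_eq_one (totalDegree_linForm hv)
  intro x hx
  obtain ⟨o, ho⟩ := Finsupp.ne_iff.1 hv
  have := hx (Finsupp.single o 1)
  rw [coeff_linForm] at this
  exact isUnit_of_dvd_unit this (IsUnit.mk0 _ ho)

lemma smul_of_dvd_linForm {u v : RootSpace B} (h : linForm u ∣ linForm v) :
    ∃ c : ℝ, v = c • u := by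
  obtain ⟨q, hq⟩ := h
  by_cases hv : v = 0
  · exact ⟨0, by simp [hv]⟩
  have hv' : linForm v ≠ 0 := fun h => hv (linForm_injective (h.trans (map_zero _).symm))
  have hu' : linForm u ≠ 0 := by rintro h; rw [h, zero_mul] at hq; exact hv' hq
  have hq' : q ≠ 0 := by rintro rfl; rw [mul_zero] at hq; exact hv' hq
  have hu : u ≠ 0 := by rintro rfl; simp at hu'
  have hd := congrArg totalDegree hq
  rw [totalDegree_mul_of_isDomain hu' hq', totalDegree_linForm hv, totalDegree_linForm hu] at hd
  obtain hc := totalDegree_eq_zero_iff_eq_C.1 (by omega : q.totalDegree = 0)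
  refine ⟨coeff 0 q, linForm_injective ?_⟩
  rw [map_smul, hq, MvPolynomial.smul_eq_C_mul, mul_comm, ← hc]

/-- The action on polynomials as algebra homomorphisms. -/
noncomputable def polyHom (w : W) : PolyRing B →ₐ[ℝ] PolyRing B :=
  aeval fun o => linForm (rep cs w (ev o))

lemma polyHom_linForm (w : W) (v : RootSpace B) :
    polyHom cs w (linForm v) = linForm (rep cs w v) := by
  have : (polyHom cs w).toLinearMap ∘ₗ linForm = linForm ∘ₗ rep cs w := by
    ext1 o
    ext1
    change polyHom cs w (linForm (ev o)) = linForm (rep cs w (ev o))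
    simp [polyHom]
  exact LinearMap.congr_fun this v

lemma polyHom_mul (x y : W) : polyHom cs (x * y) = (polyHom cs x).comp (polyHom cs y) := by
  apply MvPolynomial.algHom_ext
  intro o
  rw [← linForm_ev, AlgHom.comp_apply, polyHom_linForm, polyHom_linForm, polyHom_linForm,
    rep_mul_apply]

lemma polyHom_one : polyHom cs (1 : W) = AlgHom.id ℝ _ := by
  apply MvPolynomial.algHom_ext
  intro o
  rw [← linForm_ev, polyHom_linForm, map_one]; rfl

/-- The action on polynomials. -/
noncomputable def polyAct : W →* (PolyRing B ≃ₐ[ℝ] PolyRing B) where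
  toFun w := AlgEquiv.ofAlgHom (polyHom cs w) (polyHom cs w⁻¹)
    (by rw [← polyHom_mul, mul_inv_cancel, polyHom_one])
    (by rw [← polyHom_mul, inv_mul_cancel, polyHom_one])
  map_one' := by
    ext1 r
    change polyHom cs 1 r = r
    rw [polyHom_one]; rfl
  map_mul' x y := by
    ext1 r
    change polyHom cs (x * y) r = polyHom cs x (polyHom cs y r)
    rw [polyHom_mul]; rfl

lemma polyAct_apply (w : W) (r : PolyRing B) : polyAct cs w r = polyHom cs w r := rfl

lemma polyAct_linForm (w : W) (v : RootSpace B) :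
    polyAct cs w (linForm v) = linForm (rep cs w v) := polyHom_linForm cs w v

lemma exists_demazure (i : B) (r : PolyRing B) :
    ∃ q, r - polyAct cs (cs.simple i) r = X (some i) * q := by
  change X (some i) ∣ _
  induction r using MvPolynomial.induction_on with
  | C a => simp [polyAct_apply, polyHom]
  | add p q hp hq =>
    have : p + q - polyAct cs (cs.simple i) (p + q) =
      (p - polyAct cs (cs.simple i) p) + (q - polyAct cs (cs.simple i) q) := by
      rw [map_add]; ring
    rw [this]; exact dvd_add hp hq
  | mul_X p o hp =>
    have h1 : X (some i) ∣ X o - polyAct cs (cs.simple i) (X o) := by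
      rw [← linForm_ev o, polyAct_linForm, rep_simple, srefl_apply, map_sub, map_smul, linForm_ev,
        linForm_ev, MvPolynomial.smul_eq_C_mul]
      exact ⟨C ((bform M (ev (some i))) (ev o)), by ring⟩
    have : p * X o - polyAct cs (cs.simple i) (p * X o) =
      (p - polyAct cs (cs.simple i) p) * X o +
        polyAct cs (cs.simple i) p * (X o - polyAct cs (cs.simple i) (X o)) := by
      rw [map_mul]; ring
    rw [this]; exact dvd_add (dvd_mul_of_dvd_left hp _) (dvd_mul_of_dvd_right h1 _)

/-- Demazure operators on polynomials. -/
noncomputable def polyDm (i : B) : PolyRing B →ₗ[ℝ] PolyRing B where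
  toFun r := (exists_demazure cs i r).choose
  map_add' r r' := by
    apply mul_left_cancel₀ (X_ne_zero (R := ℝ) (some i))
    rw [mul_add, ← (exists_demazure cs i _).choose_spec, ← (exists_demazure cs i _).choose_spec,
      ← (exists_demazure cs i _).choose_spec, map_add]
    ring
  map_smul' c r := by
    apply mul_left_cancel₀ (X_ne_zero (R := ℝ) (some i))
    rw [RingHom.id_apply, mul_smul_comm, ← (exists_demazure cs i _).choose_spec,
      ← (exists_demazure cs i _).choose_spec, map_smul, smul_sub]

lemma polyDm_spec (i : B) (r : PolyRing B) :
    r - polyAct cs (cs.simple i) r = X (some i) * polyDm cs i r :=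
  (exists_demazure cs i r).choose_spec

lemma polyDm_linForm (i : B) (v : RootSpace B) :
    polyDm cs i (linForm v) = algebraMap ℝ _ (bform M (ev (some i)) v) := by
  apply mul_left_cancel₀ (X_ne_zero (R := ℝ) (some i))
  rw [← polyDm_spec, polyAct_linForm, rep_simple, srefl_apply, map_sub, map_smul, linForm_ev,
    MvPolynomial.smul_eq_C_mul, MvPolynomial.algebraMap_eq]
  ring

/-- Twice the Euler derivation. -/
noncomputable def polyEu : Derivation ℝ (PolyRing B) (PolyRing B) :=
  mkDerivation ℝ fun o => (2 : ℝ) • X o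

lemma polyEu_linForm (v : RootSpace B) : polyEu (linForm v) = (2 : ℝ) • linForm v := by
  have : polyEu.toLinearMap ∘ₗ linForm = (2 : ℝ) • (linForm (B := B)) := by
    ext1 o
    ext1
    change polyEu (linForm (ev o)) = (2 : ℝ) • linForm (ev o)
    simp [polyEu]
  exact LinearMap.congr_fun this v

lemma polyEu_monomial (s : Option B →₀ ℕ) (a : ℝ) :
    polyEu (monomial s a) = (2 * s.degree : ℝ) • monomial s a := by
  rw [polyEu, mkDerivation_monomial]
  have : (s.sum fun i k => monomial (s - Finsupp.single i 1) (k : ℝ) • (2 : ℝ) • (X i : PolyRing B))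
      = s.sum fun _ k => (2 * k : ℝ) • monomial s 1 := by
    apply Finsupp.sum_congr
    intro o ho
    rw [smul_eq_mul, mul_smul_comm, mul_comm, X, monomial_mul, one_mul]
    rw [add_comm, tsub_add_cancel_of_le (by
      rw [Finsupp.single_le_iff]; exact Nat.one_le_iff_ne_zero.2 (Finsupp.mem_support_iff.1 ho))]
    rw [smul_monomial, smul_monomial]; simp
  rw [this, Finsupp.sum, ← Finset.sum_smul, smul_comm, smul_monomial, smul_eq_mul, mul_one]
  congr 1
  rw [← Finset.mul_sum, Finsupp.degree_apply, Nat.cast_sum]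

lemma coeff_polyEu (s : Option B →₀ ℕ) (r : PolyRing B) :
    coeff s (polyEu r) = 2 * s.degree * coeff s r := by
  classical
  induction r using MvPolynomial.induction_on' with
  | monomial u a =>
    rw [polyEu_monomial, coeff_smul, coeff_monomial]
    split_ifs with h
    · rw [h]; rfl
    · simp
  | add p q hp hq => rw [map_add, coeff_add, coeff_add, hp, hq]; ring

lemma polyEu_act (w : W) (r : PolyRing B) :
    polyEu (polyAct cs w r) = polyAct cs w (polyEu r) := by
  induction r using MvPolynomial.induction_on with
  | C a => simp [polyAct_apply, polyHom, MvPolynomial.algebraMap_eq]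
  | add p q hp hq => simp only [map_add, hp, hq]
  | mul_X p o hp =>
    simp only [map_mul, Derivation.leibniz, smul_eq_mul, map_add, hp]
    rw [← linForm_ev, polyAct_linForm, polyEu_linForm, polyEu_linForm, map_smul, polyAct_linForm]

lemma aeval_zero_act (w : W) (r : PolyRing B) :
    (aeval (fun _ => (0 : ℝ))) (polyAct cs w r) = aeval (fun _ => (0 : ℝ)) r := by
  have : (aeval (fun _ : Option B => (0 : ℝ))).comp (polyHom cs w) = aeval (fun _ => (0 : ℝ)) := by
    apply MvPolynomial.algHom_ext
    intro o
    rw [← linForm_ev, AlgHom.comp_apply, polyHom_linForm]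
    have h : ∀ v : RootSpace B, aeval (fun _ : Option B => (0 : ℝ)) (linForm v) = 0 := by
      intro v
      rw [linForm, Finsupp.linearCombination_apply, Finsupp.sum, map_sum]
      simp
    rw [h, h]
  exact DFunLike.congr_fun this r

lemma aeval_zero_eq (r : PolyRing B) : aeval (fun _ => (0 : ℝ)) r = coeff 0 r := by
  have := MvPolynomial.aeval_zero' (R := ℝ) (S₁ := ℝ) (σ := Option B) r
  simp [constantCoeff_eq]

/-- The realization on the polynomial ring of the reflection space. -/
noncomputable def polyRealization : Realization cs (PolyRing B) where
  act := polyAct cs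
  α i := X (some i)
  dm := polyDm cs
  eu := polyEu.toLinearMap
  ε := aeval fun _ => 0
  lin := LinearMap.range linForm
  ρ := X none
  IsPR t r := ∃ β, IsPosRoot cs t β ∧ r = linForm β
  act_α i := by
    rw [← linForm_ev, polyAct_linForm, rep_simple, srefl_self, map_neg]
  sub_act := polyDm_spec cs
  eu_mul r r' := by
    change polyEu (r * r') = _
    rw [Derivation.leibniz, smul_eq_mul, smul_eq_mul, add_comm, mul_comm r']; rfl
  eu_act := polyEu_act cs
  ε_act := aeval_zero_act cs
  ε_eu r := by
    rw [aeval_zero_eq]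
    change coeff 0 (polyEu r) = 0
    rw [coeff_polyEu]; simp
  α_mem i := ⟨ev (some i), linForm_ev _⟩
  α_ne i := X_ne_zero _
  ρ_mem := ⟨ev none, linForm_ev _⟩
  act_lin := by
    rintro w _ ⟨v, rfl⟩
    exact ⟨_, (polyAct_linForm cs w v).symm⟩
  eu_lin := by
    rintro _ ⟨v, rfl⟩
    exact polyEu_linForm v
  dm_lin := by
    rintro i _ ⟨v, rfl⟩
    rw [polyDm_linForm, AlgHom.commutes]; rfl
  prime_lin := by
    rintro _ ⟨v, rfl⟩ h
    exact prime_linForm (by rintro rfl; simp at h)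
  dvd_lin := by
    rintro _ ⟨u, rfl⟩ _ ⟨v, rfl⟩ h
    obtain ⟨c, rfl⟩ := smul_of_dvd_linForm h
    exact ⟨c, map_smul _ _ _⟩
  eu_span r := by
    induction r using MvPolynomial.induction_on' with
    | monomial u a =>
      exact Submodule.subset_span ⟨u.degree, polyEu_monomial u a⟩
    | add p q hp hq => exact Submodule.add_mem _ hp hq
  eu_const r h := by
    change polyEu r = 0 at h
    ext s
    rw [aeval_zero_eq, MvPolynomial.algebraMap_eq]
    by_cases hs : s = 0
    · subst hs; simp
    · classical
      rw [coeff_C, if_neg (Ne.symm hs)]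
      have := coeff_polyEu s r
      rw [h, coeff_zero] at this
      have hd : (s.degree : ℝ) ≠ 0 := by
        exact_mod_cast fun h => hs ((Finsupp.degree_eq_zero_iff s).1 h)
      simpa [hd] using this.symm
  eu_eigen r c h := by
    change polyEu r = c • r at h
    by_cases hr : r = 0
    · exact Or.inl hr
    · right
      obtain ⟨s, hs⟩ := ne_zero_iff.1 hr
      refine ⟨s.degree, ?_⟩
      have := coeff_polyEu s r
      rw [h, coeff_smul, smul_eq_mul] at this
      exact mul_right_cancel₀ hs this
  rho_pos x i h := by
    rw [← linForm_ev, polyAct_linForm, polyDm_linForm, AlgHom.commutes]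
    change 0 < bform M (ev (some i)) (rep cs x⁻¹ (ev none))
    rw [← bform_rep cs x, rep_rep_inv, bform_symm]
    exact bform_none_pos (cs := cs) (t := x * cs.simple i * x⁻¹)
      ⟨⟨x, i, rfl, rfl⟩, root_nonneg cs x i h⟩
  pr_simple i := ⟨ev (some i), ⟨isRootOf_simple i, ev_nonneg _⟩, (linForm_ev _).symm⟩
  pr_lin := by
    rintro t _ ⟨β, h, rfl⟩
    exact ⟨⟨β, rfl⟩, fun h0 => h.1.ne_zero (linForm_injective (h0.trans (map_zero _).symm))⟩
  pr_conj := by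
    rintro t _ i ⟨β, h, rfl⟩ ht
    exact ⟨_, h.simple_conj ht, by rw [polyAct_linForm, rep_simple]⟩
  pr_mul_self := by
    rintro t _ ⟨β, h, rfl⟩
    exact h.1.mul_self
  pr_lt := by
    rintro t _ i y ⟨β, h, rfl⟩ ht hy
    exact h.lt_simple ht hy
  pr_not_dvd := by
    rintro t _ i ⟨β, h, rfl⟩ ht hd
    rw [← linForm_ev] at hd
    obtain ⟨c, hc⟩ := smul_of_dvd_linForm hd
    apply ht
    have h1 := h.1.bform_self
    have h2 := bform_simple_self (M := M) i
    rw [hc] at h2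
    simp only [map_smul, LinearMap.smul_apply, h1, smul_eq_mul] at h2
    have hc0 : 0 ≤ c := by
      by_contra hneg
      have : (ev (some i) : RootSpace B) ≤ 0 := by
        rw [hc]; exact smul_nonpos_of_nonpos_of_nonneg (by linarith) h.2
      exact not_nonneg_of_nonpos (ev_ne_zero _) this (ev_nonneg _)
    have hc1 : c = 1 := by nlinarith
    rw [hc1, one_smul] at hc
    exact h.1.unique (hc ▸ isRootOf_simple i)
  pr_act := by
    rintro t _ r ⟨β, ⟨⟨w, i, rfl, rfl⟩, -⟩, rfl⟩
    refine ⟨polyAct cs w (polyDm cs i (polyAct cs w⁻¹ r)), ?_⟩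
    rw [← polyAct_linForm, ← map_mul, linForm_ev, ← polyDm_spec, map_sub, map_mul, map_mul]
    have : ∀ r, polyAct cs w (polyAct cs w⁻¹ r) = r := by
      intro r; rw [← AlgEquiv.mul_apply, ← map_mul]; simp
    rw [this]; rfl
  pr_length_ne := by
    rintro t _ y ⟨β, ⟨⟨w, i, rfl, -⟩, -⟩, -⟩
    exact CoxeterSystem.IsReflection.length_mul_left_ne ⟨w, i, rfl⟩ y
  pr_bound y := by
    obtain ⟨I, hI, h⟩ := exists_inversion_bound (cs := cs) y
    refine ⟨I, hI, ?_⟩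
    rintro t _ ⟨β, hβ, rfl⟩ hlt
    exact h t β hβ hlt
  pr_unique := by
    rintro t _ _ ⟨β, hβ, rfl⟩ ⟨β', hβ', rfl⟩
    congr 1
    have h1 := hβ.1.rep_self
    rw [hβ'.1.rep_apply] at h1
    have h2 : bform M β' β • β' = (2 : ℝ) • β := by
      have : bform M β' β • β' = β + β := by
        rw [sub_eq_iff_eq_add, eq_comm, neg_add_eq_iff_eq_add] at h1; exact h1
      rw [this]; module
    set c := bform M β' β with hc
    have h3 : β = (c / 2) • β' := by
      rw [div_eq_inv_mul, mul_smul, h2, smul_smul]; norm_num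
    have h4 := hβ.1.bform_self
    rw [h3] at h4
    simp only [map_smul, LinearMap.smul_apply, hβ'.1.bform_self, smul_eq_mul] at h4
    have hc0 : 0 ≤ c := by
      by_contra hneg
      have : β ≤ 0 := by
        rw [h3]; exact smul_nonpos_of_nonpos_of_nonneg (by linarith) hβ'.2
      exact not_nonneg_of_nonpos hβ.1.ne_zero this hβ.2
    have : c / 2 = 1 := by nlinarith
    rw [h3, this, one_smul]
  separate := by
    rintro y y' hne _ ⟨p, rfl⟩ hp
    simp only [LinearMap.mem_range]
    by_cases hex : ∃ v, ¬ linForm p ∣ polyAct cs y⁻¹ (linForm v) - polyAct cs y'⁻¹ (linForm v)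
    · obtain ⟨v, hv⟩ := hex
      exact ⟨linForm v, ⟨v, rfl⟩, fun h => hv (h ▸ dvd_zero _), Or.inl hv⟩
    · push Not at hex
      have hw : y⁻¹ * y' ≠ 1 := fun h => hne (inv_mul_eq_one.1 h)
      obtain ⟨β, hβ, c, hc, hpc⟩ := exists_root_of_rank_one (cs := cs) (w := y⁻¹ * y') hw (p := p)
        (fun v => by
          have := hex (rep cs y' v)
          rw [polyAct_linForm, polyAct_linForm, ← map_sub] at this
          obtain ⟨c, hc⟩ := smul_of_dvd_linForm this
          rw [rep_inv_rep, ← rep_mul_apply] at hc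
          exact ⟨c, by rw [← hc]; abel⟩)
      have hv : ∃ v, rep cs y⁻¹ v ≠ rep cs y'⁻¹ v := by
        by_contra! hcon
        exact hne (inv_injective (rep_injective (cs := cs) (LinearMap.ext hcon)))
      obtain ⟨v, hv⟩ := hv
      refine ⟨linForm v, ⟨v, rfl⟩, ?_, Or.inr ⟨y⁻¹ * y', linForm β, ⟨β, hβ, rfl⟩, by group, c, hc, ?_⟩⟩
      · rw [polyAct_linForm, polyAct_linForm, ← map_sub]
        intro h
        exact hv (sub_eq_zero.1 (linForm_injective (h.trans (map_zero _).symm)))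
      · rw [hpc, map_smul]

end KLPos

namespace KLPos

variable {B W : Type} [Group W] {M : CoxeterMatrix B} {cs : CoxeterSystem M W}
  {R : Type} [CommRing R] [Algebra ℝ R]

namespace Realization

variable (G : Realization cs R)

/-- The action of a simple reflection on the ring of a realization. -/
def sa (i : B) : R ≃ₐ[ℝ] R := G.act (cs.simple i)

@[simp] lemma act_simple (i : B) (r : R) : G.act (cs.simple i) r = G.sa i r := rfl

@[simp] lemma sa_sa (i : B) (r : R) : G.sa i (G.sa i r) = r := by
  rw [sa, ← AlgEquiv.mul_apply, ← map_mul, cs.simple_mul_simple_self, map_one, AlgEquiv.one_apply]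

@[simp] lemma sa_α (i : B) : G.sa i (G.α i) = - G.α i := G.act_α i

@[simp] lemma act_one (r : R) : G.act 1 r = r := by rw [map_one]; rfl

lemma act_mul (x y : W) (r : R) : G.act (x * y) r = G.act x (G.act y r) := by
  rw [map_mul]; rfl

@[simp] lemma act_inv_act (x : W) (r : R) : G.act x⁻¹ (G.act x r) = r := by
  rw [← act_mul, inv_mul_cancel, act_one]

@[simp] lemma act_act_inv (x : W) (r : R) : G.act x (G.act x⁻¹ r) = r := by
  rw [← act_mul, mul_inv_cancel, act_one]

@[simp] lemma act_mul_simple_inv (y : W) (i : B) (r : R) :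
    G.act (y * cs.simple i)⁻¹ r = G.sa i (G.act y⁻¹ r) := by
  rw [mul_inv_rev, cs.inv_simple, act_mul]; rfl

@[simp] lemma act_mul_simple (y : W) (i : B) (r : R) :
    G.act (y * cs.simple i) r = G.act y (G.sa i r) := by
  rw [act_mul]; rfl

/-- The symmetric part of a ring element for a simple reflection. -/
noncomputable def av (i : B) (r : R) : R := (1 / 2 : ℝ) • (r + G.sa i r)

/-- Half of the Demazure operator. -/
noncomputable def hd (i : B) (r : R) : R := (1 / 2 : ℝ) • G.dm i r

lemma av_add_hd (i : B) (r : R) : G.av i r + G.hd i r * G.α i = r := by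
  have h := G.sub_act i r
  rw [act_simple] at h
  rw [av, hd, smul_mul_assoc, mul_comm, ← h]
  module

lemma av_sub_hd (i : B) (r : R) : G.av i r - G.hd i r * G.α i = G.sa i r := by
  have h := G.sub_act i r
  rw [act_simple] at h
  rw [av, hd, smul_mul_assoc, mul_comm, ← h]
  module

variable [IsDomain R]

lemma dm_sa (i : B) (r : R) : G.sa i (G.dm i r) = G.dm i r := by
  have h := G.sub_act i r
  have h2 := congrArg (G.sa i) h
  rw [act_simple] at h h2
  rw [map_sub, map_mul, sa_sa, sa_α] at h2
  have : G.α i * (G.sa i (G.dm i r) - G.dm i r) = 0 := by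
    linear_combination h2 + h
  rcases mul_eq_zero.1 this with h | h
  · exact absurd h (G.α_ne i)
  · exact sub_eq_zero.1 h

@[simp] lemma sa_hd (i : B) (r : R) : G.sa i (G.hd i r) = G.hd i r := by
  rw [hd, map_smul, dm_sa]

@[simp] lemma sa_av (i : B) (r : R) : G.sa i (G.av i r) = G.av i r := by
  rw [av, map_smul, map_add, sa_sa, add_comm]

lemma two_ne : (2 : R) ≠ 0 := by
  have : (2 : R) = algebraMap ℝ R 2 := (map_ofNat _ 2).symm
  rw [this, Ne, FaithfulSMul.algebraMap_eq_zero_iff]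
  norm_num

lemma two_inj {a b : R} (h : 2 * a = 2 * b) : a = b :=
  mul_left_cancel₀ two_ne h

lemma eq_av_hd {i : B} {r a b : R} (h : r = a + b * G.α i) (ha : G.sa i a = a)
    (hb : G.sa i b = b) : G.av i r = a ∧ G.hd i r = b := by
  have h1 := G.av_add_hd i r
  have h2 := G.av_sub_hd i r
  have h3 : G.sa i r = a - b * G.α i := by
    rw [h, map_add, map_mul, ha, hb, sa_α]; ring
  have e1 : G.av i r = a := by
    apply two_inj; linear_combination h1 + h2 + h + h3
  have e2 : G.hd i r * G.α i = b * G.α i := by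
    rw [e1] at h1; linear_combination h1 + h
  exact ⟨e1, mul_right_cancel₀ (G.α_ne i) e2⟩

@[simp] lemma av_add (i : B) (r r' : R) : G.av i (r + r') = G.av i r + G.av i r' := by
  rw [av, av, av, map_add]; module

@[simp] lemma hd_add (i : B) (r r' : R) : G.hd i (r + r') = G.hd i r + G.hd i r' := by
  rw [hd, hd, hd, map_add]; module

lemma av_mul (i : B) (r r' : R) :
    G.av i (r * r') = G.av i r * G.av i r' + G.hd i r * G.hd i r' * G.α i ^ 2 := by
  refine (G.eq_av_hd (b := G.av i r * G.hd i r' + G.hd i r * G.av i r') ?_ ?_ ?_).1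
  · conv_lhs => rw [← G.av_add_hd i r, ← G.av_add_hd i r']
    ring
  · simp
  · simp

lemma hd_mul (i : B) (r r' : R) :
    G.hd i (r * r') = G.av i r * G.hd i r' + G.hd i r * G.av i r' := by
  refine (G.eq_av_hd (a := G.av i r * G.av i r' + G.hd i r * G.hd i r' * G.α i ^ 2) ?_ ?_ ?_).2
  · conv_lhs => rw [← G.av_add_hd i r, ← G.av_add_hd i r']
    ring
  · simp
  · simp

lemma av_of_inv {i : B} {r : R} (h : G.sa i r = r) : G.av i r = r :=
  (G.eq_av_hd (a := r) (b := 0) (by ring) h (by simp)).1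

lemma hd_of_inv {i : B} {r : R} (h : G.sa i r = r) : G.hd i r = 0 :=
  (G.eq_av_hd (a := r) (b := 0) (by ring) h (by simp)).2

@[simp] lemma av_one (i : B) : G.av i 1 = 1 := G.av_of_inv (by simp)
@[simp] lemma hd_one (i : B) : G.hd i 1 = 0 := G.hd_of_inv (by simp)
@[simp] lemma av_zero (i : B) : G.av i 0 = 0 := G.av_of_inv (by simp)
@[simp] lemma hd_zero (i : B) : G.hd i 0 = 0 := G.hd_of_inv (by simp)
@[simp] lemma av_α (i : B) : G.av i (G.α i) = 0 :=
  (G.eq_av_hd (b := 1) (by ring) (by simp) (by simp)).1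
@[simp] lemma hd_α (i : B) : G.hd i (G.α i) = 1 :=
  (G.eq_av_hd (a := 0) (by ring) (by simp) (by simp)).2
@[simp] lemma av_algebraMap (i : B) (c : ℝ) : G.av i (algebraMap ℝ R c) = algebraMap ℝ R c :=
  G.av_of_inv (by simp)
@[simp] lemma hd_algebraMap (i : B) (c : ℝ) : G.hd i (algebraMap ℝ R c) = 0 :=
  G.hd_of_inv (by simp)

lemma hd_inv_mul {i : B} {a : R} (h : G.sa i a = a) (r : R) : G.hd i (a * r) = a * G.hd i r := by
  rw [hd_mul, G.hd_of_inv h, G.av_of_inv h]; ring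

lemma hd_mul_α (i : B) (r : R) : G.hd i (r * G.α i) = G.av i r := by
  rw [hd_mul]; simp

@[simp] lemma av_sa (i : B) (r : R) : G.av i (G.sa i r) = G.av i r := by
  rw [av, av, sa_sa, add_comm]

@[simp] lemma hd_sa (i : B) (r : R) : G.hd i (G.sa i r) = - G.hd i r := by
  refine (G.eq_av_hd (a := G.av i r) ?_ (by simp) (by simp)).2
  rw [← G.av_sub_hd]; ring

lemma eu_algebraMap (c : ℝ) : G.eu (algebraMap ℝ R c) = 0 := by
  have h1 : G.eu 1 = 0 := by
    have := G.eu_mul 1 1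
    simp only [mul_one, one_mul] at this
    linear_combination -this
  rw [Algebra.algebraMap_eq_smul_one, map_smul, h1, smul_zero]

lemma eu_sa (i : B) (r : R) : G.eu (G.sa i r) = G.sa i (G.eu r) := G.eu_act _ r

lemma eu_av (i : B) (r : R) : G.eu (G.av i r) = G.av i (G.eu r) := by
  rw [av, av, map_smul, map_add, eu_sa]

lemma eu_α (i : B) : G.eu (G.α i) = 2 * G.α i := by
  rw [G.eu_lin _ (G.α_mem i), Algebra.smul_def, map_ofNat]

lemma eu_hd (i : B) (r : R) : G.eu (G.hd i r) = G.hd i (G.eu r) - 2 * G.hd i r := by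
  have h := congrArg G.eu (G.av_add_hd i r)
  rw [map_add, eu_av, G.eu_mul, eu_α] at h
  have h2 := G.av_add_hd i (G.eu r)
  apply mul_right_cancel₀ (G.α_ne i)
  linear_combination h - h2

end Realization

end KLPos

namespace KLPos

variable {B W : Type} [Group W] {M : CoxeterMatrix B} {cs : CoxeterSystem M W}
  {R : Type} [CommRing R] [Algebra ℝ R]

/-- A graded `R`-bimodule with a perfect symmetric invariant form: the right action is the module
structure, the left action is `l`, the grading is encoded in the operator `D`. -/
structure SObj (G : Realization cs R) where
  /-- underlying type -/
  carrier : Type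
  [grp : AddCommGroup carrier]
  [mod : Module R carrier]
  /-- left action -/
  l : R →+* Module.End R carrier
  /-- grading operator -/
  D : carrier →+ carrier
  /-- the form -/
  form : carrier →ₗ[R] carrier →ₗ[R] R
  l_const : ∀ (c : ℝ) m, l (algebraMap ℝ R c) m = algebraMap ℝ R c • m
  D_smul : ∀ (r : R) m, D (r • m) = G.eu r • m + r • D m
  D_l : ∀ (r : R) m, D (l r m) = l (G.eu r) m + l r (D m)
  form_symm : ∀ m n, form m n = form n m
  form_l : ∀ r m n, form (l r m) n = form m (l r n)
  form_D : ∀ m n, form (D m) n + form m (D n) = G.eu (form m n)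
  graded : ∀ m, m ∈ AddSubgroup.closure {m : carrier | ∃ d : ℤ, D m = d • m}
  dual : ∃ (ι : Type) (_ : Fintype ι) (p q : ι → carrier), ∀ m, m = ∑ j, form (p j) m • q j

namespace SObj

variable {G : Realization cs R}

instance : CoeSort (SObj G) Type := ⟨carrier⟩

variable (X : SObj G)

instance : AddCommGroup X := X.grp
instance : Module R X := X.mod
instance : Module ℝ X := Module.compHom X (algebraMap ℝ R)
instance : IsScalarTower ℝ R X := ⟨fun c r m => by
  rw [Algebra.smul_def, mul_smul]; rfl⟩

lemma real_smul_def (c : ℝ) (m : X) : c • m = algebraMap ℝ R c • m := rfl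

/-- Homogeneity of degree `d`. -/
def Hg (d : ℤ) (m : X) : Prop := X.D m = d • m

variable {X}

lemma l_mul (r r' : R) (m : X) : X.l (r * r') m = X.l r (X.l r' m) := by
  rw [map_mul]; rfl

lemma l_comm (r r' : R) (m : X) : X.l r (X.l r' m) = X.l r' (X.l r m) := by
  rw [← l_mul, mul_comm, l_mul]

@[simp] lemma l_one (m : X) : X.l 1 m = m := by rw [map_one]; rfl

@[simp] lemma l_zero (m : X) : X.l 0 m = 0 := by rw [map_zero]; rfl

lemma l_add (r r' : R) (m : X) : X.l (r + r') m = X.l r m + X.l r' m := by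
  rw [map_add]; rfl

lemma l_neg (r : R) (m : X) : X.l (-r) m = - X.l r m := by
  rw [map_neg]; rfl

lemma l_smul_real (c : ℝ) (r : R) (m : X) : X.l (c • r) m = c • X.l r m := by
  rw [Algebra.smul_def, l_mul, X.l_const]; rfl

variable [IsDomain R]

lemma eq_zero_of_form (m : X) (h : ∀ n, X.form n m = 0) : m = 0 := by
  obtain ⟨ι, _, p, q, hpq⟩ := X.dual
  rw [hpq m]; simp [h]

lemma eq_of_form {m m' : X} (h : ∀ n, X.form n m = X.form n m') : m = m' := by
  rw [← sub_eq_zero]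
  exact eq_zero_of_form _ fun n => by rw [map_sub, h, sub_self]

lemma eq_of_form' {m m' : X} (h : ∀ n, X.form m n = X.form m' n) : m = m' :=
  eq_of_form fun n => by rw [X.form_symm, h, X.form_symm]

lemma smul_eq_zero' {r : R} {m : X} (h : r • m = 0) (hr : r ≠ 0) : m = 0 :=
  eq_zero_of_form m fun n => by
    have := congrArg (X.form n) h
    rw [map_smul, map_zero, smul_eq_mul] at this
    exact (mul_eq_zero.1 this).resolve_left hr

lemma smul_cancel {r : R} {m m' : X} (h : r • m = r • m') (hr : r ≠ 0) : m = m' := by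
  rw [← sub_eq_zero] at h ⊢
  rw [← smul_sub] at h
  exact smul_eq_zero' h hr

lemma exists_repr (F : X →ₗ[R] R) : ∃ n : X, ∀ m, F m = X.form n m := by
  obtain ⟨ι, _, p, q, hpq⟩ := X.dual
  refine ⟨∑ j, F (q j) • p j, fun m => ?_⟩
  conv_lhs => rw [hpq m]
  simp [mul_comm]

/-- Divisibility by a ring element can be tested on the form. -/
lemma exists_smul_of_form {r : R} {m : X} (h : ∀ n, r ∣ X.form n m) : ∃ m', m = r • m' := by
  obtain ⟨ι, _, p, q, hpq⟩ := X.dual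
  choose k hk using fun j => h (p j)
  refine ⟨∑ j, k j • q j, ?_⟩
  conv_lhs => rw [hpq m]
  rw [Finset.smul_sum]
  exact Finset.sum_congr rfl fun j _ => by rw [hk, mul_smul]

lemma exists_smul_of_prime {p r : R} (hp : Prime p) (hr : ¬ p ∣ r) {m m' : X}
    (h : r • m = p • m') : ∃ m'', m = p • m'' := by
  apply exists_smul_of_form
  intro n
  have := congrArg (X.form n) h
  rw [map_smul, map_smul, smul_eq_mul, smul_eq_mul] at this
  exact (hp.dvd_or_dvd ⟨_, this⟩).resolve_left hr

lemma D_smul_const (c : ℝ) (m : X) : X.D (c • m) = c • X.D m := by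
  rw [real_smul_def, X.D_smul, G.eu_algebraMap, zero_smul, zero_add]; rfl

lemma Hg.add {d : ℤ} {m m' : X} (h : X.Hg d m) (h' : X.Hg d m') : X.Hg d (m + m') := by
  rw [Hg] at *; rw [map_add, h, h', smul_add]

lemma Hg.sub {d : ℤ} {m m' : X} (h : X.Hg d m) (h' : X.Hg d m') : X.Hg d (m - m') := by
  rw [Hg] at *; rw [map_sub, h, h', smul_sub]

lemma Hg.neg {d : ℤ} {m : X} (h : X.Hg d m) : X.Hg d (-m) := by
  rw [Hg] at *; rw [map_neg, h, smul_neg]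

lemma Hg.zero (d : ℤ) : X.Hg d 0 := by
  rw [Hg]; rw [map_zero, smul_zero]

lemma Hg.sum {ι : Type} {s : Finset ι} {d : ℤ} {f : ι → X} (h : ∀ j ∈ s, X.Hg d (f j)) :
    X.Hg d (∑ j ∈ s, f j) := by
  classical
  induction s using Finset.induction_on with
  | empty => simpa using Hg.zero d
  | insert a s ha ih =>
    rw [Finset.sum_insert ha]
    exact (h a (by simp)).add (ih fun j hj => h j (by simp [hj]))

lemma Hg.real {d : ℤ} {m : X} (h : X.Hg d m) (c : ℝ) : X.Hg d (c • m) := by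
  rw [Hg] at *; rw [D_smul_const, h, smul_comm]

lemma Hg.smul {d k : ℤ} {m : X} (h : X.Hg d m) {r : R} (hr : G.eu r = k • r) :
    X.Hg (d + k) (r • m) := by
  rw [Hg] at *; rw [X.D_smul, h, hr, add_smul, smul_comm r d m, smul_assoc, add_comm]

lemma Hg.l {d k : ℤ} {m : X} (h : X.Hg d m) {r : R} (hr : G.eu r = k • r) :
    X.Hg (d + k) (X.l r m) := by
  rw [Hg] at *
  rw [X.D_l, h, hr, add_smul, map_zsmul, map_zsmul, add_comm]; rfl

lemma form_hg {d k : ℤ} {m n : X} (hm : X.Hg d m) (hn : X.Hg k n) :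
    G.eu (X.form m n) = (d + k) • X.form m n := by
  rw [Hg] at *
  rw [← X.form_D, hm, hn, map_zsmul, map_zsmul, add_smul]; rfl

lemma zsmul_cancel {d : ℤ} {m : X} (h : d • m = 0) (hd : d ≠ 0) : m = 0 := by
  rw [← Int.cast_smul_eq_zsmul ℝ, real_smul_def] at h
  refine smul_eq_zero' h ?_
  rw [Ne, FaithfulSMul.algebraMap_eq_zero_iff]
  exact_mod_cast hd

lemma real_smul_cancel {c : ℝ} {m : X} (h : c • m = 0) (hd : c ≠ 0) : m = 0 := by
  rw [real_smul_def] at h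
  refine smul_eq_zero' h ?_
  rwa [Ne, FaithfulSMul.algebraMap_eq_zero_iff]

lemma Hg.unique {d k : ℤ} {m : X} (h : X.Hg d m) (h' : X.Hg k m) (hm : m ≠ 0) : d = k := by
  rw [Hg] at *
  by_contra hne
  exact hm (zsmul_cancel (d := d - k) (by rw [sub_smul, ← h, ← h', sub_self]) (sub_ne_zero.2 hne))

/-- `f` is a bimodule map, homogeneous of degree `k`. -/
structure IsHom {X Y : SObj G} (k : ℤ) (f : X →ₗ[R] Y) : Prop where
  map_l : ∀ r m, f (X.l r m) = Y.l r (f m)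
  map_D : ∀ m, Y.D (f m) = f (X.D m) + k • f m

/-- Adjointness of two maps. -/
def IsAdj {X Y : SObj G} (f : X →ₗ[R] Y) (g : Y →ₗ[R] X) : Prop :=
  ∀ m n, Y.form (f m) n = X.form m (g n)

variable {Y Z : SObj G}

lemma IsAdj.symm {f : X →ₗ[R] Y} {g : Y →ₗ[R] X} (h : IsAdj f g) : IsAdj g f :=
  fun m n => by rw [X.form_symm, ← h, Y.form_symm]

lemma IsAdj.comp {f : X →ₗ[R] Y} {g : Y →ₗ[R] X} {f' : Y →ₗ[R] Z} {g' : Z →ₗ[R] Y}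
    (h : IsAdj f g) (h' : IsAdj f' g') : IsAdj (f' ∘ₗ f) (g ∘ₗ g') :=
  fun m n => by simp [h' _ _, h _ _]

lemma IsAdj.add {f f' : X →ₗ[R] Y} {g g' : Y →ₗ[R] X}
    (h : IsAdj f g) (h' : IsAdj f' g') : IsAdj (f + f') (g + g') :=
  fun m n => by simp [h' _ _, h _ _]

lemma IsAdj.smul {f : X →ₗ[R] Y} {g : Y →ₗ[R] X} (h : IsAdj f g) (c : ℝ) :
    IsAdj (c • f) (c • g) :=
  fun m n => by
    simp only [LinearMap.smul_apply, real_smul_def, map_smul, h m n]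

lemma IsAdj.sub {f f' : X →ₗ[R] Y} {g g' : Y →ₗ[R] X}
    (h : IsAdj f g) (h' : IsAdj f' g') : IsAdj (f - f') (g - g') :=
  fun m n => by simp [h' _ _, h _ _]

lemma IsAdj.id : IsAdj (LinearMap.id : X →ₗ[R] X) LinearMap.id := fun _ _ => rfl

lemma IsAdj.unique {f : X →ₗ[R] Y} {g g' : Y →ₗ[R] X} (h : IsAdj f g) (h' : IsAdj f g') :
    g = g' := by
  ext n
  exact eq_of_form fun m => by rw [← h, ← h']

lemma IsAdj.zero_iff {f : X →ₗ[R] Y} {g : Y →ₗ[R] X} (h : IsAdj f g) : f = 0 ↔ g = 0 := by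
  constructor
  · rintro rfl
    ext n; exact eq_of_form fun m => by rw [← h]; simp
  · rintro rfl
    ext n; exact eq_of_form' fun m => by rw [h]; simp

lemma IsHom.hg {k d : ℤ} {f : X →ₗ[R] Y} (h : IsHom k f) {m : X} (hm : X.Hg d m) :
    Y.Hg (d + k) (f m) := by
  rw [Hg] at *; rw [h.map_D, hm, map_zsmul, add_smul]

lemma IsHom.comp {k k' : ℤ} {f : X →ₗ[R] Y} {f' : Y →ₗ[R] Z} (h : IsHom k f) (h' : IsHom k' f') :
    IsHom (k + k') (f' ∘ₗ f) where
  map_l r m := by simp [h.map_l, h'.map_l]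
  map_D m := by simp [h.map_D, h'.map_D, add_smul, add_assoc]

lemma IsHom.add {k : ℤ} {f f' : X →ₗ[R] Y} (h : IsHom k f) (h' : IsHom k f') :
    IsHom k (f + f') where
  map_l r m := by simp [h.map_l, h'.map_l]
  map_D m := by simp [h.map_D, h'.map_D]; abel

lemma IsHom.smul {k : ℤ} {f : X →ₗ[R] Y} (h : IsHom k f) (c : ℝ) : IsHom k (c • f) where
  map_l r m := by simp only [LinearMap.smul_apply, h.map_l, LinearMap.map_smul_of_tower]
  map_D m := by simp [h.map_D, D_smul_const, smul_comm c k]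

lemma IsHom.sub {k : ℤ} {f f' : X →ₗ[R] Y} (h : IsHom k f) (h' : IsHom k f') :
    IsHom k (f - f') where
  map_l r m := by simp [h.map_l, h'.map_l]
  map_D m := by simp [h.map_D, h'.map_D, smul_sub]; abel

lemma IsHom.zero (k : ℤ) : IsHom k (0 : X →ₗ[R] Y) where
  map_l r m := by simp
  map_D m := by simp

lemma IsHom.id : IsHom 0 (LinearMap.id : X →ₗ[R] X) where
  map_l r m := by simp
  map_D m := by simp

lemma IsHom.comp' {k k' n : ℤ} {f : X →ₗ[R] Y} {f' : Y →ₗ[R] Z} (h : IsHom k f)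
    (h' : IsHom k' f') (hn : k + k' = n) : IsHom n (f' ∘ₗ f) := hn ▸ h.comp h'

lemma IsHom.sum {ι : Type} {s : Finset ι} {k : ℤ} {f : ι → X →ₗ[R] Y}
    (h : ∀ j ∈ s, IsHom k (f j)) : IsHom k (∑ j ∈ s, f j) := by
  classical
  induction s using Finset.induction_on with
  | empty => simpa using IsHom.zero k
  | insert a s ha ih =>
    rw [Finset.sum_insert ha]
    exact (h a (by simp)).add (ih fun j hj => h j (by simp [hj]))

lemma IsHom.adj {k : ℤ} {f : X →ₗ[R] Y} {g : Y →ₗ[R] X} (h : IsHom k f) (ha : IsAdj f g) :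
    IsHom k g where
  map_l r n := eq_of_form fun m => by
    rw [← ha, ← Y.form_l, ← h.map_l, ha, X.form_l]
  map_D n := eq_of_form fun m => by
    have h1 := X.form_D m (g n)
    have h2 := Y.form_D (f m) n
    rw [← ha, ← ha] at h1
    rw [h.map_D, map_add, map_zsmul, LinearMap.add_apply, LinearMap.smul_apply] at h2
    rw [map_add, map_zsmul, ← ha, ← ha]
    linear_combination h1 - h2

lemma exists_adj (f : X →ₗ[R] Y) : ∃ g : Y →ₗ[R] X, IsAdj f g := by
  choose g hg using fun n : Y => exists_repr (X := X) ((Y.form n) ∘ₗ f)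
  have key : ∀ m n, Y.form (f m) n = X.form m (g n) := fun m n => by
    rw [X.form_symm, ← hg, LinearMap.comp_apply, Y.form_symm]
  exact ⟨{ toFun := g
           map_add' := fun n n' => eq_of_form fun m => by
             rw [← key, map_add, map_add, key, key]
           map_smul' := fun r n => eq_of_form fun m => by
             rw [← key, map_smul, map_smul, key]; rfl }, key⟩

variable (X)

/-- The grading operator on the image of an idempotent. -/
def cutD {X : SObj G} {e : X →ₗ[R] X} (h0 : IsHom 0 e) : LinearMap.range e →+ LinearMap.range e where
  toFun m := ⟨X.D m, by
    obtain ⟨_, m, rfl⟩ := m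
    exact ⟨X.D m, by simp [h0.map_D]⟩⟩
  map_zero' := Subtype.ext (map_zero X.D)
  map_add' _ _ := Subtype.ext (map_add X.D _ _)

/-- The image of a self-adjoint idempotent. -/
noncomputable def cut (e : X →ₗ[R] X) (h0 : IsHom 0 e) (hs : IsAdj e e) (he : e ∘ₗ e = e) :
    SObj G where
  carrier := LinearMap.range e
  l :=
    { toFun := fun r => (X.l r).restrict (p := LinearMap.range e) (q := LinearMap.range e) (by
        rintro _ ⟨m, rfl⟩; exact ⟨X.l r m, h0.map_l r m⟩)
      map_one' := by ext m; simp
      map_mul' := fun r r' => by ext m; simp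
      map_zero' := by ext m; simp
      map_add' := fun r r' => by ext m; simp }
  D := cutD h0
  form := X.form.domRestrict₁₂ _ _
  l_const c m := Subtype.ext (X.l_const c m)
  D_smul r m := Subtype.ext (X.D_smul r m)
  D_l r m := Subtype.ext (X.D_l r m)
  form_symm m n := X.form_symm _ _
  form_l r m n := X.form_l r _ _
  form_D m n := X.form_D _ _
  graded := by
    have key : ∀ m : X, (⟨e m, m, rfl⟩ : LinearMap.range e) ∈ AddSubgroup.closure
        {m : LinearMap.range e | ∃ d : ℤ, cutD h0 m = d • m} := by
      intro m
      refine AddSubgroup.closure_induction (p := fun m _ => (⟨e m, m, rfl⟩ : LinearMap.range e) ∈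
        AddSubgroup.closure _) ?_ ?_ ?_ ?_ (X.graded m)
      · rintro m ⟨d, hd⟩
        refine AddSubgroup.subset_closure ⟨d, Subtype.ext ?_⟩
        have := h0.hg hd
        rw [add_zero] at this
        exact this
      · convert AddSubgroup.zero_mem _
        simp
      · intro a b _ _ ha hb
        convert AddSubgroup.add_mem _ ha hb using 1
        exact Subtype.ext (map_add e a b)
      · intro a _ ha
        convert AddSubgroup.neg_mem _ ha using 1
        exact Subtype.ext (map_neg e a)
    rintro ⟨_, m, rfl⟩
    exact key m
  dual := by
    obtain ⟨ι, _, p, q, hpq⟩ := X.dual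
    refine ⟨ι, inferInstance, fun j => ⟨e (p j), _, rfl⟩, fun j => ⟨e (q j), _, rfl⟩, ?_⟩
    rintro ⟨_, m, rfl⟩
    apply Subtype.ext
    have h1 : ∀ m, e (e m) = e m := fun m => LinearMap.congr_fun he m
    have := congrArg e (hpq (e m))
    rw [h1, map_sum] at this
    simp only [LinearMap.domRestrict₁₂_apply, Submodule.coe_sum, Submodule.coe_smul]
    refine this.trans ?_
    refine Finset.sum_congr rfl fun j _ => ?_
    rw [map_smul, hs, h1]

variable {X}

section cut

variable {e : X →ₗ[R] X} (h0 : IsHom 0 e) (hs : IsAdj e e) (he : e ∘ₗ e = e)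

/-- The inclusion of the image of an idempotent. -/
noncomputable def cutI : X.cut e h0 hs he →ₗ[R] X := (LinearMap.range e).subtype

/-- The projection onto the image of an idempotent. -/
noncomputable def cutP : X →ₗ[R] X.cut e h0 hs he := e.rangeRestrict

lemma cutI_cutP (m : X) : cutI h0 hs he (cutP h0 hs he m) = e m := rfl

lemma cutP_cutI (m : X.cut e h0 hs he) : cutP h0 hs he (cutI h0 hs he m) = m := by
  obtain ⟨_, m, rfl⟩ := m
  exact Subtype.ext (LinearMap.congr_fun he m)

lemma isHom_cutI : IsHom 0 (cutI h0 hs he) where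
  map_l r m := rfl
  map_D m := by rw [zero_smul, add_zero]; rfl

lemma isAdj_cut : IsAdj (cutI h0 hs he) (cutP h0 hs he) := fun m n => by
  obtain ⟨_, m, rfl⟩ := m
  change X.form (e m) n = X.form (e m) (e n)
  rw [← hs]
  exact congrArg (fun z => X.form z n) (LinearMap.congr_fun he m).symm

lemma isHom_cutP : IsHom 0 (cutP h0 hs he) := (isHom_cutI h0 hs he).adj (isAdj_cut h0 hs he)

end cut

end SObj

end KLPos

namespace KLPos

variable {B W : Type} [Group W] {M : CoxeterMatrix B} {cs : CoxeterSystem M W}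
  {R : Type} [CommRing R] [Algebra ℝ R]

namespace SObj

variable {G : Realization cs R} [IsDomain R]

/-- The monoidal unit. -/
noncomputable def unit (G : Realization cs R) : SObj G where
  carrier := R
  l := Algebra.lmul R R
  D := G.eu.toAddMonoidHom
  form := LinearMap.mul R R
  l_const c m := rfl
  D_smul r m := G.eu_mul r m
  D_l r m := G.eu_mul r m
  form_symm m n := mul_comm m n
  form_l r m n := by
    change r * m * n = m * (r * n); ring
  form_D m n := (G.eu_mul m n).symm
  graded m := by
    refine Submodule.span_induction (p := fun m _ => m ∈ AddSubgroup.closure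
      {m : R | ∃ d : ℤ, G.eu.toAddMonoidHom m = d • m}) ?_ ?_ ?_ ?_ (G.eu_span m)
    · rintro r ⟨k, hk⟩
      exact AddSubgroup.subset_closure ⟨2 * k, by
        rw [LinearMap.toAddMonoidHom_coe, hk, ← Int.cast_smul_eq_zsmul ℝ]; push_cast; rfl⟩
    · exact zero_mem _
    · exact fun _ _ _ _ => add_mem
    · intro c r _ hr
      refine AddSubgroup.closure_induction (p := fun m _ => c • m ∈ AddSubgroup.closure _)
        ?_ ?_ ?_ ?_ hr
      · rintro m ⟨d, hd⟩
        rw [LinearMap.toAddMonoidHom_coe] at hd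
        exact AddSubgroup.subset_closure ⟨d, by
          rw [LinearMap.toAddMonoidHom_coe, map_smul, hd, smul_comm]⟩
      · rw [smul_zero]; exact zero_mem _
      · intro a b _ _ ha hb; rw [smul_add]; exact add_mem ha hb
      · intro a _ ha; rw [smul_neg]; exact neg_mem ha
  dual := ⟨Unit, inferInstance, fun _ => 1, fun _ => 1, fun m => by
    simp only [Finset.univ_unique, Finset.sum_const, Finset.card_singleton, one_smul]
    change m = 1 * m * 1; ring⟩

/-- Carrier of the induced object: `(m₀, m₁)` stands for `m₀ ⊗ 1 + m₁ ⊗ α`. -/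
@[ext] structure IndC (X : SObj G) (i : B) : Type where
  /-- coefficient of `1` -/
  fst : X
  /-- coefficient of `α` -/
  snd : X

variable (X : SObj G) (i : B)

/-- The induced object as a product. -/
def IndC.equiv : IndC X i ≃ X × X := ⟨fun m => (m.1, m.2), fun m => ⟨m.1, m.2⟩, fun _ => rfl, fun _ => rfl⟩

instance : AddCommGroup (IndC X i) := (IndC.equiv X i).addCommGroup


noncomputable instance : Module R (IndC X i) where
  smul r m := ⟨G.av i r • m.1 + (G.hd i r * G.α i ^ 2) • m.2, G.hd i r • m.1 + G.av i r • m.2⟩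
  one_smul m := by
    apply IndC.ext
    · change G.av i 1 • m.1 + (G.hd i 1 * G.α i ^ 2) • m.2 = m.1
      simp
    · change G.hd i 1 • m.1 + G.av i 1 • m.2 = m.2
      simp
  mul_smul r r' m := by
    apply IndC.ext
    · change G.av i (r * r') • m.1 + (G.hd i (r * r') * G.α i ^ 2) • m.2 =
        G.av i r • (G.av i r' • m.1 + (G.hd i r' * G.α i ^ 2) • m.2) +
        (G.hd i r * G.α i ^ 2) • (G.hd i r' • m.1 + G.av i r' • m.2)
      rw [G.av_mul, G.hd_mul]; module
    · change G.hd i (r * r') • m.1 + G.av i (r * r') • m.2 =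
        G.hd i r • (G.av i r' • m.1 + (G.hd i r' * G.α i ^ 2) • m.2) +
        G.av i r • (G.hd i r' • m.1 + G.av i r' • m.2)
      rw [G.av_mul, G.hd_mul]; module
  smul_zero r := by
    apply IndC.ext
    · change G.av i r • (0 : X) + (G.hd i r * G.α i ^ 2) • (0 : X) = 0
      simp
    · change G.hd i r • (0 : X) + G.av i r • (0 : X) = 0
      simp
  smul_add r m n := by
    apply IndC.ext
    · change G.av i r • (m.1 + n.1) + (G.hd i r * G.α i ^ 2) • (m.2 + n.2) =
        (G.av i r • m.1 + (G.hd i r * G.α i ^ 2) • m.2) +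
        (G.av i r • n.1 + (G.hd i r * G.α i ^ 2) • n.2)
      module
    · change G.hd i r • (m.1 + n.1) + G.av i r • (m.2 + n.2) =
        (G.hd i r • m.1 + G.av i r • m.2) + (G.hd i r • n.1 + G.av i r • n.2)
      module
  add_smul r r' m := by
    apply IndC.ext
    · change G.av i (r + r') • m.1 + (G.hd i (r + r') * G.α i ^ 2) • m.2 =
        (G.av i r • m.1 + (G.hd i r * G.α i ^ 2) • m.2) +
        (G.av i r' • m.1 + (G.hd i r' * G.α i ^ 2) • m.2)
      rw [G.av_add, G.hd_add]; module
    · change G.hd i (r + r') • m.1 + G.av i (r + r') • m.2 =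
        (G.hd i r • m.1 + G.av i r • m.2) + (G.hd i r' • m.1 + G.av i r' • m.2)
      rw [G.av_add, G.hd_add]; module
  zero_smul m := by
    apply IndC.ext
    · change G.av i 0 • m.1 + (G.hd i 0 * G.α i ^ 2) • m.2 = 0
      simp
    · change G.hd i 0 • m.1 + G.av i 0 • m.2 = 0
      simp

variable {X i}

lemma IndC.smul_fst (r : R) (m : IndC X i) :
    (r • m).1 = G.av i r • m.1 + (G.hd i r * G.α i ^ 2) • m.2 := rfl

lemma IndC.smul_snd (r : R) (m : IndC X i) :
    (r • m).2 = G.hd i r • m.1 + G.av i r • m.2 := rfl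

lemma IndC.add_fst (m n : IndC X i) : (m + n).1 = m.1 + n.1 := rfl
lemma IndC.add_snd (m n : IndC X i) : (m + n).2 = m.2 + n.2 := rfl

variable (X i)

/-- First component as an additive map. -/
def IndC.fstHom : IndC X i →+ X := ⟨⟨IndC.fst, rfl⟩, fun _ _ => rfl⟩

/-- Second component as an additive map. -/
def IndC.sndHom : IndC X i →+ X := ⟨⟨IndC.snd, rfl⟩, fun _ _ => rfl⟩

/-- The form of the induced object. -/
def indForm (m n : IndC X i) : R :=
  G.dm i (X.form m.1 n.1) + G.α i * G.dm i (X.form m.1 n.2 + X.form m.2 n.1)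
    + G.α i ^ 2 * G.dm i (X.form m.2 n.2)

variable {X i}

lemma indForm_symm (m n : IndC X i) : indForm X i m n = indForm X i n m := by
  rw [indForm, indForm, X.form_symm m.1, X.form_symm m.2, X.form_symm m.1, X.form_symm m.2,
    add_comm (X.form n.2 m.1)]

lemma dm_eq (i : B) (r : R) : G.dm i r = 2 * G.hd i r := by
  rw [Realization.hd, ← map_ofNat (algebraMap ℝ R) 2, ← Algebra.smul_def, smul_smul]
  norm_num

lemma indForm_add (m m' n : IndC X i) :
    indForm X i (m + m') n = indForm X i m n + indForm X i m' n := by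
  simp only [indForm, IndC.add_fst, IndC.add_snd, map_add, LinearMap.add_apply]; ring

lemma indForm_smul (r : R) (m : IndC X i) (n : IndC X i) :
    indForm X i (r • m) n = r * indForm X i m n := by
  simp only [indForm, IndC.smul_fst, IndC.smul_snd, map_add, LinearMap.add_apply, map_smul,
    LinearMap.smul_apply, smul_eq_mul, dm_eq, G.hd_inv_mul (G.sa_hd i _),
    G.hd_inv_mul (G.sa_av i _), mul_assoc]
  have h2 : ∀ z, G.hd i (G.α i ^ 2 * z) = G.α i ^ 2 * G.hd i z :=
    G.hd_inv_mul (by simp)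
  simp only [h2]
  conv_rhs => rw [← G.av_add_hd i r]
  ring

variable (X i)

/-- The induced object `X ⊗_{R^s} R` (shifted), i.e. `X B_s`. -/
noncomputable def ind : SObj G where
  carrier := IndC X i
  l :=
    { toFun := fun r =>
        { toFun := fun m => ⟨X.l r m.1, X.l r m.2⟩
          map_add' := fun m n => IndC.ext (map_add (X.l r) _ _) (map_add (X.l r) _ _)
          map_smul' := fun a m => IndC.ext
            (by simp [IndC.smul_fst]) (by simp [IndC.smul_snd]) }
      map_one' := LinearMap.ext fun m => IndC.ext (l_one _) (l_one _)
      map_mul' := fun r r' => LinearMap.ext fun m => IndC.ext (l_mul _ _ _) (l_mul _ _ _)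
      map_zero' := LinearMap.ext fun m => IndC.ext (l_zero _) (l_zero _)
      map_add' := fun r r' => LinearMap.ext fun m => IndC.ext (l_add _ _ _) (l_add _ _ _) }
  D :=
    { toFun := fun m => ⟨X.D m.1 - m.1, X.D m.2 + m.2⟩
      map_zero' := IndC.ext (show X.D 0 - 0 = 0 by simp) (show X.D 0 + 0 = 0 by simp)
      map_add' := fun m n => IndC.ext
        (by simp only [IndC.add_fst, map_add]; abel) (by simp only [IndC.add_snd, map_add]; abel) }
  form := LinearMap.mk₂ R (indForm X i) indForm_add indForm_smul
    (fun m n n' => by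
      rw [indForm_symm, indForm_add, indForm_symm, indForm_symm n'])
    (fun r m n => by rw [indForm_symm, indForm_smul, indForm_symm]; rfl)
  l_const c m := IndC.ext
    (show X.l _ m.1 = _ by rw [X.l_const, IndC.smul_fst]; simp)
    (show X.l _ m.2 = _ by rw [X.l_const, IndC.smul_snd]; simp)
  D_smul r m := by
    apply IndC.ext
    · change X.D (r • m).1 - (r • m).1 = (G.eu r • m).1 + (r • (⟨X.D m.1 - m.1, X.D m.2 + m.2⟩ : IndC X i)).1
      simp only [IndC.smul_fst, map_add, X.D_smul, G.eu_av, G.eu_mul, G.eu_hd, pow_two, G.eu_α]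
      module
    · change X.D (r • m).2 + (r • m).2 = (G.eu r • m).2 + (r • (⟨X.D m.1 - m.1, X.D m.2 + m.2⟩ : IndC X i)).2
      simp only [IndC.smul_snd, map_add, X.D_smul, G.eu_av, G.eu_hd]
      module
  D_l r m := by
    apply IndC.ext
    · change X.D (X.l r m.1) - X.l r m.1 = X.l (G.eu r) m.1 + X.l r (X.D m.1 - m.1)
      rw [X.D_l, map_sub]; abel
    · change X.D (X.l r m.2) + X.l r m.2 = X.l (G.eu r) m.2 + X.l r (X.D m.2 + m.2)
      rw [X.D_l, map_add]; abel
  form_symm := indForm_symm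
  form_l r m n := by
    change indForm X i ⟨X.l r m.1, X.l r m.2⟩ n = indForm X i m ⟨X.l r n.1, X.l r n.2⟩
    simp only [indForm, X.form_l]
  form_D m n := by
    change indForm X i ⟨X.D m.1 - m.1, X.D m.2 + m.2⟩ n +
      indForm X i m ⟨X.D n.1 - n.1, X.D n.2 + n.2⟩ = G.eu (indForm X i m n)
    have h2 : G.eu 2 = 0 := by
      rw [← map_ofNat (algebraMap ℝ R) 2]; exact G.eu_algebraMap 2
    simp only [indForm, map_add, map_sub, LinearMap.sub_apply, LinearMap.add_apply, dm_eq,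
      G.eu_mul, G.eu_hd, h2, pow_two, G.eu_α, ← X.form_D, G.hd_add]
    ring
  graded m := by
    have h1 : ∀ m0 : X, (⟨m0, 0⟩ : IndC X i) ∈ AddSubgroup.closure
        {m : IndC X i | ∃ d : ℤ, (⟨X.D m.1 - m.1, X.D m.2 + m.2⟩ : IndC X i) = d • m} := by
      intro m0
      refine AddSubgroup.closure_induction (p := fun m0 _ => (⟨m0, 0⟩ : IndC X i) ∈
        AddSubgroup.closure _) ?_ ?_ ?_ ?_ (X.graded m0)
      · rintro m ⟨d, hd⟩
        refine AddSubgroup.subset_closure ⟨d - 1, IndC.ext ?_ ?_⟩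
        · change X.D m - m = (d - 1) • m
          rw [hd, sub_smul, one_smul]
        · change X.D 0 + 0 = (d - 1) • (0 : X)
          simp
      · exact zero_mem _
      · intro a b _ _ ha hb
        convert add_mem ha hb using 1
        exact IndC.ext rfl (add_zero (0 : X)).symm
      · intro a _ ha
        convert neg_mem ha using 1
        exact IndC.ext rfl (neg_zero (G := X)).symm
    have h2 : ∀ m0 : X, (⟨0, m0⟩ : IndC X i) ∈ AddSubgroup.closure
        {m : IndC X i | ∃ d : ℤ, (⟨X.D m.1 - m.1, X.D m.2 + m.2⟩ : IndC X i) = d • m} := by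
      intro m0
      refine AddSubgroup.closure_induction (p := fun m0 _ => (⟨0, m0⟩ : IndC X i) ∈
        AddSubgroup.closure _) ?_ ?_ ?_ ?_ (X.graded m0)
      · rintro m ⟨d, hd⟩
        refine AddSubgroup.subset_closure ⟨d + 1, IndC.ext ?_ ?_⟩
        · change X.D 0 - 0 = (d + 1) • (0 : X)
          simp
        · change X.D m + m = (d + 1) • m
          rw [hd, add_smul, one_smul]
      · exact zero_mem _
      · intro a b _ _ ha hb
        convert add_mem ha hb using 1
        exact IndC.ext (add_zero (0 : X)).symm rfl
      · intro a _ ha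
        convert neg_mem ha using 1
        exact IndC.ext (neg_zero (G := X)).symm rfl
    have h3 : m = (⟨m.1, 0⟩ : IndC X i) + (⟨0, m.2⟩ : IndC X i) :=
      IndC.ext (by rw [IndC.add_fst, add_zero]) (by rw [IndC.add_snd, zero_add])
    rw [h3]
    exact add_mem (h1 m.1) (h2 m.2)
  dual := by
    obtain ⟨ι, _, p, q, hpq⟩ := X.dual
    refine ⟨ι ⊕ ι, inferInstance,
      Sum.elim (fun j => ⟨((1 / 2 : ℝ) • G.α i) • p j, 0⟩) (fun j => ⟨(1 / 2 : ℝ) • p j, 0⟩),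
      Sum.elim (fun j => ⟨q j, 0⟩) (fun j => ⟨G.α i • q j, 0⟩), fun m => ?_⟩
    have hf : ∀ (p : X), indForm X i ⟨((1 / 2 : ℝ) • G.α i) • p, 0⟩ m =
        G.av i (X.form p m.1) + G.av i (X.form p m.2) * G.α i := fun p => by
      simp only [indForm, map_smul, LinearMap.smul_apply, map_zero, LinearMap.zero_apply, smul_eq_mul,
        smul_mul_assoc, add_zero, mul_zero, mul_smul_comm]
      rw [mul_comm (G.α i) (X.form p m.1), mul_comm (G.α i) (X.form p m.2), ← G.hd_mul_α,
        ← G.hd_mul_α, Realization.hd, Realization.hd, smul_mul_assoc, mul_comm (G.α i) (G.dm i _)]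
    have hf2 : ∀ (p : X), indForm X i ⟨(1 / 2 : ℝ) • p, 0⟩ m =
        G.hd i (X.form p m.1) + G.hd i (X.form p m.2) * G.α i := fun p => by
      simp only [indForm, LinearMap.map_smul_of_tower, LinearMap.smul_apply, map_zero,
        LinearMap.zero_apply, add_zero, mul_zero, mul_smul_comm, map_smul]
      rw [mul_comm _ (G.α i), Realization.hd, Realization.hd, mul_smul_comm]
    have hs : ∀ (a b : R) (q : X), G.sa i a = a → G.sa i b = b →
        (a + b * G.α i) • (⟨q, 0⟩ : IndC X i) = ⟨a • q, b • q⟩ := fun a b q ha hb => by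
      obtain ⟨h1, h2⟩ := G.eq_av_hd rfl ha hb
      exact IndC.ext (by rw [IndC.smul_fst, h1, smul_zero, add_zero])
        (by rw [IndC.smul_snd, h2, smul_zero, add_zero])
    simp only [Fintype.sum_sum_type, Sum.elim_inl, Sum.elim_inr, LinearMap.mk₂_apply, hf, hf2]
    rw [← Finset.sum_add_distrib]
    have : ∀ j, (G.av i (X.form (p j) m.1) + G.av i (X.form (p j) m.2) * G.α i) • (⟨q j, 0⟩ : IndC X i) +
        (G.hd i (X.form (p j) m.1) + G.hd i (X.form (p j) m.2) * G.α i) •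
          (⟨G.α i • q j, 0⟩ : IndC X i) = ⟨X.form (p j) m.1 • q j, X.form (p j) m.2 • q j⟩ := by
      intro j
      rw [hs _ _ _ (by simp) (by simp), hs _ _ _ (by simp) (by simp)]
      refine IndC.ext ?_ ?_
      · rw [IndC.add_fst, smul_smul, ← add_smul, G.av_add_hd]
      · change _ • q j + _ • G.α i • q j = _ • q j
        rw [smul_smul, ← add_smul, G.av_add_hd]
    rw [Finset.sum_congr rfl fun j _ => this j]
    refine IndC.ext ?_ ?_
    · exact (hpq m.1).trans (map_sum (IndC.fstHom X i)
        (fun j => ⟨X.form (p j) m.1 • q j, X.form (p j) m.2 • q j⟩) Finset.univ).symm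
    · exact (hpq m.2).trans (map_sum (IndC.sndHom X i)
        (fun j => ⟨X.form (p j) m.1 • q j, X.form (p j) m.2 • q j⟩) Finset.univ).symm

variable {X}

/-- The element `m₀ ⊗ 1 + m₁ ⊗ α`. -/
def tm (i : B) (m0 m1 : X) : X.ind i := IndC.mk m0 m1

variable {i}

/-- The coefficient of `1`. -/
def fs : X.ind i →+ X := IndC.fstHom X i

/-- The coefficient of `α`. -/
def sn : X.ind i →+ X := IndC.sndHom X i

@[simp] lemma fs_tm (m0 m1 : X) : fs (tm i m0 m1) = m0 := rfl
@[simp] lemma sn_tm (m0 m1 : X) : sn (tm i m0 m1) = m1 := rfl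
@[simp] lemma tm_eta (m : X.ind i) : tm i (fs m) (sn m) = m := rfl

lemma ind_ext {m n : X.ind i} (h0 : fs m = fs n) (h1 : sn m = sn n) : m = n := IndC.ext h0 h1

@[simp] lemma fs_smul (r : R) (m : X.ind i) :
    fs (r • m) = G.av i r • fs m + (G.hd i r * G.α i ^ 2) • sn m := rfl

@[simp] lemma sn_smul (r : R) (m : X.ind i) :
    sn (r • m) = G.hd i r • fs m + G.av i r • sn m := rfl

@[simp] lemma fs_real (c : ℝ) (m : X.ind i) : fs (c • m) = c • fs m := by
  rw [real_smul_def, fs_smul]; simp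

@[simp] lemma sn_real (c : ℝ) (m : X.ind i) : sn (c • m) = c • sn m := by
  rw [real_smul_def, sn_smul]; simp

@[simp] lemma fs_l (r : R) (m : X.ind i) : fs ((X.ind i).l r m) = X.l r (fs m) := rfl
@[simp] lemma sn_l (r : R) (m : X.ind i) : sn ((X.ind i).l r m) = X.l r (sn m) := rfl
@[simp] lemma fs_D (m : X.ind i) : fs ((X.ind i).D m) = X.D (fs m) - fs m := rfl
@[simp] lemma sn_D (m : X.ind i) : sn ((X.ind i).D m) = X.D (sn m) + sn m := rfl

lemma form_ind (m n : X.ind i) : (X.ind i).form m n =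
    G.dm i (X.form (fs m) (fs n)) + G.α i * G.dm i (X.form (fs m) (sn n) + X.form (sn m) (fs n))
    + G.α i ^ 2 * G.dm i (X.form (sn m) (sn n)) := rfl

lemma Hg.tm {d : ℤ} {m0 m1 : X} (h0 : X.Hg (d + 1) m0) (h1 : X.Hg (d - 1) m1) :
    (X.ind i).Hg d (tm i m0 m1) := by
  rw [Hg] at *
  apply ind_ext
  · rw [fs_D, fs_tm, h0, map_zsmul, fs_tm, add_smul, one_smul, add_sub_cancel_right]
  · rw [sn_D, sn_tm, h1, map_zsmul, sn_tm, sub_smul, one_smul, sub_add_cancel]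

lemma hg_ind_iff {d : ℤ} {m : X.ind i} :
    (X.ind i).Hg d m ↔ X.Hg (d + 1) (fs m) ∧ X.Hg (d - 1) (sn m) := by
  refine ⟨fun h => ⟨?_, ?_⟩, fun h => by rw [← tm_eta m]; exact h.1.tm h.2⟩
  · have := congrArg fs h
    rw [fs_D, map_zsmul, sub_eq_iff_eq_add] at this
    rw [Hg, this, add_smul, one_smul]
  · have := congrArg sn h
    rw [sn_D, map_zsmul, ← eq_sub_iff_add_eq] at this
    rw [Hg, this, sub_smul, one_smul]

section maps

variable {Y : SObj G}

/-- The map `f ⊗ 1`. -/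
noncomputable def indMap (i : B) (f : X →ₗ[R] Y) : X.ind i →ₗ[R] Y.ind i where
  toFun m := tm i (f (fs m)) (f (sn m))
  map_add' m n := ind_ext (by simp) (by simp)
  map_smul' r m := ind_ext (by simp) (by simp)

@[simp] lemma fs_indMap (f : X →ₗ[R] Y) (m : X.ind i) : fs (indMap i f m) = f (fs m) := rfl
@[simp] lemma sn_indMap (f : X →ₗ[R] Y) (m : X.ind i) : sn (indMap i f m) = f (sn m) := rfl

lemma IsHom.ind {k : ℤ} {f : X →ₗ[R] Y} (h : IsHom k f) : IsHom k (indMap i f) where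
  map_l r m := ind_ext (by simp [h.map_l]) (by simp [h.map_l])
  map_D m := ind_ext (by simp [h.map_D]; abel) (by simp [h.map_D]; abel)

lemma IsAdj.ind {f : X →ₗ[R] Y} {g : Y →ₗ[R] X} (h : IsAdj f g) :
    IsAdj (indMap i f) (indMap i g) := fun m n => by
  simp only [form_ind, fs_indMap, sn_indMap, h _ _]

variable (X i)

/-- The counit-type map `X B_s → X`. -/
noncomputable def dd : X.ind i →ₗ[R] X where
  toFun m := fs m + G.α i • sn m
  map_add' m n := by simp; abel
  map_smul' r m := by
    simp only [fs_smul, sn_smul, RingHom.id_apply]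
    conv_rhs => rw [← G.av_add_hd i r]
    module

/-- The unit-type map `X → X B_s`. -/
noncomputable def io : X →ₗ[R] X.ind i where
  toFun m := tm i (G.α i • m) m
  map_add' m n := ind_ext (by simp) (by simp)
  map_smul' r m := ind_ext
    (by
      simp only [fs_tm, fs_smul, sn_tm, RingHom.id_apply]
      conv_lhs => rw [← G.av_add_hd i r]
      module)
    (by
      simp only [fs_tm, sn_smul, sn_tm, RingHom.id_apply]
      conv_lhs => rw [← G.av_add_hd i r]
      module)

/-- Multiplication in the middle. -/
noncomputable def mid (a : R) : X.ind i →ₗ[R] X.ind i where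
  toFun m := tm i (a • fs m) (a • sn m)
  map_add' m n := ind_ext (by simp) (by simp)
  map_smul' r m := ind_ext (by simp; module) (by simp; module)

variable {X i}

lemma dd_apply (m : X.ind i) : dd X i m = fs m + G.α i • sn m := rfl
@[simp] lemma fs_io (m : X) : fs (io X i m) = G.α i • m := rfl
@[simp] lemma sn_io (m : X) : sn (io X i m) = m := rfl
@[simp] lemma fs_mid (a : R) (m : X.ind i) : fs (mid X i a m) = a • fs m := rfl
@[simp] lemma sn_mid (a : R) (m : X.ind i) : sn (mid X i a m) = a • sn m := rfl

lemma isHom_dd : IsHom 1 (dd X i) where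
  map_l r m := by simp [dd_apply]
  map_D m := by
    simp only [dd_apply, map_add, X.D_smul, G.eu_α, fs_D, sn_D, one_smul]; module

lemma isHom_io : IsHom 1 (io X i) where
  map_l r m := ind_ext (by simp) (by simp)
  map_D m := ind_ext (by simp [X.D_smul, G.eu_α]; module) (by simp)

lemma form_io (m : X) (n : X.ind i) :
    (X.ind i).form (io X i m) n = 2 * X.form m (dd X i n) := by
  simp only [form_ind, fs_io, sn_io, dd_apply, map_smul, LinearMap.smul_apply, map_add, smul_eq_mul,
    dm_eq, mul_comm (G.α i) (X.form _ _), G.hd_mul_α]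
  conv_rhs => rw [← G.av_add_hd i (X.form m (fs n)), ← G.av_add_hd i (X.form m (sn n))]
  ring

lemma mid_eq {a : R} (ha : a ∈ G.lin) (m : X.ind i) :
    mid X i a m = G.hd i a • io X i (dd X i m) + G.sa i a • m := by
  have hc : G.hd i a = algebraMap ℝ R (G.ε (G.hd i a)) := by
    rw [Realization.hd, G.dm_lin i a ha, map_smul, Algebra.smul_def, Algebra.smul_def]
    simp
  have h1 := G.av_sub_hd i a
  have h2 := G.av_add_hd i a
  have hav : G.av i (G.hd i a) = G.hd i a := G.av_of_inv (G.sa_hd _ _)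
  have hhd : G.hd i (G.hd i a) = 0 := G.hd_of_inv (G.sa_hd _ _)
  apply ind_ext
  · simp only [fs_mid, map_add, fs_smul, G.av_sa, G.hd_sa, dd_apply, fs_io, sn_io, hav, hhd]
    conv_lhs => rw [← h2]
    module
  · simp only [sn_mid, map_add, sn_smul, G.av_sa, G.hd_sa, dd_apply, fs_io, sn_io, hav, hhd]
    conv_lhs => rw [← h2]
    module

lemma form_mid {a : R} (ha : a ∈ G.lin) (m n : X.ind i) :
    (X.ind i).form (mid X i a m) n = G.dm i a * X.form (dd X i m) (dd X i n) +
      G.sa i a * (X.ind i).form m n := by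
  rw [mid_eq ha, map_add, LinearMap.add_apply, map_smul, map_smul, LinearMap.smul_apply,
    LinearMap.smul_apply, form_io, dm_eq]
  simp only [smul_eq_mul]; ring

lemma indMap_mid {f : X →ₗ[R] Y} (a : R) (m : X.ind i) :
    indMap i f (mid X i a m) = mid Y i a (indMap i f m) := ind_ext (by simp) (by simp)

/-- The semilinear involution of an induced object. -/
noncomputable def th : X.ind i →+ X.ind i where
  toFun m := tm i (fs m) (- sn m)
  map_zero' := ind_ext (by simp) (by simp)
  map_add' m n := ind_ext (by simp) (by simp; abel)

@[simp] lemma fs_th (m : X.ind i) : fs (th m) = fs m := rfl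
@[simp] lemma sn_th (m : X.ind i) : sn (th m) = - sn m := rfl

@[simp] lemma th_th (m : X.ind i) : th (th m) = m := ind_ext (by simp) (by simp)

lemma th_smul (r : R) (m : X.ind i) : th (r • m) = G.sa i r • th m :=
  ind_ext (by simp) (by simp; abel)

lemma th_l (r : R) (m : X.ind i) : th ((X.ind i).l r m) = (X.ind i).l r (th m) :=
  ind_ext (by simp) (by simp)

lemma form_th (m n : X.ind i) :
    (X.ind i).form (th m) (th n) = G.sa i ((X.ind i).form m n) := by
  simp only [form_ind, fs_th, sn_th, map_add, map_neg, LinearMap.neg_apply, map_mul, G.dm_sa,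
    G.sa_α, map_pow]
  ring

lemma Hg.th {d : ℤ} {m : X.ind i} (h : (X.ind i).Hg d m) : (X.ind i).Hg d (th m) := by
  rw [hg_ind_iff] at *
  exact ⟨h.1, by simpa using h.2.neg⟩

end maps

end SObj

end KLPos

namespace KLPos

variable {B W : Type} [Group W] {M : CoxeterMatrix B} {cs : CoxeterSystem M W}
  {R : Type} [CommRing R] [Algebra ℝ R]

namespace SObj

variable {G : Realization cs R} [IsDomain R]

/-- Elements supported on the graph of `y`. -/
def Ga (X : SObj G) (y : W) : Submodule R X where
  carrier := {m | ∀ r, X.l r m = G.act y⁻¹ r • m}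
  zero_mem' r := by simp
  add_mem' {a b} ha hb r := by rw [map_add, ha, hb, smul_add]
  smul_mem' c x hx r := by rw [map_smul, hx, smul_comm]

lemma mem_Ga {X : SObj G} {y : W} {m : X} : m ∈ X.Ga y ↔ ∀ r, X.l r m = G.act y⁻¹ r • m := Iff.rfl

variable {X Y : SObj G} {i : B}

lemma IsHom.map_Ga {k : ℤ} {f : X →ₗ[R] Y} (h : IsHom k f) {y : W} {m : X} (hm : m ∈ X.Ga y) :
    f m ∈ Y.Ga y := fun r => by rw [← h.map_l, hm, map_smul]

lemma exists_act_ne (G : Realization cs R) {y y' : W} (h : y ≠ y') :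
    ∃ r ∈ G.lin, G.act y⁻¹ r - G.act y'⁻¹ r ≠ 0 := by
  have : Nonempty B := by
    by_contra hB
    have h1 : ∀ w : W, w = 1 := fun w => by
      by_contra hw
      obtain ⟨i, -⟩ := cs.exists_rightDescent_of_ne_one hw
      exact hB ⟨i⟩
    exact h (by rw [h1 y, h1 y'])
  obtain ⟨i⟩ := this
  obtain ⟨r, hr, h1, -⟩ := G.separate y y' h _ (G.α_mem i) (G.α_ne i)
  exact ⟨r, hr, h1⟩

lemma form_Ga_eq_zero {y y' : W} (h : y ≠ y') {c c' : X} (hc : c ∈ X.Ga y) (hc' : c' ∈ X.Ga y') :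
    X.form c c' = 0 := by
  obtain ⟨r, -, hr⟩ := exists_act_ne G h
  have := X.form_l r c c'
  rw [hc, hc', map_smul, map_smul, LinearMap.smul_apply, ← sub_eq_zero, ← sub_smul] at this
  exact (smul_eq_zero.1 this).resolve_left hr

/-- The class of objects with well-behaved stalks. -/
structure Nice (X : SObj G) : Prop where
  db : ∀ y, ∃ (ι : Type) (_ : Fintype ι) (d : ι → ℤ) (c n : ι → X),
    (∀ j, c j ∈ X.Ga y ∧ X.Hg (d j) (c j) ∧ X.Hg (-d j) (n j)) ∧
    ∀ c' ∈ X.Ga y, c' = ∑ j, X.form c' (n j) • c j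
  lift : ∀ t β y d c', G.IsPR t β → cs.length y < cs.length (y * t) → c' ∈ X.Ga (y * t) →
    X.Hg d c' → ∃ c ∈ X.Ga y, X.Hg d c ∧ ∃ w, c' - c = β • w
  sep : ∃ (S : Finset W) (Δ : R), Δ ≠ 0 ∧ ∀ m, Δ • m ∈ ⨆ y ∈ S, X.Ga y

lemma nice_unit : (unit G).Nice := by
  have key : ∀ y : W, y ≠ 1 → ∀ m ∈ (unit G).Ga y, m = 0 := by
    intro y hy m hm
    obtain ⟨r, -, hr⟩ := exists_act_ne G hy
    have := hm r
    rw [inv_one, G.act_one] at hr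
    have h2 : (G.act y⁻¹ r - r) • m = 0 := by
      rw [sub_smul, ← this]; exact sub_self _
    exact smul_eq_zero' h2 hr
  have key1 : ∀ m, m ∈ (unit G).Ga 1 := fun m r => by
    rw [inv_one, G.act_one]; rfl
  refine ⟨fun y => ?_, ?_, ?_⟩
  · by_cases hy : y = 1
    · subst hy
      have h1 : (unit G).Hg 0 (1 : R) := by
        change G.eu 1 = (0 : ℤ) • (1 : R)
        rw [← map_one (algebraMap ℝ R), G.eu_algebraMap, zero_smul]
      refine ⟨Unit, inferInstance, fun _ => 0, fun _ => (1 : R), fun _ => (1 : R),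
        fun j => ⟨key1 _, h1, by simpa using h1⟩, fun c' _ => ?_⟩
      simp only [Finset.univ_unique, Finset.sum_const, Finset.card_singleton, one_smul]
      exact ((mul_one (M := R) _).trans (mul_one (M := R) _)).symm
    · exact ⟨Empty, inferInstance, fun _ => 0, fun _ => 0, fun _ => 0, fun j => j.elim,
        fun c' hc' => by rw [key y hy c' hc']; simp⟩
  · intro t β y d c' _ hlt hc' _
    have : y * t ≠ 1 := by
      intro h; rw [h, cs.length_one] at hlt; omega
    rw [key _ this c' hc']
    exact ⟨0, zero_mem _, Hg.zero d, 0, by simp⟩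
  · refine ⟨{1}, 1, one_ne_zero, fun m => ?_⟩
    simpa using key1 m

/-- A retract by mutually adjoint maps. -/
structure Retract (E X : SObj G) where
  /-- inclusion -/
  inc : E →ₗ[R] X
  /-- projection -/
  pro : X →ₗ[R] E
  isHom_inc : IsHom 0 inc
  isHom_pro : IsHom 0 pro
  adj : IsAdj inc pro
  pro_inc : ∀ m, pro (inc m) = m

lemma IsHom.hg0 {d : ℤ} {f : X →ₗ[R] Y} (h : IsHom 0 f) {m : X} (hm : X.Hg d m) :
    Y.Hg d (f m) := by simpa using h.hg hm

lemma Nice.retract {E : SObj G} (h : X.Nice) (T : Retract E X) : E.Nice := by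
  refine ⟨fun y => ?_, ?_, ?_⟩
  · obtain ⟨ι, _, d, c, n, h1, h2⟩ := h.db y
    refine ⟨ι, inferInstance, d, fun j => T.pro (c j), fun j => T.pro (n j), fun j =>
      ⟨T.isHom_pro.map_Ga (h1 j).1, T.isHom_pro.hg0 (h1 j).2.1, T.isHom_pro.hg0 (h1 j).2.2⟩,
      fun c' hc' => ?_⟩
    have := congrArg T.pro (h2 _ (T.isHom_inc.map_Ga hc'))
    rw [T.pro_inc, map_sum] at this
    refine this.trans (Finset.sum_congr rfl fun j _ => ?_)
    rw [map_smul, T.adj]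
  · intro t β y d c' ht hlt hc' hd
    obtain ⟨c, hc, hcd, w, hw⟩ := h.lift t β y d _ ht hlt (T.isHom_inc.map_Ga hc')
      (T.isHom_inc.hg0 hd)
    refine ⟨T.pro c, T.isHom_pro.map_Ga hc, T.isHom_pro.hg0 hcd, T.pro w, ?_⟩
    rw [← map_smul, ← hw, map_sub, T.pro_inc]
  · obtain ⟨S, Δ, h0, h1⟩ := h.sep
    refine ⟨S, Δ, h0, fun m => ?_⟩
    have h2 : (⨆ y ∈ S, X.Ga y) ≤ (⨆ y ∈ S, E.Ga y).comap T.pro := by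
      refine iSup₂_le fun y hy c hc => ?_
      exact Submodule.mem_iSup_of_mem y (Submodule.mem_iSup_of_mem hy (T.isHom_pro.map_Ga hc))
    have := h2 (h1 (T.inc m))
    rwa [Submodule.mem_comap, map_smul, T.pro_inc] at this

/-! ### Stalks of induced objects -/

/-- Elements supported on the graphs of `y` and `y s`. -/
def Ga2 (X : SObj G) (i : B) (y : W) (n : X) : Prop :=
  ∀ r, G.sa i r = r → X.l (G.act y r) n = r • n

/-- The stalk element of the induced object attached to an element supported on `{y, ys}`. -/
noncomputable def Jn (i : B) (y : W) (n : X) : X.ind i := tm i (X.l (G.act y (G.α i)) n) n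

/-- The component at `y` of an element supported on `{y, ys}`, multiplied by `2 α`. -/
def up (i : B) (y : W) (n : X) : X := G.α i • n + X.l (G.act y (G.α i)) n

variable {y : W}

lemma act_split (G : Realization cs R) (i : B) (y : W) (r : R) :
    r = G.act y (G.av i (G.act y⁻¹ r)) + G.act y (G.hd i (G.act y⁻¹ r)) * G.act y (G.α i) := by
  rw [← map_mul, ← map_add, G.av_add_hd, G.act_act_inv]

lemma Ga2.l_eq {n : X} (h : X.Ga2 i y n) (r : R) : X.l r n =
    G.av i (G.act y⁻¹ r) • n + G.hd i (G.act y⁻¹ r) • X.l (G.act y (G.α i)) n := by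
  conv_lhs => rw [act_split G i y r]
  rw [l_add, h _ (by simp), mul_comm, l_mul, h _ (by simp), map_smul]

lemma Ga2.l_sq {n : X} (h : X.Ga2 i y n) :
    X.l (G.act y (G.α i)) (X.l (G.act y (G.α i)) n) = G.α i ^ 2 • n := by
  rw [← l_mul, ← map_mul, ← pow_two, h _ (by simp)]

lemma Ga2.l {n : X} (h : X.Ga2 i y n) (r : R) : X.Ga2 i y (X.l r n) := fun a ha => by
  rw [l_comm, h a ha, map_smul]

lemma Ga2.add {n n' : X} (h : X.Ga2 i y n) (h' : X.Ga2 i y n') : X.Ga2 i y (n + n') :=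
  fun a ha => by rw [map_add, h a ha, h' a ha, smul_add]

lemma Ga2.of_Ga {c : X} (h : c ∈ X.Ga y) : X.Ga2 i y c := fun r _ => by
  rw [h, G.act_inv_act]

lemma Ga2.mul_simple {n : X} (h : X.Ga2 i y n) : X.Ga2 i (y * cs.simple i) n := fun r hr => by
  rw [G.act_mul_simple, hr, h r hr]

lemma mem_Ga_ind {C : X.ind i} : C ∈ (X.ind i).Ga y ↔ X.Ga2 i y (sn C) ∧ C = Jn i y (sn C) := by
  constructor
  · intro h
    refine ⟨fun r hr => ?_, ind_ext ?_ rfl⟩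
    · have := congrArg sn (h (G.act y r))
      rw [G.act_inv_act] at this
      simpa [G.hd_of_inv hr, G.av_of_inv hr] using this
    · have := congrArg sn (h (G.act y (G.α i)))
      rw [G.act_inv_act] at this
      simpa [Jn] using this.symm
  · rintro ⟨h, hC⟩ r
    apply ind_ext
    · have e : fs C = X.l (G.act y (G.α i)) (sn C) := congrArg fs hC
      rw [fs_l, fs_smul, e, l_comm, h.l_eq r, map_add, map_smul, map_smul, h.l_sq, mul_smul]
    · have e : fs C = X.l (G.act y (G.α i)) (sn C) := congrArg fs hC
      rw [sn_l, sn_smul, e, h.l_eq r, add_comm]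

lemma Jn_mem {n : X} (h : X.Ga2 i y n) : Jn i y n ∈ (X.ind i).Ga y := mem_Ga_ind.2 ⟨h, rfl⟩

@[simp] lemma sn_Jn (n : X) : sn (Jn i y n) = n := rfl

lemma Jn_add (n n' : X) : Jn i y (n + n') = Jn i y n + Jn i y n' :=
  ind_ext (by simp [Jn]) (by simp)

lemma smul_Jn {n : X} (h : X.Ga2 i y n) (r : R) :
    r • Jn i y n = Jn i y (X.l (G.act y r) n) := by
  rw [mem_Ga_ind.1 (Submodule.smul_mem _ r (Jn_mem h)) |>.2, sn_smul, h.l_eq (G.act y r), sn_Jn,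
    G.act_inv_act, add_comm]
  rfl

lemma Hg.Jn {d : ℤ} {n : X} (h : X.Hg d n) (i : B) (y : W) : (X.ind i).Hg (d + 1) (Jn i y n) := by
  refine Hg.tm ?_ (by simpa using h)
  have := h.l (r := G.act y (G.α i)) (k := 2) (by
    rw [G.eu_act, G.eu_α]; simp [two_mul, two_smul])
  rwa [add_assoc]

lemma up_mem {n : X} (h : X.Ga2 i y n) : up i y n ∈ X.Ga y := fun r => by
  conv_rhs => rw [← G.av_add_hd i (G.act y⁻¹ r)]
  rw [up, map_add, map_smul, l_comm, h.l_eq r, map_add, map_smul, map_smul, h.l_sq]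
  module

lemma up_mul_simple (n : X) :
    up i (y * cs.simple i) n = G.α i • n - X.l (G.act y (G.α i)) n := by
  rw [up, G.act_mul_simple, G.sa_α, map_neg, l_neg, sub_eq_add_neg]

lemma up_add_up (n : X) : up i y n + up i (y * cs.simple i) n = (2 * G.α i) • n := by
  rw [up_mul_simple, up]; module

lemma up_l {n : X} (r : R) : up i y (X.l r n) = X.l r (up i y n) := by
  rw [up, up, map_add, map_smul, l_comm]

lemma up_add (n n' : X) : up i y (n + n') = up i y n + up i y n' := by
  rw [up, up, up, map_add]; module

lemma up_of_Ga {c : X} (h : c ∈ X.Ga y) : up i y c = (2 * G.α i) • c := by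
  rw [up, h, G.act_inv_act]; module

lemma up_of_Ga' {c : X} (h : c ∈ X.Ga y) : up i (y * cs.simple i) c = 0 := by
  rw [up_mul_simple, h, G.act_inv_act, sub_self]

lemma two_α_ne (G : Realization cs R) (i : B) : 2 * G.α i ≠ 0 :=
  mul_ne_zero (Realization.two_ne) (G.α_ne i)

lemma mem_Ga_of_up_eq_zero {n : X} (h : X.Ga2 i y n) (h0 : up i (y * cs.simple i) n = 0) :
    n ∈ X.Ga y := fun r => by
  have h1 := up_add_up (i := i) (y := y) n
  rw [h0, add_zero] at h1
  have h2 := up_mem h r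
  rw [h1, map_smul, smul_comm] at h2
  exact smul_cancel h2 (two_α_ne G i)

lemma exists_Ga2 {c c' w : X} (hc : c ∈ X.Ga y) (hc' : c' ∈ X.Ga (y * cs.simple i))
    (hw : c + c' = (2 * G.α i) • w) :
    X.Ga2 i y w ∧ up i y w = c ∧ up i (y * cs.simple i) w = c' := by
  have h1 : X.Ga2 i y w := fun r hr => by
    apply smul_cancel _ (two_α_ne G i)
    rw [← map_smul, ← hw, smul_comm, ← hw, map_add, hc, hc', G.act_inv_act, G.act_mul_simple_inv,
      G.act_inv_act, hr, smul_add]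
  have h2 : (2 : R) • X.l (G.act y (G.α i)) w = c - c' := by
    apply smul_cancel _ (G.α_ne i)
    rw [smul_smul, mul_comm, ← map_smul, ← hw, map_add, hc, hc', G.act_inv_act,
      G.act_mul_simple_inv, G.act_inv_act, G.sa_α, neg_smul, smul_sub, sub_eq_add_neg]
  have h3 : up i y w = c := by
    apply smul_cancel (r := (2 : R)) _ Realization.two_ne
    rw [up, smul_add, h2, smul_smul, ← hw]; module
  refine ⟨h1, h3, ?_⟩
  have := up_add_up (i := i) (y := y) w
  rw [h3, ← hw] at this
  exact add_left_cancel this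

lemma Hg.of_α {d : ℤ} {n : X} (h : X.Hg d (G.α i • n)) : X.Hg (d - 2) n := by
  rw [Hg, X.D_smul, G.eu_α] at h
  apply smul_cancel _ (G.α_ne i)
  rw [sub_smul, smul_sub, smul_comm (G.α i) d n, ← h]
  module

lemma Hg.up {d : ℤ} {n : X} (h : X.Hg d n) (i : B) (y : W) : X.Hg (d + 2) (up i y n) :=
  (h.smul (k := 2) (by rw [G.eu_α, two_smul, two_mul])).add (h.l (k := 2) (by
    rw [G.eu_act, G.eu_α]; simp [two_mul, two_smul]))

lemma two_smul_half (w : X) : (2 : R) • ((1 / 2 : ℝ) • w) = w := by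
  rw [← algebraMap_smul R (1 / 2 : ℝ) w, smul_smul, ← map_ofNat (algebraMap ℝ R) 2, ← map_mul]
  norm_num

/-- Lifting from the upper stalk. -/
lemma Nice.exists_lift (hX : X.Nice) (hy : cs.length y < cs.length (y * cs.simple i)) {d : ℤ} {c' : X}
    (hc' : c' ∈ X.Ga (y * cs.simple i)) (hd : X.Hg d c') :
    ∃ n, X.Ga2 i y n ∧ up i (y * cs.simple i) n = c' ∧ X.Hg (d - 2) n := by
  obtain ⟨c, hc, hcd, w, hw⟩ := hX.lift _ _ y d c' (G.pr_simple i) hy hc' hd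
  have h1 : (-c) + c' = (2 * G.α i) • ((1 / 2 : ℝ) • w) := by
    rw [neg_add_eq_sub, hw, mul_comm, mul_smul, two_smul_half]
  obtain ⟨h2, -, h4⟩ := exists_Ga2 (neg_mem hc) hc' h1
  refine ⟨_, h2, h4, Hg.of_α (i := i) ?_⟩
  have : G.α i • ((1 / 2 : ℝ) • w) = (1 / 2 : ℝ) • (c' - c) := by
    rw [hw, smul_comm]
  rw [this]
  exact (hd.sub hcd).real _

lemma α_form_Jn (n b : X) : G.α i * (X.ind i).form (Jn i y n) (tm i b 0) =
    X.form (up i y n) b + G.sa i (X.form (up i (y * cs.simple i) n) b) := by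
  rw [up_mul_simple]
  simp only [form_ind, Jn, fs_tm, sn_tm, map_zero, zero_add, add_zero, mul_zero, up,
    map_add, map_sub, LinearMap.add_apply, LinearMap.sub_apply, map_smul, LinearMap.smul_apply,
    smul_eq_mul, map_mul, G.sa_α]
  have h1 := G.sub_act i (X.form n b)
  have h2 := G.sub_act i (X.form (X.l (G.act y (G.α i)) n) b)
  rw [G.act_simple] at h1 h2
  linear_combination - G.α i * h1 - h2

lemma form_Jn_of_Ga {c : X} (h : c ∈ X.Ga y) (b : X) :
    (X.ind i).form (Jn i y c) (tm i b 0) = 2 * X.form c b := by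
  apply mul_left_cancel₀ (G.α_ne i)
  rw [α_form_Jn, up_of_Ga h, up_of_Ga' h]
  simp only [map_smul, LinearMap.smul_apply, smul_eq_mul, map_zero, LinearMap.zero_apply]; ring

lemma form_Jn_th (n b : X) : (X.ind i).form (Jn i y n) (th (io X i b)) =
    - 2 * G.sa i (X.form (up i (y * cs.simple i) n) b) := by
  have h1 : (X.ind i).form (Jn i y n) (th (io X i b)) =
      G.sa i ((X.ind i).form (th (Jn i y n)) (io X i b)) := by
    rw [← form_th, th_th]
  have h2 : dd X i (th (Jn i y n)) = - up i (y * cs.simple i) n := by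
    rw [dd_apply, up_mul_simple, fs_th, sn_th]; simp only [Jn, fs_tm, sn_tm]; module
  rw [h1, (X.ind i).form_symm, form_io, h2, X.form_symm]; simp [map_ofNat]

lemma th_mem_Ga {C : X.ind i} (h : C ∈ (X.ind i).Ga y) :
    th C ∈ (X.ind i).Ga (y * cs.simple i) := fun r => by
  rw [← th_l, h, th_smul, G.act_mul_simple_inv]

lemma th_mem_Ga' {C : X.ind i} (h : C ∈ (X.ind i).Ga (y * cs.simple i)) :
    th C ∈ (X.ind i).Ga y := by
  simpa using th_mem_Ga h

lemma io_eq_Jn {c : X} (h : c ∈ X.Ga y) : io X i c = Jn i y c := by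
  rw [Jn, h, G.act_inv_act]; rfl

/-- Having dual bases for the stalk at `y`. -/
def HasDB (X : SObj G) (y : W) : Prop := ∃ (ι : Type) (_ : Fintype ι) (d : ι → ℤ) (c n : ι → X),
    (∀ j, c j ∈ X.Ga y ∧ X.Hg (d j) (c j) ∧ X.Hg (-d j) (n j)) ∧
    ∀ c' ∈ X.Ga y, c' = ∑ j, X.form c' (n j) • c j

lemma Nice.hasDB_ind (hX : X.Nice) (hy : cs.length y < cs.length (y * cs.simple i)) :
    HasDB (X.ind i) y := by
  obtain ⟨ι, _, d, c, n, h1, h2⟩ := hX.db y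
  obtain ⟨κ, _, d', c', n', h1', h2'⟩ := hX.db (y * cs.simple i)
  choose N hN1 hN2 hN3 using fun k => hX.exists_lift hy (h1' k).1 (h1' k).2.1
  let e : κ → X.ind i := fun k => (-1 / 2 : ℝ) • th (io X i (n' k))
  let f : ι → X.ind i := fun j => (1 / 2 : ℝ) • (tm i (n j) 0 -
    ∑ k, (X.ind i).form (Jn i y (N k)) (tm i (n j) 0) • e k)
  have he : ∀ k, (X.ind i).Hg (-(d' k - 2 + 1)) (e k) := fun k => by
    have := ((isHom_io (X := X) (i := i)).hg (h1' k).2.2).th.real (-1 / 2 : ℝ)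
    convert this using 1; ring
  have hn : ∀ j, (X.ind i).Hg (-(d j + 1)) (tm i (n j) 0) := fun j =>
    Hg.tm (by simpa using (h1 j).2.2) (Hg.zero _)
  have hf : ∀ j, (X.ind i).Hg (-(d j + 1)) (f j) := fun j => by
    refine Hg.real (Hg.sub (hn j) (Hg.sum fun k _ => ?_)) _
    have := (he k).smul (form_hg ((hN3 k).Jn i y) (hn j))
    convert this using 1; ring
  have hfe : ∀ k n0, (X.ind i).form (Jn i y n0) (e k) =
      G.sa i (X.form (up i (y * cs.simple i) n0) (n' k)) := fun k n0 => by
    rw [LinearMap.map_smul_of_tower, form_Jn_th, Algebra.smul_def]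
    have : (algebraMap ℝ R (-1 / 2)) * -2 = 1 := by
      rw [← map_ofNat (algebraMap ℝ R) 2, ← map_neg, ← map_mul]; norm_num
    rw [← mul_assoc, this, one_mul]
  refine ⟨ι ⊕ κ, inferInstance, Sum.elim (fun j => d j + 1) (fun k => d' k - 2 + 1),
    Sum.elim (fun j => Jn i y (c j)) (fun k => Jn i y (N k)), Sum.elim f e, ?_, ?_⟩
  · rintro (j | k)
    · exact ⟨Jn_mem (Ga2.of_Ga (h1 j).1), (h1 j).2.1.Jn i y, hf j⟩
    · exact ⟨Jn_mem (hN1 k), (hN3 k).Jn i y, he k⟩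
  · intro C hC
    obtain ⟨hg, hC'⟩ := mem_Ga_ind.1 hC
    set n0 := sn C
    set C1 := ∑ k, (X.ind i).form C (e k) • Jn i y (N k)
    have hC1 : C1 ∈ (X.ind i).Ga y :=
      Submodule.sum_mem _ fun k _ => Submodule.smul_mem _ _ (Jn_mem (hN1 k))
    have hC2 := mem_Ga_ind.1 (sub_mem hC hC1)
    set c0 := sn (C - C1) with hc0
    have hC1' : sn C1 = ∑ k, X.l (G.act y ((X.ind i).form C (e k))) (N k) := by
      rw [map_sum]
      exact Finset.sum_congr rfl fun k _ => by rw [smul_Jn (hN1 k), sn_Jn]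
    have hup : up i (y * cs.simple i) (sn C1) = up i (y * cs.simple i) n0 := by
      have hadd : ∀ v : κ → X, up i (y * cs.simple i) (∑ k, v k) =
          ∑ k, up i (y * cs.simple i) (v k) := fun v =>
        map_sum (⟨⟨up i (y * cs.simple i), by simp [up]⟩, up_add⟩ : X →+ X) v _
      conv_rhs => rw [h2' _ (up_mem hg.mul_simple)]
      rw [hC1', hadd]
      refine Finset.sum_congr rfl fun k _ => ?_
      rw [up_l, hN2, (h1' k).1, G.act_mul_simple_inv, G.act_inv_act]
      conv_lhs => rw [hC', hfe, G.sa_sa]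
    have hc0' : c0 ∈ X.Ga y := by
      refine mem_Ga_of_up_eq_zero hC2.1 ?_
      have := up_add (i := i) (y := y * cs.simple i) c0 (sn C1)
      rw [hup, hc0, ← map_add, sub_add_cancel] at this
      exact (add_eq_right.1 this.symm)
    have hJ : C - C1 = ∑ j, X.form c0 (n j) • Jn i y (c j) := by
      rw [hC2.2]
      have h3 := h2 c0 hc0'
      have hadd : ∀ v : ι → X, Jn i y (∑ j, v j) = ∑ j, Jn i y (v j) := fun v =>
        map_sum (⟨⟨Jn i y, by
          exact ind_ext (by simp [Jn]) (by simp)⟩, Jn_add⟩ : X →+ X.ind i) v _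
      conv_lhs => rw [h3]
      rw [hadd]
      refine Finset.sum_congr rfl fun j _ => ?_
      rw [smul_Jn (Ga2.of_Ga (h1 j).1), (h1 j).1, G.act_inv_act]
    have hform : ∀ j, X.form c0 (n j) = (X.ind i).form C (f j) := fun j => by
      have h3 := form_Jn_of_Ga (i := i) hc0' (n j)
      rw [← hC2.2] at h3
      have h4 : (X.ind i).form C (f j) = (1 / 2 : ℝ) • ((X.ind i).form (C - C1) (tm i (n j) 0)) := by
        simp only [f, C1, LinearMap.map_smul_of_tower, map_sub, LinearMap.sub_apply, map_sum,
          LinearMap.sum_apply, map_smul, LinearMap.smul_apply, smul_eq_mul]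
        congr 2
        exact Finset.sum_congr rfl fun k _ => mul_comm _ _
      rw [h4, h3, Algebra.smul_def, ← mul_assoc, ← map_ofNat (algebraMap ℝ R) 2, ← map_mul]
      norm_num
    simp only [Fintype.sum_sum_type, Sum.elim_inl, Sum.elim_inr, ← hform]
    rw [← hJ]; exact (sub_add_cancel C C1).symm

lemma HasDB.th (h : HasDB (X.ind i) y) : HasDB (X.ind i) (y * cs.simple i) := by
  obtain ⟨ι, _, d, c, n, h1, h2⟩ := h
  refine ⟨ι, inferInstance, d, fun j => SObj.th (c j), fun j => SObj.th (n j), fun j =>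
    ⟨th_mem_Ga (h1 j).1, (h1 j).2.1.th, (h1 j).2.2.th⟩, fun C hC => ?_⟩
  have := congrArg SObj.th (h2 _ (th_mem_Ga' hC))
  rw [th_th, map_sum] at this
  refine this.trans (Finset.sum_congr rfl fun j _ => ?_)
  rw [th_smul, ← form_th, th_th]

lemma length_lt_or (y : W) (i : B) :
    cs.length y < cs.length (y * cs.simple i) ∨ cs.length (y * cs.simple i) < cs.length y := by
  have := cs.length_mul_simple_ne y i
  omega

lemma Nice.hasDB_ind' (hX : X.Nice) (y : W) : HasDB (X.ind i) y := by
  rcases length_lt_or (cs := cs) y i with h | h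
  · exact hX.hasDB_ind h
  · have := (hX.hasDB_ind (i := i) (y := y * cs.simple i) (by simpa using h)).th
    simpa using this

lemma dvd_two {β a : R} (h : β ∣ 2 * a) : β ∣ a := by
  obtain ⟨k, hk⟩ := h
  refine ⟨(1 / 2 : ℝ) • k, ?_⟩
  rw [mul_smul_comm, ← hk, ← map_ofNat (algebraMap ℝ R) 2, ← Algebra.smul_def, smul_smul]
  norm_num

lemma Nice.lift_ind (hX : X.Nice) {t : W} {β : R} {d : ℤ} {C' : X.ind i} (ht : G.IsPR t β)
    (hlt : cs.length y < cs.length (y * t)) (hC' : C' ∈ (X.ind i).Ga (y * t))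
    (hd : (X.ind i).Hg d C') : ∃ C ∈ (X.ind i).Ga y, (X.ind i).Hg d C ∧ ∃ w, C' - C = β • w := by
  by_cases hts : t = cs.simple i
  · subst hts
    rw [G.pr_unique _ _ _ ht (G.pr_simple i)]
    refine ⟨th C', th_mem_Ga' hC', hd.th, tm i ((2 : ℝ) • sn C') 0, ind_ext ?_ ?_⟩
    · simp
    · simp [two_smul]
  · obtain ⟨hn, hJ⟩ := mem_Ga_ind.1 hC'
    set n := sn C'
    have hdn : X.Hg (d - 1) n := (hg_ind_iff.1 hd).2
    obtain ⟨c, hc, -, w, hw⟩ := hX.lift t β y _ _ ht hlt (up_mem hn) (hdn.up i _)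
    have e1 : y * cs.simple i * (cs.simple i * t * cs.simple i) = y * t * cs.simple i := by
      simp [mul_assoc]
    obtain ⟨c', hc', -, w', hw'⟩ := hX.lift _ _ (y * cs.simple i) _ (up i (y * t * cs.simple i) n)
      (G.pr_conj t β i ht hts)
      (by rw [e1]; exact G.pr_lt t β i y ht hts hlt) (by rw [e1]; exact up_mem hn.mul_simple)
      (hdn.up i _)
    have h1 : (2 * G.α i) • C' = io X i (up i (y * t) n) +
        th (io X i (up i (y * t * cs.simple i) n)) := by
      have h2 : (2 : R) • Jn i (y * t) (X.l (G.act (y * t) (G.α i)) n) = (2 * G.α i) • C' := by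
        rw [← smul_Jn hn, smul_smul]; conv_rhs => rw [hJ]
      rw [← h2]
      have hav2 : G.av i 2 = 2 := G.av_of_inv (map_ofNat _ 2)
      have hhd2 : G.hd i 2 = 0 := G.hd_of_inv (map_ofNat _ 2)
      rw [up_mul_simple]
      refine ind_ext ?_ ?_
      · simp only [Jn, fs_smul, fs_tm, sn_tm, hav2, hhd2, map_add, fs_io, fs_th, up,
          hn.l_sq]
        module
      · simp only [Jn, sn_smul, fs_tm, sn_tm, hav2, hhd2, map_add, sn_io, sn_th, up]
        module
    set C0 := io X i c + th (io X i c') with hC0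
    have hC0m : C0 ∈ (X.ind i).Ga y := by
      refine add_mem ?_ (th_mem_Ga' ?_)
      · exact isHom_io.map_Ga hc
      · exact isHom_io.map_Ga hc'
    have h3 : (2 * G.α i) • C' - C0 = β • (io X i w + th (io X i w')) := by
      have a1 : io X i (up i (y * t) n) - io X i c = β • io X i w := by
        rw [← map_sub, hw, map_smul]
      have a2 : th (io X i (up i (y * t * cs.simple i) n)) - th (io X i c') = β • th (io X i w') := by
        rw [← map_sub, ← map_sub, hw', map_smul, th_smul, G.act_simple, G.sa_sa]
      rw [h1, hC0, smul_add, ← a1, ← a2]; abel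
    obtain ⟨ι, _, δ, cc, nn, k1, k2⟩ := hX.hasDB_ind' (i := i) y
    set C := ∑ j, (X.ind i).form C' (nn j) • cc j with hC
    refine ⟨C, Submodule.sum_mem _ fun j _ => Submodule.smul_mem _ _ (k1 j).1,
      Hg.sum fun j _ => ?_, ?_⟩
    · have := (k1 j).2.1.smul (form_hg hd (k1 j).2.2)
      convert this using 1; ring
    · have k3 : (2 * G.α i) • (C' - C) = β • ((io X i w + th (io X i w')) -
          ∑ j, (X.ind i).form (io X i w + th (io X i w')) (nn j) • cc j) := by
        have k4 := k2 C0 hC0m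
        have k5 : (2 * G.α i) • C = ∑ j, (X.ind i).form ((2 * G.α i) • C') (nn j) • cc j := by
          rw [hC, Finset.smul_sum]
          refine Finset.sum_congr rfl fun j _ => ?_
          rw [map_smul, LinearMap.smul_apply, smul_assoc]
        have k6 : (2 * G.α i) • C' = C0 + β • (io X i w + th (io X i w')) := by
          rw [← h3]; abel
        have k7 : (2 * G.α i) • C = C0 +
            β • ∑ j, (X.ind i).form (io X i w + th (io X i w')) (nn j) • cc j := by
          rw [k5, k6]
          conv_rhs => rw [k4, Finset.smul_sum]
          rw [← Finset.sum_add_distrib]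
          refine Finset.sum_congr rfl fun j _ => ?_
          rw [map_add, LinearMap.add_apply, map_smul, LinearMap.smul_apply, add_smul, smul_assoc]
        rw [smul_sub, k6, k7, smul_sub]; abel
      have hp := G.prime_lin β (G.pr_lin t β ht).1 (G.pr_lin t β ht).2
      exact exists_smul_of_prime hp (fun h => G.pr_not_dvd t β i ht hts (dvd_two h)) k3

lemma Nice.ind (hX : X.Nice) (i : B) : (X.ind i).Nice := by
  classical
  refine ⟨fun y => hX.hasDB_ind' y, fun t β y d C' => hX.lift_ind, ?_⟩
  obtain ⟨S, Δ, h0, h1⟩ := hX.sep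
  set S' := S ∪ S.image (· * cs.simple i)
  set V := ⨆ y ∈ S', (X.ind i).Ga y
  have hio : ∀ m ∈ ⨆ y ∈ S, X.Ga y, io X i m ∈ V := by
    have : (⨆ y ∈ S, X.Ga y) ≤ V.comap (io X i) := by
      refine iSup₂_le fun y hy c hc => ?_
      exact Submodule.mem_iSup_of_mem y (Submodule.mem_iSup_of_mem
        (Finset.mem_union_left _ hy) (isHom_io.map_Ga hc))
    exact fun m hm => this hm
  have hth : ∀ m ∈ V, th m ∈ V := by
    let V' : Submodule R (X.ind i) :=
      { carrier := {m | th m ∈ V}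
        zero_mem' := by simp
        add_mem' := fun {a b} ha hb => by
          simp only [Set.mem_ofPred_eq, map_add] at *; exact add_mem ha hb
        smul_mem' := fun r m hm => by
          simp only [Set.mem_ofPred_eq, th_smul] at *; exact Submodule.smul_mem _ _ hm }
    have : V ≤ V' := by
      refine iSup₂_le fun y hy c hc => ?_
      refine Submodule.mem_iSup_of_mem (y * cs.simple i) (Submodule.mem_iSup_of_mem ?_ (th_mem_Ga hc))
      simp only [S', Finset.mem_union, Finset.mem_image] at hy ⊢
      rcases hy with hy | ⟨z, hz, rfl⟩
      · exact Or.inr ⟨y, hy, rfl⟩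
      · left; simpa using hz
    exact fun m hm => this hm
  refine ⟨S', 2 * (Δ * G.sa i Δ * G.α i ^ 2), ?_, fun m => ?_⟩
  · refine mul_ne_zero Realization.two_ne (mul_ne_zero (mul_ne_zero h0 ?_) (pow_ne_zero _ (G.α_ne i)))
    simpa using h0
  · set a := (G.sa i Δ * G.α i) • (Δ • fs m)
    set b := (G.sa i Δ * G.α i ^ 2) • (Δ • sn m)
    have ha : a ∈ ⨆ y ∈ S, X.Ga y := Submodule.smul_mem _ _ (h1 _)
    have hb : b ∈ ⨆ y ∈ S, X.Ga y := Submodule.smul_mem _ _ (h1 _)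
    have e : (2 * (Δ * G.sa i Δ * G.α i ^ 2)) • m =
        (io X i a + th (io X i a)) + (io X i b - th (io X i b)) := by
      have hinv : G.sa i (2 * (Δ * G.sa i Δ * G.α i ^ 2)) = 2 * (Δ * G.sa i Δ * G.α i ^ 2) := by
        simp only [map_mul, map_pow, G.sa_sa, G.sa_α, map_ofNat]; ring
      apply ind_ext
      · simp only [fs_smul, G.av_of_inv hinv, G.hd_of_inv hinv, map_add, map_sub, fs_io, fs_th, a, b]
        module
      · simp only [sn_smul, G.av_of_inv hinv, G.hd_of_inv hinv, map_add, map_sub, sn_io, sn_th, a, b]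
        module
    rw [e]
    exact add_mem (add_mem (hio _ ha) (hth _ (hio _ ha))) (sub_mem (hio _ hb) (hth _ (hio _ hb)))

end SObj

end KLPos

namespace KLPos

variable {B W : Type} [Group W] {M : CoxeterMatrix B} {cs : CoxeterSystem M W}
  {R : Type} [CommRing R] [Algebra ℝ R]

namespace Realization

variable (G : Realization cs R) [IsDomain R]

lemma pr_ne_one {t : W} {β : R} (h : G.IsPR t β) : t ≠ 1 := fun h1 =>
  G.pr_length_ne t β 1 h (by rw [h1, mul_one])

lemma pr_inv {t : W} {β : R} (h : G.IsPR t β) : t⁻¹ = t :=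
  inv_eq_of_mul_eq_one_left (G.pr_mul_self t β h)

lemma smul_cancel_real {c d : ℝ} {r : R} (h : c • r = d • r) (hr : r ≠ 0) : c = d := by
  rw [Algebra.smul_def, Algebra.smul_def] at h
  exact (algebraMap ℝ R).injective (mul_right_cancel₀ hr h)

lemma pr_act_self {t : W} {β : R} (h : G.IsPR t β) : G.act t β = -β := by
  obtain ⟨hβ, h0⟩ := G.pr_lin t β h
  have htt : ∀ r, G.act t (G.act t r) = r := fun r => by
    have := G.act_inv_act t r
    rwa [G.pr_inv h] at this
  obtain ⟨k, hk⟩ := G.dvd_lin β hβ _ (sub_mem hβ (G.act_lin t β hβ)) (G.pr_act t β β h)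
  have h1 : G.act t β = (1 - k) • β := by
    rw [sub_smul, one_smul, ← hk, sub_sub_cancel]
  have h2 : ((1 - k) * (1 - k)) • β = (1 : ℝ) • β := by
    conv_rhs => rw [one_smul, ← htt β, h1, map_smul, h1]
    rw [mul_smul]
  have h3 := smul_cancel_real h2 h0
  rcases mul_self_eq_one_iff.1 h3 with h4 | h4
  · exfalso
    obtain ⟨r, hr, hne, -⟩ := G.separate 1 t (Ne.symm (G.pr_ne_one h)) β hβ h0
    rw [inv_one, G.act_one, G.pr_inv h] at hne
    obtain ⟨c, hc⟩ := G.dvd_lin β hβ _ (sub_mem hr (G.act_lin t r hr)) (G.pr_act t β r h)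
    have h5 := congrArg (G.act t) hc
    rw [map_sub, htt, map_smul, h1, h4, one_smul, ← hc] at h5
    have h6 : 2 * (r - G.act t r) = 0 := by linear_combination - h5
    exact hne ((mul_eq_zero.1 h6).resolve_left Realization.two_ne)
  · rw [h1, h4, neg_one_smul]

lemma pr_inj {t t' : W} {β β' p : R} (h : G.IsPR t β) (h' : G.IsPR t' β') {c c' : ℝ} (hc : c ≠ 0)
    (hc' : c' ≠ 0) (hp : p = c • β) (hp' : p = c' • β') : t = t' := by
  by_contra hne
  have hl := G.pr_lin t β h
  have hpl : p ∈ G.lin := by rw [hp]; exact Submodule.smul_mem _ _ hl.1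
  have hp0 : p ≠ 0 := by rw [hp]; exact smul_ne_zero hc hl.2
  have dv : ∀ {s : W} {γ : R} {e : ℝ}, G.IsPR s γ → e ≠ 0 → p = e • γ →
      (∀ r, p ∣ r - G.act s r) ∧ G.act s p = -p := by
    intro s γ e hs he hpe
    constructor
    · intro r
      obtain ⟨k, hk⟩ := G.pr_act s γ r hs
      refine ⟨e⁻¹ • k, ?_⟩
      rw [hk, hpe, smul_mul_smul_comm, mul_inv_cancel₀ he, one_smul]
    · rw [hpe, map_smul, G.pr_act_self hs, smul_neg]
  obtain ⟨r, hr, h0, h1 | ⟨s, γ, hs, hts, e, he, hpe⟩⟩ := G.separate t t' hne p hpl hp0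
  · rw [G.pr_inv h, G.pr_inv h'] at h1
    apply h1
    have := dvd_sub ((dv h' hc' hp').1 r) ((dv h hc hp).1 r)
    convert this using 1; ring
  · have e1 := (dv h' hc' hp').2
    rw [hts, G.act_mul, (dv hs he hpe).2, map_neg, (dv h hc hp).2] at e1
    have : 2 * p = 0 := by linear_combination e1
    exact hp0 ((mul_eq_zero.1 this).resolve_left Realization.two_ne)

lemma exists_separating (y : W) (S : Finset W) (hS : y ∉ S) {p : R} (hp : p ∈ G.lin) (hp0 : p ≠ 0) :
    ∃ r : W → R, (∀ z, r z ∈ G.lin) ∧ (∀ z ∈ S, G.act y⁻¹ (r z) - G.act z⁻¹ (r z) ≠ 0) ∧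
      ¬ p ^ 2 ∣ (∏ z ∈ S, (G.act y⁻¹ (r z) - G.act z⁻¹ (r z))) ∧
      (p ∣ (∏ z ∈ S, (G.act y⁻¹ (r z) - G.act z⁻¹ (r z))) →
        ∃ t β, G.IsPR t β ∧ y * t ∈ S ∧ ∃ c : ℝ, c ≠ 0 ∧ p = c • β) := by
  classical
  have h1 : ∀ z, ∃ r ∈ G.lin, z ∈ S → G.act y⁻¹ r - G.act z⁻¹ r ≠ 0 ∧
      (p ∣ G.act y⁻¹ r - G.act z⁻¹ r → ∃ t β, G.IsPR t β ∧ z = y * t ∧ ∃ c : ℝ, c ≠ 0 ∧ p = c • β) := by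
    intro z
    by_cases hz : z = y
    · exact ⟨0, zero_mem _, fun h => absurd (hz ▸ h) hS⟩
    · obtain ⟨r, hr, h1, h2⟩ := G.separate y z (Ne.symm hz) p hp hp0
      exact ⟨r, hr, fun _ => ⟨h1, fun h => h2.resolve_left (not_not_intro h)⟩⟩
  choose r hr h2 using h1
  set δ : W → R := fun z => G.act y⁻¹ (r z) - G.act z⁻¹ (r z) with hδ
  have hpp := G.prime_lin p hp hp0
  refine ⟨r, hr, fun z hz => (h2 z hz).1, ?_, fun h => ?_⟩
  · intro hdvd
    obtain ⟨z, hz, hpz⟩ := (Prime.dvd_finsetProd_iff hpp _).1 ((dvd_pow_self p two_ne_zero).trans hdvd)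
    rw [← Finset.mul_prod_erase S _ hz] at hdvd
    have h3 : ¬ p ∣ ∏ z' ∈ S.erase z, (G.act y⁻¹ (r z') - G.act z'⁻¹ (r z')) := by
      intro h
      obtain ⟨z', hz', hpz'⟩ := (Prime.dvd_finsetProd_iff hpp _).1 h
      obtain ⟨hne, hzS⟩ := Finset.mem_erase.1 hz'
      obtain ⟨t, β, ht, rfl, c, hc, e⟩ := (h2 z hz).2 hpz
      obtain ⟨t', β', ht', rfl, c', hc', e'⟩ := (h2 z' hzS).2 hpz'
      exact hne (by rw [G.pr_inj ht ht' hc hc' e e'])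
    have h4 := hpp.pow_dvd_of_dvd_mul_right 2 h3 hdvd
    obtain ⟨c, hc⟩ := G.dvd_lin p hp _ (sub_mem (G.act_lin _ _ (hr z)) (G.act_lin _ _ (hr z))) hpz
    have hc0 : c ≠ 0 := fun h => (h2 z hz).1 (by rw [hc, h, zero_smul])
    rw [hc, Algebra.smul_def, mul_comm, pow_two] at h4
    have h5 := (mul_dvd_mul_iff_left hp0).1 h4
    exact hpp.not_isUnit (isUnit_of_dvd_unit h5 ((IsUnit.mk0 c hc0).map _))
  · obtain ⟨z, hz, hpz⟩ := (Prime.dvd_finsetProd_iff hpp _).1 h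
    obtain ⟨t, β, ht, rfl, h3⟩ := (h2 z hz).2 hpz
    exact ⟨t, β, ht, hz, h3⟩

end Realization

namespace SObj

variable {G : Realization cs R} [IsDomain R] {X Y Z : SObj G} {y : W}

lemma exists_operator (S : Finset W) (r : W → R) (m : X) :
    ∃ C : X, ∀ w, ∀ c ∈ X.Ga w, X.form c C =
      (∏ z ∈ S, (G.act w⁻¹ (r z) - G.act z⁻¹ (r z))) * X.form c m := by
  classical
  induction S using Finset.induction_on with
  | empty => exact ⟨m, by simp⟩
  | insert a S ha ih =>
    obtain ⟨C, hC⟩ := ih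
    refine ⟨X.l (r a) C - G.act a⁻¹ (r a) • C, fun w c hc => ?_⟩
    rw [Finset.prod_insert ha, map_sub, ← X.form_l, hc, map_smul, map_smul, LinearMap.smul_apply,
      hC w c hc, smul_eq_mul, smul_eq_mul]
    ring

lemma Nice.eq_zero (h : X.Nice) {m : X} (hm : ∀ y, ∀ c ∈ X.Ga y, X.form c m = 0) : m = 0 := by
  obtain ⟨S, Δ, h0, h1⟩ := h.sep
  refine eq_zero_of_form m fun n => ?_
  have h2 : (⨆ y ∈ S, X.Ga y) ≤ LinearMap.ker (X.form.flip m) :=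
    iSup₂_le fun y _ c hc => hm y c hc
  have h3 := h2 (h1 n)
  rw [LinearMap.mem_ker, LinearMap.flip_apply, map_smul, LinearMap.smul_apply, smul_eq_mul] at h3
  exact (mul_eq_zero.1 h3).resolve_left h0

lemma Nice.eq_zero_of_mem (h : X.Nice) {m : X} (hm : m ∈ X.Ga y) (h0 : ∀ c ∈ X.Ga y, X.form c m = 0) :
    m = 0 := h.eq_zero fun y' c hc => by
  by_cases hy : y' = y
  · subst hy; exact h0 c hc
  · exact form_Ga_eq_zero hy hc hm

lemma Nice.mem_Ga (h : X.Nice) {m : X} (hm : ∀ y', y' ≠ y → ∀ c ∈ X.Ga y', X.form c m = 0) :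
    m ∈ X.Ga y := fun r => by
  rw [← sub_eq_zero]
  refine h.eq_zero fun y' c hc => ?_
  rw [map_sub, ← X.form_l, hc, map_smul, map_smul, LinearMap.smul_apply, ← sub_smul]
  by_cases hy : y' = y
  · rw [hy, sub_self, zero_smul]
  · rw [hm y' hy c hc, smul_zero]

lemma D_mem_Ga {c : X} (hc : c ∈ X.Ga y) : X.D c ∈ X.Ga y := fun r => by
  have h := congrArg X.D (hc r)
  rw [X.D_l, X.D_smul, hc, G.eu_act] at h
  exact add_left_cancel h

/-- Projection to the stalk at `y`, up to a product of few linear forms. -/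
lemma Nice.exists_proj (h : X.Nice) {D : ℤ} {m : X} (hmD : X.Hg D m)
    (hm : ∀ y', cs.length y < cs.length y' → ∀ c ∈ X.Ga y', X.form c m = 0) :
    ∃ (d : R) (k : ℕ) (C : X), k ≤ cs.length y ∧ d ≠ 0 ∧ C ∈ X.Ga y ∧ X.Hg (D + 2 * k) C ∧
      ∀ c ∈ X.Ga y, X.form c C = d * X.form c m := by
  classical
  obtain ⟨S0, Δ, hΔ, hS0⟩ := h.sep
  set S := S0.filter fun z => z ≠ y ∧ cs.length z ≤ cs.length y with hS
  have hyS : y ∉ S := by simp [hS]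
  have hrep : ∀ r : W → R, (∀ z, r z ∈ G.lin) → ∃ C ∈ X.Ga y, ∀ c ∈ X.Ga y, X.form c C =
      (∏ z ∈ S, (G.act y⁻¹ (r z) - G.act z⁻¹ (r z))) * X.form c m := by
    intro r hr
    obtain ⟨C, hC⟩ := exists_operator S r m
    refine ⟨C, fun a => ?_, hC y⟩
    rw [← sub_eq_zero]
    refine eq_zero_of_form _ fun n => ?_
    have h2 : (⨆ y ∈ S0, X.Ga y) ≤ LinearMap.ker (X.form.flip (X.l a C - G.act y⁻¹ a • C)) := by
      refine iSup₂_le fun z hz c hc => ?_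
      rw [LinearMap.mem_ker, LinearMap.flip_apply, map_sub, ← X.form_l, hc, map_smul, map_smul,
        LinearMap.smul_apply, ← sub_smul]
      by_cases hzy : z = y
      · rw [hzy, sub_self, zero_smul]
      · have : X.form c C = 0 := by
          rw [hC z c hc]
          by_cases hl : cs.length z ≤ cs.length y
          · rw [Finset.prod_eq_zero (i := z), zero_mul]
            · simp [hS, hz, hzy, hl]
            · rw [sub_self]
          · rw [hm z (not_le.1 hl) c hc, mul_zero]
        rw [this, smul_zero]
    have h3 := h2 (hS0 n)
    rw [LinearMap.mem_ker, LinearMap.flip_apply, map_smul, LinearMap.smul_apply, smul_eq_mul] at h3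
    exact (mul_eq_zero.1 h3).resolve_left hΔ
  let P : ℕ → Prop := fun k => ∃ s : Multiset R, s.card = k ∧ (∀ p ∈ s, p ∈ G.lin ∧ p ≠ 0) ∧
    ∃ C ∈ X.Ga y, ∀ c ∈ X.Ga y, X.form c C = s.prod * X.form c m
  have hP : ∃ k, P k := by
    have h1 : ∀ z, ∃ r ∈ G.lin, z ≠ y → G.act y⁻¹ r - G.act z⁻¹ r ≠ 0 := fun z => by
      by_cases hz : z = y
      · exact ⟨0, zero_mem _, fun h => absurd hz h⟩
      · obtain ⟨r, hr, h1⟩ := exists_act_ne G (Ne.symm hz)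
        exact ⟨r, hr, fun _ => h1⟩
    choose r hr hr' using h1
    obtain ⟨C, hC, hC'⟩ := hrep r hr
    refine ⟨_, S.val.map fun z => G.act y⁻¹ (r z) - G.act z⁻¹ (r z), rfl, fun p hp => ?_, C, hC, hC'⟩
    obtain ⟨z, hz, rfl⟩ := Multiset.mem_map.1 hp
    refine ⟨sub_mem (G.act_lin _ _ (hr z)) (G.act_lin _ _ (hr z)), hr' z ?_⟩
    rintro rfl; exact hyS hz
  obtain ⟨s, hk, hs, C, hC, hC'⟩ := Nat.find_spec hP
  have hmin : ∀ s' : Multiset R, (∀ p ∈ s', p ∈ G.lin ∧ p ≠ 0) → (∃ C ∈ X.Ga y, ∀ c ∈ X.Ga y,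
      X.form c C = s'.prod * X.form c m) → s.card ≤ s'.card := fun s' h1 h2 => by
    rw [hk]; exact Nat.find_min' hP ⟨s', rfl, h1, h2⟩
  have key : ∀ p ∈ s, ¬ p ∣ (s.erase p).prod ∧ ∃ t β, G.IsPR t β ∧
      cs.length (y * t) < cs.length y ∧ ∃ c : ℝ, c ≠ 0 ∧ p = c • β := by
    intro p hp
    obtain ⟨hpl, hp0⟩ := hs p hp
    have hpp := G.prime_lin p hpl hp0
    have hprod : s.prod = p * (s.erase p).prod := by
      rw [← Multiset.prod_cons, Multiset.cons_erase hp]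
    have hndiv : ∀ w, C ≠ p • w := by
      intro w hw
      have h1 := hmin (s.erase p) (fun q hq => hs q (Multiset.mem_of_mem_erase hq)) ⟨w, ?_, ?_⟩
      · rw [Multiset.card_erase_of_mem hp] at h1
        have := Multiset.card_pos_iff_exists_mem.2 ⟨p, hp⟩
        rw [Nat.pred_eq_sub_one] at h1; omega
      · intro a
        apply smul_cancel _ hp0
        rw [← map_smul, ← hw, hC, smul_comm, hw]
      · intro c hc
        apply mul_left_cancel₀ hp0
        have := hC' c hc
        rw [hw, map_smul, smul_eq_mul, hprod] at this
        rw [this, mul_assoc]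
    obtain ⟨r, hr, -, h2, h3⟩ := G.exists_separating y S hyS hpl hp0
    set d' := ∏ z ∈ S, (G.act y⁻¹ (r z) - G.act z⁻¹ (r z))
    obtain ⟨C1, hC1, hC1'⟩ := hrep r hr
    have hcomp : d' • C = s.prod • C1 := by
      rw [← sub_eq_zero]
      refine h.eq_zero_of_mem (sub_mem (Submodule.smul_mem _ _ hC) (Submodule.smul_mem _ _ hC1))
        fun c hc => ?_
      rw [map_sub, map_smul, map_smul, hC' c hc, hC1' c hc, smul_eq_mul, smul_eq_mul]; ring
    have hpd : p ∣ d' := by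
      by_contra hpd
      rw [hprod, mul_smul] at hcomp
      obtain ⟨w, hw⟩ := exists_smul_of_prime hpp hpd hcomp
      exact hndiv w hw
    constructor
    · rintro ⟨e, he⟩
      obtain ⟨d'', hd''⟩ := hpd
      have h4 : ¬ p ∣ d'' := by
        rintro ⟨f, rfl⟩
        exact h2 ⟨f, by rw [hd'']; ring⟩
      rw [hprod, hd'', mul_smul, mul_smul] at hcomp
      have h5 := smul_cancel hcomp hp0
      rw [he, mul_smul] at h5
      obtain ⟨w, hw⟩ := exists_smul_of_prime hpp h4 h5
      exact hndiv w hw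
    · obtain ⟨t, β, ht, hyt, h5⟩ := h3 hpd
      refine ⟨t, β, ht, ?_, h5⟩
      have h6 := (Finset.mem_filter.1 hyt).2.2
      exact lt_of_le_of_ne h6 (G.pr_length_ne t β y ht)
  have hnodup : s.Nodup := by
    rw [Multiset.nodup_iff_count_le_one]
    intro p
    by_contra hc
    have hp : p ∈ s.erase p := by
      rw [← Multiset.count_pos, Multiset.count_erase_self]; omega
    exact (key p (Multiset.mem_of_mem_erase hp)).1 (Multiset.dvd_prod hp)
  have hcard : s.card ≤ cs.length y := by
    obtain ⟨I, hI, hI'⟩ := G.pr_bound y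
    have h1 : ∀ p, ∃ t, p ∈ s → t ∈ I ∧ ∃ β, G.IsPR t β ∧ ∃ c : ℝ, c ≠ 0 ∧ p = c • β := fun p => by
      by_cases hp : p ∈ s
      · obtain ⟨-, t, β, ht, hl, h5⟩ := key p hp
        exact ⟨t, fun _ => ⟨hI' t β ht hl, β, ht, h5⟩⟩
      · exact ⟨1, fun h => absurd h hp⟩
    choose f hf using h1
    refine le_trans ?_ hI
    change (⟨s, hnodup⟩ : Finset R).card ≤ _
    refine Finset.card_le_card_of_injOn f (fun p hp => (hf p hp).1) fun p hp p' hp' hpp' => ?_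
    obtain ⟨β, hβ, c, hc, e⟩ := (hf p hp).2
    obtain ⟨β', hβ', c', hc', e'⟩ := (hf p' hp').2
    by_contra hne
    refine (key p hp).1 (dvd_trans ?_ (Multiset.dvd_prod ((Multiset.mem_erase_of_ne (Ne.symm hne)).2 hp')))
    have : β = β' := G.pr_unique _ _ _ hβ (hpp' ▸ hβ')
    refine ⟨algebraMap ℝ R (c⁻¹ * c'), ?_⟩
    rw [e, e', ← this, mul_comm, ← Algebra.smul_def, smul_smul, mul_right_comm, inv_mul_cancel₀ hc,
      one_mul]
  have heu : G.eu s.prod = (2 * s.card : ℤ) • s.prod := by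
    clear hcard hnodup key hmin hC' hC hk
    induction s using Multiset.induction_on with
    | empty =>
      have : G.eu 1 = 0 := by rw [← map_one (algebraMap ℝ R), G.eu_algebraMap]
      simp [this]
    | cons a s ih =>
      rw [Multiset.prod_cons, G.eu_mul, ih fun p hp => hs p (Multiset.mem_cons_of_mem hp),
        G.eu_lin a (hs a (Multiset.mem_cons_self a s)).1, Multiset.card_cons]
      have : (2 : ℝ) • a = 2 * a := by rw [Algebra.smul_def, map_ofNat]
      rw [this, zsmul_eq_mul, zsmul_eq_mul]; push_cast; ring
  refine ⟨s.prod, s.card, C, hcard, Multiset.prod_ne_zero fun h0 => (hs 0 h0).2 rfl, hC, ?_, hC'⟩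
  rw [Hg, ← sub_eq_zero]
  refine h.eq_zero_of_mem (sub_mem (D_mem_Ga hC) (zsmul_mem hC _)) fun c hc => ?_
  have h1 := X.form_D c C
  have h2 := X.form_D c m
  rw [hC' c hc, G.eu_mul, heu, hC' _ (D_mem_Ga hc)] at h1
  rw [hmD, map_zsmul] at h2
  rw [map_sub, map_zsmul, hC' c hc, sub_eq_zero]
  rw [zsmul_eq_mul] at h1 h2 ⊢
  push_cast at h1 ⊢
  linear_combination h1 - s.prod * h2

/-- The properties of the indecomposable object attached to `x`, apart from Hodge theory. -/
structure Good (x : W) (X : SObj G) (ct cb : X) : Prop where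
  nice : X.Nice
  mem : ct ∈ X.Ga x
  hg_ct : X.Hg (cs.length x) ct
  hg_cb : X.Hg (-cs.length x) cb
  form_ct : X.form ct cb = 1
  gen : ∀ c ∈ X.Ga x, ∃ r : R, c = r • ct
  low : ∀ y, y ≠ x → ∀ d, ∀ c ∈ X.Ga y, X.Hg d c → c ≠ 0 → cs.length y < d
  zero : ∀ y, y ≠ x → cs.length x ≤ cs.length y → ∀ c ∈ X.Ga y, c = 0

namespace Good

variable {x z : W} {ct cb : X} {zt zb : Z}

lemma ct_ne (h : Good x X ct cb) : ct ≠ 0 := fun h0 => by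
  have := h.form_ct
  rw [h0, map_zero, LinearMap.zero_apply] at this
  exact zero_ne_one this

lemma hg_coeff {d : ℤ} {k : ℤ} {m : X} (hm : X.Hg k m) (hm0 : m ≠ 0) {r : R} (h : X.Hg d (r • m)) :
    G.eu r = (d - k) • r := by
  rw [Hg, X.D_smul, hm] at h
  rw [← sub_eq_zero]
  by_contra h0
  refine hm0 (smul_eq_zero' ?_ h0)
  rw [sub_smul, smul_assoc, sub_smul, ← h, smul_comm r k m]
  abel

lemma eu_int {r : R} {k : ℤ} (h : G.eu r = k • r) (hr : r ≠ 0) : 0 ≤ k ∧ ∃ j : ℕ, k = 2 * j := by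
  have h1 : G.eu r = (k : ℝ) • r := by rw [h, Int.cast_smul_eq_zsmul]
  obtain ⟨j, hj⟩ := (G.eu_eigen r k h1).resolve_left hr
  have : k = 2 * j := by exact_mod_cast hj
  exact ⟨by omega, j, this⟩

lemma length_le (h : Good x X ct cb) {y : W} {d : ℤ} {c : X} (hc : c ∈ X.Ga y) (hd : X.Hg d c)
    (h0 : c ≠ 0) : cs.length y ≤ d ∧ (d = cs.length y → y = x) := by
  by_cases hy : y = x
  · subst hy
    obtain ⟨r, rfl⟩ := h.gen c hc
    have := (eu_int (hg_coeff h.hg_ct h.ct_ne hd) (fun h1 => h0 (by rw [h1, zero_smul]))).1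
    exact ⟨by omega, fun _ => rfl⟩
  · have := h.low y hy d c hc hd h0
    exact ⟨this.le, by omega⟩

lemma length_le' (h : Good x X ct cb) {y : W} {c : X} (hc : c ∈ X.Ga y) (h0 : c ≠ 0) :
    cs.length y ≤ cs.length x := by
  by_cases hy : y = x
  · rw [hy]
  · by_contra hl
    exact h0 (h.zero y hy (by omega) c hc)

lemma hom_aux (hX : Good x X ct cb) (hZ : Good z Z zt zb) {k : ℤ} {f : X →ₗ[R] Z} {g : Z →ₗ[R] X}
    (hf : IsHom k f) (hfg : IsAdj f g) (hk : k ≤ 0) (hf0 : f ≠ 0) : k = 0 ∧ x = z ∧ g zt ≠ 0 := by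
  have hg : IsHom k g := hf.adj hfg
  have hg0 : ∃ y, ∃ c ∈ Z.Ga y, g c ≠ 0 := by
    by_contra! hc
    obtain ⟨S, Δ, h0, h1⟩ := hZ.nice.sep
    apply hf0
    rw [hfg.zero_iff]
    ext m
    refine smul_eq_zero' (r := Δ) ?_ h0
    have h2 : (⨆ y ∈ S, Z.Ga y) ≤ LinearMap.ker g := iSup₂_le fun y _ c hcc => hc y c hcc
    rw [← map_smul]; exact h2 (h1 m)
  have hb : ∀ y, (∃ c ∈ Z.Ga y, g c ≠ 0) → cs.length y ≤ cs.length x := fun y ⟨c, hc, h0⟩ =>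
    hX.length_le' (hg.map_Ga hc) h0
  obtain ⟨y, ⟨c', hc', hgc'⟩, hmax⟩ : ∃ y, (∃ c ∈ Z.Ga y, g c ≠ 0) ∧
      ∀ y', (∃ c ∈ Z.Ga y', g c ≠ 0) → cs.length y' ≤ cs.length y := by
    let Q : ℕ → Prop := fun n => ∃ y, (∃ c ∈ Z.Ga y, g c ≠ 0) ∧ cs.length y = n
    classical
    obtain ⟨y0, hy0⟩ := hg0
    have h1 := Nat.findGreatest_spec (P := Q) (hb y0 hy0) ⟨y0, hy0, rfl⟩
    obtain ⟨y, hy, hl⟩ := h1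
    refine ⟨y, hy, fun y' hy' => ?_⟩
    rw [hl]
    exact Nat.le_findGreatest (hb y' hy') ⟨y', hy', rfl⟩
  obtain ⟨c, hc, hgc⟩ : ∃ c ∈ Z.Ga y, g c ≠ 0 := ⟨c', hc', hgc'⟩
  obtain ⟨ι, _, d, cc, n, h1, h2⟩ := hX.nice.db y
  have h3 := h2 _ (hg.map_Ga hc)
  obtain ⟨j, hj⟩ : ∃ j, X.form (g c) (n j) • cc j ≠ 0 := by
    by_contra! hcon
    exact hgc (by rw [h3]; exact Finset.sum_eq_zero fun j _ => hcon j)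
  have hcj : cc j ≠ 0 := fun h => hj (by rw [h, smul_zero])
  have hfj : X.form (g c) (n j) ≠ 0 := fun h => hj (by rw [h, zero_smul])
  have hdj := hX.length_le (h1 j).1 (h1 j).2.1 hcj
  have hm : Z.Hg (-d j + k) (f (n j)) := hf.hg (h1 j).2.2
  have hadj : ∀ e, Z.form e (f (n j)) = X.form (g e) (n j) := fun e => by
    rw [Z.form_symm, hfg, X.form_symm]
  obtain ⟨δ, k', C, hk', hδ, hC, hCd, hCf⟩ := hZ.nice.exists_proj (y := y) hm (fun y' hy' e he => by
    rw [hadj]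
    have : g e = 0 := by
      by_contra h0
      have := hmax y' ⟨e, he, h0⟩
      omega
    rw [this, map_zero, LinearMap.zero_apply])
  have hC0 : C ≠ 0 := fun h => by
    have := hCf c hc
    rw [h, map_zero, hadj] at this
    exact mul_ne_zero hδ hfj this.symm
  have h4 := hZ.length_le hC hCd hC0
  have hyx : y = x := hdj.2 (by omega)
  have hyz : y = z := h4.2 (by omega)
  subst hyx
  subst hyz
  refine ⟨by omega, rfl, fun h0 => ?_⟩
  obtain ⟨r, rfl⟩ := hZ.gen c hc
  exact hgc (by rw [map_smul, h0, smul_zero])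

lemma hom_neg (hX : Good x X ct cb) (hZ : Good z Z zt zb) {k : ℤ} {f : X →ₗ[R] Z}
    (hf : IsHom k f) (hk : k < 0) : f = 0 := by
  obtain ⟨g, hg⟩ := exists_adj f
  by_contra h0
  have := (hX.hom_aux hZ hf hg hk.le h0).1
  omega

lemma hom_ne (hX : Good x X ct cb) (hZ : Good z Z zt zb) {f : X →ₗ[R] Z}
    (hf : IsHom 0 f) (hxz : x ≠ z) : f = 0 := by
  obtain ⟨g, hg⟩ := exists_adj f
  by_contra h0
  exact hxz (hX.hom_aux hZ hf hg le_rfl h0).2.1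

lemma exists_scalar (hX : Good x X ct cb) (hZ : Good x Z zt zb) {g : Z →ₗ[R] X} (hg : IsHom 0 g) :
    ∃ a : ℝ, g zt = a • ct := by
  obtain ⟨r, hr⟩ := hX.gen _ (hg.map_Ga hZ.mem)
  have h1 : X.Hg (cs.length x) (r • ct) := by rw [← hr]; exact hg.hg0 hZ.hg_ct
  have h2 := hg_coeff hX.hg_ct hX.ct_ne h1
  rw [sub_self, zero_smul] at h2
  refine ⟨G.ε r, ?_⟩
  rw [hr]
  conv_lhs => rw [G.eu_const r h2]
  rfl

lemma hom_scalar (hX : Good x X ct cb) {f : X →ₗ[R] X} (hf : IsHom 0 f) :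
    ∃ a : ℝ, ∀ m, f m = a • m := by
  obtain ⟨g, hg⟩ := exists_adj f
  obtain ⟨a, ha⟩ := hX.exists_scalar hX (hf.adj hg)
  refine ⟨a, fun m => ?_⟩
  have h1 : f - a • LinearMap.id = 0 := by
    by_contra h0
    refine (hX.hom_aux hX (hf.sub (IsHom.id.smul a)) (hg.sub (IsAdj.id.smul a)) le_rfl h0).2.2 ?_
    simp [ha]
  have := congrArg (fun F => F m) h1
  simpa [sub_eq_zero] using this

end Good

end SObj

end KLPos

namespace KLPos

variable {B W : Type} [Group W] {M : CoxeterMatrix B} {cs : CoxeterSystem M W}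
  {R : Type} [CommRing R] [Algebra ℝ R]

namespace SObj

variable {G : Realization cs R} [IsDomain R] {X Y Z : SObj G} {y : W} {i : B}

/-- Stalk elements at `u` of nice objects are represented by maps to `X`. -/
def LL (X : SObj G) (u : W) (ct : X) : Prop :=
  ∀ (Z : SObj G), Z.Nice → ∀ c ∈ Z.Ga u, ∀ d : ℤ, Z.Hg d c →
    ∃ F : Z →ₗ[R] X, IsHom (d - cs.length u) F ∧ ∀ b, X.form ct (F b) = Z.form c b

lemma LL_unit : LL (unit G) 1 (1 : R) := by
  intro Z _ c hc d hd
  refine ⟨(Z.form c : Z →ₗ[R] R), ⟨fun r m => ?_, fun m => ?_⟩, fun b => one_mul (M := R) _⟩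
  · have h1 : Z.form c (Z.l r m) = r * Z.form c m := by
      rw [← Z.form_l, hc, inv_one, G.act_one, map_smul]; rfl
    exact h1
  · have h1 := Z.form_D c m
    rw [hd, map_zsmul, LinearMap.smul_apply] at h1
    rw [cs.length_one, Nat.cast_zero, sub_zero]
    refine h1.symm.trans ?_
    rw [add_comm]; rfl

lemma av_av (r : R) : G.av i (G.av i r) = G.av i r := G.av_of_inv (G.sa_av i r)
lemma hd_av (r : R) : G.hd i (G.av i r) = 0 := G.hd_of_inv (G.sa_av i r)
lemma av_hd (r : R) : G.av i (G.hd i r) = G.hd i r := G.av_of_inv (G.sa_hd i r)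
lemma hd_hd (r : R) : G.hd i (G.hd i r) = 0 := G.hd_of_inv (G.sa_hd i r)

lemma sa_hd_mul_sq (r : R) : G.sa i (G.hd i r * G.α i ^ 2) = G.hd i r * G.α i ^ 2 := by
  rw [map_mul, map_pow, G.sa_hd, G.sa_α, neg_sq]

lemma av_hd_mul_sq (r : R) : G.av i (G.hd i r * G.α i ^ 2) = G.hd i r * G.α i ^ 2 :=
  G.av_of_inv (sa_hd_mul_sq r)
lemma hd_hd_mul_sq (r : R) : G.hd i (G.hd i r * G.α i ^ 2) = 0 := G.hd_of_inv (sa_hd_mul_sq r)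

/-- The map `Z → X.ind i` attached to a map `Z.ind i → X`. -/
noncomputable def mate (f : Z.ind i →ₗ[R] X) : Z →ₗ[R] X.ind i where
  toFun b := tm i (f (tm i (G.α i • b) 0)) (f (tm i b 0))
  map_add' b b' := ind_ext
    (by rw [map_add, fs_tm, fs_tm, fs_tm, ← map_add f]; congr 1; exact ind_ext (by simp) (by simp))
    (by rw [map_add, sn_tm, sn_tm, sn_tm, ← map_add f]; congr 1; exact ind_ext (by simp) (by simp))
  map_smul' r b := ind_ext
    (by
      simp only [fs_tm, sn_tm, fs_smul, ← map_smul f, ← map_add f, RingHom.id_apply]; congr 1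
      refine ind_ext ?_ ?_
      · conv_lhs => rw [← G.av_add_hd i r]
        simp [av_av, hd_av, av_hd_mul_sq, hd_hd_mul_sq]; module
      · simp [av_av, hd_av, av_hd_mul_sq, hd_hd_mul_sq])
    (by
      simp only [fs_tm, sn_tm, sn_smul, ← map_smul f, ← map_add f, RingHom.id_apply]; congr 1
      refine ind_ext ?_ ?_
      · conv_lhs => rw [← G.av_add_hd i r]
        simp [av_av, av_hd, hd_av, hd_hd]; module
      · simp [av_av, av_hd, hd_av, hd_hd])

lemma fs_mate (f : Z.ind i →ₗ[R] X) (b : Z) : fs (mate f b) = f (tm i (G.α i • b) 0) := rfl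
lemma sn_mate (f : Z.ind i →ₗ[R] X) (b : Z) : sn (mate f b) = f (tm i b 0) := rfl

lemma IsHom.mate {f : Z.ind i →ₗ[R] X} {k : ℤ} (h : IsHom k f) : IsHom k (mate f) where
  map_l r m := ind_ext
    (by rw [fs_mate, fs_l, fs_mate, ← h.map_l]; congr 1; exact ind_ext (by simp) (by simp))
    (by rw [sn_mate, sn_l, sn_mate, ← h.map_l]; congr 1; exact ind_ext (by simp) (by simp))
  map_D m := ind_ext
    (by
      rw [fs_D, map_add, map_zsmul, fs_mate, fs_mate, h.map_D, add_sub_right_comm, ← map_sub]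
      congr 2
      exact ind_ext (by simp [Z.D_smul, G.eu_α]; module) (by simp))
    (by
      rw [sn_D, map_add, map_zsmul, sn_mate, sn_mate, h.map_D, add_right_comm, ← map_add]
      congr 2
      exact ind_ext (by simp) (by simp))

lemma form_Jn_upper {c : X} (hc : c ∈ X.Ga y) (m : X.ind i) :
    (X.ind i).form (Jn i (y * cs.simple i) c) m =
      -2 * G.sa i (X.form c (fs m) - G.α i * X.form c (sn m)) := by
  have h1 : X.l (G.act (y * cs.simple i) (G.α i)) c = - G.α i • c := by
    rw [G.act_mul_simple, hc, G.act_inv_act, G.sa_α]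
  rw [Jn, h1]
  simp only [form_ind, fs_tm, sn_tm, map_smul, LinearMap.smul_apply, smul_eq_mul, dm_eq, map_add,
    neg_mul, map_neg, neg_smul, LinearMap.neg_apply, map_sub, map_mul, G.sa_α]
  have e1 := G.av_sub_hd i (X.form c (fs m))
  have e2 := G.av_sub_hd i (X.form c (sn m))
  have e3 : ∀ r, G.hd i (G.α i * r) = G.av i r := fun r => by rw [mul_comm, G.hd_mul_α]
  rw [← e1, ← e2, e3, e3]
  ring

lemma LL.ind {ct : X} (h : LL X y ct) (hct : ct ∈ X.Ga y)
    (hy : cs.length y < cs.length (y * cs.simple i)) :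
    LL (X.ind i) (y * cs.simple i) (Jn i (y * cs.simple i) ct) := by
  intro Z hZ c hc d hd
  obtain ⟨n, hn, hnc, hnd⟩ := hZ.exists_lift hy hc hd
  obtain ⟨F, hF, hFf⟩ := h (Z.ind i) (hZ.ind i) _ (Jn_mem hn) _ (hnd.Jn i y)
  refine ⟨(1 / 4 : ℝ) • mate F, ?_, fun b => ?_⟩
  · have h1 := hF.mate.smul (1 / 4 : ℝ)
    have h2 : cs.length (y * cs.simple i) = cs.length y + 1 := by
      rcases cs.length_mul_simple y i with h | h <;> omega
    rw [h2]
    convert h1 using 1; push_cast; ring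
  · have e : tm i (G.α i • b) 0 - G.α i • tm i b 0 = th (io Z i b) :=
      ind_ext (by simp) (by simp)
    rw [LinearMap.smul_apply, LinearMap.map_smul_of_tower, form_Jn_upper hct, fs_mate, sn_mate, hFf,
      hFf, ← smul_eq_mul (G.α i), ← map_smul, ← map_sub, e, form_Jn_th, hnc]
    rw [map_mul, G.sa_sa, map_neg, map_ofNat, Algebra.smul_def, ← mul_assoc, ← mul_assoc]
    have : (algebraMap ℝ R (1 / 4)) * -2 * -2 = 1 := by
      rw [← map_ofNat (algebraMap ℝ R) 2, ← map_neg, ← map_mul, ← map_mul]; norm_num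
    rw [this, one_mul]

lemma LL.retract {E : SObj G} {ct : X} (h : LL X y ct) (T : Retract E X) {ce : E}
    (hce : T.inc ce = ct) : LL E y ce := by
  intro Z hZ c hc d hd
  obtain ⟨F, hF, hFf⟩ := h Z hZ c hc d hd
  refine ⟨T.pro ∘ₗ F, by simpa using hF.comp T.isHom_pro, fun b => ?_⟩
  rw [LinearMap.comp_apply, ← T.adj, hce, hFf]

end SObj

end KLPos

namespace KLPos

/-- A psd nondegenerate form is positive definite. -/
lemma pos_of_nonneg_of_nondeg {V : Type} [AddCommGroup V] [Module ℝ V] {S : V →ₗ[ℝ] V →ₗ[ℝ] ℝ}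
    (hs : ∀ x y, S x y = S y x) (h0 : ∀ x, 0 ≤ S x x) (hn : ∀ x, (∀ y, S x y = 0) → x = 0) {x : V}
    (hx : x ≠ 0) : 0 < S x x := by
  refine lt_of_le_of_ne (h0 x) fun h => hx (hn x fun y => ?_)
  by_contra hxy
  have h1 := h0 (y + (-(S y y + 1) / (2 * S x y)) • x)
  have h2 : -(S y y + 1) / (2 * S x y) * S x y = -(S y y + 1) / 2 := by field_simp
  simp only [map_add, map_smul, LinearMap.add_apply, LinearMap.smul_apply, smul_eq_mul, ← h,
    hs y x, h2] at h1
  linarith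

lemma posdef_path {V : Type} [AddCommGroup V] [Module ℝ V] [FiniteDimensional ℝ V]
    (S : ℝ → V →ₗ[ℝ] V →ₗ[ℝ] ℝ) (hc : ∀ x y, Continuous fun t => S t x y)
    (hs : ∀ t x y, S t x y = S t y x)
    (hn : ∀ t ∈ Set.Icc (0 : ℝ) 1, ∀ x, (∀ y, S t x y = 0) → x = 0)
    (h0 : ∀ x, x ≠ 0 → 0 < S 0 x x) : ∀ t ∈ Set.Icc (0 : ℝ) 1, ∀ x, x ≠ 0 → 0 < S t x x := by
  set A : Set ℝ := {t | ∀ x, 0 ≤ S t x x} with hA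
  have hAc : IsClosed A := by
    rw [hA, show {t | ∀ x, 0 ≤ S t x x} = ⋂ x, {t | 0 ≤ S t x x} by ext; simp]
    exact isClosed_iInter fun x => isClosed_le continuous_const (hc x x)
  have hpd : ∀ t ∈ A ∩ Set.Icc (0 : ℝ) 1, ∀ x, x ≠ 0 → 0 < S t x x := fun t ht x hx =>
    pos_of_nonneg_of_nondeg (hs t) ht.1 (hn t ht.2) hx
  let b := Module.finBasis ℝ V
  have hf : ∀ t (c : Fin (Module.finrank ℝ V) → ℝ), S t (b.equivFun.symm c) (b.equivFun.symm c) =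
      ∑ k, ∑ l, c k * (c l * S t (b k) (b l)) := fun t c => by
    simp only [Module.Basis.equivFun_symm_apply, map_sum, map_smul, LinearMap.sum_apply,
      LinearMap.smul_apply, smul_eq_mul]
    refine Finset.sum_congr rfl fun k _ => ?_
    rw [Finset.mul_sum]
    exact Finset.sum_congr rfl fun l _ => by rw [hs]
  have hcont : Continuous fun p : ℝ × (Fin (Module.finrank ℝ V) → ℝ) =>
      S p.1 (b.equivFun.symm p.2) (b.equivFun.symm p.2) := by
    simp only [hf]
    refine continuous_finsetSum _ fun k _ => continuous_finsetSum _ fun l _ => ?_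
    have := (hc (b k) (b l)).comp (continuous_fst (X := ℝ) (Y := Fin (Module.finrank ℝ V) → ℝ))
    exact ((continuous_apply k).comp continuous_snd).mul
      (((continuous_apply l).comp continuous_snd).mul this)
  have hsub : Set.Icc (0 : ℝ) 1 ⊆ A := by
    refine IsClosed.Icc_subset_of_forall_exists_gt (hAc.inter isClosed_Icc) ?_ ?_
    · intro x
      by_cases hx : x = 0
      · simp [hx]
      · exact (h0 x hx).le
    · rintro t ⟨ht, ht'⟩ y hy
      have hpos := hpd t ⟨ht, Set.Ico_subset_Icc_self ht'⟩
      have hev : ∀ᶠ t' in nhds t, ∀ c ∈ Metric.sphere (0 : Fin (Module.finrank ℝ V) → ℝ) 1,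
          0 < S t' (b.equivFun.symm c) (b.equivFun.symm c) := by
        refine (isCompact_sphere _ _).eventually_forall_of_forall_eventually fun c hc => ?_
        have h1 : 0 < S t (b.equivFun.symm c) (b.equivFun.symm c) := by
          refine hpos _ fun h => ?_
          rw [LinearEquiv.map_eq_zero_iff] at h
          rw [h] at hc
          simp at hc
        exact hcont.continuousAt.eventually (lt_mem_nhds h1)
      have h2 : ∀ᶠ t' in nhdsWithin t (Set.Ioi t), t' ∈ A := by
        refine Filter.Eventually.filter_mono nhdsWithin_le_nhds (hev.mono fun t' h x => ?_)
        set c := b.equivFun x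
        by_cases hx : c = 0
        · have : x = 0 := by simpa [c] using hx
          simp [this]
        · have h3 := h (‖c‖⁻¹ • c) (by
            rw [mem_sphere_zero_iff_norm, norm_smul, norm_inv, norm_norm,
              inv_mul_cancel₀ (norm_ne_zero_iff.2 hx)])
          rw [map_smul, LinearEquiv.symm_apply_apply, map_smul, map_smul, LinearMap.smul_apply,
            smul_smul, smul_eq_mul] at h3
          exact (pos_of_mul_pos_right h3 (mul_self_nonneg _)).le
      have h3 : ∀ᶠ t' in nhdsWithin t (Set.Ioi t), t' ∈ Set.Ioc t y := Ioc_mem_nhdsGT hy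
      obtain ⟨t', h4, h5⟩ := (h2.and h3).exists
      exact ⟨t', h4, h5⟩
  exact fun t ht => hpd t ⟨hsub ht, ht⟩

/-- Positivity on the orthogonal of a moving nondegenerate subspace is preserved along paths. -/
lemma posdef_path_orth {V U : Type} [AddCommGroup V] [Module ℝ V] [FiniteDimensional ℝ V]
    [AddCommGroup U] [Module ℝ U] [FiniteDimensional ℝ U]
    (S : ℝ → V →ₗ[ℝ] V →ₗ[ℝ] ℝ) (c : ℝ → V →ₗ[ℝ] U →ₗ[ℝ] ℝ) (g : ℝ → U →ₗ[ℝ] U →ₗ[ℝ] ℝ)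
    (hS : ∀ x y, Continuous fun t => S t x y) (hc : ∀ x y, Continuous fun t => c t x y)
    (hg : ∀ x y, Continuous fun t => g t x y)
    (hs : ∀ t x y, S t x y = S t y x) (hgs : ∀ t x y, g t x y = g t y x)
    (hn : ∀ t ∈ Set.Icc (0 : ℝ) 1, ∀ x, (∀ y, S t x y = 0) → x = 0)
    (hgn : ∀ t ∈ Set.Icc (0 : ℝ) 1, ∀ x, (∀ y, g t x y = 0) → x = 0)
    (hj : ∀ t u, ∃ x0, (∀ x, S t x x0 = c t x u) ∧ ∀ u', c t x0 u' = g t u u')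
    (h0 : ∀ x, x ≠ 0 → (∀ u, c 0 x u = 0) → 0 < S 0 x x) :
    ∀ t ∈ Set.Icc (0 : ℝ) 1, ∀ x, x ≠ 0 → (∀ u, c t x u = 0) → 0 < S t x x := by
  let e := Module.finBasis ℝ U
  let Gm : ℝ → Matrix (Fin (Module.finrank ℝ U)) (Fin (Module.finrank ℝ U)) ℝ := fun t =>
    Matrix.of fun k l => g t (e k) (e l)
  have hGsymm : ∀ t, (Gm t).transpose = Gm t := fun t => by ext k l; exact hgs t _ _
  have hGc : Continuous Gm := continuous_pi fun k => continuous_pi fun l => hg _ _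
  have hdet : ∀ t ∈ Set.Icc (0 : ℝ) 1, (Gm t).det ≠ 0 := by
    intro t ht hd
    obtain ⟨v, hv, hv'⟩ := Matrix.exists_vecMul_eq_zero_iff.2 hd
    apply hv
    have h1 := hgn t ht (∑ k, v k • e k) fun y => by
      rw [← e.sum_repr y]
      simp only [map_sum, map_smul, LinearMap.sum_apply, LinearMap.smul_apply, smul_eq_mul]
      refine Finset.sum_eq_zero fun l _ => ?_
      have := congrFun hv' l
      simp only [Matrix.vecMul, dotProduct, Gm, Matrix.of_apply, Pi.zero_apply] at this
      rw [this, mul_zero]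
    exact funext fun k => (Fintype.linearIndependent_iff.1 e.linearIndependent v h1 k)
  let T : ℝ → V →ₗ[ℝ] V →ₗ[ℝ] ℝ := fun t => (Gm t).det ^ 2 • S t
    - (Gm t).det • ∑ k, ∑ l, (Gm t).adjugate k l •
      (LinearMap.mul ℝ ℝ).compl₁₂ ((c t).flip (e l)) ((c t).flip (e k))
    + ∑ k, (LinearMap.mul ℝ ℝ).compl₁₂ ((c t).flip (e k)) ((c t).flip (e k))
  have hT : ∀ t x y, T t x y = (Gm t).det ^ 2 * S t x y
    - (Gm t).det * ∑ k, ∑ l, (Gm t).adjugate k l * (c t x (e l) * c t y (e k))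
    + ∑ k, c t x (e k) * c t y (e k) := fun t x y => by
    simp [T, LinearMap.sum_apply]
  have hadj : ∀ t k l, (Gm t).adjugate k l = (Gm t).adjugate l k := fun t k l => by
    rw [← Matrix.transpose_apply (Gm t).adjugate, Matrix.adjugate_transpose, hGsymm]
  have key : ∀ t x, ∃ z u, (∀ u', c t z u' = 0) ∧
      (∀ y, S t z y = (Gm t).det * S t x y - c t y u) ∧
      u = ∑ k, (∑ l, (Gm t).adjugate k l * c t x (e l)) • e k ∧
      (∀ y, (∀ u', c t y u' = 0) → S t z y = (Gm t).det * S t x y) ∧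
      T t x x = S t z z + ∑ k, c t x (e k) * c t x (e k) ∧
      (∀ y, (∀ u', c t y u' = 0) → T t x y = (Gm t).det * S t z y) ∧
      ∃ x0, z = (Gm t).det • x - x0 ∧ ∀ y, S t y x0 = c t y u := by
    intro t x
    set u := ∑ k, (∑ l, (Gm t).adjugate k l * c t x (e l)) • e k with hu
    obtain ⟨x0, hx0, hx0'⟩ := hj t u
    have hcz : ∀ u', c t ((Gm t).det • x - x0) u' = 0 := by
      intro u'
      rw [← e.sum_repr u', map_sum]
      refine Finset.sum_eq_zero fun m _ => ?_
      rw [map_smul, map_sub, map_smul, LinearMap.sub_apply, LinearMap.smul_apply, hx0', hu]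
      simp only [map_sum, map_smul, LinearMap.sum_apply, LinearMap.smul_apply, smul_eq_mul]
      have h1 : ∑ k, (∑ l, (Gm t).adjugate k l * c t x (e l)) * g t (e k) (e m) =
          (Gm t).det * c t x (e m) := by
        have h2 := congrFun (congrArg (fun A => A.mulVec (fun l => c t x (e l)))
          (Matrix.mul_adjugate (Gm t))) m
        simp only [← Matrix.mulVec_mulVec, Matrix.smul_mulVec, Matrix.one_mulVec, Pi.smul_apply,
          smul_eq_mul] at h2
        rw [← h2]
        simp only [Matrix.mulVec, dotProduct]
        refine Finset.sum_congr rfl fun k _ => ?_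
        rw [mul_comm, hgs]; rfl
      rw [h1, sub_self, mul_zero]
    have hz : ∀ y, S t ((Gm t).det • x - x0) y = (Gm t).det * S t x y - c t y u := fun y => by
      rw [map_sub, LinearMap.sub_apply, map_smul, LinearMap.smul_apply, hs t x0 y, hx0, smul_eq_mul]
    have hcu : ∀ y, c t y u = ∑ k, ∑ l, (Gm t).adjugate k l * (c t x (e l) * c t y (e k)) := fun y => by
      rw [hu, map_sum]
      refine Finset.sum_congr rfl fun k _ => ?_
      rw [map_smul, smul_eq_mul, Finset.sum_mul]
      exact Finset.sum_congr rfl fun l _ => mul_assoc _ _ _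
    refine ⟨(Gm t).det • x - x0, u, hcz, hz, rfl, fun y hy => by rw [hz, hy, sub_zero], ?_,
      fun y hy => ?_, x0, rfl, hx0⟩
    · have h3 : S t ((Gm t).det • x - x0) ((Gm t).det • x - x0) =
          (Gm t).det * S t ((Gm t).det • x - x0) x := by
        conv_lhs => rw [map_sub, map_smul, hx0, hcz]
        simp
      rw [hT, h3, hz, hcu]; ring
    · rw [hT, hz, hy, sub_zero]
      simp only [hy, mul_zero, Finset.sum_const_zero]; ring
  have fin : ∀ t ∈ Set.Icc (0 : ℝ) 1, ∀ x z u x0, u = ∑ k, (∑ l, (Gm t).adjugate k l * c t x (e l)) • e k →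
      z = (Gm t).det • x - x0 → (∀ y, S t y x0 = c t y u) → z = 0 →
      ∑ k, c t x (e k) * c t x (e k) = 0 → x = 0 := by
    intro t ht x z u x0 hu hz hx0 hz0 hsum
    have h1 : ∀ k, c t x (e k) = 0 := fun k => by
      have := (Finset.sum_eq_zero_iff_of_nonneg (fun k _ => mul_self_nonneg (c t x (e k)))).1 hsum k
        (Finset.mem_univ _)
      exact mul_self_eq_zero.1 this
    have h2 : u = 0 := by simp [hu, h1]
    have h3 : x0 = 0 := hn t ht x0 fun y => by rw [hs, hx0, h2, map_zero]
    rw [hz0, h3, sub_zero] at hz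
    exact (smul_eq_zero.1 hz.symm).resolve_left (hdet t ht)
  have hTs : ∀ t x y, T t x y = T t y x := fun t x y => by
    rw [hT, hT, hs t x y, Finset.sum_comm]
    congr 1
    · congr 2
      refine Finset.sum_congr rfl fun k _ => Finset.sum_congr rfl fun l _ => ?_
      rw [hadj]; ring
    · exact Finset.sum_congr rfl fun k _ => mul_comm _ _
  have hTc : ∀ x y, Continuous fun t => T t x y := fun x y => by
    simp only [hT]
    have h1 := hGc.matrix_det
    have h2 : ∀ k l, Continuous fun t => (Gm t).adjugate k l := fun k l =>
      hGc.matrix_adjugate.matrix_elem k l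
    refine (((h1.pow 2).mul (hS x y)).sub (h1.mul (continuous_finsetSum _ fun k _ =>
      continuous_finsetSum _ fun l _ => (h2 k l).mul ((hc _ _).mul (hc _ _))))).add
      (continuous_finsetSum _ fun k _ => (hc _ _).mul (hc _ _))
  intro t ht x hx hxc
  have hpos := posdef_path T hTc hTs (fun t ht x hx => by
    obtain ⟨z, u, hcz, -, hu, -, hTx, hTy, x0, hzx, hx0⟩ := key t x
    have hP : ∀ y, (∀ u', c t y u' = 0) → S t z y = 0 := fun y hy => by
      have h1 := hTy y hy
      rw [hx] at h1
      exact (mul_eq_zero.1 h1.symm).resolve_left (hdet t ht)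
    have hz0 : z = 0 := hn t ht z fun y => by
      obtain ⟨zy, uy, hczy, -, -, -, -, -, y0, hzy, hy0⟩ := key t y
      have h1 : (Gm t).det * S t z y = 0 := by
        rw [← smul_eq_mul, ← map_smul, ← sub_add_cancel ((Gm t).det • y) y0, ← hzy, map_add, hP _ hczy,
          hy0, hcz, zero_add]
      exact (mul_eq_zero.1 h1).resolve_left (hdet t ht)
    rw [hx, hz0, map_zero, zero_add] at hTx
    exact fin t ht x z u x0 hu hzx hx0 hz0 hTx.symm) (fun x hx => by
    obtain ⟨z, u, hcz, -, hu, -, hTx, hTy, x0, hzx, hx0⟩ := key 0 x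
    have hnn : 0 ≤ ∑ k, c 0 x (e k) * c 0 x (e k) := Finset.sum_nonneg fun k _ => mul_self_nonneg _
    rw [hTx]
    by_cases hz : z = 0
    · refine lt_of_le_of_ne ?_ fun h => hx ?_
      · rw [hz, map_zero, zero_add]; exact hnn
      · rw [hz, map_zero, zero_add] at h
        exact fin 0 ⟨le_rfl, zero_le_one⟩ x z u x0 hu hzx hx0 hz h.symm
    · exact add_pos_of_pos_of_nonneg (h0 z hz hcz) hnn) t ht x hx
  rw [hT] at hpos
  simp only [hxc, mul_zero, Finset.sum_const_zero, sub_zero, add_zero] at hpos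
  exact pos_of_mul_pos_right hpos (sq_nonneg _)

end KLPos

namespace KLPos

/-- The sign `(-1)^(n/2)` for even `n`, and `0` for odd `n`. -/
noncomputable def sg (n : ℤ) : ℝ := if n % 4 = 0 then 1 else if n % 4 = 2 then -1 else 0

lemma sg_add_two (n : ℤ) : sg (n + 2) = -sg n := by
  unfold sg
  have h1 : (n + 2) % 4 = 0 ↔ n % 4 = 2 := by omega
  have h2 : (n + 2) % 4 = 2 ↔ n % 4 = 0 := by omega
  simp only [h1, h2]
  by_cases h : n % 4 = 0 <;> by_cases h' : n % 4 = 2 <;> simp [h, h']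

lemma sg_zero : sg 0 = 1 := by simp [sg]

lemma sg_cases (n : ℤ) : sg n = 0 ∨ sg n = 1 ∨ sg n = -1 := by
  unfold sg
  split_ifs <;> simp

section
variable {V : Type} [AddCommGroup V] [Module ℝ V]

/-- A graded space with a nondegenerate graded form and a self-adjoint operator of degree two. -/
structure Lef (D L : V →ₗ[ℝ] V) (Q : V →ₗ[ℝ] V →ₗ[ℝ] ℝ) : Prop where
  symm : ∀ x y, Q x y = Q y x
  nondeg : ∀ x, (∀ y, Q x y = 0) → x = 0
  skew : ∀ x y, Q (D x) y + Q x (D y) = 0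
  adj : ∀ x y, Q (L x) y = Q x (L y)
  deg : ∀ x, D (L x) = L (D x) + (2 : ℤ) • L x
  span : Submodule.span ℝ {x | ∃ d : ℤ, D x = d • x} = ⊤

/-- The Hodge-Riemann relations, normalized by the index `l`. -/
def HR (D L : V →ₗ[ℝ] V) (Q : V →ₗ[ℝ] V →ₗ[ℝ] ℝ) (l : ℤ) : Prop :=
  ∀ (i : ℕ) (x : V), D x = (-(i : ℤ)) • x → x ≠ 0 → (L ^ (i + 1)) x = 0 →
    0 < sg (l - i) * Q ((L ^ i) x) x

/-- The hard Lefschetz property. -/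
def HL (D L : V →ₗ[ℝ] V) : Prop :=
  ∀ (i : ℕ) (x : V), D x = (-(i : ℤ)) • x → (L ^ i) x = 0 → x = 0

lemma HR.hl {D L : V →ₗ[ℝ] V} {Q : V →ₗ[ℝ] V →ₗ[ℝ] ℝ} {l : ℤ} (h : HR D L Q l) : HL D L := by
  intro i x hx h0
  by_contra hne
  have := h i x hx hne (by rw [pow_succ', Module.End.mul_apply, h0, map_zero])
  rw [h0, map_zero, LinearMap.zero_apply, mul_zero] at this
  exact lt_irrefl _ this

lemma HR.transfer {V' : Type} [AddCommGroup V'] [Module ℝ V'] {D L : V →ₗ[ℝ] V}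
    {Q : V →ₗ[ℝ] V →ₗ[ℝ] ℝ} {D' L' : V' →ₗ[ℝ] V'} {Q' : V' →ₗ[ℝ] V' →ₗ[ℝ] ℝ} {l : ℤ}
    (h : HR D' L' Q' l) (f : V →ₗ[ℝ] V') (hf : Function.Injective f) (hL : ∀ x, f (L x) = L' (f x))
    (hD : ∀ x, f (D x) = D' (f x)) {c : ℝ} (hc : 0 < c) (hQ : ∀ x y, Q' (f x) (f y) = c * Q x y) :
    HR D L Q l := by
  have hp : ∀ i x, f ((L ^ i) x) = (L' ^ i) (f x) := by
    intro i x
    induction i with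
    | zero => rfl
    | succ i ih => rw [pow_succ', pow_succ', Module.End.mul_apply, Module.End.mul_apply, hL, ih]
  intro i x hx h0 h1
  have h2 := h i (f x) (by rw [← hD, hx, map_zsmul]) (fun h => h0 (hf (by rw [h, map_zero])))
    (by rw [← hp, h1, map_zero])
  rw [← hp, hQ] at h2
  exact pos_of_mul_pos_right (by linarith : 0 < c * (sg (l - i) * Q ((L ^ i) x) x)) hc.le

section
variable {D : V →ₗ[ℝ] V} {L : V →ₗ[ℝ] V} {Q : V →ₗ[ℝ] V →ₗ[ℝ] ℝ}

lemma form_eq_zero_of_deg (hskew : ∀ x y, Q (D x) y + Q x (D y) = 0) {a b : ℤ} {x y : V}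
    (hx : D x = a • x) (hy : D y = b • y) (hab : a + b ≠ 0) : Q x y = 0 := by
  have h := hskew x y
  rw [hx, hy, map_zsmul, map_zsmul, LinearMap.smul_apply, ← add_smul, zsmul_eq_mul] at h
  exact (mul_eq_zero.1 h).resolve_left (Int.cast_ne_zero.2 hab)

lemma deg_pow (hdeg : ∀ x, D (L x) = L (D x) + (2 : ℤ) • L x) {d : ℤ} {x : V} (hx : D x = d • x)
    (i : ℕ) : D ((L ^ i) x) = (d + 2 * i) • (L ^ i) x := by
  induction i with
  | zero => simpa using hx
  | succ i ih =>
    rw [pow_succ', Module.End.mul_apply, hdeg, ih, map_zsmul, ← add_smul]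
    congr 1
    push_cast; ring

lemma adj_pow (hadj : ∀ x y, Q (L x) y = Q x (L y)) (i : ℕ) (x y : V) :
    Q ((L ^ i) x) y = Q x ((L ^ i) y) := by
  induction i generalizing x with
  | zero => rfl
  | succ i ih => rw [pow_succ, Module.End.mul_apply, ih, hadj, ← Module.End.mul_apply, ← pow_succ', ← pow_succ]

/-- The Lefschetz form in degree `-i` is nondegenerate. -/
lemma Lef.lform_nondeg (h : Lef D L Q) (hl : HL D L) (i : ℕ) {x : V} (hx : D x = (-(i : ℤ)) • x)
    (h0 : ∀ y, D y = (-(i : ℤ)) • y → Q ((L ^ i) x) y = 0) : x = 0 := by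
  refine hl i x hx (h.nondeg _ fun y => ?_)
  have hy : y ∈ Submodule.span ℝ {x | ∃ d : ℤ, D x = d • x} := by rw [h.span]; trivial
  induction hy using Submodule.span_induction with
  | mem y hy =>
    obtain ⟨d, hd⟩ := hy
    by_cases hdi : d = -i
    · exact h0 y (by rw [hd, hdi])
    · exact form_eq_zero_of_deg h.skew (deg_pow h.deg hx i) hd (by omega)
  | zero => exact map_zero _
  | add y y' _ _ h1 h2 => rw [map_add, h1, h2, add_zero]
  | smul a y _ h1 => rw [map_smul, h1, smul_zero]

end

/-- The Hodge-Riemann relations are preserved along a path of Lefschetz structures. -/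
theorem HR.path [FiniteDimensional ℝ V] {D : V →ₗ[ℝ] V} {L : ℝ → V →ₗ[ℝ] V}
    {Q : ℝ → V →ₗ[ℝ] V →ₗ[ℝ] ℝ} {l : ℤ} (h : ∀ t, Lef D (L t) (Q t))
    (hc : ∀ i x y, Continuous fun t => Q t ((L t ^ i) x) y)
    (hl : ∀ t ∈ Set.Icc (0 : ℝ) 1, HL D (L t)) (h0 : HR D (L 0) (Q 0) l) :
    ∀ t ∈ Set.Icc (0 : ℝ) 1, HR D (L t) (Q t) l := by
  intro t ht i
  let P : ℕ → Submodule ℝ V := fun i => LinearMap.ker (D + (i : ℝ) • LinearMap.id)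
  have hP : ∀ i x, x ∈ P i ↔ D x = (-(i : ℤ)) • x := fun i x => by
    rw [LinearMap.mem_ker, LinearMap.add_apply, LinearMap.smul_apply, LinearMap.id_apply,
      add_eq_zero_iff_eq_neg, neg_smul, natCast_zsmul, Nat.cast_smul_eq_nsmul]
  have main : ∀ s : ℝ, s ≠ 0 → (∀ x, D x = (-(i : ℤ)) • x → x ≠ 0 → (L 0 ^ (i + 1)) x = 0 →
      0 < s * Q 0 ((L 0 ^ i) x) x) → ∀ x, D x = (-(i : ℤ)) • x → x ≠ 0 → (L t ^ (i + 1)) x = 0 →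
      0 < s * Q t ((L t ^ i) x) x := by
    intro s hs hs0
    have hprim : ∀ t ∈ Set.Icc (0 : ℝ) 1, ∀ x : P i, (∀ u : P (i + 2), Q t ((L t ^ (i + 1)) x) u = 0) →
        (L t ^ (i + 1)) (x : V) = 0 := by
      intro t ht x hx
      refine (h t).nondeg _ fun y => ?_
      have hy : y ∈ Submodule.span ℝ {x | ∃ d : ℤ, D x = d • x} := by rw [(h t).span]; trivial
      induction hy using Submodule.span_induction with
      | mem y hy =>
        obtain ⟨d, hd⟩ := hy
        by_cases hdi : d = -(i + 2 : ℕ)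
        · exact hx ⟨y, (hP _ _).2 (by rw [hd, hdi])⟩
        · exact form_eq_zero_of_deg (h t).skew (deg_pow (h t).deg ((hP _ _).1 x.2) (i + 1)) hd
            (by push_cast at hdi ⊢; omega)
      | zero => exact map_zero _
      | add y y' _ _ h1 h2 => rw [map_add, h1, h2, add_zero]
      | smul a y _ h1 => rw [map_smul, h1, smul_zero]
    have hnd : ∀ k, ∀ t ∈ Set.Icc (0 : ℝ) 1, ∀ x : P k,
        (∀ y : P k, s * Q t ((L t ^ k) (x : V)) y = 0) → x = 0 := by
      intro k t ht x hx
      refine Subtype.ext ((h t).lform_nondeg (hl t ht) k ((hP _ _).1 x.2) fun y hy => ?_)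
      exact (mul_eq_zero.1 (hx ⟨y, (hP _ _).2 hy⟩)).resolve_left hs
    have key := posdef_path_orth (V := P i) (U := P (i + 2))
      (fun t => s • (Q t).compl₁₂ ((L t ^ i) ∘ₗ (P i).subtype) (P i).subtype)
      (fun t => s • (Q t).compl₁₂ ((L t ^ (i + 1)) ∘ₗ (P i).subtype) (P (i + 2)).subtype)
      (fun t => s • (Q t).compl₁₂ ((L t ^ (i + 2)) ∘ₗ (P (i + 2)).subtype) (P (i + 2)).subtype)
      (fun x y => continuous_const.mul (hc i x y)) (fun x y => continuous_const.mul (hc (i + 1) x y))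
      (fun x y => continuous_const.mul (hc (i + 2) x y))
      (fun t x y => by
        show s * Q t ((L t ^ i) (x : V)) y = s * Q t ((L t ^ i) (y : V)) x
        rw [adj_pow (h t).adj, (h t).symm])
      (fun t x y => by
        show s * Q t ((L t ^ (i + 2)) (x : V)) y = s * Q t ((L t ^ (i + 2)) (y : V)) x
        rw [adj_pow (h t).adj, (h t).symm])
      (fun t ht x hx => hnd i t ht x hx) (fun t ht x hx => hnd (i + 2) t ht x hx)
      (fun t u => by
        refine ⟨⟨L t u, (hP _ _).2 ?_⟩, fun x => ?_, fun u' => ?_⟩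
        · rw [(h t).deg, (hP _ _).1 u.2, map_zsmul, ← add_smul]
          congr 1
          push_cast; ring
        · show s * Q t ((L t ^ i) (x : V)) (L t u) = s * Q t ((L t ^ (i + 1)) (x : V)) u
          rw [← (h t).adj, pow_succ', Module.End.mul_apply]
        · show s * Q t ((L t ^ (i + 1)) (L t u)) u' = s * Q t ((L t ^ (i + 2)) (u : V)) u'
          rw [pow_succ _ (i + 1), Module.End.mul_apply])
      (fun x hx hxc => hs0 x ((hP _ _).1 x.2) (fun h => hx (Subtype.ext h))
        (hprim 0 ⟨le_rfl, zero_le_one⟩ x fun u => (mul_eq_zero.1 (hxc u)).resolve_left hs))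
    intro x hx hx0 hx1
    refine key t ht ⟨x, (hP _ _).2 hx⟩ (fun h => hx0 (congrArg Subtype.val h)) fun u => ?_
    show s * Q t ((L t ^ (i + 1)) x) u = 0
    rw [hx1, map_zero, LinearMap.zero_apply, mul_zero]
  intro x hx hx0 hx1
  rcases sg_cases (l - i) with hs | hs | hs
  · have hno : ∀ x, D x = (-(i : ℤ)) • x → x ≠ 0 → (L 0 ^ (i + 1)) x = 0 → False :=
      fun x hx hx0 hx1 => by
        have := h0 i x hx hx0 hx1
        rw [hs, zero_mul] at this
        exact lt_irrefl _ this
    have h1 := main 1 one_ne_zero (fun x hx hx0 hx1 => (hno x hx hx0 hx1).elim) x hx hx0 hx1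
    have h2 := main (-1) (by norm_num) (fun x hx hx0 hx1 => (hno x hx hx0 hx1).elim) x hx hx0 hx1
    linarith
  · exact main _ (by rw [hs]; norm_num) (h0 i) x hx hx0 hx1
  · exact main _ (by rw [hs]; norm_num) (h0 i) x hx hx0 hx1

end

section
variable {U : Type} [AddCommGroup U] [Module ℝ U]

/-- The degree operator on `U(1) ⊕ U(-1)`. -/
def prodD (D : U →ₗ[ℝ] U) : U × U →ₗ[ℝ] U × U := (D - LinearMap.id).prodMap (D + LinearMap.id)

/-- The operator `ρ ⊗ 1 + 1 ⊗ x` on `U ⊗ H*(ℙ¹)`. -/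
def prodL (ρ : U →ₗ[ℝ] U) : U × U →ₗ[ℝ] U × U :=
  (ρ ∘ₗ LinearMap.fst ℝ U U).prod (ρ ∘ₗ LinearMap.snd ℝ U U + LinearMap.fst ℝ U U)

/-- The form on `U ⊗ H*(ℙ¹)`. -/
def prodQ (q : U →ₗ[ℝ] U →ₗ[ℝ] ℝ) : U × U →ₗ[ℝ] U × U →ₗ[ℝ] ℝ :=
  (2 : ℝ) • (q.compl₁₂ (LinearMap.fst ℝ U U) (LinearMap.snd ℝ U U) +
    q.compl₁₂ (LinearMap.snd ℝ U U) (LinearMap.fst ℝ U U))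

variable {D ρ : U →ₗ[ℝ] U} {q : U →ₗ[ℝ] U →ₗ[ℝ] ℝ}

lemma prodL_pow (i : ℕ) (u u' : U) :
    ((prodL ρ) ^ i) (u, u') = ((ρ ^ i) u, (ρ ^ i) u' + (i : ℝ) • (ρ ^ (i - 1)) u) := by
  induction i with
  | zero => simp
  | succ i ih =>
    rw [pow_succ', Module.End.mul_apply, ih]
    refine Prod.ext ?_ ?_
    · simp [prodL, pow_succ']
    · simp only [prodL, LinearMap.prod_apply, Function.prod_apply, LinearMap.add_apply, LinearMap.comp_apply, LinearMap.snd_apply,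
        LinearMap.fst_apply, map_add, map_smul, Nat.add_sub_cancel]
      rw [← Module.End.mul_apply, ← pow_succ', ← Module.End.mul_apply, ← pow_succ', add_assoc]
      congr 1
      rcases i with _ | i
      · simp
      · rw [Nat.add_sub_cancel, Nat.cast_succ (i + 1), add_smul, one_smul]

/-- The Hodge-Riemann relations for `U ⊗ H*(ℙ¹)`. -/
theorem HR.prod {l : ℤ} (h : Lef D ρ q) (hr : HR D ρ q l) :
    HR (prodD D) (prodL ρ) (prodQ q) (l + 1) := by
  rintro i ⟨u, u'⟩ hx hx0 hx1
  have hi : (i + 1 : ℝ) ≠ 0 := by positivity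
  obtain ⟨h1, h2⟩ := Prod.ext_iff.1 hx
  have hu : D u = (-(i : ℤ) + 1) • u := by
    have : D u - u = (-(i : ℤ)) • u := h1
    rw [add_smul, one_smul, ← this, sub_add_cancel]
  have hu' : D u' = (-((i + 1 : ℕ) : ℤ)) • u' := by
    have : D u' + u' = (-(i : ℤ)) • u' := h2
    rw [eq_sub_of_add_eq this, Nat.cast_succ, neg_add, add_smul, neg_smul 1, one_smul, sub_eq_add_neg]
  rw [prodL_pow, Prod.mk_eq_zero, Nat.add_sub_cancel] at hx1
  obtain ⟨h3, h4⟩ := hx1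
  set r := (-(i + 1 : ℝ)⁻¹) • u' with hr'
  set p := u - ρ r with hp
  have hur : u' = (-(i + 1 : ℝ)) • r := by
    rw [hr', smul_smul, neg_mul_neg, mul_inv_cancel₀ hi, one_smul]
  have hup : u = p + ρ r := by rw [hp, sub_add_cancel]
  have hDr : D r = (-((i + 1 : ℕ) : ℤ)) • r := by rw [hr', map_smul, hu', smul_comm]
  clear_value p r
  have hDp : D p = (-(i : ℤ) + 1) • p := by
    rw [hp, map_sub, hu, h.deg, hDr, map_zsmul, ← add_smul, smul_sub]
    congr 2
    push_cast; ring
  have hp0 : (ρ ^ i) p = 0 := by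
    have h5 : (i + 1 : ℝ) • (ρ ^ i) p = 0 := by
      rw [← h4, hp, map_sub, smul_sub, hur, map_smul, neg_smul, Nat.cast_succ, sub_eq_neg_add,
        ← Module.End.mul_apply, ← pow_succ]
      
    exact (smul_eq_zero.1 h5).resolve_left hi
  have hr0 : (ρ ^ (i + 2)) r = 0 := by
    rw [hup, map_add, pow_succ', Module.End.mul_apply, hp0, map_zero, zero_add, ← pow_succ',
      ← Module.End.mul_apply, ← pow_succ] at h3
    exact h3
  have hval : prodQ q (((prodL ρ) ^ i) (u, u')) (u, u') =
      2 * (i * q ((ρ ^ (i - 1)) p) p - (i + 2) * q ((ρ ^ (i + 1)) r) r) := by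
    rw [prodL_pow]
    simp only [prodQ, LinearMap.smul_apply, LinearMap.add_apply, LinearMap.compl₁₂_apply,
      LinearMap.fst_apply, LinearMap.snd_apply, smul_eq_mul]
    have e1 : (ρ ^ i) u = (ρ ^ (i + 1)) r := by
      rw [hup, map_add, hp0, zero_add, ← Module.End.mul_apply, ← pow_succ]
    have e2 : q ((ρ ^ i) u') u = q ((ρ ^ (i + 1)) r) u' := by
      rw [adj_pow h.adj, h.symm, e1]
    have e3 : (i : ℝ) * q ((ρ ^ (i - 1)) u) u = i * (q ((ρ ^ (i - 1)) p) p + q ((ρ ^ (i + 1)) r) r) := by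
      rcases i with _ | i
      · simp
      · congr 1
        rw [Nat.add_sub_cancel]
        have e4 : (ρ ^ i) u = (ρ ^ i) p + (ρ ^ (i + 1)) r := by
          rw [hup, map_add, ← Module.End.mul_apply, ← pow_succ]
        have e5 : q ((ρ ^ i) p) (ρ r) = 0 := by
          rw [← h.adj, ← Module.End.mul_apply, ← pow_succ', hp0, map_zero, LinearMap.zero_apply]
        have e6 : q ((ρ ^ (i + 1)) r) p = 0 := by
          rw [adj_pow h.adj, hp0, map_zero]
        rw [e4, map_add, LinearMap.add_apply, hup, map_add, map_add, e5, e6, add_zero, zero_add,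
          ← h.adj, ← Module.End.mul_apply, ← pow_succ' ρ]
    rw [map_add, LinearMap.add_apply, e2, e1, map_smul, LinearMap.smul_apply, smul_eq_mul, e3, hur,
      map_smul, smul_eq_mul]
    ring
  have hpp : p ≠ 0 → 0 < sg (l + 1 - i) * (i * q ((ρ ^ (i - 1)) p) p) := by
    intro hp1
    rcases i with _ | i
    · exact (hp1 hp0).elim
    · have := hr i p (by rw [hDp]; congr 1; push_cast; ring) hp1 hp0
      rw [show l + 1 - ((i + 1 : ℕ) : ℤ) = l - i by push_cast; ring, Nat.add_sub_cancel,
        mul_left_comm]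
      positivity
  have hrr : r ≠ 0 → 0 < sg (l + 1 - i) * (-((i + 2) * q ((ρ ^ (i + 1)) r) r)) := by
    intro hr1
    have := hr (i + 1) r hDr hr1 hr0
    rw [show l + 1 - (i : ℤ) = l - ((i + 1 : ℕ) : ℤ) + 2 by push_cast; ring, sg_add_two,
      neg_mul_neg, mul_left_comm]
    positivity
  rw [hval]
  have hs : sg (l + 1 - i) * (2 * (i * q ((ρ ^ (i - 1)) p) p - (i + 2) * q ((ρ ^ (i + 1)) r) r)) =
      2 * (sg (l + 1 - i) * (i * q ((ρ ^ (i - 1)) p) p) +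
        sg (l + 1 - i) * (-((i + 2) * q ((ρ ^ (i + 1)) r) r))) := by ring
  rw [hs]
  by_cases hp1 : p = 0
  · have hr1 : r ≠ 0 := fun hr1 => hx0 (by rw [hup, hur, hp1, hr1]; simp)
    have := hrr hr1
    rw [hp1, map_zero, mul_zero, mul_zero, zero_add]
    positivity
  · have h5 := hpp hp1
    by_cases hr1 : r = 0
    · rw [hr1, map_zero, mul_zero, neg_zero, mul_zero, add_zero]
      positivity
    · have h6 := hrr hr1
      positivity

end

end KLPos

namespace KLPos

section
variable {V U : Type} [AddCommGroup V] [Module ℝ V] [AddCommGroup U] [Module ℝ U]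

/-- A surjection of graded spaces has a graded section. -/
lemma exists_section {D : V →ₗ[ℝ] V} {D' : U →ₗ[ℝ] U} {π : V →ₗ[ℝ] U}
    (hV : Submodule.span ℝ {x | ∃ d : ℤ, D x = d • x} = ⊤) (hπ : Function.Surjective π)
    (hD : ∀ x, D' (π x) = π (D x) + π x) :
    ∃ a : U →ₗ[ℝ] V, (∀ u, π (a u) = u) ∧ ∀ u, D (a u) = a (D' u) - a u := by
  obtain ⟨b, hb, hspan, hli⟩ := exists_linearIndependent ℝ (Set.image π {x | ∃ d : ℤ, D x = d • x})
  rw [← Submodule.map_span, hV, Submodule.map_top, LinearMap.range_eq_top.2 hπ] at hspan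
  let e : Module.Basis b ℝ U := Module.Basis.mk hli (by rw [Subtype.range_coe, hspan])
  have hl : ∀ u : b, ∃ v, π v = u ∧ ∃ d : ℤ, D v = d • v := fun u => by
    obtain ⟨v, hv, hvu⟩ := hb u.2
    exact ⟨v, hvu, hv⟩
  choose f hf hfd using hl
  have he : ∀ u, e u = u := fun u => Module.Basis.mk_apply _ _ _
  refine ⟨e.constr ℝ f, fun u => ?_, fun u => ?_⟩
  · have : π ∘ₗ e.constr ℝ f = LinearMap.id := e.ext fun u => by
      rw [LinearMap.comp_apply, Module.Basis.constr_basis, hf, LinearMap.id_apply, he]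
    exact LinearMap.congr_fun this u
  · have : D ∘ₗ e.constr ℝ f = e.constr ℝ f ∘ₗ D' - e.constr ℝ f := e.ext fun u => by
      obtain ⟨d, hd⟩ := hfd u
      have h1 : D' (e u) = (d + 1) • e u := by
        rw [he, ← hf u, hD, hd, map_zsmul, add_smul, one_smul]
      rw [LinearMap.sub_apply, LinearMap.comp_apply, LinearMap.comp_apply, h1, map_zsmul,
        Module.Basis.constr_basis, hd, add_smul, one_smul, add_sub_cancel_right]
    exact LinearMap.congr_fun this u

lemma continuous_affine_pow {A C : V →ₗ[ℝ] V} (i : ℕ) (x : V) (φ : V →ₗ[ℝ] ℝ) :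
    Continuous fun t : ℝ => φ (((A + t • C) ^ i) x) := by
  induction i generalizing φ with
  | zero => simpa using continuous_const
  | succ i ih =>
    have h : (fun t : ℝ => φ (((A + t • C) ^ (i + 1)) x)) = fun t =>
        (φ ∘ₗ A) (((A + t • C) ^ i) x) + t * (φ ∘ₗ C) (((A + t • C) ^ i) x) := by
      funext t
      rw [pow_succ', Module.End.mul_apply, LinearMap.add_apply, map_add, LinearMap.smul_apply, map_smul]
      rfl
    rw [h]
    exact (ih _).add (continuous_id.mul (ih _))

/-- An extension of `U(-1)` by `U(1)` satisfying hard Lefschetz for all positive perturbations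
satisfies the Hodge-Riemann relations. -/
theorem HR.of_extension [FiniteDimensional ℝ U] {D L N : V →ₗ[ℝ] V} {Q : V →ₗ[ℝ] V →ₗ[ℝ] ℝ}
    {D' ρ : U →ₗ[ℝ] U} {q : U →ₗ[ℝ] U →ₗ[ℝ] ℝ} {l : ℤ} {π : V →ₗ[ℝ] U} {j : U →ₗ[ℝ] V}
    (hV : Lef D L Q) (hU : Lef D' ρ q) (hr : HR D' ρ q l)
    (hπ : Function.Surjective π) (hj : Function.Injective j)
    (hex : ∀ x, π x = 0 → ∃ u, j u = x) (hπj : ∀ u, π (j u) = 0) (hN : ∀ x, N x = j (π x))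
    (hπL : ∀ x, π (L x) = ρ (π x)) (hjL : ∀ u, L (j u) = j (ρ u))
    (hQ : ∀ u x, Q (j u) x = 2 * q u (π x))
    (hπD : ∀ x, D' (π x) = π (D x) + π x) (hjD : ∀ u, D (j u) = j (D' u) + j u)
    (hl : ∀ ζ : ℝ, 0 ≤ ζ → HL D (L + ζ • N)) {ζ : ℝ} (hζ : 0 ≤ ζ) : HR D (L + ζ • N) Q (l + 1) := by
  obtain ⟨a, haπ, haD⟩ := exists_section hV.span hπ hπD
  have hk : ∀ u, ∃ w, j w = L (a u) - a (ρ u) := fun u => hex _ (by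
    rw [map_sub, hπL, haπ, haπ, sub_self])
  choose k0 hk0 using hk
  let k : U →ₗ[ℝ] U :=
    { toFun := k0
      map_add' := fun u w => hj (by simp only [map_add, hk0]; abel)
      map_smul' := fun r u => hj (by simp only [map_smul, hk0, RingHom.id_apply, smul_sub]) }
  have hk : ∀ u, j (k u) = L (a u) - a (ρ u) := hk0
  have hjj : ∀ u w, Q (j u) (j w) = 0 := fun u w => by rw [hQ, hπj, map_zero, mul_zero]
  let fs := LinearMap.fst ℝ U U
  let sn := LinearMap.snd ℝ U U
  let A : U × U →ₗ[ℝ] U × U := prodL ρ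
  let C : U × U →ₗ[ℝ] U × U := (0 : U × U →ₗ[ℝ] U).prod (k ∘ₗ fs - fs)
  let Lt : ℝ → U × U →ₗ[ℝ] U × U := fun t => A + t • C
  let q' : U × U →ₗ[ℝ] U × U →ₗ[ℝ] ℝ := Q.compl₁₂ (a ∘ₗ fs) (a ∘ₗ fs)
  let Qt : ℝ → U × U →ₗ[ℝ] U × U →ₗ[ℝ] ℝ := fun t => prodQ q + t • q'
  have hLt : ∀ t u w, Lt t (u, w) = (ρ u, ρ w + u + t • (k u - u)) := fun t u w => by
    refine Prod.ext ?_ rfl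
    show ρ u + t • (0 : U) = ρ u
    rw [smul_zero, add_zero]
  have hQt : ∀ t u w u' w', Qt t (u, w) (u', w') = 2 * (q u w' + q w u') + t * Q (a u) (a u') :=
    fun t u w u' w' => rfl
  have hDp : ∀ u w, prodD D' (u, w) = (D' u - u, D' w + w) := fun u w => rfl
  have hkD : ∀ u, D' (k u) = k (D' u) := fun u => hj (by
    have h1 : j (D' (k u)) = D (j (k u)) - j (k u) := by rw [hjD, add_sub_cancel_right]
    rw [h1, hk, hk, map_sub, hV.deg, haD, haD, hU.deg]
    simp only [map_add, map_sub, two_smul]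
    abel)
  have hkq : ∀ u w, 2 * q (k u) w = Q (L (a u)) (a w) - Q (a (ρ u)) (a w) := fun u w => by
    rw [← LinearMap.sub_apply, ← map_sub, ← hk, hQ, haπ]
  have hLef : ∀ t, Lef (prodD D') (Lt t) (Qt t) := fun t => by
    constructor
    · rintro ⟨u, w⟩ ⟨u', w'⟩
      rw [hQt, hQt, hV.symm (a u), hU.symm u w', hU.symm w u', add_comm (q w' u)]
    · rintro ⟨u, w⟩ h
      have hu : u = 0 := hU.nondeg u fun w' => by
        have := h (0, w')
        rw [hQt, map_zero, map_zero, map_zero, add_zero, mul_zero, add_zero] at this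
        linarith
      have hw : w = 0 := hU.nondeg w fun u' => by
        have := h (u', 0)
        rw [hQt, hu, map_zero, map_zero, map_zero, zero_add, LinearMap.zero_apply, mul_zero,
          add_zero] at this
        linarith
      rw [hu, hw]; rfl
    · rintro ⟨u, w⟩ ⟨u', w'⟩
      rw [hDp, hDp, hQt, hQt]
      have h1 := hU.skew u w'
      have h2 := hU.skew w u'
      have h3 := hV.skew (a u) (a u')
      rw [haD, haD, ← map_sub, ← map_sub] at h3
      simp only [map_add, map_sub, LinearMap.add_apply, LinearMap.sub_apply] at h3 ⊢
      linear_combination 2 * h1 + 2 * h2 + t * h3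
    · rintro ⟨u, w⟩ ⟨u', w'⟩
      rw [hLt, hLt, hQt, hQt]
      have h1 := hU.adj u w'
      have h2 := hU.adj w u'
      have h3 := hkq u u'
      have h4 := hkq u' u
      have h5 := hV.adj (a u) (a u')
      have h6 := hV.symm (L (a u')) (a u)
      have h7 := hV.symm (a (ρ u')) (a u)
      have h8 := hU.symm (k u') u
      simp only [map_add, map_sub, map_smul, LinearMap.add_apply, LinearMap.sub_apply,
        LinearMap.smul_apply, smul_eq_mul]
      linear_combination 2 * h1 + 2 * h2 + t * h3 - t * h4 + t * h5 - t * h6 + t * h7 + 2 * t * h8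
    · rintro ⟨u, w⟩
      rw [hLt, hDp, hDp, hLt]
      refine Prod.ext ?_ ?_
      · show D' (ρ u) - ρ u = ρ (D' u - u) + (2 : ℤ) • ρ u
        rw [hU.deg, map_sub, two_smul]; abel
      · show D' (ρ w + u + t • (k u - u)) + (ρ w + u + t • (k u - u)) =
          ρ (D' w + w) + (D' u - u) + t • (k (D' u - u) - (D' u - u)) +
            (2 : ℤ) • (ρ w + u + t • (k u - u))
        simp only [map_add, map_sub, map_smul, hU.deg, hkD, two_smul, smul_sub]
        abel
    · rw [eq_top_iff]
      rintro ⟨u, w⟩ -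
      have h1 : ∀ u : U, u ∈ Submodule.span ℝ {x | ∃ d : ℤ, D' x = d • x} := fun u => by
        rw [hU.span]; trivial
      have h2 : ((u, w) : U × U) = (u, 0) + (0, w) := by simp
      rw [h2]
      refine add_mem ?_ ?_
      · have := Submodule.apply_mem_span_image_of_mem_span (LinearMap.inl ℝ U U) (h1 u)
        refine Submodule.span_mono ?_ this
        rintro _ ⟨x, ⟨d, hd⟩, rfl⟩
        exact ⟨d - 1, by
          show ((D' x - x, D' 0 + 0) : U × U) = ((d - 1) • x, (d - 1) • (0 : U))
          rw [hd, map_zero, add_zero, smul_zero, sub_smul, one_smul]⟩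
      · have := Submodule.apply_mem_span_image_of_mem_span (LinearMap.inr ℝ U U) (h1 w)
        refine Submodule.span_mono ?_ this
        rintro _ ⟨x, ⟨d, hd⟩, rfl⟩
        exact ⟨d + 1, by
          show ((D' 0 - 0, D' x + x) : U × U) = ((d + 1) • (0 : U), (d + 1) • x)
          rw [hd, map_zero, sub_zero, smul_zero, add_smul, one_smul]⟩
  let Φ : ℝ → U × U →ₗ[ℝ] V := fun t => a ∘ₗ fs + t⁻¹ • j ∘ₗ sn
  have hΦ : ∀ t u w, Φ t (u, w) = a u + t⁻¹ • j w := fun t u w => rfl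
  have hΦi : ∀ t, t ≠ 0 → Function.Injective (Φ t) := by
    intro t ht
    rw [injective_iff_map_eq_zero]
    rintro ⟨u, w⟩ h
    rw [hΦ] at h
    have hu : u = 0 := by
      have := congrArg π h
      rwa [map_add, haπ, map_smul, hπj, smul_zero, add_zero, map_zero] at this
    rw [hu, map_zero, zero_add, smul_eq_zero, or_iff_right (inv_ne_zero ht)] at h
    rw [hu, hj (h.trans (map_zero j).symm)]; rfl
  have hΦs : ∀ t, t ≠ 0 → Function.Surjective (Φ t) := by
    intro t ht v
    obtain ⟨w, hw⟩ := hex (v - a (π v)) (by rw [map_sub, haπ, sub_self])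
    refine ⟨(π v, t • w), ?_⟩
    rw [hΦ, map_smul, smul_smul, inv_mul_cancel₀ ht, one_smul, hw, add_sub_cancel]
  have hΦL : ∀ t, t ≠ 0 → ∀ x, Φ t (Lt t x) = (L + ((1 - t) / t) • N) (Φ t x) := by
    rintro t ht ⟨u, w⟩
    rw [hLt, hΦ, hΦ, LinearMap.add_apply, LinearMap.smul_apply, hN, map_add π, haπ, map_smul π, hπj,
      smul_zero, add_zero, map_add L, map_smul L, hjL]
    have e1 : L (a u) = a (ρ u) + j (k u) := by rw [hk]; abel
    have e2 : (1 - t) / t = t⁻¹ - 1 := by field_simp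
    rw [e1, e2]
    simp only [map_add, map_sub, map_smul, smul_add, smul_sub, smul_smul, inv_mul_cancel₀ ht, one_smul,
      sub_smul]
    abel
  have hΦD : ∀ t x, Φ t (prodD D' x) = D (Φ t x) := by
    rintro t ⟨u, w⟩
    rw [hDp, hΦ, hΦ, map_add D, haD, map_smul D, hjD, map_sub, map_add]
  have hΦQ : ∀ t, t ≠ 0 → ∀ x y, Q (Φ t x) (Φ t y) = t⁻¹ * Qt t x y := by
    rintro t ht ⟨u, w⟩ ⟨u', w'⟩
    rw [hQt, hΦ, hΦ]
    have e1 : Q (a u) (j w') = 2 * q u w' := by rw [hV.symm, hQ, haπ, hU.symm]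
    have e2 : Q (j w) (a u') = 2 * q w u' := by rw [hQ, haπ]
    simp only [map_add, map_smul, LinearMap.add_apply, LinearMap.smul_apply, smul_eq_mul, e1, e2, hjj]
    field_simp
    ring
  have h0 : HR (prodD D') (Lt 0) (Qt 0) (l + 1) := by
    have e1 : Lt 0 = prodL ρ := by simp [Lt, A]
    have e2 : Qt 0 = prodQ q := by simp [Qt]
    rw [e1, e2]
    exact HR.prod hU hr
  have hhl : ∀ t ∈ Set.Icc (0 : ℝ) 1, HL (prodD D') (Lt t) := by
    intro t ht
    by_cases h : t = 0
    · rw [h]; exact h0.hl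
    · intro i x hx hx0
      have hp : ∀ i x, Φ t ((Lt t ^ i) x) = ((L + ((1 - t) / t) • N) ^ i) (Φ t x) := by
        intro i x
        induction i with
        | zero => rfl
        | succ i ih => rw [pow_succ', pow_succ', Module.End.mul_apply, Module.End.mul_apply, hΦL t h, ih]
      refine hΦi t h ?_
      rw [map_zero]
      exact hl _ (div_nonneg (sub_nonneg.2 ht.2) ht.1) i _ (by rw [← hΦD, hx, map_zsmul])
        (by rw [← hp, hx0, map_zero])
  have hpath := HR.path hLef (fun i x y => by
    have h1 := continuous_affine_pow (A := A) (C := C) i x ((prodQ q).flip y)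
    have h2 := continuous_affine_pow (A := A) (C := C) i x (q'.flip y)
    exact h1.add (continuous_id.mul h2)) hhl h0
  have hζ1 : (1 + ζ) ≠ 0 := by positivity
  set t := (1 + ζ)⁻¹ with ht
  have ht0 : t ≠ 0 := inv_ne_zero hζ1
  have htζ : (1 - t) / t = ζ := by rw [ht]; field_simp; ring
  have htI : t ∈ Set.Icc (0 : ℝ) 1 := ⟨by positivity, inv_le_one_of_one_le₀ (by linarith)⟩
  let Ψ := LinearEquiv.ofBijective (Φ t) ⟨hΦi t ht0, hΦs t ht0⟩
  have hΨ : ∀ x, Φ t (Ψ.symm x) = x := fun x => Ψ.apply_symm_apply x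
  refine (hpath t htI).transfer (Ψ.symm : V →ₗ[ℝ] U × U) Ψ.symm.injective (fun x => ?_) (fun x => ?_)
    (c := t) (by positivity) (fun x y => ?_)
  · refine hΦi t ht0 ?_
    rw [hΦL t ht0, htζ]
    exact (hΨ _).trans (congrArg _ (hΨ _).symm)
  · refine hΦi t ht0 ?_
    rw [hΦD]
    exact (hΨ _).trans (congrArg _ (hΨ _).symm)
  · have := hΦQ t ht0 (Ψ.symm x) (Ψ.symm y)
    rw [hΨ, hΨ] at this
    rw [this, ← mul_assoc, mul_inv_cancel₀ ht0, one_mul]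
    rfl

end

end KLPos

namespace KLPos

variable {B W : Type} [Group W] {M : CoxeterMatrix B} {cs : CoxeterSystem M W}
  {R : Type} [CommRing R] [Algebra ℝ R]

namespace SObj

variable {G : Realization cs R} [IsDomain R] (X : SObj G)

/-- The specialization of the form at the origin. -/
noncomputable def eform : X →ₗ[ℝ] X →ₗ[ℝ] ℝ :=
  LinearMap.mk₂ ℝ (fun m n => G.ε (X.form m n)) (fun _ _ _ => by simp)
    (fun c m n => by
      rw [real_smul_def, map_smul, LinearMap.smul_apply, smul_eq_mul, map_mul, AlgHom.commutes]; rfl)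
    (fun _ _ _ => by simp) (fun c m n => by
      rw [real_smul_def, map_smul, smul_eq_mul, map_mul, AlgHom.commutes]; rfl)

lemma eform_apply (m n : X) : X.eform m n = G.ε (X.form m n) := rfl

/-- The radical of the specialized form. -/
noncomputable def rad : Submodule ℝ X := LinearMap.ker X.eform

variable {X} in
lemma mem_rad {m : X} : m ∈ X.rad ↔ ∀ n, G.ε (X.form m n) = 0 :=
  ⟨fun h n => LinearMap.congr_fun (LinearMap.mem_ker.1 h) n,
    fun h => LinearMap.mem_ker.2 (LinearMap.ext h)⟩

/-- The specialization `X ⊗_R ℝ`. -/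
abbrev Bar : Type := X ⧸ X.rad

/-- The quotient map to the specialization. -/
noncomputable def bmk : X →ₗ[ℝ] X.Bar := X.rad.mkQ

lemma bmk_surjective : Function.Surjective X.bmk := X.rad.mkQ_surjective

variable {X}

lemma bmk_eq_zero {m : X} : X.bmk m = 0 ↔ ∀ n, G.ε (X.form m n) = 0 := by
  rw [bmk, Submodule.mkQ_apply, Submodule.Quotient.mk_eq_zero, mem_rad]

lemma bmk_smul (r : R) (m : X) : X.bmk (r • m) = G.ε r • X.bmk m := by
  rw [← map_smul, ← sub_eq_zero, ← map_sub, bmk_eq_zero]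
  intro n
  rw [real_smul_def, map_sub, map_smul, map_smul, LinearMap.sub_apply, LinearMap.smul_apply,
    LinearMap.smul_apply, smul_eq_mul, smul_eq_mul, map_sub, map_mul, map_mul, AlgHom.commutes,
    Algebra.algebraMap_self, RingHom.id_apply, sub_self]

variable (X)

/-- The form on the specialization. -/
noncomputable def bq : X.Bar →ₗ[ℝ] X.Bar →ₗ[ℝ] ℝ :=
  X.rad.liftQ
    { toFun := fun m => X.rad.liftQ (X.eform m) fun n hn => by
        rw [LinearMap.mem_ker, eform_apply, X.form_symm]; exact mem_rad.1 hn m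
      map_add' := fun m m' => by ext n; simp
      map_smul' := fun c m => by ext n; simp }
    fun m hm => by
      rw [LinearMap.mem_ker]; ext n; exact mem_rad.1 hm n

@[simp] lemma bq_mk (m n : X) : X.bq (X.bmk m) (X.bmk n) = G.ε (X.form m n) := rfl

/-- The grading operator on the specialization. -/
noncomputable def bD : X.Bar →ₗ[ℝ] X.Bar :=
  X.rad.mapQ X.rad { X.D with map_smul' := D_smul_const } fun m hm => by
    refine mem_rad.2 fun n => ?_
    have h := congrArg G.ε (X.form_D m n)
    rw [map_add, G.ε_eu, mem_rad.1 hm, add_zero] at h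
    exact h

@[simp] lemma bD_mk (m : X) : X.bD (X.bmk m) = X.bmk (X.D m) := rfl

variable {X} {Y Z : SObj G}

/-- The map induced on specializations. -/
noncomputable def bmap (f : X →ₗ[R] Y) : X.Bar →ₗ[ℝ] Y.Bar :=
  X.rad.mapQ Y.rad (f.restrictScalars ℝ) fun m hm => by
    obtain ⟨g, hg⟩ := exists_adj f
    refine mem_rad.2 fun n => ?_
    change G.ε (Y.form (f m) n) = 0
    rw [hg]; exact mem_rad.1 hm _

@[simp] lemma bmap_mk (f : X →ₗ[R] Y) (m : X) : bmap f (X.bmk m) = Y.bmk (f m) := rfl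

lemma bar_ext {V : Type} [AddCommGroup V] [Module ℝ V] {f g : X.Bar →ₗ[ℝ] V}
    (h : ∀ m, f (X.bmk m) = g (X.bmk m)) : f = g :=
  LinearMap.ext fun x => by obtain ⟨m, rfl⟩ := X.bmk_surjective x; exact h m

lemma bmap_comp (f : X →ₗ[R] Y) (g : Y →ₗ[R] Z) : bmap (g ∘ₗ f) = bmap g ∘ₗ bmap f :=
  bar_ext fun _ => rfl

lemma bmap_add (f g : X →ₗ[R] Y) : bmap (f + g) = bmap f + bmap g := bar_ext fun _ => rfl

lemma bmap_real (c : ℝ) (f : X →ₗ[R] Y) : bmap (c • f) = c • bmap f := bar_ext fun _ => rfl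

lemma IsAdj.bar {f : X →ₗ[R] Y} {g : Y →ₗ[R] X} (h : IsAdj f g) (x : X.Bar) (y : Y.Bar) :
    Y.bq (bmap f x) y = X.bq x (bmap g y) := by
  obtain ⟨m, rfl⟩ := X.bmk_surjective x
  obtain ⟨n, rfl⟩ := Y.bmk_surjective y
  rw [bmap_mk, bmap_mk, bq_mk, bq_mk, h]

lemma IsHom.bar_D {k : ℤ} {f : X →ₗ[R] Y} (h : IsHom k f) (x : X.Bar) :
    Y.bD (bmap f x) = bmap f (X.bD x) + k • bmap f x := by
  obtain ⟨m, rfl⟩ := X.bmk_surjective x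
  simp only [bmap_mk, bD_mk, h.map_D, map_add, map_zsmul]

lemma IsHom.bar_l {k : ℤ} {f : X →ₗ[R] Y} (h : IsHom k f) (r : R) (x : X.Bar) :
    bmap f (bmap (X.l r) x) = bmap (Y.l r) (bmap f x) := by
  obtain ⟨m, rfl⟩ := X.bmk_surjective x
  simp only [bmap_mk, h.map_l]

lemma bq_symm (x y : X.Bar) : X.bq x y = X.bq y x := by
  obtain ⟨m, rfl⟩ := X.bmk_surjective x
  obtain ⟨n, rfl⟩ := X.bmk_surjective y
  rw [bq_mk, bq_mk, X.form_symm]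

lemma bq_nondeg (x : X.Bar) (h : ∀ y, X.bq x y = 0) : x = 0 := by
  obtain ⟨m, rfl⟩ := X.bmk_surjective x
  exact bmk_eq_zero.2 fun n => h (X.bmk n)

/-- A self-adjoint endomorphism of degree 2 gives Lefschetz data on the specialization. -/
lemma IsHom.lef {f : X →ₗ[R] X} (h : IsHom 2 f) (ha : IsAdj f f) : Lef X.bD (bmap f) X.bq where
  symm := bq_symm
  nondeg := bq_nondeg
  skew x y := by
    obtain ⟨m, rfl⟩ := X.bmk_surjective x
    obtain ⟨n, rfl⟩ := X.bmk_surjective y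
    rw [bD_mk, bD_mk, bq_mk, bq_mk, ← map_add, X.form_D, G.ε_eu]
  adj := ha.bar
  deg := h.bar_D
  span := by
    rw [eq_top_iff]
    intro x _
    obtain ⟨m, rfl⟩ := X.bmk_surjective x
    refine AddSubgroup.closure_induction (p := fun m _ => X.bmk m ∈
      Submodule.span ℝ {x : X.Bar | ∃ d : ℤ, X.bD x = d • x}) ?_ ?_ ?_ ?_ (X.graded m)
    · rintro m ⟨d, hd⟩
      exact Submodule.subset_span ⟨d, by rw [bD_mk, hd, map_zsmul]⟩
    · rw [map_zero]; exact zero_mem _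
    · intro a b _ _ ha hb; rw [map_add]; exact add_mem ha hb
    · intro a _ ha; rw [map_neg]; exact neg_mem ha

instance : FiniteDimensional ℝ X.Bar := by
  obtain ⟨ι, _, p, q, hpq⟩ := X.dual
  refine ⟨(Set.finite_range fun j => X.bmk (q j)).toFinset, ?_⟩
  rw [eq_top_iff]
  intro x _
  obtain ⟨m, rfl⟩ := X.bmk_surjective x
  rw [hpq m, map_sum]
  refine sum_mem fun j _ => ?_
  rw [bmk_smul]
  exact Submodule.smul_mem _ _ (Submodule.subset_span (by simp))

/-- An object with zero specialization is zero. -/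
lemma eq_zero_of_bar (h : ∀ m, X.bmk m = 0) (m : X) : m = 0 := by
  classical
  obtain ⟨ι, _, p, q, hpq⟩ := X.dual
  let A : Matrix ι ι R := 1 - Matrix.of fun i j => X.form (p i) (q j)
  have hA : (G.ε : R →+* ℝ).mapMatrix A = 1 := by
    ext i j
    have : G.ε (X.form (p i) (q j)) = 0 := bmk_eq_zero.1 (h (p i)) (q j)
    simp only [A, map_sub, map_one, RingHom.mapMatrix_apply, Matrix.sub_apply, Matrix.map_apply,
      Matrix.of_apply, RingHom.coe_coe, this, sub_zero]
  have hd : A.det ≠ 0 := fun h0 => by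
    have := congrArg (G.ε : R →+* ℝ) h0
    rw [RingHom.map_det, hA, Matrix.det_one, map_zero] at this
    exact one_ne_zero this
  have hv : A.mulVec (fun i => X.form (p i) m) = 0 := by
    ext i
    rw [Matrix.sub_mulVec, Matrix.one_mulVec, Pi.sub_apply, Pi.zero_apply, sub_eq_zero]
    conv_lhs => rw [hpq m]
    rw [map_sum]
    simp [Matrix.mulVec, dotProduct, mul_comm]
  have h0 := Matrix.eq_zero_of_mulVec_eq_zero hd hv
  rw [hpq m]
  exact Finset.sum_eq_zero fun j _ => by rw [show X.form (p j) m = 0 from congrFun h0 j, zero_smul]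

lemma isHom_l {r : R} (hr : r ∈ G.lin) : IsHom 2 (X.l r) where
  map_l r' m := l_comm r r' m
  map_D m := by
    rw [X.D_l, G.eu_lin r hr, l_smul_real, add_comm, ← Int.cast_smul_eq_zsmul ℝ]
    norm_num

lemma isAdj_l (r : R) : IsAdj (X.l r) (X.l r) := fun m n => X.form_l r m n

variable (X) in
/-- The Lefschetz operator on the specialization. -/
noncomputable def bL : X.Bar →ₗ[ℝ] X.Bar := bmap (X.l G.ρ)

lemma lef : Lef X.bD X.bL X.bq := (isHom_l G.ρ_mem).lef (isAdj_l _)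

variable (X) in
/-- The deformed Lefschetz operator on the specialization of `X B_s`. -/
noncomputable def bLz (i : B) (ζ : ℝ) : (X.ind i).Bar →ₗ[ℝ] (X.ind i).Bar :=
  (X.ind i).bL + ζ • bmap (mid X i (G.α i))

variable {i : B}

lemma bLz_eq (ζ : ℝ) : X.bLz i ζ = bmap ((X.ind i).l G.ρ + ζ • mid X i (G.α i)) := by
  rw [bmap_add, bmap_real]; rfl

lemma eps_α (G : Realization cs R) (i : B) : G.ε (G.α i) = 0 := by
  have h := G.ε_eu (G.α i)
  rw [G.eu_lin _ (G.α_mem i), map_smul] at h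
  simpa using h

lemma bmid_eq (x : (X.ind i).Bar) :
    bmap (mid X i (G.α i)) x = bmap (io X i) (bmap (dd X i) x) := by
  obtain ⟨m, rfl⟩ := (X.ind i).bmk_surjective x
  rw [bmap_mk, mid_eq (G.α_mem i), map_add, bmk_smul, bmk_smul]
  simp [eps_α]

lemma dd_surjective (m : X) : dd X i (tm i m 0) = m := by simp [dd_apply]

lemma smul_tm_α (m : X) : G.α i • tm i m 0 = tm i 0 m := ind_ext (by simp) (by simp)

/-- Exactness of `0 → X̄ → X̄B_s → X̄ → 0`. -/
lemma bio_inj : Function.Injective (bmap (io X i)) := by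
  rw [← LinearMap.ker_eq_bot, LinearMap.ker_eq_bot']
  intro x hx
  refine bq_nondeg _ fun y => ?_
  obtain ⟨m, rfl⟩ := X.bmk_surjective x
  obtain ⟨n, rfl⟩ := X.bmk_surjective y
  rw [bmap_mk] at hx
  have h := bmk_eq_zero.1 hx (tm i n 0)
  rw [form_io, dd_surjective, map_mul, map_ofNat] at h
  rw [bq_mk]; linarith

lemma bdd_surj : Function.Surjective (bmap (dd X i)) := fun x => by
  obtain ⟨m, rfl⟩ := X.bmk_surjective x
  exact ⟨(X.ind i).bmk (tm i m 0), by rw [bmap_mk, dd_surjective]⟩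

lemma bdd_bio (x : X.Bar) : bmap (dd X i) (bmap (io X i) x) = 0 := by
  obtain ⟨m, rfl⟩ := X.bmk_surjective x
  rw [bmap_mk, bmap_mk, dd_apply, fs_io, sn_io, ← add_smul, bmk_smul]
  simp [eps_α]

lemma form_dd_bar (x : X.Bar) (y : (X.ind i).Bar) :
    (X.ind i).bq (bmap (io X i) x) y = 2 * X.bq x (bmap (dd X i) y) := by
  obtain ⟨m, rfl⟩ := X.bmk_surjective x
  obtain ⟨n, rfl⟩ := (X.ind i).bmk_surjective y
  rw [bmap_mk, bmap_mk, bq_mk, bq_mk, form_io, map_mul, map_ofNat]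

lemma bdd_exact (y : (X.ind i).Bar) (hy : bmap (dd X i) y = 0) : ∃ x, bmap (io X i) x = y := by
  obtain ⟨m, rfl⟩ := (X.ind i).bmk_surjective y
  rw [bmap_mk] at hy
  have h0 : G.ε (G.α i) = 0 := eps_α G i
  have h1 : ∀ q : X, (X.ind i).bmk (tm i 0 q) = 0 := fun q => by
    rw [← smul_tm_α, bmk_smul, h0, zero_smul]
  have h2 : ∀ q : X, (X.ind i).bmk (tm i (G.α i • q) 0) = (X.ind i).bmk (io X i q) := fun q => by
    have : io X i q = tm i (G.α i • q) 0 + tm i 0 q := ind_ext (by simp) (by simp)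
    rw [this, map_add, h1, add_zero]
  have h3 : ∀ n, G.ε (X.form n (fs m)) = 0 := fun n => by
    have := bmk_eq_zero.1 hy n
    rw [dd_apply, map_add, LinearMap.add_apply, map_add, map_smul, LinearMap.smul_apply, smul_eq_mul,
      map_mul, h0, zero_mul, add_zero] at this
    rw [X.form_symm, this]
  obtain ⟨ι, _, p, q, hpq⟩ := X.dual
  have h4 : ∀ j, (X.ind i).bmk (tm i (X.form (p j) (fs m) • q j) 0) =
      bmap (io X i) (G.ε (G.hd i (X.form (p j) (fs m))) • X.bmk (q j)) := fun j => by
    have h5 : tm i (X.form (p j) (fs m) • q j) 0 = G.av i (X.form (p j) (fs m)) • tm i (q j) 0 +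
        G.hd i (X.form (p j) (fs m)) • tm i (G.α i • q j) 0 := by
      refine ind_ext ?_ ?_
      · rw [map_add, fs_smul, fs_smul]
        simp only [fs_tm, sn_tm, smul_zero, add_zero, smul_smul, av_av, av_hd, hd_av, ← add_smul]
        conv_lhs => rw [← G.av_add_hd i (X.form _ _)]
      · simp [hd_av, hd_hd]
    have h6 : G.ε (G.av i (X.form (p j) (fs m))) = 0 := by
      have h7 := congrArg G.ε (G.av_add_hd i (X.form (p j) (fs m)))
      rwa [map_add, map_mul, h0, mul_zero, add_zero, h3] at h7
    rw [h5, map_add, bmk_smul, bmk_smul, h6, zero_smul, zero_add, h2, map_smul, bmap_mk]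
  refine ⟨∑ j, G.ε (G.hd i (X.form (p j) (fs m))) • X.bmk (q j), ?_⟩
  rw [map_sum, ← Finset.sum_congr rfl fun j _ => h4 j, ← map_sum]
  have h8 : m = (∑ j, tm i (X.form (p j) (fs m) • q j) 0) + tm i 0 (sn m) := by
    refine ind_ext ?_ ?_
    · rw [map_add, map_sum]
      simpa using hpq (fs m)
    · simp
  conv_rhs => rw [h8, map_add, h1, add_zero]

lemma finrank_ind : Module.finrank ℝ (X.ind i).Bar = 2 * Module.finrank ℝ X.Bar := by
  have h := LinearMap.finrank_range_add_finrank_ker (bmap (dd X i))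
  rw [LinearMap.range_eq_top.2 bdd_surj, finrank_top] at h
  have h2 : LinearMap.ker (bmap (dd X i)) = LinearMap.range (bmap (io X i)) := by
    ext y
    rw [LinearMap.mem_ker, LinearMap.mem_range]
    exact ⟨bdd_exact y, by rintro ⟨x, rfl⟩; exact bdd_bio x⟩
  rw [h2, LinearMap.finrank_range_of_inj bio_inj] at h
  omega

end SObj

end KLPos

namespace KLPos

variable {B W : Type} [Group W] {M : CoxeterMatrix B} {cs : CoxeterSystem M W}
  {R : Type} [CommRing R] [Algebra ℝ R]

namespace SObj

variable {G : Realization cs R} [IsDomain R] {X Y Z N : SObj G} {i : B}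

/-- The first projection `N B_s B_s → N B_s`. -/
noncomputable def prP (N : SObj G) (i : B) : (N.ind i).ind i →ₗ[R] N.ind i where
  toFun m := tm i (fs (fs m)) (fs (sn m))
  map_add' m n := ind_ext (by simp) (by simp)
  map_smul' r m := ind_ext (by simp [av_av, hd_av, av_hd_mul_sq, hd_hd_mul_sq])
    (by simp [av_av, hd_av, av_hd, hd_hd])

/-- The second projection `N B_s B_s → N B_s`. -/
noncomputable def prQ (N : SObj G) (i : B) : (N.ind i).ind i →ₗ[R] N.ind i where
  toFun m := tm i (sn (fs m)) (sn (sn m))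
  map_add' m n := ind_ext (by simp) (by simp)
  map_smul' r m := ind_ext (by simp [av_av, hd_av, av_hd_mul_sq, hd_hd_mul_sq])
    (by simp [av_av, hd_av, av_hd, hd_hd])

@[simp] lemma fs_prP (m : (N.ind i).ind i) : fs (prP N i m) = fs (fs m) := rfl
@[simp] lemma sn_prP (m : (N.ind i).ind i) : sn (prP N i m) = fs (sn m) := rfl
@[simp] lemma fs_prQ (m : (N.ind i).ind i) : fs (prQ N i m) = sn (fs m) := rfl
@[simp] lemma sn_prQ (m : (N.ind i).ind i) : sn (prQ N i m) = sn (sn m) := rfl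

lemma isHom_prP : IsHom 1 (prP N i) where
  map_l r m := ind_ext (by simp) (by simp)
  map_D m := ind_ext (by simp) (by simp)

lemma isHom_prQ : IsHom (-1) (prQ N i) where
  map_l r m := ind_ext (by simp) (by simp)
  map_D m := ind_ext (by simp [sub_eq_add_neg]) (by simp)

lemma form_ind_ind (m n : (N.ind i).ind i) : ((N.ind i).ind i).form m n =
    2 * ((N.ind i).form (prP N i m) (prQ N i n) + (N.ind i).form (prQ N i m) (prP N i n)) := by
  have inv : ∀ r : R, G.sa i (2 * G.hd i r) = 2 * G.hd i r := fun r => by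
    rw [map_mul, G.sa_hd, map_ofNat]
  have e1 : ∀ r r' r'' : R, G.hd i (2 * G.hd i r + G.α i * (2 * G.hd i r') +
      G.α i ^ 2 * (2 * G.hd i r'')) = 2 * G.hd i r' := fun r r' r'' => by
    rw [G.hd_add, G.hd_add, G.hd_of_inv (inv r), mul_comm (G.α i), G.hd_mul_α, G.av_of_inv (inv r'),
      G.hd_of_inv (r := G.α i ^ 2 * _), zero_add, add_zero]
    rw [map_mul, inv, map_pow, G.sa_α, neg_sq]
  simp only [form_ind, fs_prP, sn_prP, fs_prQ, sn_prQ, dm_eq, G.hd_add]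
  simp only [← G.hd_add, e1]
  simp only [G.hd_add]
  ring

lemma prP_mid (m : (N.ind i).ind i) :
    prP N i (mid (N.ind i) i (G.α i) m) = mid N i (G.α i ^ 2) (prQ N i m) :=
  ind_ext (by simp) (by simp)

lemma prQ_mid (m : (N.ind i).ind i) : prQ N i (mid (N.ind i) i (G.α i) m) = prP N i m :=
  ind_ext (by simp) (by simp)

end SObj

end KLPos

namespace KLPos

variable {B W : Type} [Group W] {M : CoxeterMatrix B} {cs : CoxeterSystem M W}
  {R : Type} [CommRing R] [Algebra ℝ R]

namespace SObj

variable {G : Realization cs R} [IsDomain R] {X Y Z N : SObj G} {i : B}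

section Product

variable {a : X →ₗ[R] N.ind i} {a' : N.ind i →ₗ[R] X} {c : ℝ}

lemma bq_ind_eq (haa : IsAdj a a') (hc : ∀ m, a' (a m) = c • m) (x y : (X.ind i).Bar) :
    c * (X.ind i).bq x y = 2 * ((N.ind i).bq (bmap (prP N i ∘ₗ indMap i a) x)
      (bmap (prQ N i ∘ₗ indMap i a) y) + (N.ind i).bq (bmap (prQ N i ∘ₗ indMap i a) x)
      (bmap (prP N i ∘ₗ indMap i a) y)) := by
  obtain ⟨m, rfl⟩ := (X.ind i).bmk_surjective x
  obtain ⟨n, rfl⟩ := (X.ind i).bmk_surjective y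
  simp only [bmap_mk, bq_mk, LinearMap.comp_apply]
  rw [← map_add, ← map_ofNat G.ε 2, ← map_mul, ← form_ind_ind, haa.ind]
  have : indMap i a' (indMap i a n) = c • n :=
    ind_ext (by rw [fs_real, fs_indMap, fs_indMap, hc]) (by rw [sn_real, sn_indMap, sn_indMap, hc])
  rw [this, real_smul_def, map_smul, smul_eq_mul, map_mul, AlgHom.commutes]; rfl

lemma prP_bLz (ha : IsHom 0 a) (ζ : ℝ) (x : (X.ind i).Bar) :
    bmap (prP N i ∘ₗ indMap i a) (X.bLz i ζ x) =
      (N.ind i).bL (bmap (prP N i ∘ₗ indMap i a) x) := by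
  have h := ha.ind.comp (isHom_prP (N := N) (i := i))
  have hα : G.sa i (G.α i ^ 2) = G.α i ^ 2 := by rw [map_pow, G.sa_α, neg_sq]
  have e : (prP N i ∘ₗ indMap i a) ∘ₗ mid X i (G.α i) =
      G.α i ^ 2 • (prQ N i ∘ₗ indMap i a) := by
    refine LinearMap.ext fun m => ((congrArg (prP N i) (indMap_mid _ m)).trans (prP_mid _)).trans ?_
    refine ind_ext ?_ ?_ <;> simp [G.av_of_inv hα, G.hd_of_inv hα]
  have e2 : bmap (G.α i ^ 2 • (prQ N i ∘ₗ indMap i a)) = 0 := bar_ext fun m => by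
    rw [bmap_mk, LinearMap.smul_apply, bmk_smul, map_pow, eps_α, zero_pow two_ne_zero, zero_smul]
    rfl
  rw [bLz, LinearMap.add_apply, LinearMap.smul_apply, map_add, map_smul, bL, bL, h.bar_l,
    ← LinearMap.comp_apply (bmap (prP N i ∘ₗ indMap i a)), ← bmap_comp, e, e2, LinearMap.zero_apply,
    smul_zero, add_zero]

lemma prQ_bLz (ha : IsHom 0 a) (ζ : ℝ) (x : (X.ind i).Bar) :
    bmap (prQ N i ∘ₗ indMap i a) (X.bLz i ζ x) =
      (N.ind i).bL (bmap (prQ N i ∘ₗ indMap i a) x) + ζ • bmap (prP N i ∘ₗ indMap i a) x := by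
  have h := ha.ind.comp (isHom_prQ (N := N) (i := i))
  have e : (prQ N i ∘ₗ indMap i a) ∘ₗ mid X i (G.α i) = prP N i ∘ₗ indMap i a :=
    LinearMap.ext fun m => (congrArg (prQ N i) (indMap_mid _ m)).trans (prQ_mid _)
  rw [bLz, LinearMap.add_apply, LinearMap.smul_apply, map_add, map_smul, bL, bL, h.bar_l, ← e,
    bmap_comp _ (prQ N i ∘ₗ indMap i a), LinearMap.comp_apply]

lemma prP_bD (ha : IsHom 0 a) (x : (X.ind i).Bar) :
    bmap (prP N i ∘ₗ indMap i a) ((X.ind i).bD x) =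
      (N.ind i).bD (bmap (prP N i ∘ₗ indMap i a) x) - bmap (prP N i ∘ₗ indMap i a) x := by
  rw [(ha.ind.comp (isHom_prP (N := N) (i := i))).bar_D x]
  module

lemma prQ_bD (ha : IsHom 0 a) (x : (X.ind i).Bar) :
    bmap (prQ N i ∘ₗ indMap i a) ((X.ind i).bD x) =
      (N.ind i).bD (bmap (prQ N i ∘ₗ indMap i a) x) + bmap (prQ N i ∘ₗ indMap i a) x := by
  rw [(ha.ind.comp (isHom_prQ (N := N) (i := i))).bar_D x]
  module

/-- The product with the cohomology of the projective line. -/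
theorem HR.ind_of_inc (ha : IsHom 0 a) (haa : IsAdj a a') (hc : ∀ m, a' (a m) = c • m) (hc0 : 0 < c)
    {l : ℤ} (h : HR (N.ind i).bD (N.ind i).bL (N.ind i).bq l) {ζ : ℝ} (hζ : 0 < ζ) :
    HR (X.ind i).bD (X.bLz i ζ) (X.ind i).bq (l + 1) := by
  refine (h.prod lef).transfer ((ζ • bmap (prP N i ∘ₗ indMap i a)).prod
    (bmap (prQ N i ∘ₗ indMap i a))) ?_ ?_ ?_ (mul_pos hζ hc0) ?_
  · rw [← LinearMap.ker_eq_bot, LinearMap.ker_eq_bot']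
    intro x hx
    obtain ⟨h1, h2⟩ := Prod.ext_iff.1 hx
    have h1' : ζ • bmap (prP N i ∘ₗ indMap i a) x = 0 := h1
    have h2' : bmap (prQ N i ∘ₗ indMap i a) x = 0 := h2
    refine bq_nondeg _ fun y => ?_
    have h3 := bq_ind_eq haa hc x y
    rw [(smul_eq_zero.1 h1').resolve_left hζ.ne', h2'] at h3
    simpa [hc0.ne'] using h3
  · intro x
    refine Prod.ext ?_ ?_
    · simp [prodL, prP_bLz ha]
    · simp [prodL, prQ_bLz ha]
  · intro x
    refine Prod.ext ?_ ?_
    · simp [prodD, prP_bD ha, smul_sub]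
    · simp [prodD, prQ_bD ha]
  · intro x y
    rw [mul_assoc, bq_ind_eq haa hc]
    simp [prodQ]; ring

lemma HL.ind_of_inc (ha : IsHom 0 a) (haa : IsAdj a a') (hc : ∀ m, a' (a m) = c • m) (hc0 : 0 < c)
    (h : HL (N.ind i).bD (N.ind i).bL) {k : ℕ} {x : (X.ind i).Bar}
    (hx : (X.ind i).bD x = (-(k : ℤ)) • x) (hx0 : ((X.ind i).bL ^ (k + 1)) x = 0) (j : ℕ) :
    (X.ind i).bq (((X.ind i).bL ^ j) x) x = 0 := by
  have hL : ∀ y, bmap (prQ N i ∘ₗ indMap i a) ((X.ind i).bL y) =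
      (N.ind i).bL (bmap (prQ N i ∘ₗ indMap i a) y) := fun y => by
    have := prQ_bLz ha 0 y
    simpa [bLz] using this
  have hp : ∀ j y, bmap (prQ N i ∘ₗ indMap i a) (((X.ind i).bL ^ j) y) =
      ((N.ind i).bL ^ j) (bmap (prQ N i ∘ₗ indMap i a) y) := fun j y => by
    induction j with
    | zero => rfl
    | succ j ih => rw [pow_succ', pow_succ', Module.End.mul_apply, Module.End.mul_apply, hL, ih]
  have h0 : bmap (prQ N i ∘ₗ indMap i a) x = 0 := by
    refine h (k + 1) _ ?_ ?_
    · have h1 := prQ_bD ha x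
      rw [hx, map_zsmul] at h1
      rw [← sub_eq_iff_eq_add] at h1
      rw [← h1]; push_cast; module
    · rw [← hp, hx0, map_zero]
  have h1 := bq_ind_eq haa hc (((X.ind i).bL ^ j) x) x
  rw [hp, h0] at h1
  simpa [hc0.ne'] using h1

end Product

end SObj

end KLPos

namespace KLPos

lemma sg_add {a b : ℤ} (h : sg a ≠ 0) : sg (a + b) = sg a * sg b := by
  unfold sg at *
  have h0 : a % 4 = 0 ∨ a % 4 = 2 := by
    by_contra! h'
    simp [h'] at h
  rcases h0 with h0 | h0
  · have e : (a + b) % 4 = b % 4 := by omega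
    simp [h0, e]
  · have h1 : (a + b) % 4 = 0 ↔ b % 4 = 2 := by omega
    have h2 : (a + b) % 4 = 2 ↔ b % 4 = 0 := by omega
    simp only [h0, h1, h2]
    by_cases h3 : b % 4 = 0
    · norm_num [h3]
    · by_cases h4 : b % 4 = 2 <;> norm_num [h3, h4]

lemma sg_pos_trans {a b : ℤ} {κ κ' : ℝ} (h : 0 < κ * sg a) (h' : 0 < κ' * sg b) :
    0 < κ * κ' * sg (a + b) := by
  rw [sg_add fun h0 => by rw [h0, mul_zero] at h; exact lt_irrefl _ h]
  linarith [mul_pos h h']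

/-- Semidefinite Hodge–Riemann relations. -/
def HRw {V : Type} [AddCommGroup V] [Module ℝ V] (D L : V →ₗ[ℝ] V) (Q : V →ₗ[ℝ] V →ₗ[ℝ] ℝ) (l : ℤ) :
    Prop :=
  ∀ (j : ℕ) x, D x = (-(j : ℤ)) • x → (L ^ (j + 1)) x = 0 → 0 ≤ sg (l - j) * Q ((L ^ j) x) x

lemma HR.weak {V : Type} [AddCommGroup V] [Module ℝ V] {D L : V →ₗ[ℝ] V} {Q : V →ₗ[ℝ] V →ₗ[ℝ] ℝ}
    {l : ℤ} (h : HR D L Q l) : HRw D L Q l := fun j x hx hx0 => by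
  by_cases h0 : x = 0
  · rw [h0]; simp
  · exact (h j x hx h0 hx0).le

variable {B W : Type} [Group W] {M : CoxeterMatrix B} {cs : CoxeterSystem M W}
  {R : Type} [CommRing R] [Algebra ℝ R]

namespace SObj

variable {G : Realization cs R} [IsDomain R] {X Y Z N : SObj G} {i : B} {x z : W}

/-- The object `X` is an indecomposable object attached to `x` satisfying the Hodge–Riemann
relations. -/
def KL (x : W) (X : SObj G) : Prop :=
  ∃ ct cb, Good x X ct cb ∧ LL X x ct ∧ HR X.bD X.bL X.bq (cs.length x)

/-- Signed squares of homomorphisms of degree `k` to smaller objects. -/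
def posGen (k : ℤ) (n : ℤ) (X : SObj G) : Set (X → X → R) :=
  {q | ∃ (z : W) (Z : SObj G) (κ : ℝ) (f : X →ₗ[R] Z), KL z Z ∧ cs.length z ≤ n ∧ IsHom k f ∧
    0 < κ * sg (n - cs.length z) ∧ q = fun m m' => κ • Z.form (f m) (f m')}

/-- Sums of signed squares of homomorphisms of degree `k` to smaller objects. -/
def PosQ (k : ℤ) (n : ℤ) (X : SObj G) : AddSubmonoid (X → X → R) :=
  AddSubmonoid.closure (posGen k n X)

/-- The failure of `ρ` to act by the scalar determined by `x`. -/
def dfct (x : W) (X : SObj G) : X → X → R := fun m m' =>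
  X.form (X.l G.ρ m) m' - G.act x⁻¹ G.ρ * X.form m m'

/-- The operator `ρ` is diagonal up to signed squares. -/
def DD (x : W) (X : SObj G) : Prop := dfct x X ∈ PosQ 1 (cs.length x - 1) X

/-- Induction of biadditive functions. -/
noncomputable def indQ (i : B) (X : SObj G) : (X → X → R) →+ (X.ind i → X.ind i → R) where
  toFun q m n := G.dm i (q (fs m) (fs n)) + G.α i * G.dm i (q (fs m) (sn n) + q (sn m) (fs n))
    + G.α i ^ 2 * G.dm i (q (sn m) (sn n))
  map_zero' := by ext m n; simp
  map_add' q q' := by ext m n; simp only [Pi.add_apply, map_add]; ring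

lemma indQ_form (f : X →ₗ[R] Z) (κ : ℝ) : indQ i X (fun m m' => κ • Z.form (f m) (f m')) =
    fun m m' => κ • (Z.ind i).form (indMap i f m) (indMap i f m') := by
  ext m n
  simp only [indQ, AddMonoidHom.coe_mk, ZeroHom.coe_mk, form_ind, fs_indMap, sn_indMap, map_smul,
    ← smul_add, mul_smul_comm]

lemma eps_lin {r : R} (hr : r ∈ G.lin) : G.ε r = 0 := by
  have h := G.ε_eu r
  rw [G.eu_lin _ hr, map_smul] at h
  simpa using h

lemma dfct_ind (x : W) (X : SObj G) (i : B) (m m' : X.ind i) :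
    dfct (x * cs.simple i) (X.ind i) m m' = indQ i X (dfct x X) m m' +
      G.dm i (G.act x⁻¹ G.ρ) * X.form (dd X i m) (dd X i m') := by
  have h := form_mid (X := X) (i := i) (G.act_lin x⁻¹ _ G.ρ_mem) m m'
  rw [dfct, G.act_mul_simple_inv, ← sub_eq_iff_eq_add, ← sub_eq_zero]
  have h2 : (X.ind i).form ((X.ind i).l G.ρ m) m' = indQ i X (dfct x X) m m' +
      (X.ind i).form (mid X i (G.act x⁻¹ G.ρ) m) m' := by
    rw [form_ind, form_ind]
    simp only [indQ, AddMonoidHom.coe_mk, ZeroHom.coe_mk, dfct, fs_l, sn_l, fs_mid, sn_mid, map_smul,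
      LinearMap.smul_apply, smul_eq_mul, map_sub, map_add]
    ring
  rw [h2, h]; ring

lemma bL_dd (ζ : ℝ) (y : (X.ind i).Bar) :
    bmap (dd X i) (X.bLz i ζ y) = X.bL (bmap (dd X i) y) := by
  rw [bLz, LinearMap.add_apply, LinearMap.smul_apply, bmid_eq, map_add, map_smul, bdd_bio, smul_zero,
    add_zero, bL, isHom_dd.bar_l]; rfl

lemma bL_dd_pow (ζ : ℝ) (k : ℕ) (y : (X.ind i).Bar) :
    bmap (dd X i) ((X.bLz i ζ ^ k) y) = (X.bL ^ k) (bmap (dd X i) y) := by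
  induction k with
  | zero => rfl
  | succ j ih => rw [pow_succ', pow_succ', Module.End.mul_apply, Module.End.mul_apply, bL_dd, ih]

lemma bL_io (ζ : ℝ) (y : X.Bar) :
    X.bLz i ζ (bmap (io X i) y) = bmap (io X i) (X.bL y) := by
  rw [bLz, LinearMap.add_apply, LinearMap.smul_apply, bmid_eq, bdd_bio, map_zero, smul_zero,
    add_zero, bL, bL, isHom_io.bar_l]

lemma bL_io_pow (ζ : ℝ) (k : ℕ) (y : X.Bar) :
    (X.bLz i ζ ^ k) (bmap (io X i) y) = bmap (io X i) ((X.bL ^ k) y) := by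
  induction k with
  | zero => rfl
  | succ j ih => rw [pow_succ', pow_succ', Module.End.mul_apply, Module.End.mul_apply, ih, bL_io]

lemma indMap_bLz {k : ℤ} {f : X →ₗ[R] Z} (hf : IsHom k f) (ζ : ℝ) (y : (X.ind i).Bar) :
    bmap (indMap i f) (X.bLz i ζ y) = Z.bLz i ζ (bmap (indMap i f) y) := by
  rw [bLz_eq, bLz_eq, ← LinearMap.comp_apply (bmap (indMap i f)), ← bmap_comp,
    ← LinearMap.comp_apply (bmap ((Z.ind i).l G.ρ + _)), ← bmap_comp]
  refine congrArg (fun F => bmap F _) (LinearMap.ext fun m => ?_)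
  simp only [LinearMap.comp_apply, LinearMap.add_apply, LinearMap.smul_apply, map_add, hf.ind.map_l,
    ← indMap_mid]
  rw [LinearMap.map_smul_of_tower]

lemma indMap_bLz_pow {k : ℤ} {f : X →ₗ[R] Z} (hf : IsHom k f) (ζ : ℝ) (j : ℕ) (y : (X.ind i).Bar) :
    bmap (indMap i f) ((X.bLz i ζ ^ j) y) = (Z.bLz i ζ ^ j) (bmap (indMap i f) y) := by
  induction j with
  | zero => rfl
  | succ j ih =>
    rw [pow_succ', pow_succ', Module.End.mul_apply, Module.End.mul_apply, indMap_bLz hf, ih]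

/-- The hard Lefschetz property for `X B_s`. -/
theorem HL.ind (hr : HR X.bD X.bL X.bq (cs.length x)) (hd : DD x X)
    (hxi : cs.length x < cs.length (x * cs.simple i)) {ζ : ℝ} (hζ : 0 ≤ ζ)
    (hZ : ∀ z (Z : SObj G), KL z Z → cs.length z < cs.length x →
      HRw (Z.ind i).bD (Z.bLz i ζ) (Z.ind i).bq (cs.length z + 1)) :
    HL (X.ind i).bD (X.bLz i ζ) := by
  rintro (_ | j) y hy hy0
  · exact hy0
  set y1 := (X.bLz i ζ ^ j) y with hy1
  obtain ⟨m, rfl⟩ := (X.ind i).bmk_surjective y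
  obtain ⟨m1, hm1⟩ := (X.ind i).bmk_surjective y1
  have hddy : X.bD (bmap (dd X i) ((X.ind i).bmk m)) = (-(j : ℤ)) • bmap (dd X i) ((X.ind i).bmk m) := by
    rw [isHom_dd.bar_D, hy, map_zsmul]; push_cast; module
  have hdd0 : (X.bL ^ (j + 1)) (bmap (dd X i) ((X.ind i).bmk m)) = 0 := by
    rw [← bL_dd_pow ζ, hy0, map_zero]
  have hsum : 0 ≤ sg (cs.length x - j) * G.ε (indQ i X (dfct x X) m1 m) := by
    have h1 : ∀ q ∈ PosQ 1 (cs.length x - 1) X, 0 ≤ sg (cs.length x - j) * G.ε (indQ i X q m1 m) := by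
      intro q hq
      induction hq using AddSubmonoid.closure_induction with
      | mem q hq =>
        obtain ⟨z, Z, κ, f, hz, hl, hf, hκ, rfl⟩ := hq
        have h2 := hZ z Z hz (by omega) j (bmap (indMap i f) ((X.ind i).bmk m)) (by
          rw [hf.ind.bar_D, hy, map_zsmul]; push_cast; module) (by
          rw [← indMap_bLz_pow hf, hy0, map_zero])
        rw [← indMap_bLz_pow hf, ← hy1, ← hm1, bmap_mk, bmap_mk, bq_mk] at h2
        have h3 : sg (cs.length x - 1 - cs.length z) ≠ 0 := fun h0 => by
          rw [h0, mul_zero] at hκ; exact lt_irrefl _ hκ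
        rw [indQ_form, map_smul, smul_eq_mul]
        have h4 : sg ((cs.length x : ℤ) - j) = sg (cs.length x - 1 - cs.length z) *
            sg (cs.length z + 1 - j) := by
          rw [← sg_add h3]; congr 1; ring
        rw [h4]
        have := mul_nonneg hκ.le h2
        linarith
      | zero => simp
      | add q q' _ _ h h' => 
        rw [map_add, Pi.add_apply, Pi.add_apply, map_add, mul_add]
        exact add_nonneg h h'
    exact h1 _ hd
  have heq : 0 = G.ε (indQ i X (dfct x X) m1 m) + (G.ε (G.dm i (G.act x⁻¹ G.ρ)) + 2 * ζ) *
      X.bq ((X.bL ^ j) (bmap (dd X i) ((X.ind i).bmk m))) (bmap (dd X i) ((X.ind i).bmk m)) := by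
    have h1 : (X.ind i).bq (X.bLz i ζ y1) ((X.ind i).bmk m) = 0 := by
      rw [hy1, ← Module.End.mul_apply, ← pow_succ', hy0, map_zero, LinearMap.zero_apply]
    have h2 : X.bq ((X.bL ^ j) (bmap (dd X i) ((X.ind i).bmk m))) (bmap (dd X i) ((X.ind i).bmk m)) =
        X.bq (bmap (dd X i) y1) (bmap (dd X i) ((X.ind i).bmk m)) := by
      rw [← bL_dd_pow ζ]
    have h3 : (X.ind i).bq (bmap (mid X i (G.α i)) y1) ((X.ind i).bmk m) =
        2 * X.bq (bmap (dd X i) y1) (bmap (dd X i) ((X.ind i).bmk m)) := by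
      rw [bmid_eq, form_dd_bar]
    have h4 : (X.ind i).bq ((X.ind i).bL y1) ((X.ind i).bmk m) = G.ε (indQ i X (dfct x X) m1 m) +
        G.ε (G.dm i (G.act x⁻¹ G.ρ)) * X.bq (bmap (dd X i) y1) (bmap (dd X i) ((X.ind i).bmk m)) := by
      have h5 := congrArg G.ε (dfct_ind x X i m1 m)
      rw [dfct, map_sub, map_mul, eps_lin (G.act_lin _ _ G.ρ_mem), zero_mul, sub_zero, map_add,
        map_mul] at h5
      rw [← hm1, bL, bmap_mk, bmap_mk, bmap_mk, bq_mk, bq_mk, h5]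
    rw [bLz, LinearMap.add_apply, LinearMap.smul_apply, map_add, map_smul, LinearMap.add_apply,
      LinearMap.smul_apply, h3, h4, smul_eq_mul] at h1
    rw [h2]; linear_combination - h1
  have hpos : 0 < G.ε (G.dm i (G.act x⁻¹ G.ρ)) + 2 * ζ := by
    have := G.rho_pos x i hxi; positivity
  have h0 : bmap (dd X i) ((X.ind i).bmk m) = 0 := by
    by_contra hne
    have h5 := hr j _ hddy hne hdd0
    have h6 := mul_pos hpos h5
    have h7 := congrArg (fun r => sg (cs.length x - j) * r) heq
    simp only [mul_zero, mul_add] at h7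
    nlinarith
  obtain ⟨u, hu⟩ := bdd_exact _ h0
  rw [← hu] at hy hy0 ⊢
  rw [bL_io_pow] at hy0
  have h8 := bio_inj (hy0.trans (map_zero _).symm)
  have h9 : X.bD u = (-((j + 2 : ℕ) : ℤ)) • u := by
    apply bio_inj (i := i)
    have := (isHom_io (i := i)).bar_D u
    rw [hy] at this
    rw [map_zsmul, ← sub_eq_iff_eq_add.2 this]; push_cast; module
  have h10 := hr.hl (j + 2) u h9 (by rw [pow_succ', Module.End.mul_apply, h8, map_zero])
  rw [h10, map_zero]

/-- The Hodge–Riemann relations for `X B_s`. -/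
theorem HR.ind (hr : HR X.bD X.bL X.bq (cs.length x)) (hd : DD x X)
    (hxi : cs.length x < cs.length (x * cs.simple i))
    (hZ : ∀ z (Z : SObj G), KL z Z → cs.length z < cs.length x → ∀ ζ : ℝ, 0 ≤ ζ →
      HRw (Z.ind i).bD (Z.bLz i ζ) (Z.ind i).bq (cs.length z + 1)) {ζ : ℝ} (hζ : 0 ≤ ζ) :
    HR (X.ind i).bD (X.bLz i ζ) (X.ind i).bq (cs.length x + 1) := by
  have e : (X.ind i).bL = X.bLz i 0 := by rw [bLz, zero_smul, add_zero]
  refine HR.of_extension (j := bmap (io X i)) lef lef hr bdd_surj bio_inj bdd_exact bdd_bio bmid_eq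
    (fun y => ?_) (fun u => ?_) form_dd_bar (fun y => ?_) (fun u => ?_) (fun ζ' hζ' => ?_) hζ
  · rw [e, bL_dd]
  · rw [e, bL_io]
  · simpa using isHom_dd.bar_D y
  · simpa using isHom_io.bar_D u
  · exact HL.ind hr hd hxi hζ' fun z Z hz hl => hZ z Z hz hl ζ' hζ'

end SObj

end KLPos

namespace KLPos

section

variable {V : Type} [AddCommGroup V] [Module ℝ V] {D L : V →ₗ[ℝ] V} {Q : V →ₗ[ℝ] V →ₗ[ℝ] ℝ}

lemma Lef.eq_zero_of_deg (h : Lef D L Q) {i : ℤ} {x : V} (hx : D x = i • x)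
    (h0 : ∀ y, D y = (-i) • y → Q x y = 0) : x = 0 := by
  refine h.nondeg _ fun y => ?_
  have hy : y ∈ Submodule.span ℝ {x | ∃ d : ℤ, D x = d • x} := by rw [h.span]; trivial
  induction hy using Submodule.span_induction with
  | mem y hy =>
    obtain ⟨d, hd⟩ := hy
    by_cases hdi : d = -i
    · exact h0 y (by rw [hd, hdi])
    · exact form_eq_zero_of_deg h.skew hx hd (by omega)
  | zero => exact map_zero _
  | add y y' _ _ h1 h2 => rw [map_add, h1, h2, add_zero]
  | smul a y _ h1 => rw [map_smul, h1, smul_zero]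

/-- The hard Lefschetz isomorphism is surjective. -/
lemma Lef.exists_pow_eq [FiniteDimensional ℝ V] (h : Lef D L Q) (hl : HL D L) (i : ℕ) {y : V}
    (hy : D y = (i : ℤ) • y) : ∃ x, D x = (-(i : ℤ)) • x ∧ (L ^ i) x = y := by
  let P : Submodule ℝ V := LinearMap.ker (D + (i : ℝ) • LinearMap.id)
  have hP : ∀ x, x ∈ P ↔ D x = (-(i : ℤ)) • x := fun x => by
    rw [LinearMap.mem_ker, LinearMap.add_apply, LinearMap.smul_apply, LinearMap.id_apply,
      add_eq_zero_iff_eq_neg, neg_smul, natCast_zsmul, ← Nat.cast_smul_eq_nsmul ℝ]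
  let φ : P →ₗ[ℝ] Module.Dual ℝ P := Q.compl₁₂ ((L ^ i) ∘ₗ P.subtype) P.subtype
  have hφ : Function.Injective φ := by
    rw [← LinearMap.ker_eq_bot, LinearMap.ker_eq_bot']
    intro x hx
    exact Subtype.ext (h.lform_nondeg hl i ((hP _).1 x.2) fun y hy =>
      LinearMap.congr_fun hx ⟨y, (hP _).2 hy⟩)
  obtain ⟨x, hx⟩ := (LinearMap.injective_iff_surjective_of_finrank_eq_finrank
    (Subspace.dual_finrank_eq (K := ℝ) (V := P)).symm).1 hφ ((Q y) ∘ₗ P.subtype)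
  have hxD := (hP _).1 x.2
  refine ⟨x, hxD, sub_eq_zero.1 (h.eq_zero_of_deg (i := i) ?_ fun z hz => ?_)⟩
  · rw [map_sub, hy, deg_pow h.deg hxD i, smul_sub]
    congr 2; ring
  · rw [map_sub, LinearMap.sub_apply, sub_eq_zero]
    exact LinearMap.congr_fun hx ⟨z, (hP _).2 hz⟩

end

variable {B W : Type} [Group W] {M : CoxeterMatrix B} {cs : CoxeterSystem M W}
  {R : Type} [CommRing R] [Algebra ℝ R]

namespace SObj

variable {G : Realization cs R} [IsDomain R] {X Y Z N E U : SObj G} {i : B} {x z u : W}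

lemma IsHom.bL_pow {k : ℤ} {f : X →ₗ[R] Y} (h : IsHom k f) (j : ℕ) (y : X.Bar) :
    bmap f ((X.bL ^ j) y) = (Y.bL ^ j) (bmap f y) := by
  induction j with
  | zero => rfl
  | succ j ih =>
    rw [pow_succ', pow_succ', Module.End.mul_apply, Module.End.mul_apply, ← ih]
    exact h.bar_l _ _

lemma Good.bmk_ne {ct cb : X} (h : Good x X ct cb) : X.bmk ct ≠ 0 := fun h0 => by
  have := bmk_eq_zero.1 h0 cb
  rw [h.form_ct, map_one] at this
  exact one_ne_zero this

lemma bD_bmk_hg {d : ℤ} {m : X} (h : X.Hg d m) : X.bD (X.bmk m) = d • X.bmk m := by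
  rw [bD_mk, h, map_zsmul]

lemma bL_bmk_Ga {c : X} (hc : c ∈ X.Ga x) : X.bL (X.bmk c) = 0 := by
  rw [bL, bmap_mk, hc, bmk_smul, eps_lin (G.act_lin _ _ G.ρ_mem), zero_smul]

/-- A stalk element of minimal degree splits off an indecomposable object. -/
theorem split_pos {ct cb : U} (hU : Good u U ct cb) (hL : LL U u ct)
    (hr : HR U.bD U.bL U.bq (cs.length u)) (hE : E.Nice) {m : ℤ} (hrE : HR E.bD E.bL E.bq m) {c : E}
    (hc : c ∈ E.Ga u) (hcd : E.Hg (cs.length u) c) (hc0 : E.bmk c ≠ 0) :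
    ∃ (g : U →ₗ[R] E) (g' : E →ₗ[R] U) (a : ℝ), IsHom 0 g ∧ IsAdj g g' ∧ g ct = c ∧
      (∀ m, g' (g m) = a • m) ∧ 0 < a * sg (m - cs.length u) := by
  obtain ⟨τ, hτ, hτc⟩ := hL E hE c hc _ hcd
  rw [sub_self] at hτ
  obtain ⟨g, hg⟩ := exists_adj τ
  have hgh : IsHom 0 g := hτ.adj hg
  have hgc : g ct = c := eq_of_form' fun n => by rw [hg.symm, hτc]
  obtain ⟨a, ha⟩ := hU.hom_scalar (f := τ ∘ₗ g) (by simpa using hgh.comp hτ)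
  refine ⟨g, τ, a, hgh, hg.symm, hgc, ha, ?_⟩
  obtain ⟨p, hp, hpt⟩ := lef.exists_pow_eq hr.hl (cs.length u) (bD_bmk_hg hU.hg_ct)
  have hp1 : (U.bL ^ (cs.length u + 1)) p = 0 := by
    rw [pow_succ', Module.End.mul_apply, hpt, bL_bmk_Ga hU.mem]
  have hp0 : p ≠ 0 := fun h0 => hU.bmk_ne (by rw [← hpt, h0, map_zero])
  have hgp : (E.bL ^ cs.length u) (bmap g p) = E.bmk c := by
    rw [← hgh.bL_pow, hpt, bmap_mk, hgc]
  have h1 := hr _ p hp hp0 hp1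
  have h2 := hrE (cs.length u) (bmap g p) (by rw [hgh.bar_D, hp, zero_smul, add_zero, map_zsmul])
    (fun h0 => hc0 (by rw [← hgp, h0, map_zero])) (by rw [← hgh.bL_pow, hp1, map_zero])
  have h3 : bmap τ (bmap g p) = a • p := by
    obtain ⟨n, rfl⟩ := U.bmk_surjective p
    rw [bmap_mk, bmap_mk, ← map_smul, ← ha]; rfl
  rw [← hgh.bL_pow, hg.symm.bar, h3, map_smul, smul_eq_mul] at h2
  rw [sub_self, sg_zero, one_mul] at h1
  exact (mul_pos_iff_of_pos_right h1).1 (by linarith)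

/-- Indecomposable objects attached to the same element are isomorphic. -/
theorem KL.iso {X' : SObj G} (h : KL x X) (h' : KL x X') : ∃ (g : X →ₗ[R] X') (g' : X' →ₗ[R] X)
    (a : ℝ), IsHom 0 g ∧ IsAdj g g' ∧ 0 < a ∧ (∀ m, g' (g m) = a • m) ∧ ∀ m, g (g' m) = a • m := by
  obtain ⟨ct, cb, h1, h2, h3⟩ := h
  obtain ⟨ct', cb', h1', h2', h3'⟩ := h'
  obtain ⟨g, g', a, hg, hgg, hgc, ha, hpos⟩ := split_pos h1 h2 h3 h1'.nice h3' h1'.mem h1'.hg_ct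
    h1'.bmk_ne
  rw [sub_self, sg_zero, mul_one] at hpos
  obtain ⟨a', ha'⟩ := h1'.hom_scalar (f := g ∘ₗ g') (by simpa using (hg.adj hgg).comp hg)
  refine ⟨g, g', a, hg, hgg, hpos, ha, fun m => ?_⟩
  have h4 : a' = a := by
    have e := ha' (g ct)
    rw [LinearMap.comp_apply, ha, LinearMap.map_smul_of_tower, ← sub_eq_zero, ← sub_smul, hgc] at e
    by_contra hne
    exact h1'.ct_ne (real_smul_cancel e (sub_ne_zero.2 (Ne.symm hne)))
  rw [← h4]; exact ha' m

end SObj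

end KLPos

namespace KLPos

variable {B W : Type} [Group W] {M : CoxeterMatrix B} {cs : CoxeterSystem M W}
  {R : Type} [CommRing R] [Algebra ℝ R]

namespace SObj

variable {G : Realization cs R} [IsDomain R] {X Y Z N E U : SObj G} {i : B} {x y z u : W}

/-- Composition of retracts. -/
noncomputable def Retract.trans (T : Retract E X) (S : Retract X Y) : Retract E Y where
  inc := S.inc ∘ₗ T.inc
  pro := T.pro ∘ₗ S.pro
  isHom_inc := by simpa using T.isHom_inc.comp S.isHom_inc
  isHom_pro := by simpa using S.isHom_pro.comp T.isHom_pro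
  adj := T.adj.comp S.adj
  pro_inc m := by simp [S.pro_inc, T.pro_inc]

lemma Retract.inc_inj (T : Retract E X) : Function.Injective T.inc :=
  Function.LeftInverse.injective T.pro_inc

lemma Retract.bar_pro_inc (T : Retract E X) (m : E.Bar) : bmap T.pro (bmap T.inc m) = m := by
  obtain ⟨m, rfl⟩ := E.bmk_surjective m
  rw [bmap_mk, bmap_mk, T.pro_inc]

lemma HR.retract (T : Retract E X) {l : ℤ} (h : HR X.bD X.bL X.bq l) : HR E.bD E.bL E.bq l := by
  refine h.transfer (bmap T.inc) (Function.LeftInverse.injective T.bar_pro_inc)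
    (fun x => T.isHom_inc.bar_l _ _) (fun x => ?_) one_pos fun x y => ?_
  · rw [T.isHom_inc.bar_D, zero_smul, add_zero]
  · rw [T.adj.bar, T.bar_pro_inc, one_mul]

lemma Nice.bmk_ne (h : X.Nice) (hlow : ∀ d, ∀ c ∈ X.Ga u, X.Hg d c → c ≠ 0 → cs.length u ≤ d) {c : X}
    (hc : c ∈ X.Ga u) (hcd : X.Hg (cs.length u) c) (h0 : c ≠ 0) : X.bmk c ≠ 0 := by
  intro hb
  obtain ⟨ι, _, d, e, n, h1, h2⟩ := h.db u
  refine h0 ((h2 c hc).trans (Finset.sum_eq_zero fun j _ => ?_))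
  by_cases he : e j = 0
  · rw [he, smul_zero]
  by_cases hf : X.form c (n j) = 0
  · rw [hf, zero_smul]
  have hd := hlow _ _ (h1 j).1 (h1 j).2.1 he
  have h3 := form_hg hcd (h1 j).2.2
  have h4 := (Good.eu_int h3 hf).1
  rw [show (cs.length u : ℤ) + -d j = 0 by omega, zero_smul] at h3
  rw [G.eu_const _ h3, bmk_eq_zero.1 hb, map_zero, zero_smul]

section Facts

variable {ct cb : X}

lemma Hg.sn {d : ℤ} {m : X.ind i} (h : (X.ind i).Hg d m) : X.Hg (d - 1) (SObj.sn m) :=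
  (hg_ind_iff.1 h).2

lemma length_mul_of_lt (h : cs.length y < cs.length (y * cs.simple i)) :
    cs.length (y * cs.simple i) = cs.length y + 1 := by
  rcases cs.length_mul_simple y i with h | h <;> omega

lemma ss (y : W) (i : B) : y * cs.simple i * cs.simple i = y := by simp [mul_assoc]

lemma Good.ind_le_aux (h : Good x X ct cb) (hx : cs.length x < cs.length (x * cs.simple i))
    (hy : cs.length y < cs.length (y * cs.simple i)) {d : ℤ} {n : X} (hn : X.Ga2 i y n)
    (hd : X.Hg (d - 1) n) (h0 : n ≠ 0) : cs.length (y * cs.simple i) ≤ d := by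
  have hl := length_mul_of_lt hy
  by_cases hu : up i (y * cs.simple i) n = 0
  · have h1 := (h.length_le (mem_Ga_of_up_eq_zero hn hu) hd h0).1
    omega
  · have hd' := hd.up i (y * cs.simple i)
    obtain ⟨h1, h2⟩ := h.length_le (up_mem hn.mul_simple) hd' hu
    by_contra hlt
    have h3 := h2 (by omega)
    rw [← h3, ss] at hx
    omega

lemma Good.ind_le (h : Good x X ct cb) (hx : cs.length x < cs.length (x * cs.simple i)) {d : ℤ}
    {c : X.ind i} (hc : c ∈ (X.ind i).Ga y) (hd : (X.ind i).Hg d c) (h0 : c ≠ 0) :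
    cs.length y ≤ d := by
  obtain ⟨h1, h2⟩ := mem_Ga_ind.1 hc
  have hn : sn c ≠ 0 := fun hn => h0 (by rw [h2, hn]; exact ind_ext (by simp [Jn]) (by simp))
  rcases length_lt_or y i with hy | hy
  · have := h.ind_le_aux hx hy h1 hd.sn hn
    omega
  · have := h.ind_le_aux hx (y := y * cs.simple i) (by rwa [ss]) h1.mul_simple hd.sn hn
    rwa [ss] at this

lemma Good.ind_zero_aux (h : Good x X ct cb) (hl : cs.length x < cs.length (y * cs.simple i))
    {n : X} (hn : X.Ga2 i y n) (hlx : cs.length x ≤ cs.length y) (hyx : y ≠ x) : n = 0 := by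
  have h1 : up i (y * cs.simple i) n = 0 :=
    h.zero _ (fun he => by rw [he] at hl; omega) hl.le _ (up_mem hn.mul_simple)
  exact h.zero y hyx hlx _ (mem_Ga_of_up_eq_zero hn h1)

lemma Good.ind_zero (h : Good x X ct cb) (hx : cs.length x < cs.length (x * cs.simple i))
    (hy : y ≠ x * cs.simple i) (hl : cs.length (x * cs.simple i) ≤ cs.length y)
    {c : X.ind i} (hc : c ∈ (X.ind i).Ga y) : c = 0 := by
  obtain ⟨h1, h2⟩ := mem_Ga_ind.1 hc
  have hn : sn c = 0 := by
    rcases length_lt_or (cs := cs) y i with hy' | hy'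
    · exact h.ind_zero_aux (by omega) h1 (by omega) fun he => by rw [he] at hl; omega
    · have := length_mul_of_lt (y := y * cs.simple i) (i := i) (by rwa [ss])
      rw [ss] at this
      exact h.ind_zero_aux (y := y * cs.simple i) (by rw [ss]; omega) h1.mul_simple (by omega)
        fun he => hy (by rw [← he, ss])
  rw [h2, hn]; exact ind_ext (by simp [Jn]) (by simp)

lemma Good.ind_gen (h : Good x X ct cb) (hx : cs.length x < cs.length (x * cs.simple i))
    {c : X.ind i} (hc : c ∈ (X.ind i).Ga (x * cs.simple i)) :
    ∃ r : R, c = r • Jn i (x * cs.simple i) ct := by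
  obtain ⟨h1, h2⟩ := mem_Ga_ind.1 hc
  have hu : up i (x * cs.simple i) (sn c) = 0 :=
    h.zero _ (fun he => by rw [he] at hx; omega) hx.le _ (up_mem h1)
  have h3 := h1.mul_simple
  rw [ss] at h3
  obtain ⟨r, hr⟩ := h.gen _ (mem_Ga_of_up_eq_zero h3 hu)
  refine ⟨G.act (x * cs.simple i)⁻¹ (G.act x r), ?_⟩
  rw [smul_Jn (Ga2.of_Ga h.mem).mul_simple, G.act_act_inv, h2, hr, h.mem, G.act_inv_act]

lemma Good.ind_top (h : Good x X ct cb) (hx : cs.length x < cs.length (x * cs.simple i)) :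
    Jn i (x * cs.simple i) ct ∈ (X.ind i).Ga (x * cs.simple i) ∧
    (X.ind i).Hg (cs.length (x * cs.simple i)) (Jn i (x * cs.simple i) ct) ∧
    (X.ind i).Hg (-cs.length (x * cs.simple i)) (tm i ((-1 / 2 : ℝ) • cb) 0) ∧
    (X.ind i).form (Jn i (x * cs.simple i) ct) (tm i ((-1 / 2 : ℝ) • cb) 0) = 1 := by
  have hl := length_mul_of_lt hx
  refine ⟨Jn_mem (Ga2.of_Ga h.mem).mul_simple, ?_, ?_, ?_⟩
  · rw [hl]; push_cast; exact h.hg_ct.Jn i _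
  · refine Hg.tm (Hg.real ?_ _) (Hg.zero _)
    rw [hl]; push_cast
    convert h.hg_cb using 1; ring
  · rw [form_Jn_upper h.mem, fs_tm, sn_tm, map_zero, mul_zero, sub_zero, real_smul_def, map_smul,
      h.form_ct, smul_eq_mul, mul_one, Realization.sa, AlgEquiv.commutes, ← map_ofNat (algebraMap ℝ R) 2,
      ← map_neg, ← map_mul]
    norm_num

end Facts

end SObj

end KLPos

namespace KLPos

variable {B W : Type} [Group W] {M : CoxeterMatrix B} {cs : CoxeterSystem M W}
  {R : Type} [CommRing R] [Algebra ℝ R]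

namespace SObj

variable {G : Realization cs R} [IsDomain R] {X Y Z N E U : SObj G} {i : B} {x y z u w : W}

/-- Signed orthogonal decomposition into an indecomposable object attached to `w` and smaller
indecomposable objects. -/
inductive SDec (w : W) : SObj G → Prop
  | top (E : SObj G) : KL w E → SDec w E
  | step (E U E' : SObj G) (u : W) (κ : ℝ) (g : U →ₗ[R] E) (g' : E →ₗ[R] U) (T : Retract E' E) :
      KL u U → cs.length u < cs.length w → IsHom 0 g → IsAdj g g' →
      0 < κ * sg (cs.length w - cs.length u) → (∀ m, κ • g' (g m) = m) →
      (∀ m, T.inc (T.pro m) + κ • g (g' m) = m) → SDec w E' → SDec w E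

lemma sg_inv_pos {a b : ℝ} (h : 0 < a * b) : 0 < a⁻¹ * b := by
  have ha : a ≠ 0 := fun h0 => by rw [h0, zero_mul] at h; exact lt_irrefl _ h
  have : a⁻¹ * b = (a * b) * (a⁻¹) ^ 2 := by field_simp
  rw [this]; positivity

/-- The complement of a split summand. -/
lemma exists_compl {g : U →ₗ[R] E} {g' : E →ₗ[R] U} (hg : IsHom 0 g) (ha : IsAdj g g') {κ : ℝ}
    (h : ∀ m, κ • g' (g m) = m) :
    ∃ (E' : SObj G) (T : Retract E' E), ∀ m, T.inc (T.pro m) + κ • g (g' m) = m := by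
  have h0 : IsHom 0 (LinearMap.id - κ • (g ∘ₗ g')) :=
    IsHom.id.sub (IsHom.smul (by simpa using (hg.adj ha).comp hg) κ)
  have hs : IsAdj (LinearMap.id - κ • (g ∘ₗ g')) (LinearMap.id - κ • (g ∘ₗ g')) :=
    IsAdj.id.sub (IsAdj.smul (ha.symm.comp ha) κ)
  have he : (LinearMap.id - κ • (g ∘ₗ g')) ∘ₗ (LinearMap.id - κ • (g ∘ₗ g')) =
      LinearMap.id - κ • (g ∘ₗ g') := by
    ext m
    simp only [LinearMap.comp_apply, LinearMap.sub_apply, LinearMap.id_apply, LinearMap.smul_apply,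
      map_sub, LinearMap.map_smul_of_tower, h]
    rw [sub_self, sub_zero]
  refine ⟨E.cut _ h0 hs he, ⟨cutI h0 hs he, cutP h0 hs he, isHom_cutI h0 hs he, isHom_cutP h0 hs he,
    isAdj_cut h0 hs he, cutP_cutI h0 hs he⟩, fun m => ?_⟩
  rw [cutI_cutP]
  simp

lemma compl_pro_inc {g : U →ₗ[R] E} {g' : E →ₗ[R] U} {κ : ℝ} (h : ∀ m, κ • g' (g m) = m)
    {E' : SObj G} (T : Retract E' E) (hT : ∀ m, T.inc (T.pro m) + κ • g (g' m) = m) (m : E') :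
    g' (T.inc m) = 0 := by
  have h1 := hT (T.inc m)
  rw [T.pro_inc, add_eq_left] at h1
  have h2 := congrArg g' h1
  rw [LinearMap.map_smul_of_tower, h, map_zero] at h2
  exact h2

/-- Splitting `X B_s` into indecomposable objects. -/
theorem SDec.of_retract {ct cb : X} (h : Good x X ct cb) (hL : LL X x ct)
    (hx : cs.length x < cs.length (x * cs.simple i))
    (hr : HR (X.ind i).bD (X.ind i).bL (X.ind i).bq (cs.length x + 1))
    (hex : ∀ u, cs.length u ≤ cs.length x → ∃ U : SObj G, KL u U) :
    ∀ (n : ℕ) (E : SObj G), Module.finrank ℝ E.Bar = n → ∀ (T : Retract E (X.ind i)) (ce : E),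
      T.inc ce = Jn i (x * cs.simple i) ct → SDec (x * cs.simple i) E := by
  intro n
  induction n using Nat.strong_induction_on with
  | _ n ih =>
  intro E hn T ce hce
  have hl := length_mul_of_lt hx
  have hnE : E.Nice := (h.nice.ind i).retract T
  have hrE : HR E.bD E.bL E.bq (cs.length (x * cs.simple i)) := by
    rw [hl]; push_cast; exact HR.retract T hr
  have hlow : ∀ y d, ∀ c ∈ E.Ga y, E.Hg d c → c ≠ 0 → cs.length y ≤ d := fun y d c hc hd h0 =>
    h.ind_le hx (T.isHom_inc.map_Ga hc) (T.isHom_inc.hg0 hd) fun he => h0 (T.inc_inj (by rw [he, map_zero]))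
  have hzero : ∀ y, y ≠ x * cs.simple i → cs.length (x * cs.simple i) ≤ cs.length y → ∀ c ∈ E.Ga y,
      c = 0 := fun y hy hly c hc => T.inc_inj (by
    rw [map_zero]; exact h.ind_zero hx hy hly (T.isHom_inc.map_Ga hc))
  obtain ⟨t1, t2, t3, t4⟩ := h.ind_top hx
  have hcp : ce = T.pro (Jn i (x * cs.simple i) ct) := by rw [← hce, T.pro_inc]
  have hcem : ce ∈ E.Ga (x * cs.simple i) := by rw [hcp]; exact T.isHom_pro.map_Ga t1
  by_cases hsp : ∃ u, u ≠ x * cs.simple i ∧ ∃ c ∈ E.Ga u, E.Hg (cs.length u) c ∧ c ≠ 0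
  · obtain ⟨u, hu, c, hc, hcd, hc0⟩ := hsp
    have hlu : cs.length u < cs.length (x * cs.simple i) := by
      by_contra hlt
      exact hc0 (hzero u hu (by omega) c hc)
    obtain ⟨U, hU⟩ := hex u (by omega)
    have hU' := hU
    obtain ⟨ut, ub, hU1, hU2, hU3⟩ := hU'
    have hcb := hnE.bmk_ne (hlow u) hc hcd hc0
    obtain ⟨g, g', a, hg, hgg, hgc, hga, hpos⟩ := split_pos hU1 hU2 hU3 hnE hrE hc hcd hcb
    have ha : a ≠ 0 := fun h0 => by rw [h0, zero_mul] at hpos; exact lt_irrefl _ hpos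
    have hκ : ∀ m, a⁻¹ • g' (g m) = m := fun m => by rw [hga, inv_smul_smul₀ ha]
    obtain ⟨E', S, hS⟩ := exists_compl hg hgg hκ
    have hS' := compl_pro_inc hκ S hS
    refine SDec.step E U E' u a⁻¹ g g' S hU hlu hg hgg (sg_inv_pos hpos) hκ hS ?_
    refine ih (Module.finrank ℝ E'.Bar) ?_ E' rfl (S.trans T) (S.pro ce) ?_
    · rw [← hn]
      have hinj : Function.Injective (bmap S.inc) := Function.LeftInverse.injective S.bar_pro_inc
      refine lt_of_le_of_ne (LinearMap.finrank_le_finrank_of_injective hinj) fun heq => ?_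
      obtain ⟨m, hm⟩ := (LinearMap.injective_iff_surjective_of_finrank_eq_finrank heq).1 hinj
        (E.bmk c)
      obtain ⟨m, rfl⟩ := E'.bmk_surjective m
      have h1 := congrArg (bmap g') hm
      rw [bmap_mk, bmap_mk, hS', map_zero, bmap_mk, ← hgc, hga, map_smul] at h1
      exact hU1.bmk_ne ((smul_eq_zero.1 h1.symm).resolve_left ha)
    · have h1 := hS ce
      have h2 : g' ce = 0 := by
        by_contra hne
        have := hU1.length_le' ((hg.adj hgg).map_Ga hcem) hne
        omega
      rw [h2, map_zero, smul_zero, add_zero] at h1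
      change T.inc (S.inc (S.pro ce)) = _
      rw [h1, hce]
  · refine SDec.top E ⟨ce, T.pro (tm i ((-1 / 2 : ℝ) • cb) 0), ⟨hnE, hcem, ?_, ?_, ?_, ?_, ?_, hzero⟩,
      (hL.ind h.mem hx).retract T hce, hrE⟩
    · rw [hcp]; exact T.isHom_pro.hg0 t2
    · exact T.isHom_pro.hg0 t3
    · rw [← T.adj, hce, t4]
    · intro c hc
      obtain ⟨r, hr⟩ := h.ind_gen hx (T.isHom_inc.map_Ga hc)
      exact ⟨r, T.inc_inj (by rw [hr, map_smul, hce])⟩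
    · intro y hy d c hc hd h0
      refine lt_of_le_of_ne (hlow y d c hc hd h0) fun he => hsp ⟨y, hy, c, hc, by rwa [he], h0⟩

theorem SDec.of_ind (h : KL x X) (hx : cs.length x < cs.length (x * cs.simple i))
    (hr : HR (X.ind i).bD (X.ind i).bL (X.ind i).bq (cs.length x + 1))
    (hex : ∀ u, cs.length u ≤ cs.length x → ∃ U : SObj G, KL u U) :
    SDec (x * cs.simple i) (X.ind i) := by
  obtain ⟨ct, cb, h1, h2, -⟩ := h
  exact SDec.of_retract h1 h2 hx hr hex _ _ rfl ⟨LinearMap.id, LinearMap.id, IsHom.id, IsHom.id,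
    IsAdj.id, fun _ => rfl⟩ _ rfl

lemma SDec.exists_top (h : SDec w X) : ∃ E : SObj G, KL w E ∧ Nonempty (Retract E X) := by
  induction h with
  | top E h => exact ⟨E, h, ⟨⟨LinearMap.id, LinearMap.id, IsHom.id, IsHom.id, IsAdj.id, fun _ => rfl⟩⟩⟩
  | step E U E' u κ g g' T hU hl hg ha hκ h1 h2 h3 ih =>
    obtain ⟨E0, h0, ⟨S⟩⟩ := ih
    exact ⟨E0, h0, ⟨S.trans T⟩⟩

lemma SDec.form_mem (h : SDec w X) : ∀ {Y : SObj G} {k : ℤ} {f : Y →ₗ[R] X} {κ : ℝ} {n : ℤ},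
    IsHom k f → 0 < κ * sg (n - cs.length w) → cs.length w ≤ n →
    (fun m m' => κ • X.form (f m) (f m')) ∈ PosQ k n Y := by
  induction h with
  | top E h =>
    intro Y k f κ n hf hκ hn
    exact AddSubmonoid.subset_closure ⟨w, E, κ, f, h, hn, hf, hκ, rfl⟩
  | step E U E' u a g g' T hU hl hg ha hκ h1 h2 h3 ih =>
    intro Y k f κ n hf hκ' hn
    have e : (fun m m' => κ • E.form (f m) (f m')) =
        (fun m m' => κ • E'.form ((T.pro ∘ₗ f) m) ((T.pro ∘ₗ f) m')) +
        fun m m' => (κ * a) • U.form ((g' ∘ₗ f) m) ((g' ∘ₗ f) m') := by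
      ext m m'
      simp only [Pi.add_apply, LinearMap.comp_apply]
      conv_lhs => rw [← h2 (f m')]
      rw [map_add, LinearMap.map_smul_of_tower, smul_add, T.adj.symm, ha.symm, mul_smul]
    rw [e]
    refine add_mem (ih (by simpa using hf.comp T.isHom_pro) hκ' hn) (AddSubmonoid.subset_closure
      ⟨u, U, κ * a, g' ∘ₗ f, hU, by omega, by simpa using hf.comp (hg.adj ha), ?_, rfl⟩)
    have := sg_pos_trans hκ' hκ
    rwa [show n - cs.length w + (cs.length w - cs.length u) = n - cs.length u by ring] at this

lemma SDec.hom_eq_zero (h : SDec w X) {ct cb : Y} (hY : Good y Y ct cb)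
    (hl : cs.length w < cs.length y) : ∀ {f : Y →ₗ[R] X}, IsHom 0 f → f = 0 := by
  induction h with
  | top E h =>
    intro f hf
    obtain ⟨et, eb, hE, -⟩ := h
    exact hY.hom_ne hE hf fun he => by rw [he] at hl; omega
  | step E U E' u a g g' T hU hlu hg ha hκ h1 h2 h3 ih =>
    intro f hf
    obtain ⟨et, eb, hE, -⟩ := hU
    have e1 : g' ∘ₗ f = 0 := hY.hom_ne hE (by simpa using hf.comp (hg.adj ha)) fun he => by
      rw [he] at hl; omega
    have e2 : T.pro ∘ₗ f = 0 := ih (by simpa using hf.comp T.isHom_pro)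
    ext m
    have e3 : T.pro (f m) = 0 := LinearMap.congr_fun e2 m
    have e4 : g' (f m) = 0 := LinearMap.congr_fun e1 m
    rw [← h2 (f m), e3, e4]
    simp

end SObj

end KLPos

namespace KLPos

variable {B W : Type} [Group W] {M : CoxeterMatrix B} {cs : CoxeterSystem M W}
  {R : Type} [CommRing R] [Algebra ℝ R]

namespace SObj

variable {G : Realization cs R} [IsDomain R] {X Y Z N E U : SObj G} {i : B} {x y z u w : W}

lemma unit_form (m n : unit G) : (unit G).form m n = (show R from m) * (show R from n) := rfl

lemma Ga_unit (hy : y ≠ 1) {m : unit G} (hm : m ∈ (unit G).Ga y) : m = 0 := by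
  obtain ⟨r, -, hr⟩ := exists_act_ne G hy
  rw [inv_one, G.act_one] at hr
  have h1 := hm r
  change r * (show R from m) = G.act y⁻¹ r * (show R from m) at h1
  exact (mul_eq_zero.1 (show (r - G.act y⁻¹ r) * (show R from m) = 0 by rw [sub_mul, h1, sub_self])
    ).resolve_left (sub_ne_zero.2 (sub_ne_zero.1 hr).symm)

lemma good_unit : Good (1 : W) (unit G) (1 : R) (1 : R) where
  nice := nice_unit
  mem r := by
    rw [inv_one, G.act_one]; rfl
  hg_ct := by
    rw [cs.length_one]
    have h : G.eu 1 = 0 := by simpa using G.eu_algebraMap 1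
    simp only [Nat.cast_zero]
    exact h.trans (zero_smul ℤ (1 : R)).symm
  hg_cb := by
    rw [cs.length_one]
    have h : G.eu 1 = 0 := by simpa using G.eu_algebraMap 1
    simp only [Nat.cast_zero, neg_zero]
    exact h.trans (zero_smul ℤ (1 : R)).symm
  form_ct := one_mul (1 : R)
  gen c _ := ⟨c, (mul_one (show R from c)).symm⟩
  low y hy d c hc _ h0 := absurd (Ga_unit hy hc) h0
  zero y hy _ c hc := Ga_unit hy hc

lemma hr_unit : HR (unit G).bD (unit G).bL (unit G).bq 0 := by
  intro j y hy h0 hL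
  obtain ⟨m, rfl⟩ := (unit G).bmk_surjective y
  have hm : G.ε m ≠ 0 := fun h => h0 (bmk_eq_zero.2 fun n => by
    rw [unit_form, map_mul]; exact (congrArg (· * _) h).trans (zero_mul _))
  rw [bD_mk] at hy
  have h1 : (unit G).bmk ((unit G).D m + (j : ℤ) • m) = 0 := by
    rw [map_add, hy, map_zsmul, neg_smul, neg_add_cancel]
  have h2 := bmk_eq_zero.1 h1 (1 : R)
  obtain ⟨r, rfl⟩ : ∃ r : R, (show unit G from r) = m := ⟨m, rfl⟩
  have h3 : G.ε (G.eu r + (j : ℤ) • r) = 0 := (congrArg G.ε (mul_one _).symm).trans h2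
  rw [map_add, G.ε_eu, zero_add, map_zsmul, zsmul_eq_mul] at h3
  have hj : j = 0 := by
    have := (mul_eq_zero.1 h3).resolve_right hm
    exact_mod_cast this
  subst hj
  simp only [pow_zero, Module.End.one_apply, Nat.cast_zero, sub_zero, sg_zero, one_mul]
  exact (mul_self_pos.2 hm).trans_eq (map_mul G.ε r r).symm

lemma KL_unit : KL 1 (unit G) := ⟨(1 : R), (1 : R), good_unit, LL_unit, by
  rw [cs.length_one]; exact hr_unit⟩

lemma DD_unit : DD 1 (unit G) := by
  have : dfct 1 (unit G) = 0 := by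
    ext m n
    change (G.ρ * (show R from m)) * (show R from n) - G.act _ _ * ((show R from m) * (show R from n)) = 0
    rw [inv_one, G.act_one]; ring
  rw [DD, this]; exact zero_mem _

lemma DD.iso (h : KL x X) (h' : KL x Y) (hd : DD x X) : DD x Y := by
  obtain ⟨g, g', a, hg, hgg, ha, h1, h2⟩ := h.iso h'
  have e : dfct x Y = fun m m' => a⁻¹ • dfct x X (g' m) (g' m') := by
    ext m m'
    have h3 : ∀ n n', X.form (g' n) (g' n') = a • Y.form n n' := fun n n' => by
      rw [hgg.symm, h2, LinearMap.map_smul_of_tower]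
    have h4 : X.l G.ρ (g' m) = g' (Y.l G.ρ m) := ((hg.adj hgg).map_l _ _).symm
    simp only [dfct, h4, h3]
    rw [mul_smul_comm, ← smul_sub, inv_smul_smul₀ ha.ne']
  rw [DD, e]
  have : ∀ q ∈ PosQ 1 (cs.length x - 1) X,
      (fun m m' => a⁻¹ • q (g' m) (g' m')) ∈ PosQ 1 (cs.length x - 1) Y := by
    intro q hq
    induction hq using AddSubmonoid.closure_induction with
    | mem q hq =>
      obtain ⟨z, Z, κ, f, hz, hl, hf, hκ, rfl⟩ := hq
      refine AddSubmonoid.subset_closure ⟨z, Z, a⁻¹ * κ, f ∘ₗ g', hz, hl, (hg.adj hgg).comp' hf rfl,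
        ?_, ?_⟩
      · have := mul_pos (inv_pos.2 ha) hκ
        linarith
      · ext m m'
        rw [mul_smul]; rfl
    | zero =>
      simp only [Pi.zero_apply, smul_zero]
      exact zero_mem _
    | add q q' _ _ h h' =>
      simp only [Pi.add_apply, smul_add]
      exact add_mem h h'
  exact this _ hd

/-- The properties of indecomposable objects attached to `x` established by induction. -/
structure Pst (G : Realization cs R) (x : W) : Prop where
  ex : ∃ X : SObj G, KL x X
  dd : ∀ X : SObj G, KL x X → DD x X
  hr : ∀ (X : SObj G) i ζ, KL x X → (0 < ζ ∨ 0 ≤ ζ ∧ cs.length x < cs.length (x * cs.simple i)) →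
    HR (X.ind i).bD (X.bLz i ζ) (X.ind i).bq (cs.length x + 1)
  dec : ∀ (X : SObj G) i, KL x X → cs.length x < cs.length (x * cs.simple i) →
    SDec (x * cs.simple i) (X.ind i)

lemma bL_ind : (X.ind i).bL = X.bLz i 0 := by rw [bLz, zero_smul, add_zero]

lemma Pst.top_map (hP : Pst G (z * cs.simple i)) (hz : cs.length (z * cs.simple i) < cs.length z)
    (h : KL z Z) : ∃ (N : SObj G) (a : Z →ₗ[R] N.ind i) (a' : N.ind i →ₗ[R] Z) (c : ℝ),
      KL (z * cs.simple i) N ∧ IsHom 0 a ∧ IsAdj a a' ∧ (∀ m, a' (a m) = c • m) ∧ 0 < c ∧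
      SDec z (N.ind i) := by
  obtain ⟨N, hN⟩ := hP.ex
  have hS := hP.dec N i hN (by rwa [ss])
  rw [ss] at hS
  obtain ⟨E, hE, ⟨T⟩⟩ := hS.exists_top
  obtain ⟨g, g', c, hg, hgg, hc, h1, -⟩ := h.iso hE
  refine ⟨N, T.inc ∘ₗ g, g' ∘ₗ T.pro, c, hN, hg.comp' T.isHom_inc rfl, hgg.comp T.adj, fun m => ?_,
    hc, hS⟩
  simp only [LinearMap.comp_apply, T.pro_inc, h1]

lemma Pst.hrw (hP : ∀ y, cs.length y < cs.length z → Pst G y) (h : Pst G z) (hZ : KL z Z) {ζ : ℝ}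
    (hζ : 0 ≤ ζ) : HRw (Z.ind i).bD (Z.bLz i ζ) (Z.ind i).bq (cs.length z + 1) := by
  rcases length_lt_or (cs := cs) z i with hl | hl
  · exact (h.hr Z i ζ hZ (Or.inr ⟨hζ, hl⟩)).weak
  rcases hζ.lt_or_eq with h0 | h0
  · exact (h.hr Z i ζ hZ (Or.inl h0)).weak
  obtain ⟨N, a, a', c, hN, ha, haa, hc, hc0, -⟩ := (hP _ hl).top_map hl hZ
  intro j y hy hy0
  rw [← h0, ← bL_ind] at hy0 ⊢
  have h1 := ((hP _ hl).hr N i 0 hN (Or.inr ⟨le_rfl, by rwa [ss]⟩)).hl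
  rw [← bL_ind] at h1
  rw [HL.ind_of_inc ha haa hc hc0 h1 hy hy0, mul_zero]

lemma form_ind_eq_zero {a : Z →ₗ[R] N.ind i} {a' : N.ind i →ₗ[R] Z} {c : ℝ} (haa : IsAdj a a')
    (hc : ∀ m, a' (a m) = c • m) (hc0 : 0 < c) {m m' : Z.ind i} (h : prQ N i (indMap i a m) = 0)
    (h' : prQ N i (indMap i a m') = 0) : (Z.ind i).form m m' = 0 := by
  have h5 := form_ind_ind (indMap i a m) (indMap i a m')
  have h6 : indMap i a' (indMap i a m') = c • m' :=
    ind_ext (by rw [fs_real, fs_indMap, fs_indMap, hc]) (by rw [sn_real, sn_indMap, sn_indMap, hc])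
  rw [h, h', map_zero, map_zero, LinearMap.zero_apply, add_zero, mul_zero, haa.ind, h6,
    LinearMap.map_smul_of_tower] at h5
  exact (smul_eq_zero.1 h5).resolve_left hc0.ne'

lemma indQ_mem (hP : ∀ u, cs.length u < cs.length y → Pst G u) {et eb : E} {f : E →ₗ[R] Y.ind i}
    (hE : Good x E et eb) (hx : cs.length x = cs.length y + 1) (hf : IsHom 0 f) {q : Y → Y → R}
    (hq : q ∈ PosQ 1 (cs.length y - 1) Y) :
    (fun m m' => indQ i Y q (f m) (f m')) ∈ PosQ 1 (cs.length x - 1) E := by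
  induction hq using AddSubmonoid.closure_induction with
  | mem q hq =>
    obtain ⟨z, Z, κ, p, hz, hlz, hp, hκ, rfl⟩ := hq
    rw [indQ_form]
    have hfi : IsHom 1 (indMap i p ∘ₗ f) := hf.comp' hp.ind rfl
    rcases length_lt_or (cs := cs) z i with h | h
    · have h2 := length_mul_of_lt h
      have hS : SDec (z * cs.simple i) (Z.ind i) := (hP z (by omega)).dec Z i hz h
      have hκ' : 0 < κ * sg (((cs.length x : ℤ) - 1) - cs.length (z * cs.simple i)) := by
        rw [h2, hx]; push_cast
        rwa [show (cs.length y : ℤ) + 1 - 1 - (cs.length z + 1) = cs.length y - 1 - cs.length z by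
          ring]
      have hn : (cs.length (z * cs.simple i) : ℤ) ≤ cs.length x - 1 := by omega
      have h5 := SDec.form_mem hS hfi hκ' hn
      simp only [LinearMap.comp_apply] at h5
      exact h5
    · obtain ⟨N, a, a', c, hN, ha, haa, hc, hc0, hS⟩ := (hP _ (by omega)).top_map h hz
      have h3 : prQ N i ∘ₗ (indMap i a ∘ₗ (indMap i p ∘ₗ f)) = 0 :=
        hS.hom_eq_zero hE (by omega) ((hfi.comp ha.ind).comp' isHom_prQ (by norm_num))
      have h4 : ∀ m m', (Z.ind i).form (indMap i p (f m)) (indMap i p (f m')) = 0 := fun m m' =>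
        form_ind_eq_zero haa hc hc0 (LinearMap.congr_fun h3 m) (LinearMap.congr_fun h3 m')
      simp only [h4, smul_zero]
      exact zero_mem _
  | zero =>
    simp only [map_zero, Pi.zero_apply]
    exact zero_mem _
  | add q q' _ _ h h' =>
    simp only [map_add, Pi.add_apply]
    exact add_mem h h'

lemma DD.retract (hP : ∀ u, cs.length u < cs.length (y * cs.simple i) → Pst G u)
    (hx : cs.length y < cs.length (y * cs.simple i))
    (hY : KL y Y) (hE : KL (y * cs.simple i) E) (T : Retract E (Y.ind i)) :
    DD (y * cs.simple i) E := by
  have hl := length_mul_of_lt hx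
  obtain ⟨et, eb, hG, -⟩ := id hE
  have hTf : ∀ m m', (Y.ind i).form (T.inc m) (T.inc m') = E.form m m' := fun m m' => by
    rw [T.adj, T.pro_inc]
  have e : dfct (y * cs.simple i) E = (fun m m' => indQ i Y (dfct y Y) (T.inc m) (T.inc m')) +
      fun m m' => G.ε (G.dm i (G.act y⁻¹ G.ρ)) • Y.form ((dd Y i ∘ₗ T.inc) m) ((dd Y i ∘ₗ T.inc) m') := by
    ext m m'
    have h1 := dfct_ind y Y i (T.inc m) (T.inc m')
    rw [G.dm_lin i _ (G.act_lin _ _ G.ρ_mem), dfct, ← T.isHom_inc.map_l, hTf, hTf,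
      ← Algebra.smul_def] at h1
    exact h1
  rw [DD, e]
  refine add_mem (indQ_mem (fun u hu => hP u (by omega)) hG hl T.isHom_inc ((hP y hx).dd Y hY))
    (AddSubmonoid.subset_closure ⟨y, Y, _, dd Y i ∘ₗ T.inc, hY, by omega,
      T.isHom_inc.comp' isHom_dd rfl, ?_, rfl⟩)
  rw [hl]
  push_cast
  rw [show (cs.length y : ℤ) + 1 - 1 - cs.length y = 0 by ring, sg_zero, mul_one]
  exact G.rho_pos y i hx

theorem exists_KL_DD (hP : ∀ y, cs.length y < cs.length x → Pst G y) :
    ∃ X : SObj G, KL x X ∧ DD x X := by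
  by_cases hx : x = 1
  · subst hx; exact ⟨unit G, KL_unit, DD_unit⟩
  obtain ⟨i, hi⟩ := cs.exists_rightDescent_of_ne_one hx
  have hi : cs.length (x * cs.simple i) < cs.length x := hi
  obtain ⟨Y, hY⟩ := (hP _ hi).ex
  obtain ⟨E, hE, ⟨T⟩⟩ := ((hP _ hi).dec Y i hY (by rwa [ss])).exists_top
  have hD := DD.retract (by rwa [ss]) (by rwa [ss]) hY hE T
  rw [ss] at hE hD
  exact ⟨E, hE, hD⟩

theorem pst (G : Realization cs R) (x : W) : Pst G x := by
  induction h : cs.length x using Nat.strong_induction_on generalizing x with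
  | _ n ih =>
  subst h
  have hP : ∀ y, cs.length y < cs.length x → Pst G y := fun y hy => ih _ hy y rfl
  obtain ⟨X0, hX0, hD0⟩ := exists_KL_DD hP
  have hdd : ∀ X : SObj G, KL x X → DD x X := fun X hX => hD0.iso hX0 hX
  have hr : ∀ (X : SObj G) i ζ, KL x X → (0 < ζ ∨ 0 ≤ ζ ∧ cs.length x < cs.length (x * cs.simple i)) →
      HR (X.ind i).bD (X.bLz i ζ) (X.ind i).bq (cs.length x + 1) := by
    intro X i ζ hX hζ
    rcases length_lt_or (cs := cs) x i with hl | hl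
    · obtain ⟨ct, cb, h1, h2, h3⟩ := id hX
      exact HR.ind h3 (hdd X hX) hl (fun z Z hz hlz ζ hζ =>
        Pst.hrw (fun y hy => hP y (hy.trans hlz)) (hP z hlz) hz hζ)
        (hζ.elim le_of_lt And.left)
    · obtain ⟨N, a, a', c, hN, ha, haa, hc, hc0, -⟩ := (hP _ hl).top_map hl hX
      have h1 := (hP _ hl).hr N i 0 hN (Or.inr ⟨le_rfl, by rwa [ss]⟩)
      rw [← bL_ind] at h1
      have h2 := length_mul_of_lt (cs := cs) (y := x * cs.simple i) (i := i) (by rwa [ss])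
      rw [ss] at h2
      have h3 := HR.ind_of_inc ha haa hc hc0 h1
        (hζ.elim id fun h => absurd h.2 (by omega))
      rwa [h2]
  refine ⟨⟨X0, hX0⟩, hdd, hr, fun X i hX hl => SDec.of_ind hX hl ?_ fun u hu => ?_⟩
  · rw [bL_ind]; exact hr X i 0 hX (Or.inr ⟨le_rfl, hl⟩)
  · obtain ⟨U, hU, -⟩ := exists_KL_DD (G := G) (x := u) fun y hy => hP y (by omega)
    exact ⟨U, hU⟩

end SObj

end KLPos

namespace KLPos

variable {B W : Type} [Group W] {M : CoxeterMatrix B} {cs : CoxeterSystem M W}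
  {R : Type} [CommRing R] [Algebra ℝ R]

namespace SObj

variable {G : Realization cs R} [IsDomain R] {X Y Z N E U : SObj G} {i : B} {x y z u w : W}

/-- A finite direct sum decomposition `X = ⨁ Y k (d k)`. -/
structure Dsum (X : SObj G) {ι : Type} [Fintype ι] (Y : ι → SObj G) (d : ι → ℤ) where
  /-- inclusions -/
  inc : ∀ k, Y k →ₗ[R] X
  /-- projections -/
  pro : ∀ k, X →ₗ[R] Y k
  isHom_inc : ∀ k, IsHom (d k) (inc k)
  isHom_pro : ∀ k, IsHom (-d k) (pro k)
  pro_inc : ∀ k m, pro k (inc k m) = m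
  pro_inc_ne : ∀ k l, k ≠ l → ∀ m, pro k (inc l m) = 0
  sum_inc : ∀ m, ∑ k, inc k (pro k m) = m

section Dsum

variable {ι : Type} [Fintype ι] {Y : ι → SObj G} {d : ι → ℤ}

/-- Refining a direct sum decomposition. -/
def Dsum.bind (D : Dsum X Y d) {κ : ι → Type} [∀ k, Fintype (κ k)] {V : ∀ k, κ k → SObj G}
    {e : ∀ k, κ k → ℤ} (E : ∀ k, Dsum (Y k) (V k) (e k)) :
    Dsum X (fun p : Σ k, κ k => V p.1 p.2) (fun p => d p.1 + e p.1 p.2) where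
  inc p := D.inc p.1 ∘ₗ (E p.1).inc p.2
  pro p := (E p.1).pro p.2 ∘ₗ D.pro p.1
  isHom_inc p := ((E p.1).isHom_inc p.2).comp' (D.isHom_inc p.1) (add_comm _ _)
  isHom_pro p := (D.isHom_pro p.1).comp' ((E p.1).isHom_pro p.2) (by ring)
  pro_inc p m := by simp [D.pro_inc, (E p.1).pro_inc]
  pro_inc_ne := by
    rintro ⟨k, a⟩ ⟨l, b⟩ hne m
    by_cases hkl : k = l
    · subst hkl
      have : a ≠ b := fun h => hne (by rw [h])
      simp [D.pro_inc, (E k).pro_inc_ne _ _ this]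
    · simp [D.pro_inc_ne _ _ hkl]
  sum_inc m := by
    rw [Fintype.sum_sigma]
    conv_rhs => rw [← D.sum_inc m]
    refine Finset.sum_congr rfl fun k _ => ?_
    conv_rhs => rw [← (E k).sum_inc (D.pro k m), map_sum]
    rfl

/-- Inducing a direct sum decomposition. -/
noncomputable def Dsum.ind (D : Dsum X Y d) (i : B) : Dsum (X.ind i) (fun k => (Y k).ind i) d where
  inc k := indMap i (D.inc k)
  pro k := indMap i (D.pro k)
  isHom_inc k := (D.isHom_inc k).ind
  isHom_pro k := (D.isHom_pro k).ind
  pro_inc k m := ind_ext (by simp [D.pro_inc]) (by simp [D.pro_inc])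
  pro_inc_ne k l h m := ind_ext (by simp [D.pro_inc_ne k l h]) (by simp [D.pro_inc_ne k l h])
  sum_inc m := ind_ext (by simp [map_sum, D.sum_inc]) (by simp [map_sum, D.sum_inc])

/-- Adding a summand to a direct sum decomposition. -/
def Dsum.option (D : Dsum X Y d) {E V : SObj G} {n : ℤ} (T : Retract X E) {g : V →ₗ[R] E}
    {g' : E →ₗ[R] V} (hg : IsHom n g) (hg' : IsHom (-n) g') (h1 : ∀ m, g' (g m) = m)
    (h2 : ∀ m, g' (T.inc m) = 0) (h3 : ∀ m, T.inc (T.pro m) + g (g' m) = m) :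
    Dsum E (fun k : Option ι => k.elim V Y) (fun k => k.elim n d) where
  inc k := match k with
    | none => g
    | some k => T.inc ∘ₗ D.inc k
  pro k := match k with
    | none => g'
    | some k => D.pro k ∘ₗ T.pro
  isHom_inc k := match k with
    | none => hg
    | some k => (D.isHom_inc k).comp' T.isHom_inc (add_zero _)
  isHom_pro k := match k with
    | none => hg'
    | some k => T.isHom_pro.comp' (D.isHom_pro k) (zero_add _)
  pro_inc k m := match k with
    | none => h1 m
    | some k => by
      change D.pro k (T.pro (T.inc (D.inc k m))) = m
      rw [T.pro_inc]
      exact D.pro_inc k m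
  pro_inc_ne k l h m := match k, l with
    | none, none => absurd rfl h
    | none, some l => h2 _
    | some k, none => by
      have h4 := h3 (g (show V from m))
      rw [h1, add_eq_right] at h4
      have h5 : T.pro (g (show V from m)) = 0 := T.inc_inj (by rw [h4, map_zero])
      change D.pro k (T.pro (g (show V from m))) = 0
      rw [h5, map_zero]
    | some k, some l => by
      change D.pro k (T.pro (T.inc (D.inc l m))) = 0
      rw [T.pro_inc]
      exact D.pro_inc_ne k l (fun h' => h (by rw [h'])) m
  sum_inc m := by
    rw [Fintype.sum_option]
    change g (g' m) + ∑ k, T.inc (D.inc k (D.pro k (T.pro m))) = m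
    rw [← map_sum, D.sum_inc, add_comm, h3]

/-- A direct sum decomposition with two summands. -/
def Dsum.two {E V : SObj G} {n n' : ℤ} {f g : V →ₗ[R] E} {f' g' : E →ₗ[R] V} (hf : IsHom n f)
    (hf' : IsHom (-n) f') (hg : IsHom n' g) (hg' : IsHom (-n') g') (h1 : ∀ m, f' (f m) = m)
    (h2 : ∀ m, g' (g m) = m) (h3 : ∀ m, f' (g m) = 0) (h4 : ∀ m, g' (f m) = 0)
    (h5 : ∀ m, f (f' m) + g (g' m) = m) :
    Dsum E (fun _ : Bool => V) (fun k => if k then n else n') where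
  inc k := match k with
    | true => f
    | false => g
  pro k := match k with
    | true => f'
    | false => g'
  isHom_inc k := match k with
    | true => hf
    | false => hg
  isHom_pro k := match k with
    | true => hf'
    | false => hg'
  pro_inc k m := match k with
    | true => h1 m
    | false => h2 m
  pro_inc_ne k l h m := match k, l with
    | true, true => absurd rfl h
    | true, false => h3 m
    | false, true => h4 m
    | false, false => absurd rfl h
  sum_inc m := by
    rw [Fintype.sum_bool]
    exact h5 m

/-- A direct sum decomposition with one summand. -/
def Dsum.one {E V : SObj G} {f : V →ₗ[R] E} {f' : E →ₗ[R] V} (hf : IsHom 0 f)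
    (hf' : IsHom 0 f') (h1 : ∀ m, f' (f m) = m) (h2 : ∀ m, f (f' m) = m) :
    Dsum E (fun _ : Unit => V) (fun _ => 0) where
  inc _ := f
  pro _ := f'
  isHom_inc _ := hf
  isHom_pro _ := by rwa [neg_zero]
  pro_inc _ m := h1 m
  pro_inc_ne k l h := absurd rfl h
  sum_inc m := by simp [h2]

end Dsum

/-- A choice of indecomposable objects. -/
structure Sys (G : Realization cs R) where
  /-- the objects -/
  F : W → SObj G
  /-- top generators -/
  ct : ∀ x, F x
  /-- bottom generators -/
  cb : ∀ x, F x
  good : ∀ x, Good x (F x) (ct x) (cb x)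
  kl : ∀ x, KL x (F x)

lemma exists_sys (G : Realization cs R) : Nonempty (Sys G) := by
  choose F hF using fun x => (pst G x).ex
  have hF' := hF
  choose ct cb h using hF'
  exact ⟨⟨F, ct, cb, fun x => (h x).1, hF⟩⟩

/-- A decomposition of an object into shifted indecomposable objects. -/
structure Dec (S : Sys G) (X : SObj G) where
  /-- index type -/
  ι : Type
  fin : Fintype ι
  /-- labels -/
  u : ι → W
  /-- shifts -/
  d : ι → ℤ
  /-- the decomposition -/
  D : Dsum X (fun k => S.F (u k)) d

attribute [instance] Dec.fin

variable {S : Sys G}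

/-- The summand labelled by `x` occurs once, all other labels are shorter. -/
def Dec.Top (D : Dec S X) (x : W) : Prop :=
  ∃ k, D.u k = x ∧ D.d k = 0 ∧ ∀ l, l ≠ k → cs.length (D.u l) < cs.length x

/-- Decomposition of an induced object. -/
noncomputable def Dec.bind (D : Dec S X) (E : ∀ x, Dec S ((S.F x).ind i)) : Dec S (X.ind i) where
  ι := Σ k, (E (D.u k)).ι
  fin := inferInstance
  u p := (E (D.u p.1)).u p.2
  d p := D.d p.1 + (E (D.u p.1)).d p.2
  D := (D.D.ind i).bind fun k => (E (D.u k)).D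

lemma KL.exists_iso (h : KL x X) (S : Sys G) : ∃ (g : S.F x →ₗ[R] X) (g' : X →ₗ[R] S.F x),
    IsHom 0 g ∧ IsHom 0 g' ∧ (∀ m, g' (g m) = m) ∧ ∀ m, g (g' m) = m := by
  obtain ⟨g, g', a, h1, h2, h3, h4, h5⟩ := (S.kl x).iso h
  refine ⟨g, a⁻¹ • g', h1, (h1.adj h2).smul _, fun m => ?_, fun m => ?_⟩
  · rw [LinearMap.smul_apply, h4, inv_smul_smul₀ h3.ne']
  · rw [LinearMap.smul_apply, LinearMap.map_smul_of_tower, h5, inv_smul_smul₀ h3.ne']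

lemma SDec.exists_dec (S : Sys G) (h : SDec w X) :
    ∃ D : Dec S X, D.Top w ∧ ∀ k, D.d k = 0 := by
  induction h with
  | top E h =>
    obtain ⟨g, g', h1, h2, h3, h4⟩ := h.exists_iso S
    exact ⟨⟨Unit, inferInstance, fun _ => w, fun _ => 0, Dsum.one h1 h2 h3 h4⟩, ⟨(), rfl, rfl,
      fun l hl => absurd rfl hl⟩, fun _ => rfl⟩
  | step E U E' u κ g g' T hU hu hg ha _ h1 h2 _ ih =>
    obtain ⟨D, ⟨k, hk1, hk2, hk3⟩, hz⟩ := ih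
    obtain ⟨f, f', e1, e2, e3, e4⟩ := hU.exists_iso S
    have hD := D.D.option (n := 0) T (g := g ∘ₗ f) (g' := f' ∘ₗ (κ • g'))
      (e1.comp' hg (add_zero 0)) (((hg.adj ha).smul κ).comp' e2 (by norm_num))
      (fun m => by simp only [LinearMap.comp_apply, LinearMap.smul_apply, h1, e3])
      (fun m => by
        simp only [LinearMap.comp_apply, LinearMap.smul_apply, compl_pro_inc h1 T h2, smul_zero,
          map_zero])
      (fun m => by
        simp only [LinearMap.comp_apply, LinearMap.smul_apply, e4]
        rw [LinearMap.map_smul_of_tower, h2])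
    have hD' : Dsum E (fun k : Option D.ι => S.F (k.elim u D.u)) (fun k => k.elim 0 D.d) := by
      convert hD using 1
      funext k
      cases k <;> rfl
    refine ⟨⟨Option D.ι, inferInstance, fun k => k.elim u D.u, fun k => k.elim 0 D.d, hD'⟩,
      ⟨some k, hk1, hk2, fun l hl => ?_⟩, fun l => ?_⟩
    · cases l with
      | none => exact hu
      | some l => exact hk3 l fun h => hl (by rw [h])
    · cases l with
      | none => rfl
      | some l => exact hz l

lemma idem_eq_zero {e : X →ₗ[R] X} (h0 : IsHom 0 e) (hs : IsAdj e e) (he : e ∘ₗ e = e)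
    (hb : ∀ m, X.bmk (e m) = 0) (m : X) : e m = 0 := by
  have h : cutP h0 hs he m = 0 := eq_zero_of_bar (fun n => by
    refine bmk_eq_zero.2 fun n' => ?_
    rw [← cutP_cutI h0 hs he n', ← isAdj_cut h0 hs he, ← cutP_cutI h0 hs he n, cutI_cutP]
    exact bmk_eq_zero.1 (hb _) _) _
  rw [← cutI_cutP h0 hs he, h, map_zero]

lemma isAdj_io : IsAdj (io X i) ((2 : ℝ) • dd X i) := fun m n => by
  rw [form_io, LinearMap.smul_apply, real_smul_def, map_smul, smul_eq_mul, map_ofNat]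

lemma IsHom.hyper_adj {ψ : X.ind i →ₗ[R] X} {φ : X →ₗ[R] X.ind i} (hφ : IsAdj ψ φ) :
    IsAdj (io X i - (1 / 2 : ℝ) • (φ ∘ₗ ((2 : ℝ) • dd X i) ∘ₗ io X i))
      ((2 : ℝ) • dd X i - (1 / 2 : ℝ) • (((2 : ℝ) • dd X i) ∘ₗ io X i ∘ₗ ψ)) :=
  isAdj_io.sub (((isAdj_io.comp isAdj_io.symm).comp hφ.symm).smul _)

/-- A hyperbolic pair splits the induced object. -/
theorem exists_hyperbolic {ct cb : X} (hX : Good x X ct cb) {ψ : X.ind i →ₗ[R] X}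
    (hψ : IsHom (-1) ψ) (h1 : ∀ m, ψ (io X i m) = m) :
    Nonempty (Dsum (X.ind i) (fun _ : Bool => X) (fun k => if k then 1 else -1)) := by
  obtain ⟨φ, hφ⟩ := exists_adj ψ
  have hφ1 : IsHom (-1) φ := hψ.adj hφ
  have h2 : ∀ m, ψ (φ m) = 0 := fun m =>
    LinearMap.congr_fun (hX.hom_neg hX (hφ1.comp hψ) (by norm_num)) m
  have h3 : ∀ m, (2 : ℝ) • dd X i (φ m) = m := fun m => by
    have h : IsAdj (ψ ∘ₗ io X i) (((2 : ℝ) • dd X i) ∘ₗ φ) := isAdj_io.comp hφ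
    have h' : ψ ∘ₗ io X i = LinearMap.id := LinearMap.ext h1
    rw [h'] at h
    exact LinearMap.congr_fun (h.unique IsAdj.id) m
  obtain ⟨f, hf⟩ : ∃ f, f = io X i - (1 / 2 : ℝ) • (φ ∘ₗ ((2 : ℝ) • dd X i) ∘ₗ io X i) := ⟨_, rfl⟩
  obtain ⟨f', hf'⟩ : ∃ f', f' = (2 : ℝ) • dd X i - (1 / 2 : ℝ) • (((2 : ℝ) • dd X i) ∘ₗ io X i ∘ₗ ψ) :=
    ⟨_, rfl⟩
  have hff : IsAdj f f' := by rw [hf, hf']; exact IsHom.hyper_adj hφ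
  have hf1 : IsHom 1 f := by
    rw [hf]
    exact isHom_io.sub ((((isHom_io.comp (isHom_dd.smul 2)).comp' hφ1 (by norm_num))).smul _)
  have hf1' : IsHom 1 f' := hf1.adj hff
  have e1 : ∀ m, ψ (f m) = m := fun m => by
    simp only [hf, LinearMap.sub_apply, map_sub, h1, LinearMap.smul_apply, LinearMap.comp_apply,
      LinearMap.map_smul_of_tower, h2, smul_zero, sub_zero]
  have e2 : ∀ m, f' (φ m) = m := fun m => by
    have h : IsAdj (ψ ∘ₗ f) (f' ∘ₗ φ) := hff.comp hφ
    have h' : ψ ∘ₗ f = LinearMap.id := LinearMap.ext e1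
    rw [h'] at h
    exact LinearMap.congr_fun (h.unique IsAdj.id) m
  have e3 : ∀ m, f' (f m) = 0 := fun m => by
    have h4 : ∀ m, (2 : ℝ) • dd X i (f m) = (1 / 2 : ℝ) • (2 : ℝ) • dd X i (io X i m) := fun m => by
      simp only [hf, LinearMap.sub_apply, map_sub, LinearMap.smul_apply, LinearMap.comp_apply,
        LinearMap.map_smul_of_tower, smul_sub]
      have := h3 (dd X i (io X i m))
      rw [smul_comm (2 : ℝ) (1 / 2 : ℝ), smul_comm (2 : ℝ) (2 : ℝ), this]
      module
    have h5 : f' (f m) = (2 : ℝ) • dd X i (f m) - (1 / 2 : ℝ) • (2 : ℝ) • dd X i (io X i (ψ (f m))) := by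
      simp only [hf', LinearMap.sub_apply, LinearMap.smul_apply, LinearMap.comp_apply]
    rw [h5, h4, e1, sub_self]
  have s0 : IsHom 0 (f ∘ₗ ψ + φ ∘ₗ f') :=
    (hψ.comp' hf1 (by norm_num)).add (hf1'.comp' hφ1 (by norm_num))
  have s1 : IsAdj (f ∘ₗ ψ + φ ∘ₗ f') (f ∘ₗ ψ + φ ∘ₗ f') := by
    have h : IsAdj (f ∘ₗ ψ + φ ∘ₗ f') (φ ∘ₗ f' + f ∘ₗ ψ) :=
      (hφ.comp hff).add (hff.symm.comp hφ.symm)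
    rwa [add_comm (φ ∘ₗ f')] at h
  have hfin : ∀ m, (LinearMap.id - (f ∘ₗ ψ + φ ∘ₗ f') : X.ind i →ₗ[R] X.ind i) m = 0 := by
    refine idem_eq_zero (IsHom.id.sub s0) (IsAdj.id.sub s1) ?_ ?_
    · ext m
      simp only [LinearMap.comp_apply, LinearMap.sub_apply, LinearMap.id_apply, LinearMap.add_apply,
        map_sub, map_add, e1, e2, e3, h2, map_zero, zero_add, add_zero]
      abel
    · have g1 : ∀ m, bmap ψ (bmap f m) = m := fun m => by
        obtain ⟨m, rfl⟩ := X.bmk_surjective m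
        rw [bmap_mk, bmap_mk, e1]
      have g2 : ∀ m, bmap f' (bmap φ m) = m := fun m => by
        obtain ⟨m, rfl⟩ := X.bmk_surjective m
        rw [bmap_mk, bmap_mk, e2]
      have g3 : ∀ m, bmap f' (bmap f m) = 0 := fun m => by
        obtain ⟨m, rfl⟩ := X.bmk_surjective m
        rw [bmap_mk, bmap_mk, e3, map_zero]
      have g4 : ∀ m, bmap ψ (bmap φ m) = 0 := fun m => by
        obtain ⟨m, rfl⟩ := X.bmk_surjective m
        rw [bmap_mk, bmap_mk, h2, map_zero]
      have hinj : Function.Injective ((bmap f).coprod (bmap φ)) := by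
        rw [← LinearMap.ker_eq_bot, LinearMap.ker_eq_bot']
        rintro ⟨a, b⟩ hab
        rw [LinearMap.coprod_apply] at hab
        have k1 := congrArg (bmap ψ) hab
        have k2 := congrArg (bmap f') hab
        rw [map_add, g1, g4, add_zero, map_zero] at k1
        rw [map_add, g2, g3, zero_add, map_zero] at k2
        exact Prod.ext k1 k2
      have hsur : Function.Surjective ((bmap f).coprod (bmap φ)) := by
        rwa [← LinearMap.injective_iff_surjective_of_finrank_eq_finrank]
        rw [Module.finrank_prod, finrank_ind, two_mul]
      intro m
      obtain ⟨⟨a, b⟩, hab⟩ := hsur ((X.ind i).bmk m)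
      rw [LinearMap.coprod_apply] at hab
      obtain ⟨a, rfl⟩ := X.bmk_surjective a
      obtain ⟨b, rfl⟩ := X.bmk_surjective b
      rw [bmap_mk, bmap_mk] at hab
      have k : (X.ind i).bmk ((f ∘ₗ ψ + φ ∘ₗ f') m) = (X.ind i).bmk m := by
        rw [← bmap_mk, ← hab, ← map_add, bmap_mk]
        simp only [LinearMap.comp_apply, LinearMap.add_apply, map_add, e1, e2, e3, h2, map_zero,
          zero_add, add_zero]
      rw [LinearMap.sub_apply, map_sub, k, LinearMap.id_apply, sub_self]
  refine ⟨Dsum.two hf1 hψ hφ1 (by simpa using hf1') e1 e2 h2 e3 fun m => ?_⟩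
  have := hfin m
  rw [LinearMap.sub_apply, sub_eq_zero] at this
  exact this.symm

/-- Decomposing an induced indecomposable object. -/
theorem exists_dec_ind (S : Sys G) (i : B) (z : W) : ∃ D : Dec S ((S.F z).ind i),
    (∀ k, cs.length (D.u k) ≤ cs.length z + 1) ∧
      (cs.length z < cs.length (z * cs.simple i) → D.Top (z * cs.simple i)) := by
  rcases length_lt_or (cs := cs) z i with h | h
  · obtain ⟨D, hD, -⟩ := ((pst G z).dec _ i (S.kl z) h).exists_dec S
    refine ⟨D, fun k => ?_, fun _ => hD⟩
    have hl := length_mul_of_lt h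
    obtain ⟨l, h1, -, h2⟩ := hD
    by_cases hk : k = l
    · rw [hk, h1, hl]
    · have := h2 k hk
      omega
  · obtain ⟨N, a, a', c, hN, ha, haa, hc, hc0, -⟩ := (pst G _).top_map h (S.kl z)
    have h1 : IsHom (-1) (c⁻¹ • (a' ∘ₗ prQ N i ∘ₗ indMap i a)) :=
      (((ha.ind.comp' isHom_prQ (zero_add _)).comp' (ha.adj haa) (add_zero _))).smul _
    obtain ⟨D⟩ := exists_hyperbolic (S.good z) h1 fun m => by
      have h2 : prQ N i (indMap i a (io (S.F z) i m)) = a m :=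
        ind_ext (by simp) (by simp)
      rw [LinearMap.smul_apply, LinearMap.comp_apply, LinearMap.comp_apply, h2, hc,
        inv_smul_smul₀ hc0.ne']
    exact ⟨⟨Bool, inferInstance, fun _ => z, _, D⟩, fun k => Nat.le_succ _,
      fun h' => absurd h (by omega)⟩

/-- A chosen decomposition of an induced indecomposable object. -/
noncomputable def decInd (S : Sys G) (i : B) (z : W) : Dec S ((S.F z).ind i) :=
  (exists_dec_ind S i z).choose

lemma Dec.Top.bind {D : Dec S X} (h : D.Top y) (hy : cs.length y < cs.length (y * cs.simple i)) :
    (D.bind (decInd S i)).Top (y * cs.simple i) := by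
  obtain ⟨k, rfl, hk2, hk3⟩ := h
  have hl := length_mul_of_lt hy
  obtain ⟨h1, h2⟩ := (exists_dec_ind S i (D.u k)).choose_spec
  obtain ⟨l, hl1, hl2, hl3⟩ := h2 hy
  refine ⟨⟨k, l⟩, hl1, ?_, ?_⟩
  · change D.d k + (decInd S i (D.u k)).d l = 0
    rw [hk2, zero_add]
    exact hl2
  · rintro ⟨k', l'⟩ hne
    change cs.length ((decInd S i (D.u k')).u l') < _
    by_cases hkk : k' = k
    · subst hkk
      exact hl3 l' fun h => hne (by rw [h])
    · have h3 := hk3 k' hkk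
      have h4 := (exists_dec_ind S i (D.u k')).choose_spec.1 l'
      exact lt_of_le_of_lt h4 (by omega)

end SObj
end KLPos

namespace KLPos

variable {B W : Type} [Group W] {M : CoxeterMatrix B} {cs : CoxeterSystem M W}
  {R : Type} [CommRing R] [Algebra ℝ R]

namespace SObj

variable {G : Realization cs R} [IsDomain R] {X Y Z N E U : SObj G} {i : B} {x y z u w : W}

/-- The graded piece of the specialized stalk. -/
def gr (X : SObj G) (y : W) (d : ℤ) : Submodule ℝ X.Bar where
  carrier := {v | ∃ c ∈ X.Ga y, X.Hg d c ∧ X.bmk c = v}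
  zero_mem' := ⟨0, zero_mem _, Hg.zero d, map_zero _⟩
  add_mem' := by
    rintro _ _ ⟨c, h1, h2, rfl⟩ ⟨c', h1', h2', rfl⟩
    exact ⟨c + c', add_mem h1 h1', h2.add h2', map_add _ _ _⟩
  smul_mem' := by
    rintro r _ ⟨c, h1, h2, rfl⟩
    exact ⟨r • c, Submodule.smul_mem _ (algebraMap ℝ R r) h1, h2.real r, map_smul _ _ _⟩

/-- Graded rank of the stalk. -/
noncomputable def rk (X : SObj G) (y : W) (d : ℤ) : ℕ := Module.finrank ℝ (X.gr y d)

lemma finrank_map_inj {V V' : Type} [AddCommGroup V] [Module ℝ V] [AddCommGroup V'] [Module ℝ V']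
    (f : V →ₗ[ℝ] V') (hf : Function.Injective f) (p : Submodule ℝ V) :
    Module.finrank ℝ (p.map f) = Module.finrank ℝ p :=
  (LinearEquiv.finrank_eq (Submodule.equivMapOfInjective f hf p)).symm

lemma finrank_map_add {V V' : Type} [AddCommGroup V] [Module ℝ V] [FiniteDimensional ℝ V]
    [AddCommGroup V'] [Module ℝ V'] (f : V →ₗ[ℝ] V') (p : Submodule ℝ V) :
    Module.finrank ℝ (p.map f) + Module.finrank ℝ (p ⊓ LinearMap.ker f : Submodule ℝ V) =
      Module.finrank ℝ p := by
  have h := LinearMap.finrank_range_add_finrank_ker (f.domRestrict p)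
  have h1 : LinearMap.range (f.domRestrict p) = p.map f := by
    ext v
    simp [Submodule.mem_map]
  have h2 : (LinearMap.ker (f.domRestrict p)).map p.subtype = p ⊓ LinearMap.ker f := by
    ext v
    simp [Submodule.mem_map, and_comm]
  rw [h1, ← Submodule.finrank_map_subtype_eq p, h2] at h
  exact h

/-- The involution on the specialization of an induced object. -/
noncomputable def bth (X : SObj G) (i : B) : (X.ind i).Bar →ₗ[ℝ] (X.ind i).Bar :=
  (X.ind i).rad.mapQ (X.ind i).rad { (th : X.ind i →+ X.ind i) with
    map_smul' := fun c m => by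
      change th (algebraMap ℝ R c • m) = algebraMap ℝ R c • th m
      rw [th_smul, AlgEquiv.commutes] } fun m hm => by
    refine mem_rad.2 fun n => ?_
    change G.ε ((X.ind i).form (th m) n) = 0
    rw [← th_th n, form_th, Realization.sa, G.ε_act]
    exact mem_rad.1 hm _

@[simp] lemma bth_mk (m : X.ind i) : X.bth i ((X.ind i).bmk m) = (X.ind i).bmk (th m) := rfl

lemma bth_inj : Function.Injective (X.bth i) := by
  refine Function.LeftInverse.injective (g := X.bth i) fun v => ?_
  obtain ⟨m, rfl⟩ := (X.ind i).bmk_surjective v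
  rw [bth_mk, bth_mk, th_th]

lemma rk_ind_mul (y : W) (d : ℤ) : (X.ind i).rk (y * cs.simple i) d = (X.ind i).rk y d := by
  have h : (X.ind i).gr (y * cs.simple i) d = ((X.ind i).gr y d).map (X.bth i) := by
    ext v
    constructor
    · rintro ⟨c, h1, h2, rfl⟩
      exact ⟨_, ⟨th c, th_mem_Ga' h1, h2.th, rfl⟩, by rw [bth_mk, th_th]⟩
    · rintro ⟨_, ⟨c, h1, h2, rfl⟩, rfl⟩
      exact ⟨th c, th_mem_Ga h1, h2.th, rfl⟩
  rw [rk, h, finrank_map_inj _ bth_inj, rk]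

lemma dd_th_Jn (n : X) : dd X i (th (Jn i y n)) = - up i (y * cs.simple i) n := by
  rw [dd_apply, fs_th, sn_th, sn_Jn, up_mul_simple, Jn, fs_tm, smul_neg]
  abel

lemma Nice.gr_ker (hX : X.Nice) (hy : cs.length y < cs.length (y * cs.simple i)) (d : ℤ) :
    ((X.ind i).gr y d) ⊓ LinearMap.ker (bmap (dd X i) ∘ₗ X.bth i) =
      (X.gr y (d - 1)).map (bmap (io X i)) := by
  ext v
  constructor
  · rintro ⟨⟨C, h1, h2, rfl⟩, h3⟩
    obtain ⟨h4, h5⟩ := mem_Ga_ind.1 h1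
    have h6 : X.Hg (d - 1) (sn C) := (hg_ind_iff.1 h2).2
    generalize sn C = n at *
    subst h5
    rw [SetLike.mem_coe, LinearMap.mem_ker, LinearMap.comp_apply, bth_mk, bmap_mk, dd_th_Jn, map_neg, neg_eq_zero] at h3
    obtain ⟨ι, _, e, c, c', h7, h8⟩ := hX.db (y * cs.simple i)
    choose N hN1 hN2 hN3 using fun k => hX.exists_lift hy (h7 k).1 (h7 k).2.1
    have hup := up_mem h4.mul_simple
    have hupd : X.Hg (d + 1) (up i (y * cs.simple i) n) := by
      have := h6.up i (y * cs.simple i)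
      rwa [show d - 1 + 2 = d + 1 by ring] at this
    obtain ⟨r, hr⟩ : ∃ r : ι → R, r = fun k => X.form (up i (y * cs.simple i) n) (c' k) := ⟨_, rfl⟩
    have hr0 : ∀ k, G.ε (r k) = 0 := fun k => by rw [hr]; exact bmk_eq_zero.1 h3 _
    have hrd : ∀ k, G.eu (r k) = (d + 1 - e k) • r k := fun k => by
      rw [hr]; exact form_hg hupd (h7 k).2.2
    have hrs : up i (y * cs.simple i) n = ∑ k, r k • c k := by rw [hr]; exact h8 _ hup
    obtain ⟨n', hn'⟩ : ∃ n', n' = n - ∑ k, X.l (G.act (y * cs.simple i) (r k)) (N k) := ⟨_, rfl⟩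
    have hn2 : ∀ k, X.Ga2 i y (X.l (G.act (y * cs.simple i) (r k)) (N k)) := fun k => (hN1 k).l _
    have hsum : ∑ k, X.l (G.act (y * cs.simple i) (r k)) (N k) + n' = n := by
      rw [hn']; abel
    have hn0 : up i (y * cs.simple i) n' = 0 := by
      have e1 := congrArg (AddMonoidHom.mk' (up i (y * cs.simple i)) up_add) hsum
      rw [map_add, map_sum] at e1
      simp only [AddMonoidHom.mk'_apply, up_l, hN2, (h7 _).1 _, G.act_inv_act] at e1
      rwa [← hrs, add_eq_left] at e1
    have hn1 : X.Ga2 i y n' := by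
      intro a ha
      rw [hn', map_sub, map_sum, h4 a ha, smul_sub, Finset.smul_sum]
      simp only [hn2 _ a ha]
    have hnd : X.Hg (d - 1) n' := by
      rw [hn']
      refine h6.sub (Hg.sum fun k _ => ?_)
      have := (hN3 k).l (r := G.act (y * cs.simple i) (r k)) (k := d + 1 - e k)
        (by rw [G.eu_act, hrd, map_zsmul])
      rwa [show e k - 2 + (d + 1 - e k) = d - 1 by ring] at this
    have hn'G := mem_Ga_of_up_eq_zero hn1 hn0
    refine ⟨X.bmk n', ⟨n', hn'G, hnd, rfl⟩, ?_⟩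
    have e1 := congrArg (AddMonoidHom.mk' (Jn i y) Jn_add) hsum
    rw [map_add, map_sum] at e1
    simp only [AddMonoidHom.mk'_apply, G.act_mul_simple, ← smul_Jn (hN1 _)] at e1
    rw [← e1, map_add, map_sum, bmap_mk, io_eq_Jn hn'G, right_eq_add]
    refine Finset.sum_eq_zero fun k _ => ?_
    rw [bmk_smul, Realization.sa, G.ε_act, hr0, zero_smul]
  · rintro ⟨_, ⟨c, h1, h2, rfl⟩, rfl⟩
    refine ⟨⟨io X i c, isHom_io.map_Ga h1, by simpa using isHom_io.hg h2, rfl⟩, ?_⟩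
    rw [SetLike.mem_coe, LinearMap.mem_ker, LinearMap.comp_apply, bmap_mk, bth_mk, bmap_mk, io_eq_Jn h1, dd_th_Jn,
      up_of_Ga' h1, neg_zero, map_zero]

lemma Nice.gr_map (hX : X.Nice) (hy : cs.length y < cs.length (y * cs.simple i)) (d : ℤ) :
    ((X.ind i).gr y d).map (bmap (dd X i) ∘ₗ X.bth i) = X.gr (y * cs.simple i) (d + 1) := by
  ext v
  constructor
  · rintro ⟨_, ⟨C, h1, h2, rfl⟩, rfl⟩
    rw [LinearMap.comp_apply, bth_mk, bmap_mk]
    refine ⟨_, isHom_dd.map_Ga (th_mem_Ga h1), ?_, rfl⟩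
    simpa [add_comm] using isHom_dd.hg h2.th
  · rintro ⟨c', h1, h2, rfl⟩
    obtain ⟨n, h3, h4, h5⟩ := hX.exists_lift hy h1 h2
    refine ⟨- (X.ind i).bmk (Jn i y n), neg_mem ⟨_, Jn_mem h3, ?_, rfl⟩, ?_⟩
    · have := h5.Jn i y
      rwa [show d + 1 - 2 + 1 = d by ring] at this
    · rw [map_neg, LinearMap.comp_apply, bth_mk, bmap_mk, dd_th_Jn, h4, map_neg, neg_neg]

lemma Nice.rk_ind (hX : X.Nice) (hy : cs.length y < cs.length (y * cs.simple i)) (d : ℤ) :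
    (X.ind i).rk y d = X.rk y (d - 1) + X.rk (y * cs.simple i) (d + 1) := by
  rw [rk, ← finrank_map_add (bmap (dd X i) ∘ₗ X.bth i), hX.gr_ker hy, hX.gr_map hy,
    finrank_map_inj _ bio_inj, add_comm]
  rfl

lemma Dsum.rk {ι : Type} [Fintype ι] {V : ι → SObj G} {e : ι → ℤ} (D : Dsum X V e) (y : W)
    (d : ℤ) : X.rk y d = ∑ k, (V k).rk y (d - e k) := by
  classical
  have h0 : ∀ (k l) (v : (V l).Bar), bmap (D.pro k) (bmap (D.inc l) v) = if h : l = k then h ▸ v else 0 := by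
    intro k l v
    obtain ⟨m, rfl⟩ := (V l).bmk_surjective v
    rw [bmap_mk, bmap_mk]
    split_ifs with h
    · subst h
      rw [D.pro_inc]
    · rw [D.pro_inc_ne _ _ (Ne.symm h), map_zero]
  let f : (∀ k, (V k).gr y (d - e k)) →ₗ[ℝ] X.Bar :=
    ∑ k, bmap (D.inc k) ∘ₗ ((V k).gr y (d - e k)).subtype ∘ₗ LinearMap.proj k
  have hf : ∀ a, f a = ∑ k, bmap (D.inc k) (a k) := fun a => by
    simp [f, LinearMap.sum_apply]
  have hinj : Function.Injective f := by
    rw [← LinearMap.ker_eq_bot, LinearMap.ker_eq_bot']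
    intro a ha
    funext k
    have h1 := congrArg (bmap (D.pro k)) ha
    rw [hf, map_sum, map_zero, Finset.sum_eq_single k] at h1
    · rw [h0, dif_pos rfl] at h1
      exact Subtype.ext h1
    · intro l _ hl
      rw [h0, dif_neg hl]
    · simp
  have hrange : LinearMap.range f = X.gr y d := by
    ext v
    constructor
    · rintro ⟨a, rfl⟩
      rw [hf]
      refine sum_mem fun k _ => ?_
      obtain ⟨c, h1, h2, h3⟩ := (a k).2
      rw [← h3, bmap_mk]
      exact ⟨_, (D.isHom_inc k).map_Ga h1, by simpa using (D.isHom_inc k).hg h2, rfl⟩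
    · rintro ⟨c, h1, h2, rfl⟩
      refine ⟨fun k => ⟨(V k).bmk (D.pro k c), _, (D.isHom_pro k).map_Ga h1, ?_, rfl⟩, ?_⟩
      · simpa [sub_eq_add_neg, add_comm] using (D.isHom_pro k).hg h2
      · rw [hf]
        simp only [bmap_mk]
        rw [← map_sum, D.sum_inc]
  rw [SObj.rk, ← hrange, LinearMap.finrank_range_of_inj hinj, Module.finrank_pi_fintype]
  rfl

variable {ct cb : X}

lemma Good.rk_self (h : Good x X ct cb) (d : ℤ) : X.rk x d = if d = cs.length x then 1 else 0 := by
  split_ifs with hd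
  · subst hd
    have : X.gr x (cs.length x) = Submodule.span ℝ {X.bmk ct} := by
      ext v
      rw [Submodule.mem_span_singleton]
      constructor
      · rintro ⟨c, h1, -, rfl⟩
        obtain ⟨r, rfl⟩ := h.gen c h1
        exact ⟨G.ε r, (bmk_smul _ _).symm⟩
      · rintro ⟨r, rfl⟩
        exact Submodule.smul_mem _ _ ⟨ct, h.mem, h.hg_ct, rfl⟩
    rw [rk, this, finrank_span_singleton h.bmk_ne]
  · have : X.gr x d = ⊥ := by
      rw [Submodule.eq_bot_iff]
      rintro _ ⟨c, h1, h2, rfl⟩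
      obtain ⟨r, rfl⟩ := h.gen c h1
      have e1 := bD_bmk_hg h2
      rw [bmk_smul, map_smul, bD_bmk_hg h.hg_ct, smul_comm, ← sub_eq_zero, ← sub_smul] at e1
      rw [bmk_smul]
      rw [← Int.cast_smul_eq_zsmul ℝ] at e1
      refine (smul_eq_zero.1 e1).resolve_left ?_
      rw [Int.cast_eq_zero]
      omega
    rw [rk, this, finrank_bot]

lemma Good.rk_lt (h : Good x X ct cb) (hy : y ≠ x) {d : ℤ} (hd : X.rk y d ≠ 0) : cs.length y < d := by
  by_contra hlt
  refine hd ?_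
  have : X.gr y d = ⊥ := by
    rw [Submodule.eq_bot_iff]
    rintro _ ⟨c, h1, h2, rfl⟩
    by_contra h0
    exact hlt (h.low y hy d c h1 h2 fun hc => h0 (by rw [hc, map_zero]))
  rw [rk, this, finrank_bot]

lemma rk_unit (d : ℤ) : (unit G).rk 1 d = if d = 0 then 1 else 0 := by
  rw [good_unit.rk_self, cs.length_one]
  rfl

lemma rk_unit_ne (hy : y ≠ 1) (d : ℤ) : (unit G).rk y d = 0 := by
  have : (unit G).gr y d = ⊥ := by
    rw [Submodule.eq_bot_iff]
    rintro _ ⟨c, h1, h2, rfl⟩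
    rw [Ga_unit hy h1, map_zero]
  rw [rk, this, finrank_bot]

end SObj
end KLPos

namespace KLPos

section Laurent

lemma coeff_T_mul (n k : ℤ) (f : ℤ[T;T⁻¹]) : (T n * f).coeff k = f.coeff (k - n) := by
  have h := AddMonoidAlgebra.coeff_single_mul_apply f (1 : ℤ) n k
  rw [one_mul, neg_add_eq_sub] at h
  exact h

lemma coeff_one (k : ℤ) : (1 : ℤ[T;T⁻¹]).coeff k = if k = 0 then 1 else 0 := by
  change (Finsupp.single 0 (1 : ℤ)) k = _
  rw [Finsupp.single_apply]
  simp only [eq_comm]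

end Laurent

variable {B W : Type} [Group W] {M : CoxeterMatrix B} {cs : CoxeterSystem M W}
  {H : Type} [Ring H] [Algebra ℤ[T;T⁻¹] H] {h b : Module.Basis W ℤ[T;T⁻¹] H} {d : H →+* H}
  {x y z : W} {i : B}

lemma length_lt_of_bruhatLT (hzw : bruhatLT cs z x) : cs.length z < cs.length x := by
  obtain ⟨⟨ω, h1, rfl, ω', h2, h3, rfl⟩, hne⟩ := hzw
  rw [h1.eq, h3.eq]
  refine lt_of_le_of_ne h2.length_le fun he => hne ?_
  rw [h2.eq_of_length he]

lemma hecke_mul (hH : IsHeckeAlgebra cs h) (n : ℕ) : ∀ x y, cs.length x = n →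
    cs.length (x * y) = cs.length x + cs.length y → h x * h y = h (x * y) := by
  induction n with
  | zero =>
    intro x y hx _
    rw [cs.length_eq_zero_iff.1 hx, hH.1, one_mul, one_mul]
  | succ n ih =>
    intro x y hx hxy
    have hx1 : x ≠ 1 := by
      rintro rfl
      simp at hx
    obtain ⟨i, hi⟩ := cs.exists_leftDescent_of_ne_one hx1
    have h1 := cs.isLeftDescent_iff.1 hi
    have e : x = cs.simple i * (cs.simple i * x) := by simp
    have h2 : cs.length (cs.simple i * x * y) = cs.length (cs.simple i * x) + cs.length y := by
      have h3 := cs.length_mul_le (cs.simple i * x) y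
      have h4 := cs.length_mul_le (cs.simple i) (cs.simple i * x * y)
      rw [cs.length_simple, mul_assoc, cs.simple_mul_simple_cancel_left] at h4
      rw [mul_assoc] at h3 ⊢
      omega
    have h5 := ih _ y (by omega) h2
    have h6 := (hH.2 i (cs.simple i * x)).1 (by rw [← e]; exact hi)
    rw [← e] at h6
    have h7 := (hH.2 i (cs.simple i * x * y)).1 (by rw [← mul_assoc, ← e]; omega)
    rw [← h6, mul_assoc, h5, h7, ← mul_assoc, ← e]

/-- The Kazhdan–Lusztig element of a simple reflection. -/
noncomputable def heckeB (cs : CoxeterSystem M W) (h : Module.Basis W ℤ[T;T⁻¹] H) (i : B) : H :=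
  h (cs.simple i) + (T 1 : ℤ[T;T⁻¹]) • 1

lemma hecke_sq (hH : IsHeckeAlgebra cs h) (i : B) : h (cs.simple i) * h (cs.simple i) =
    (T (-1) - T 1 : ℤ[T;T⁻¹]) • h (cs.simple i) + 1 := by
  have := (hH.2 i (cs.simple i)).2 (by simp)
  rwa [cs.simple_mul_simple_self, hH.1] at this

lemma hecke_right (hH : IsHeckeAlgebra cs h) (hx : cs.length x < cs.length (x * cs.simple i)) :
    h x * h (cs.simple i) = h (x * cs.simple i) :=
  hecke_mul hH _ _ _ rfl (by
    have := SObj.length_mul_of_lt hx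
    simpa using this)

open Classical in
lemma hecke_mul_heckeB (hH : IsHeckeAlgebra cs h) (x : W) (i : B) : h x * heckeB cs h i =
    h (x * cs.simple i) +
      (if cs.length x < cs.length (x * cs.simple i) then T 1 else T (-1) : ℤ[T;T⁻¹]) • h x := by
  rw [heckeB, mul_add, mul_smul_comm, mul_one]
  split_ifs with hx
  · rw [hecke_right hH hx]
  · have hx' := (SObj.length_lt_or (cs := cs) x i).resolve_left hx
    have h1 := hecke_right (i := i) (x := x * cs.simple i) hH (by simpa using hx')
    rw [cs.simple_mul_simple_cancel_right] at h1
    rw [← h1, mul_assoc, hecke_sq hH, mul_add, mul_smul_comm, mul_one, sub_smul]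
    abel

open Classical in
lemma repr_mul_heckeB (hH : IsHeckeAlgebra cs h) (a : H) (y : W) (i : B) :
    h.repr (a * heckeB cs h i) y = h.repr a (y * cs.simple i) +
      (if cs.length y < cs.length (y * cs.simple i) then T 1 else T (-1)) * h.repr a y := by
  set c : ℤ[T;T⁻¹] := if cs.length y < cs.length (y * cs.simple i) then T 1 else T (-1) with hc
  have : (Finsupp.lapply y ∘ₗ h.repr.toLinearMap) ∘ₗ LinearMap.mulRight ℤ[T;T⁻¹] (heckeB cs h i) =
      Finsupp.lapply (y * cs.simple i) ∘ₗ h.repr.toLinearMap +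
        c • (Finsupp.lapply y ∘ₗ h.repr.toLinearMap) := by
    refine h.ext fun x => ?_
    have e : x * cs.simple i = y ↔ x = y * cs.simple i := by
      constructor
      · rintro rfl; simp
      · rintro rfl; simp
    simp only [LinearMap.comp_apply, LinearMap.mulRight_apply, LinearMap.add_apply,
      LinearMap.smul_apply, LinearEquiv.coe_coe, Finsupp.lapply_apply]
    rw [hecke_mul_heckeB hH, map_add, map_smul, Finsupp.add_apply, Finsupp.smul_apply,
      h.repr_self_apply, h.repr_self_apply, h.repr_self_apply]
    simp only [e]
    by_cases hxy : x = y
    · subst hxy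
      rw [hc]
    · simp [hxy]
  exact LinearMap.congr_fun this a

lemma bar_smul (hd : IsBarInvolution (fun x => h x) d) (f : ℤ[T;T⁻¹]) (a : H) :
    d (f • a) = invert f • d a := by
  induction f using LaurentPolynomial.induction_on' with
  | add p q hp hq => rw [add_smul, map_add, hp, hq, map_add, add_smul]
  | C_mul_T n c =>
    rw [mul_smul, map_mul, mul_smul, invert_C, invert_T, ← hd.1 n a]
    have e : (C c : ℤ[T;T⁻¹]) = (c : ℤ[T;T⁻¹]) := by simp
    rw [e, Int.cast_smul_eq_zsmul, Int.cast_smul_eq_zsmul, map_zsmul]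

lemma bar_heckeB (hH : IsHeckeAlgebra cs h) (hd : IsBarInvolution (fun x => h x) d) (i : B) :
    d (heckeB cs h i) = heckeB cs h i := by
  have h1 := hecke_sq hH i
  let u : Hˣ := ⟨h (cs.simple i), h (cs.simple i) + (T 1 - T (-1) : ℤ[T;T⁻¹]) • 1, by
    rw [mul_add, h1, mul_smul_comm, mul_one, sub_smul, sub_smul]; abel, by
    rw [add_mul, h1, smul_mul_assoc, one_mul, sub_smul, sub_smul]; abel⟩
  have h2 : d (h (cs.simple i)) = h (cs.simple i) + (T 1 - T (-1) : ℤ[T;T⁻¹]) • 1 := by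
    have := hd.2 (cs.simple i)
    rw [cs.inv_simple] at this
    exact this.trans (Ring.inverse_unit u)
  rw [heckeB, map_add, h2, hd.1, map_one, sub_smul]
  abel

/-- A self-dual element with all standard coordinates in `vℤ[v]` vanishes. -/
lemma eq_zero_of_bar_of_coeff (hd : IsBarInvolution (fun x => h x) d)
    (hb : IsKLFamily cs h d (fun x => b x)) {r : H} (hr : d r = r)
    (h0 : ∀ y (k : ℤ), k ≤ 0 → (h.repr r y).coeff k = 0) : r = 0 := by
  by_contra hne
  have hs : (b.repr r).support.Nonempty := by
    rw [Finsupp.support_nonempty_iff]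
    simpa using hne
  obtain ⟨z, hz, hmax⟩ := Finset.exists_max_image _ cs.length hs
  have h1 : h.repr r z = b.repr r z := by
    conv_lhs => rw [← b.linearCombination_repr r, Finsupp.linearCombination_apply, Finsupp.sum,
      map_sum, Finsupp.finsetSum_apply]
    rw [Finset.sum_eq_single z]
    · rw [map_smul, Finsupp.smul_apply, (hb z).2.1, smul_eq_mul, mul_one]
    · intro w hw hwz
      rw [map_smul, Finsupp.smul_apply, ((hb w).2.2 z hwz.symm).1, smul_zero]
      exact fun hlt => absurd (length_lt_of_bruhatLT hlt) (not_lt.2 (hmax w hw))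
    · intro hz'
      exact absurd hz hz'
  have h2 : b.repr r z = invert (b.repr r z) := by
    have e : d r = Finsupp.linearCombination ℤ[T;T⁻¹] b ((b.repr r).mapRange invert (map_zero _)) := by
      conv_lhs => rw [← b.linearCombination_repr r, Finsupp.linearCombination_apply, Finsupp.sum,
        map_sum]
      rw [Finsupp.linearCombination_apply, Finsupp.sum_mapRange_index (by simp), Finsupp.sum]
      refine Finset.sum_congr rfl fun w _ => ?_
      rw [bar_smul hd, (hb w).1]
    rw [hr] at e
    have e2 := congrArg (fun a => b.repr a z) e
    simpa only [b.repr_linearCombination, Finsupp.mapRange_apply] using e2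
  refine Finsupp.mem_support_iff.1 hz (LaurentPolynomial.ext fun k => ?_)
  rcases le_total k 0 with hk | hk
  · rw [← h1, h0 z k hk]
    rfl
  · rw [h2, invert_apply, ← h1, h0 z (-k) (by omega)]
    rfl

namespace SObj

variable {R : Type} [CommRing R] [Algebra ℝ R] {G : Realization cs R} [IsDomain R] {X : SObj G}
  {a : H} {S : Sys G}

/-- The element `a` of the Hecke algebra is the character of `X`. -/
def Ch (h : Module.Basis W ℤ[T;T⁻¹] H) (X : SObj G) (a : H) : Prop :=
  ∀ (y : W) (j : ℤ), (h.repr a y).coeff j = X.rk y (j + cs.length y)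

lemma ch_unit (hH : IsHeckeAlgebra cs h) : Ch h (unit G) 1 := fun y j => by
  classical
  rw [← hH.1, h.repr_self_apply]
  split_ifs with hy
  · rw [← hy, cs.length_one, Nat.cast_zero, add_zero, rk_unit, coeff_one]
    split_ifs <;> simp
  · rw [rk_unit_ne (Ne.symm hy)]
    rfl

lemma Ch.ind (hH : IsHeckeAlgebra cs h) (hX : X.Nice) (ha : Ch h X a) (i : B) :
    Ch h (X.ind i) (a * heckeB cs h i) := by
  have key : ∀ y j, cs.length y < cs.length (y * cs.simple i) →
      (h.repr (a * heckeB cs h i) y).coeff j = (X.ind i).rk y (j + cs.length y) ∧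
      (h.repr (a * heckeB cs h i) (y * cs.simple i)).coeff j =
        (X.ind i).rk (y * cs.simple i) (j + cs.length (y * cs.simple i)) := by
    intro y j hy
    have hl := length_mul_of_lt hy
    have hy' : ¬ cs.length (y * cs.simple i) < cs.length (y * cs.simple i * cs.simple i) := by
      rw [cs.simple_mul_simple_cancel_right]
      omega
    rw [repr_mul_heckeB hH, repr_mul_heckeB hH, if_pos hy, if_neg hy',
      cs.simple_mul_simple_cancel_right, rk_ind_mul, hX.rk_ind hy, hX.rk_ind hy,
      AddMonoidAlgebra.coeff_add, AddMonoidAlgebra.coeff_add, Finsupp.add_apply, Finsupp.add_apply,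
      coeff_T_mul, coeff_T_mul, ha, ha, ha, ha, hl]
    push_cast
    constructor
    · rw [add_comm]
      congr 3 <;> ring
    · congr 3 <;> ring
  intro y j
  rcases length_lt_or (cs := cs) y i with hy | hy
  · exact (key y j hy).1
  · have := (key (y * cs.simple i) j (by simpa using hy)).2
    rwa [cs.simple_mul_simple_cancel_right] at this

lemma Dec.ch (D : Dec S X) {c : D.ι → H} (hc : ∀ k, Ch h (S.F (D.u k)) (c k)) :
    Ch h X (∑ k, (T (D.d k) : ℤ[T;T⁻¹]) • c k) := fun y j => by
  rw [map_sum, Finsupp.finsetSum_apply, D.D.rk, AddMonoidAlgebra.coeff_sum, Finsupp.finsetSum_apply]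
  push_cast
  refine Finset.sum_congr rfl fun k _ => ?_
  rw [map_smul, Finsupp.smul_apply, smul_eq_mul, coeff_T_mul, hc]
  congr 2
  ring

lemma Ch.unique {a' : H} (ha : Ch h X a) (ha' : Ch h X a') : a = a' :=
  h.repr.injective (Finsupp.ext fun y => LaurentPolynomial.ext fun j => by rw [ha, ha'])

lemma Ch.eq_of_good (hd : IsBarInvolution (fun x => h x) d)
    (hb : IsKLFamily cs h d (fun x => b x)) {ct cb : X} (hX : Good x X ct cb) (ha : Ch h X a)
    (hda : d a = a) : a = b x := by
  rw [← sub_eq_zero]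
  refine eq_zero_of_bar_of_coeff hd hb (by rw [map_sub, hda, (hb x).1]) fun y k hk => ?_
  rw [map_sub, Finsupp.sub_apply, AddMonoidAlgebra.coeff_sub, Finsupp.sub_apply, ha]
  by_cases hy : y = x
  · rw [hy, (hb x).2.1, coeff_one, hX.rk_self]
    simp
  · rw [((hb x).2.2 y hy).2 k hk, sub_zero]
    by_contra hne
    have := hX.rk_lt hy (d := k + cs.length y) (by exact_mod_cast hne)
    omega

lemma Dec.Top.ch (hd : IsBarInvolution (fun x => h x) d)
    (hb : IsKLFamily cs h d (fun x => b x)) {D : Dec S X} (hD : D.Top x) (h0 : ∀ k, D.d k = 0)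
    (ha : Ch h X a) (hda : d a = a)
    (ih : ∀ y, cs.length y < cs.length x → Ch h (S.F y) (b y)) : Ch h (S.F x) (b x) := by
  classical
  obtain ⟨k, rfl, -, hk⟩ := hD
  have h1 : Ch h (S.F (D.u k)) (a - ∑ l ∈ Finset.univ.erase k, b (D.u l)) := fun y j => by
    rw [map_sub, Finsupp.sub_apply, AddMonoidAlgebra.coeff_sub, Finsupp.sub_apply, ha, D.D.rk,
      ← Finset.add_sum_erase _ _ (Finset.mem_univ k), map_sum, Finsupp.finsetSum_apply,
      AddMonoidAlgebra.coeff_sum, Finsupp.finsetSum_apply, h0, sub_zero]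
    push_cast
    rw [add_sub_assoc, add_eq_left, sub_eq_zero]
    refine Finset.sum_congr rfl fun l hl => ?_
    rw [ih _ (hk l (Finset.ne_of_mem_erase hl)), h0, sub_zero]
  have h2 := h1.eq_of_good hd hb (S.good _) (by
    rw [map_sub, hda, map_sum]
    simp only [(hb _).1])
  rwa [h2] at h1

/-- The character of an indecomposable object is a Kazhdan–Lusztig basis element. -/
theorem ch_F (S : Sys G) (hH : IsHeckeAlgebra cs h) (hd : IsBarInvolution (fun x => h x) d)
    (hb : IsKLFamily cs h d (fun x => b x)) (n : ℕ) :
    ∀ x, cs.length x ≤ n → Ch h (S.F x) (b x) := by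
  induction n with
  | zero =>
    intro x hx
    obtain rfl := cs.length_eq_zero_iff.1 (Nat.le_zero.1 hx)
    obtain ⟨g, g', h1, h2, h3, h4⟩ := (KL_unit (G := G)).exists_iso S
    let D : Dec S (unit G) := ⟨Unit, inferInstance, fun _ => 1, fun _ => 0, Dsum.one h1 h2 h3 h4⟩
    refine Dec.Top.ch hd hb (D := D) ⟨(), rfl, rfl, fun l hl => absurd rfl hl⟩ (fun _ => rfl)
      (ch_unit hH) (map_one d) fun y hy => ?_
    rw [cs.length_one] at hy
    omega
  | succ n ih =>
    intro x hx
    rcases Nat.lt_or_ge (cs.length x) (n + 1) with hx' | hx'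
    · exact ih x (by omega)
    · have hx1 : x ≠ 1 := by
        rintro rfl
        simp at hx'
      obtain ⟨i, hi⟩ := cs.exists_rightDescent_of_ne_one hx1
      have hi' : cs.length (x * cs.simple i) < cs.length (x * cs.simple i * cs.simple i) := by
        rw [cs.simple_mul_simple_cancel_right]
        exact hi
      have hl := length_mul_of_lt hi'
      obtain ⟨D, hD, h0⟩ := ((pst G (x * cs.simple i)).dec _ i (S.kl _) hi').exists_dec S
      rw [cs.simple_mul_simple_cancel_right] at hD hl
      have hc := ih (x * cs.simple i) (by omega)
      exact hD.ch hd hb h0 (hc.ind hH (S.good _).nice i)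
        (by rw [map_mul, bar_heckeB hH hd, (hb _).1]) fun y hy => ih y (by omega)

open Classical in
/-- Multiplicities in a decomposition are read off from the character. -/
lemma Dec.coeff_repr (hF : ∀ x, Ch h (S.F x) (b x)) (D : Dec S X) (ha : Ch h X a) (z : W) (j : ℤ) :
    (b.repr a z).coeff j = ∑ k, if D.u k = z ∧ D.d k = j then (1 : ℤ) else 0 := by
  rw [ha.unique (D.ch fun k => hF (D.u k)), map_sum, Finsupp.finsetSum_apply,
    AddMonoidAlgebra.coeff_sum, Finsupp.finsetSum_apply]
  refine Finset.sum_congr rfl fun k _ => ?_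
  rw [map_smul, Finsupp.smul_apply, smul_eq_mul, coeff_T_mul, b.repr_self_apply]
  by_cases hz : D.u k = z
  · simp only [hz, coeff_one, true_and, if_true, sub_eq_zero]
    exact if_congr eq_comm rfl rfl
  · simp [hz]

end SObj

end KLPos

namespace KLPos

variable {B W : Type} [Group W] {M : CoxeterMatrix B} {cs : CoxeterSystem M W}
  {R : Type} [CommRing R] [Algebra ℝ R]

namespace SObj

variable {G : Realization cs R} [IsDomain R] {X Y Z N E U : SObj G} {i : B} {x y z u w : W}

/-- Iterated induction along a word. -/
noncomputable def bs (X : SObj G) : List B → SObj G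
  | [] => X
  | i :: w => (bs X w).ind i

section tensor

/-- The map `b ↦ m ⊗ b` from a Bott–Samelson object to the induced object. -/
noncomputable def ten (m : X) : (w : List B) → bs (unit G) w →ₗ[R] bs X w
  | [] => LinearMap.toSpanSingleton R X m
  | i :: w => indMap i (ten m w)

lemma ten_add (m m' : X) : ∀ (w : List B) (c : bs (unit G) w),
    ten (m + m') w c = ten m w c + ten m' w c
  | [], c => smul_add (M := R) (A := X) c m m'
  | _ :: w, c => ind_ext (ten_add m m' w (fs c)) (ten_add m m' w (sn c))

lemma ten_smul (r : R) (m : X) : ∀ (w : List B) (c : bs (unit G) w),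
    ten (r • m) w c = ten m w ((bs (unit G) w).l r c)
  | [], c => by
    change (show R from c) • r • m = (r * (show R from c)) • m
    rw [smul_smul, mul_comm]
  | _ :: w, c => ind_ext (ten_smul r m w (fs c)) (ten_smul r m w (sn c))

lemma ten_l (r : R) (m : X) : ∀ (w : List B) (c : bs (unit G) w),
    (bs X w).l r (ten m w c) = ten (X.l r m) w c
  | [], c => map_smul (X.l r) (show R from c) m
  | _ :: w, c => ind_ext (ten_l r m w (fs c)) (ten_l r m w (sn c))

lemma ten_D (m : X) : ∀ (w : List B) (c : bs (unit G) w),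
    (bs X w).D (ten m w c) = ten (X.D m) w c + ten m w ((bs (unit G) w).D c)
  | [], c => by
    refine (X.D_smul (show R from c) m).trans ?_
    rw [add_comm]
    rfl
  | i :: w, c => by
    refine ind_ext ?_ ?_
    · change (bs X w).D (ten m w (fs c)) - ten m w (fs c) =
        ten (X.D m) w (fs c) + ten m w ((bs (unit G) w).D (fs c) - fs c)
      rw [ten_D m w, map_sub]
      abel
    · change (bs X w).D (ten m w (sn c)) + ten m w (sn c) =
        ten (X.D m) w (sn c) + ten m w ((bs (unit G) w).D (sn c) + sn c)
      rw [ten_D m w, map_add]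
      abel

/-- The first summand of an induced object, as an additive group. -/
def fsi (X : SObj G) (i : B) : X →+ X.ind i where
  toFun m := tm i m 0
  map_zero' := rfl
  map_add' _ _ := ind_ext rfl (add_zero 0).symm

/-- The second summand of an induced object, as an additive group. -/
def sni (X : SObj G) (i : B) : X →+ X.ind i where
  toFun m := tm i 0 m
  map_zero' := rfl
  map_add' _ _ := ind_ext (add_zero 0).symm rfl

lemma fsi_add_sni (m : X.ind i) : fsi X i (fs m) + sni X i (sn m) = m :=
  ind_ext (add_zero _) (zero_add _)

lemma l_fsi (r : R) (m : X) : (X.ind i).l r (fsi X i m) = fsi X i (X.l r m) :=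
  ind_ext rfl (map_zero (X.l r))

lemma l_sni (r : R) (m : X) : (X.ind i).l r (sni X i m) = sni X i (X.l r m) :=
  ind_ext (map_zero (X.l r)) rfl

/-- Tensors generate. -/
lemma ten_induction : ∀ {w : List B} {P : bs X w → Prop} (_ : ∀ m c, P (ten m w c))
    (_ : ∀ p q, P p → P q → P (p + q)) (p : bs X w), P p
  | [], P, h1, _, p => by
    have := h1 p (1 : R)
    rwa [show ten (X := X) p [] (1 : R) = p from one_smul R (show X from p)] at this
  | i :: w, P, h1, h2, p => by
    rw [← fsi_add_sni p]
    refine h2 _ _ ?_ ?_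
    · refine ten_induction (P := fun q => P (fsi (bs X w) i q)) (fun m c => ?_)
        (fun p q hp hq => by rw [map_add]; exact h2 _ _ hp hq) (fs p)
      have := h1 m (fsi (bs (unit G) w) i c)
      rwa [show ten m (i :: w) (fsi (bs (unit G) w) i c) = fsi (bs X w) i (ten m w c) from
        ind_ext rfl (map_zero (ten m w))] at this
    · refine ten_induction (P := fun q => P (sni (bs X w) i q)) (fun m c => ?_)
        (fun p q hp hq => by rw [map_add]; exact h2 _ _ hp hq) (sn p)
      have := h1 m (sni (bs (unit G) w) i c)
      rwa [show ten m (i :: w) (sni (bs (unit G) w) i c) = sni (bs X w) i (ten m w c) from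
        ind_ext (map_zero (ten m w)) rfl] at this

/-- The universal property of tensors. -/
lemma exists_ten_lift {A : Type} [AddCommGroup A] : ∀ {w : List B} (β : X →+ bs (unit G) w →+ A)
    (_ : ∀ r m c, β (r • m) c = β m ((bs (unit G) w).l r c)),
    ∃ F : bs X w →+ A, ∀ m c, F (ten m w c) = β m c
  | [], β, h => ⟨β.flip (1 : R), fun m c => by
    refine (h (show R from c) m (1 : R)).trans ?_
    exact congrArg (β m) (mul_one (show R from c))⟩
  | i :: w, β, h => by
    obtain ⟨F, hF⟩ := exists_ten_lift (w := w)
      ((AddMonoidHom.compHom.flip (fsi (bs (unit G) w) i)).comp β)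
      (fun r m c => (h r m _).trans (congrArg (β m) (l_fsi r c)))
    obtain ⟨F', hF'⟩ := exists_ten_lift (w := w)
      ((AddMonoidHom.compHom.flip (sni (bs (unit G) w) i)).comp β)
      (fun r m c => (h r m _).trans (congrArg (β m) (l_sni r c)))
    refine ⟨F.comp fs + F'.comp sn, fun m c => ?_⟩
    change F (ten m w (fs c)) + F' (ten m w (sn c)) = β m c
    rw [hF, hF']
    exact (map_add (β m) _ _).symm.trans (congrArg (β m) (fsi_add_sni c))

variable {w w' w'' : List B}

lemma ten_ext {f g : bs X w →ₗ[R] Y} (h : ∀ m c, f (ten m w c) = g (ten m w c)) : f = g :=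
  LinearMap.ext (ten_induction h fun p q hp hq => by rw [map_add, map_add, hp, hq])

lemma exists_tmap (X : SObj G) {f : bs (unit G) w →ₗ[R] bs (unit G) w'}
    (hf : ∀ r c, f ((bs (unit G) w).l r c) = (bs (unit G) w').l r (f c)) :
    ∃ F : bs X w →ₗ[R] bs X w', ∀ m c, F (ten m w c) = ten m w' (f c) := by
  obtain ⟨F, hF⟩ := exists_ten_lift (X := X) (A := bs X w') (w := w)
    { toFun := fun m => ((ten m w').comp f).toAddMonoidHom
      map_zero' := AddMonoidHom.ext fun c => by
        have := ten_add (0 : X) 0 w' (f c)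
        rw [add_zero, left_eq_add] at this
        exact this
      map_add' := fun m m' => AddMonoidHom.ext fun c => ten_add m m' w' (f c) }
    (fun r m c => (ten_smul r m w' (f c)).trans (congrArg (ten m w') (hf r c).symm))
  refine ⟨{ F with
    map_smul' := fun r p => ?_ }, hF⟩
  change F (r • p) = r • F p
  refine ten_induction (P := fun p => F (r • p) = r • F p) (fun m c => ?_)
    (fun p q hp hq => by rw [smul_add, map_add, hp, hq, map_add, smul_add]) p
  rw [← map_smul, hF, hF]
  change ten m w' (f (r • c)) = r • ten m w' (f c)
  rw [map_smul, map_smul]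

open Classical in
/-- The map `1 ⊗ f`. -/
noncomputable def tmap (X : SObj G) (f : bs (unit G) w →ₗ[R] bs (unit G) w') : bs X w →ₗ[R] bs X w' :=
  if hf : ∀ r c, f ((bs (unit G) w).l r c) = (bs (unit G) w').l r (f c) then
    (exists_tmap X hf).choose else 0

variable {f g : bs (unit G) w →ₗ[R] bs (unit G) w'} {f' : bs (unit G) w' →ₗ[R] bs (unit G) w''}
  {k k' : ℤ}

lemma tmap_ten (hf : IsHom k f) (m : X) (c : bs (unit G) w) :
    tmap X f (ten m w c) = ten m w' (f c) := by
  rw [tmap, dif_pos hf.map_l]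
  exact (exists_tmap X hf.map_l).choose_spec m c

lemma IsHom.tmap (hf : IsHom k f) : IsHom k (tmap X f) where
  map_l r := ten_induction (fun m c => by rw [ten_l, tmap_ten hf, tmap_ten hf, ten_l])
    fun p q hp hq => by rw [map_add, map_add, map_add, map_add, hp, hq]
  map_D := ten_induction (fun m c => by
      rw [tmap_ten hf, ten_D, ten_D, map_add, tmap_ten hf, tmap_ten hf, hf.map_D, map_add, map_zsmul,
        add_assoc])
    fun p q hp hq => by rw [map_add, map_add, map_add, map_add, hp, hq, smul_add]; abel

lemma tmap_comp (hf : IsHom k f) (hf' : IsHom k' f') :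
    tmap X (f' ∘ₗ f) = tmap X f' ∘ₗ tmap X f :=
  ten_ext fun m c => by
    rw [tmap_ten (hf.comp hf'), LinearMap.comp_apply, LinearMap.comp_apply, tmap_ten hf,
      tmap_ten hf']

lemma tmap_id : tmap X (LinearMap.id : bs (unit G) w →ₗ[R] bs (unit G) w) = LinearMap.id :=
  ten_ext fun m c => by rw [tmap_ten IsHom.id]; rfl

lemma tmap_sum {ι : Type} [Fintype ι] {e : ι → bs (unit G) w →ₗ[R] bs (unit G) w'}
    (h : ∀ j, IsHom k (e j)) : tmap X (∑ j, e j) = ∑ j, tmap X (e j) :=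
  ten_ext fun m c => by
    rw [tmap_ten (IsHom.sum fun j _ => h j), LinearMap.sum_apply, LinearMap.sum_apply, map_sum]
    exact Finset.sum_congr rfl fun j _ => (tmap_ten (h j) m c).symm

end tensor

end SObj
end KLPos

namespace KLPos

variable {B W : Type} [Group W] {M : CoxeterMatrix B} {cs : CoxeterSystem M W}
  {R : Type} [CommRing R] [Algebra ℝ R]

lemma trace_nonneg_of_idem {ι : Type} [Fintype ι] [DecidableEq ι] {A : Matrix ι ι ℝ}
    (h : A * A = A) : 0 ≤ A.trace := by
  have h1 : IsIdempotentElem (Matrix.toLin' A) := by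
    rw [IsIdempotentElem, Module.End.mul_eq_comp, ← Matrix.toLin'_mul, h]
  rw [← Matrix.trace_toLin'_eq, (LinearMap.IsIdempotentElem.isProj_range _ h1).trace]
  exact Nat.cast_nonneg _

namespace SObj

variable {G : Realization cs R} [IsDomain R] {X Y Z N E U : SObj G} {i : B} {x y z u w : W}
  {S : Sys G}

open Classical in
/-- The scalar part of a morphism between indecomposable objects. -/
noncomputable def sc (g : S.F x →ₗ[R] S.F y) : ℝ :=
  if x = y then G.ε ((S.F y).form (g (S.ct x)) (S.cb y)) else 0

lemma sc_sum {ι : Type} (s : Finset ι) (g : ι → S.F x →ₗ[R] S.F y) :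
    sc (∑ j ∈ s, g j) = ∑ j ∈ s, sc (g j) := by
  by_cases h : x = y
  · simp only [sc, if_pos h, LinearMap.sum_apply, map_sum]
  · simp only [sc, if_neg h, Finset.sum_const_zero]

lemma sc_zero : sc (0 : S.F x →ₗ[R] S.F y) = 0 := by
  simp [sc]

lemma sc_smul (a : ℝ) : sc (a • LinearMap.id : S.F x →ₗ[R] S.F x) = a := by
  rw [sc, if_pos rfl, LinearMap.smul_apply, LinearMap.id_apply, real_smul_def, map_smul,
    LinearMap.smul_apply, (S.good x).form_ct, smul_eq_mul, mul_one, AlgHom.commutes]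
  rfl

lemma sc_of_ne (h : x ≠ y) (g : S.F x →ₗ[R] S.F y) : sc g = 0 := if_neg h

lemma sc_of_deg {n : ℤ} {g : S.F x →ₗ[R] S.F y} (hg : IsHom n g) (hn : n ≠ 0) : sc g = 0 := by
  by_cases h : x = y
  · subst h
    rw [sc, if_pos rfl]
    have h1 := form_hg (hg.hg (S.good x).hg_ct) (S.good x).hg_cb
    have h2 := congrArg G.ε h1
    rw [G.ε_eu, map_zsmul, zsmul_eq_mul] at h2
    have h3 : ((↑(cs.length x) + n + -↑(cs.length x) : ℤ) : ℝ) ≠ 0 := by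
      rw [Int.cast_ne_zero]
      omega
    exact (mul_eq_zero.1 h2.symm).resolve_left h3
  · exact sc_of_ne h g

lemma sc_comp {n n' : ℤ} {g : S.F x →ₗ[R] S.F y} {g' : S.F y →ₗ[R] S.F z} (hg : IsHom n g)
    (hg' : IsHom n' g') : sc (g' ∘ₗ g) = sc g' * sc g := by
  by_cases hn : n = 0
  · by_cases hn' : n' = 0
    · subst hn hn'
      by_cases h : x = y
      · subst h
        by_cases h' : x = z
        · subst h'
          obtain ⟨a, ha⟩ := (S.good x).hom_scalar hg
          obtain ⟨a', ha'⟩ := (S.good x).hom_scalar hg'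
          obtain rfl : g = a • LinearMap.id := LinearMap.ext ha
          obtain rfl : g' = a' • LinearMap.id := LinearMap.ext ha'
          rw [LinearMap.smul_comp, LinearMap.id_comp, smul_smul, sc_smul, sc_smul, sc_smul]
        · rw [sc_of_ne h', sc_of_ne h', zero_mul]
      · rw [(S.good x).hom_ne (S.good y) hg h, LinearMap.comp_zero, sc_zero, sc_zero, mul_zero]
    · rw [sc_of_deg hg' hn', zero_mul, sc_of_deg (hg.comp hg') (by omega)]
  · rw [sc_of_deg hg hn, mul_zero]
    by_cases hnn : n + n' = 0
    · rcases lt_or_gt_of_ne hn with h | h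
      · rw [(S.good x).hom_neg (S.good y) hg h, LinearMap.comp_zero, sc_zero]
      · rw [(S.good y).hom_neg (S.good z) hg' (by omega), LinearMap.zero_comp, sc_zero]
    · exact sc_of_deg (hg.comp hg') hnn

/-- The matrix of scalar parts of a morphism. -/
noncomputable def mat (D : Dec S X) (D' : Dec S Y) (e : X →ₗ[R] Y) : Matrix D'.ι D.ι ℝ :=
  fun l k => sc (D'.D.pro l ∘ₗ e ∘ₗ D.D.inc k)

variable {D : Dec S X} {D' : Dec S Y} {D'' : Dec S Z} {n n' : ℤ} {e : X →ₗ[R] Y} {e' : Y →ₗ[R] Z}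

lemma isHom_block (he : IsHom n e) (l : D'.ι) (k : D.ι) :
    IsHom (D.d k + n - D'.d l) (D'.D.pro l ∘ₗ e ∘ₗ D.D.inc k) :=
  ((D.D.isHom_inc k).comp he).comp' (D'.D.isHom_pro l) (by ring)

lemma mat_apply_ne (he : IsHom n e) {l : D'.ι} {k : D.ι} (h : mat D D' e l k ≠ 0) :
    D'.u l = D.u k ∧ D'.d l = D.d k + n := by
  constructor
  · by_contra hne
    exact h (sc_of_ne (Ne.symm hne) _)
  · by_contra hne
    exact h (sc_of_deg (isHom_block he l k) fun h0 => hne (by omega))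

lemma mat_comp (he : IsHom n e) (he' : IsHom n' e') :
    mat D D'' (e' ∘ₗ e) = mat D' D'' e' * mat D D' e := by
  ext m k
  have h1 : D''.D.pro m ∘ₗ (e' ∘ₗ e) ∘ₗ D.D.inc k =
      ∑ l, (D''.D.pro m ∘ₗ e' ∘ₗ D'.D.inc l) ∘ₗ (D'.D.pro l ∘ₗ e ∘ₗ D.D.inc k) := by
    ext v
    rw [LinearMap.sum_apply]
    simp only [LinearMap.comp_apply]
    rw [← map_sum, ← map_sum, D'.D.sum_inc]
  rw [mat, h1, sc_sum, Matrix.mul_apply]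
  exact Finset.sum_congr rfl fun l _ => sc_comp (isHom_block he l k) (isHom_block he' m l)

lemma mat_sum {ι : Type} (s : Finset ι) (f : ι → X →ₗ[R] Y) :
    mat D D' (∑ j ∈ s, f j) = ∑ j ∈ s, mat D D' (f j) := by
  ext l k
  have h1 : D'.D.pro l ∘ₗ (∑ j ∈ s, f j) ∘ₗ D.D.inc k =
      ∑ j ∈ s, D'.D.pro l ∘ₗ f j ∘ₗ D.D.inc k := by
    ext v
    simp only [LinearMap.comp_apply, LinearMap.sum_apply, map_sum]
  rw [Matrix.sum_apply, mat, h1, sc_sum]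
  rfl

lemma mat_id_apply (k : D.ι) : mat D D LinearMap.id k k = 1 := by
  have : D.D.pro k ∘ₗ LinearMap.id ∘ₗ D.D.inc k = (1 : ℝ) • LinearMap.id := by
    ext v
    rw [one_smul]
    exact D.D.pro_inc k v
  rw [mat, this, sc_smul]

open Classical in
/-- The trace on the multiplicity space of the summands with label `z` and shift `δ`. -/
noncomputable def tr (D : Dec S X) (z : W) (δ : ℤ) (A : Matrix D.ι D.ι ℝ) : ℝ :=
  ∑ k, if D.u k = z ∧ D.d k = δ then A k k else 0

lemma tr_sum {ι : Type} (s : Finset ι) (z : W) (δ : ℤ) (A : ι → Matrix D.ι D.ι ℝ) :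
    tr D z δ (∑ j ∈ s, A j) = ∑ j ∈ s, tr D z δ (A j) := by
  simp only [tr]
  rw [Finset.sum_comm]
  refine Finset.sum_congr rfl fun k _ => ?_
  split_ifs
  · rw [Matrix.sum_apply]
  · rw [Finset.sum_const_zero]

lemma tr_comm {f : Y →ₗ[R] X} (he : IsHom n e) (hf : IsHom (-n) f) (z : W) (δ : ℤ) :
    tr D z δ (mat D D (f ∘ₗ e)) = tr D' z (δ + n) (mat D' D' (e ∘ₗ f)) := by
  classical
  rw [mat_comp (D' := D') he hf, mat_comp (D' := D) hf he]
  have h1 : ∀ k : D.ι, (if D.u k = z ∧ D.d k = δ then (mat D' D f * mat D D' e) k k else 0) =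
      ∑ l : D'.ι, if D.u k = z ∧ D.d k = δ then mat D' D f k l * mat D D' e l k else 0 := fun k => by
    split_ifs
    · rw [Matrix.mul_apply]
    · rw [Finset.sum_const_zero]
  have h2 : ∀ l : D'.ι, (if D'.u l = z ∧ D'.d l = δ + n then (mat D D' e * mat D' D f) l l else 0) =
      ∑ k : D.ι, if D'.u l = z ∧ D'.d l = δ + n then mat D D' e l k * mat D' D f k l else 0 :=
    fun l => by
    split_ifs
    · rw [Matrix.mul_apply]
    · rw [Finset.sum_const_zero]
  simp only [tr]
  rw [Finset.sum_congr rfl fun k _ => h1 k, Finset.sum_congr rfl fun l _ => h2 l, Finset.sum_comm]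
  refine Finset.sum_congr rfl fun l _ => Finset.sum_congr rfl fun k _ => ?_
  by_cases h : mat D D' e l k = 0
  · simp [h]
  · obtain ⟨h3, h4⟩ := mat_apply_ne he h
    rw [mul_comm]
    refine if_congr ?_ rfl rfl
    rw [h3, h4, add_left_inj]

lemma tr_nonneg {e : X →ₗ[R] X} (he : IsHom 0 e) (hee : e ∘ₗ e = e) (z : W) (δ : ℤ) :
    0 ≤ tr D z δ (mat D D e) := by
  classical
  have h1 := mat_comp (D := D) (D' := D) (D'' := D) he he
  rw [hee] at h1
  let A : Matrix D.ι D.ι ℝ := fun l k => if D.u k = z ∧ D.d k = δ then mat D D e l k else 0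
  refine (trace_nonneg_of_idem (A := A) ?_).trans_eq rfl
  ext m k
  rw [Matrix.mul_apply]
  by_cases hk : D.u k = z ∧ D.d k = δ
  · have h2 : A m k = mat D D e m k := if_pos hk
    rw [h2, h1, Matrix.mul_apply]
    refine Finset.sum_congr rfl fun l _ => ?_
    have h3 : A l k = mat D D e l k := if_pos hk
    rw [h3]
    by_cases h : mat D D e l k = 0
    · rw [h, mul_zero, mul_zero]
    · obtain ⟨h4, h5⟩ := mat_apply_ne he h
      have h6 : A m l = mat D D e m l := if_pos (by rw [h4, h5, add_zero]; exact hk)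
      rw [h6]
  · have h2 : ∀ m, A m k = 0 := fun m => if_neg hk
    simp [h2]

end SObj
end KLPos

namespace KLPos

variable {B W : Type} [Group W] {M : CoxeterMatrix B} {cs : CoxeterSystem M W}
  {R : Type} [CommRing R] [Algebra ℝ R]
  {H : Type} [Ring H] [Algebra ℤ[T;T⁻¹] H] {h b : Module.Basis W ℤ[T;T⁻¹] H} {d : H →+* H}

namespace SObj

variable {G : Realization cs R} [IsDomain R] {X Y Z : SObj G} {i : B} {x y z : W} {S : Sys G}
  {a : H} {w w' : List B}

/-- A decomposition of the unit. -/
lemma exists_dec_unit (S : Sys G) : ∃ D : Dec S (unit G), D.Top 1 := by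
  obtain ⟨g, g', h1, h2, h3, h4⟩ := (KL_unit (G := G)).exists_iso S
  exact ⟨⟨Unit, inferInstance, fun _ => 1, fun _ => 0, Dsum.one h1 h2 h3 h4⟩, (), rfl, rfl,
    fun l hl => absurd rfl hl⟩

/-- The trivial decomposition. -/
noncomputable def Dec.self (S : Sys G) (x : W) : Dec S (S.F x) :=
  ⟨Unit, inferInstance, fun _ => x, fun _ => 0, Dsum.one (f := LinearMap.id) (f' := LinearMap.id)
    IsHom.id IsHom.id (fun _ => rfl) fun _ => rfl⟩

/-- The induced decomposition of an iterated induction. -/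
noncomputable def Dec.bs (D : Dec S X) : (w : List B) → Dec S (bs X w)
  | [] => D
  | i :: w => (Dec.bs D w).bind (decInd S i)

/-- Every element is the top label of some Bott–Samelson object. -/
lemma exists_top (S : Sys G) (n : ℕ) : ∀ y, cs.length y = n →
    ∃ (w : List B) (D : Dec S (bs (unit G) w)), D.Top y := by
  induction n with
  | zero =>
    intro y hy
    obtain rfl := cs.length_eq_zero_iff.1 hy
    exact ⟨[], exists_dec_unit S⟩
  | succ n ih =>
    intro y hy
    have hy1 : y ≠ 1 := by
      rintro rfl
      simp at hy
    obtain ⟨i, hi⟩ := cs.exists_rightDescent_of_ne_one hy1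
    have hi' : cs.length (y * cs.simple i) < cs.length (y * cs.simple i * cs.simple i) := by
      rw [cs.simple_mul_simple_cancel_right]
      exact hi
    have hl := length_mul_of_lt hi'
    rw [cs.simple_mul_simple_cancel_right] at hl
    obtain ⟨w, D, hD⟩ := ih (y * cs.simple i) (by omega)
    have := hD.bind hi'
    rw [cs.simple_mul_simple_cancel_right] at this
    exact ⟨i :: w, _, this⟩

/-- The product of Kazhdan–Lusztig elements of simple reflections along a word. -/
noncomputable def heckeBs (cs : CoxeterSystem M W) (h : Module.Basis W ℤ[T;T⁻¹] H) : List B → H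
  | [] => 1
  | i :: w => heckeBs cs h w * heckeB cs h i

lemma Nice.bs (hX : X.Nice) : ∀ w, (bs X w).Nice
  | [] => hX
  | _ :: w => (Nice.bs hX w).ind _

lemma Ch.bs (hH : IsHeckeAlgebra cs h) (hX : X.Nice) (ha : Ch h X a) :
    ∀ w, Ch h (bs X w) (a * heckeBs cs h w)
  | [] => by
    rw [heckeBs, mul_one]
    exact ha
  | i :: w => by
    rw [heckeBs, ← mul_assoc]
    exact (Ch.bs hH hX ha w).ind hH (hX.bs w) i

lemma tr_tmap_indep (D : Dec S (bs X w)) (D' : Dec S (bs X w')) {n n' : ℤ}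
    {f : Y →ₗ[R] bs (unit G) w} {g : bs (unit G) w →ₗ[R] Y} {f' : Y →ₗ[R] bs (unit G) w'}
    {g' : bs (unit G) w' →ₗ[R] Y} (hf : IsHom n f) (hg : IsHom (-n) g) (hf' : IsHom n' f')
    (hg' : IsHom (-n') g') (e : ∀ v, g (f v) = v) (e' : ∀ v, g' (f' v) = v) (z : W) (δ : ℤ) :
    tr D z (δ + n) (mat D D (tmap X (f ∘ₗ g))) =
      tr D' z (δ + n') (mat D' D' (tmap X (f' ∘ₗ g'))) := by
  have h1 : f ∘ₗ g = (f ∘ₗ g') ∘ₗ (f' ∘ₗ g) := by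
    ext v
    simp only [LinearMap.comp_apply, e']
  have h2 : f' ∘ₗ g' = (f' ∘ₗ g) ∘ₗ (f ∘ₗ g') := by
    ext v
    simp only [LinearMap.comp_apply, e]
  have h3 : IsHom (n' - n) (f' ∘ₗ g) := hg.comp' hf' (by ring)
  have h4 : IsHom (-(n' - n)) (f ∘ₗ g') := hg'.comp' hf (by ring)
  rw [h1, h2, tmap_comp h3 h4, tmap_comp h4 h3, tr_comm (D' := D') h3.tmap h4.tmap]
  congr 1
  ring

lemma tr_one (hF : ∀ x, Ch h (S.F x) (b x)) (D : Dec S X) (ha : Ch h X a) (z : W) (δ : ℤ) :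
    tr D z δ (mat D D LinearMap.id) = ((b.repr a z).coeff δ : ℝ) := by
  classical
  rw [D.coeff_repr hF ha, tr, Int.cast_sum]
  refine Finset.sum_congr rfl fun k _ => ?_
  split_ifs
  · rw [mat_id_apply, Int.cast_one]
  · rw [Int.cast_zero]

lemma sum_tr_tmap (hH : IsHeckeAlgebra cs h) (hF : ∀ x, Ch h (S.F x) (b x))
    (D : Dec S (bs (unit G) w)) (D' : Dec S (bs (S.F x) w)) (z : W) (δ : ℤ) :
    ∑ k, tr D' z δ (mat D' D' (tmap (S.F x) (D.D.inc k ∘ₗ D.D.pro k))) =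
      ∑ k, ((b.repr (b x * b (D.u k)) z).coeff (δ - D.d k) : ℝ) := by
  have h1 : heckeBs cs h w = ∑ k, (T (D.d k) : ℤ[T;T⁻¹]) • b (D.u k) := by
    have h2 := (ch_unit (G := G) hH).bs hH good_unit.nice w
    rw [one_mul] at h2
    exact h2.unique (D.ch fun k => hF _)
  have h3 : ∀ k, IsHom 0 (D.D.inc k ∘ₗ D.D.pro k) := fun k =>
    (D.D.isHom_pro k).comp' (D.D.isHom_inc k) (by ring)
  have h4 : ∑ k, D.D.inc k ∘ₗ D.D.pro k = LinearMap.id := by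
    ext v
    rw [LinearMap.sum_apply]
    exact D.D.sum_inc v
  rw [← tr_sum, ← mat_sum, ← tmap_sum h3, h4, tmap_id,
    tr_one hF D' ((hF x).bs hH (S.good x).nice w), h1, Finset.mul_sum, map_sum,
    Finsupp.finsetSum_apply, AddMonoidAlgebra.coeff_sum, Finsupp.finsetSum_apply, Int.cast_sum]
  refine Finset.sum_congr rfl fun k _ => ?_
  rw [mul_smul_comm, map_smul, Finsupp.smul_apply, smul_eq_mul, coeff_T_mul]

/-- Structure constants are traces of idempotents. -/
theorem tr_tmap (hH : IsHeckeAlgebra cs h) (hF : ∀ x, Ch h (S.F x) (b x)) (n : ℕ) :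
    ∀ y, cs.length y < n → ∀ (w : List B) (D' : Dec S (bs (S.F x) w)) (m : ℤ)
      (f : S.F y →ₗ[R] bs (unit G) w) (g : bs (unit G) w →ₗ[R] S.F y), IsHom m f → IsHom (-m) g →
      (∀ v, g (f v) = v) → ∀ (z : W) (δ : ℤ), tr D' z (δ + m) (mat D' D' (tmap (S.F x) (f ∘ₗ g))) =
        ((b.repr (b x * b y) z).coeff δ : ℝ) := by
  classical
  induction n with
  | zero => exact fun y hy => absurd hy (Nat.not_lt_zero _)
  | succ n ih =>
    intro y hy w D' m f g hf hg hgf z δ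
    obtain ⟨w0, D, k, rfl, h0, hk⟩ := exists_top S _ y rfl
    have h1 := sum_tr_tmap hH hF D ((Dec.self S x).bs w0) z δ
    rw [← Finset.add_sum_erase _ _ (Finset.mem_univ k),
      ← Finset.add_sum_erase (a := k) _ _ (Finset.mem_univ k)] at h1
    have h2 : ∀ l ∈ Finset.univ.erase k, tr ((Dec.self S x).bs w0) z δ (mat ((Dec.self S x).bs w0)
        ((Dec.self S x).bs w0) (tmap (S.F x) (D.D.inc l ∘ₗ D.D.pro l))) =
        ((b.repr (b x * b (D.u l)) z).coeff (δ - D.d l) : ℝ) := fun l hl => by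
      have := ih (D.u l) (by have := hk l (Finset.ne_of_mem_erase hl); omega) w0
        ((Dec.self S x).bs w0) (D.d l) _ _ (D.D.isHom_inc l) (D.D.isHom_pro l) (D.D.pro_inc l) z
        (δ - D.d l)
      rwa [sub_add_cancel] at this
    rw [Finset.sum_congr rfl h2, add_left_inj, h0, sub_zero] at h1
    rw [← h1, tr_tmap_indep D' ((Dec.self S x).bs w0) hf hg (D.D.isHom_inc k) (D.D.isHom_pro k) hgf
      (D.D.pro_inc k), h0, add_zero]

/-- Structure constants of the Kazhdan–Lusztig basis are nonnegative. -/
theorem coeff_nonneg (S : Sys G) (hH : IsHeckeAlgebra cs h) (hF : ∀ x, Ch h (S.F x) (b x))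
    (x y z : W) (δ : ℤ) : 0 ≤ (b.repr (b x * b y) z).coeff δ := by
  obtain ⟨w, D, k, rfl, h0, -⟩ := exists_top S _ y rfl
  have h1 := tr_tmap hH hF _ _ (Nat.lt_succ_self _) w ((Dec.self S x).bs w) _ _ _
    (D.D.isHom_inc k) (D.D.isHom_pro k) (D.D.pro_inc k) z δ
  have h2 : IsHom 0 (D.D.inc k ∘ₗ D.D.pro k) := (D.D.isHom_pro k).comp' (D.D.isHom_inc k) (by ring)
  have h3 : (0 : ℝ) ≤ ((b.repr (b x * b (D.u k)) z).coeff δ : ℝ) := by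
    rw [← h1]
    refine tr_nonneg h2.tmap ?_ _ _
    rw [← tmap_comp h2 h2]
    congr 1
    ext v
    simp only [LinearMap.comp_apply, D.D.pro_inc]
  exact_mod_cast h3

end SObj
end KLPos

/-- **Positivity of the structure constants of the Kazhdan–Lusztig basis.** Writing
`b_x b_y = Σ_z μ_{x,y}^z b_z` (so that `μ_{x,y}^z = b.repr (b_x * b_y) z`), every
coefficient of the Laurent polynomial `μ_{x,y}^z ∈ ℤ[v,v⁻¹]` is nonnegative. -/
theorem kazhdan_lusztig_structure_constant_positivity
    {B W : Type} [Group W] {M : CoxeterMatrix B} (cs : CoxeterSystem M W)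
    {H : Type} [Ring H] [Algebra (LaurentPolynomial ℤ) H]
    (h : Module.Basis W (LaurentPolynomial ℤ) H) (hH : IsHeckeAlgebra cs h)
    (d : H →+* H) (hd : IsBarInvolution (fun x : W => h x) d)
    (hinv : ∀ x : W, IsUnit (h x))
    (b : Module.Basis W (LaurentPolynomial ℤ) H) (hb : IsKLFamily cs h d (fun x : W => b x))
    (x y z : W) :
    ∀ k : ℤ, 0 ≤ (b.repr (b x * b y) z).coeff k := by
  obtain ⟨S⟩ := KLPos.SObj.exists_sys (KLPos.polyRealization cs)
  exact fun k => KLPos.SObj.coeff_nonneg S hH (fun x => KLPos.SObj.ch_F S hH hd hb _ x le_rfl) x y z k
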